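/- Let N ≥ 1, μ ∈ ℝ, p > 3, and q ∈ ℝ with N(p-1)/2 + 1 < q < N(p-1)/2 + (p+1)/2. Let β satisfy 0 < β < 2/(p-1) if μ = 0, and N/(q-1) < β < 2/(p-1) if μ ≠ 0. Then there exist T ∈ (0,1), C > 0, and a function u : ℝ^N × [0,T) → ℝ, continuously differentiable in time and twice continuously differentiable in space, such that: (1) for all x ∈ ℝ^N and t ∈ [0,T), ∂_t u(x,t) = Δu(x,t) + |u(x,t)|^{p-1}u(x,t) + μ |∇u(x,t)| ∫_{B(0,|x|)} |u(y,t)|^{q-1} dy; (2) sup_{x∈ℝ^N} |u(x,t)| → ∞ as t → T⁻ (u blows up at time T at the point 0); (3) for all t ∈ [0,T) and x ∈ ℝ^N, |u(x,t) − (T−t)^{−1/(p−1)} f(x/√((T−t)|log(T−t)|))| ≤ C (T−t)^{−1/(p−1)} / ((1 + (|x|²/(T−t))^{β/2}) |log(T−t)|^{(1−β)/2}); and (4) |∇u(x,t) − (T−t)^{−1/2−1/(p−1)} |log(T−t)|^{−1/2} ∇f(x/√((T−t)|log(T−t)|))| ≤ C (T−t)^{−1/2−1/(p−1)} / ((1 +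 (|x|²/(T−t))^{β/2}) |log(T−t)|^{(1−β)/2}). -/

import Mathlib

open MeasureTheory Real Set

/-- The Laplacian of a real-valued function on `ℝ^N`, computed coordinatewise. -/
noncomputable def lapl {N : ℕ} (v : EuclideanSpace ℝ (Fin N) → ℝ)
    (x : EuclideanSpace ℝ (Fin N)) : ℝ :=
  ∑ i : Fin N, fderiv ℝ (fun z => fderiv ℝ v z (EuclideanSpace.single i 1)) x
      (EuclideanSpace.single i 1)

/-- The blow-up profile `f(z) = (p-1 + b|z|²)^{-1/(p-1)}` with `b = (p-1)²/(4p)`. -/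
noncomputable def profF (N : ℕ) (p : ℝ) (z : EuclideanSpace ℝ (Fin N)) : ℝ :=
  (p - 1 + (p - 1) ^ 2 / (4 * p) * ‖z‖ ^ 2) ^ (-(1 / (p - 1)))

set_option linter.unusedSectionVars false

namespace BlowUp

variable {E : Type*} [NormedAddCommGroup E] [InnerProductSpace ℝ E] [FiniteDimensional ℝ E]
  [MeasurableSpace E] [BorelSpace E]
variable {V : Type*} [NormedAddCommGroup V] [NormedSpace ℝ V]

/-- The standard Gaussian density. -/
noncomputable def gau (ξ : E) : ℝ :=
  ((√(2 * π))⁻¹) ^ (Module.finrank ℝ E) * Real.exp (-‖ξ‖ ^ 2 / 2)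

/-- Averages of `f` over the translated and dilated weight `ψ`. -/
noncomputable def gs (ψ : E → V) (f : E → ℝ) (a : ℝ) (x : E) : V :=
  ∫ ξ, f (x + a • ξ) • ψ ξ

lemma one_add_pow_mul_exp_le (k : ℕ) {b t : ℝ} (hb : 0 < b) (ht : 0 ≤ t) :
    (1 + t) ^ k ≤ Real.exp (k ^ 2 / (4 * b)) * Real.exp (b * t ^ 2) := by
  have h1 : (1 + t) ^ k ≤ Real.exp (k * t) := by
    rw [Real.exp_nat_mul]
    exact pow_le_pow_left₀ (by linarith) (by linarith [Real.add_one_le_exp t]) k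
  refine h1.trans ?_
  rw [← Real.exp_add]
  refine Real.exp_le_exp.2 ?_
  have : 0 ≤ (k / (2 * b) - t) ^ 2 * b := by positivity
  have e : (k / (2 * b) - t) ^ 2 * b = k ^ 2 / (4 * b) + b * t ^ 2 - k * t := by
    field_simp; ring
  linarith

lemma integrable_exp_neg_sq {b : ℝ} (hb : 0 < b) :
    Integrable (fun ξ : E => Real.exp (-b * ‖ξ‖ ^ 2)) := by
  have h := GaussianFourier.integrable_cexp_neg_mul_sq_norm_add (V := E) (b := (b : ℂ))
    (by simpa using hb) 0 0
  have h2 := h.norm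
  refine h2.congr (Filter.Eventually.of_forall fun ξ => ?_)
  simp [Complex.norm_exp, ← Complex.ofReal_pow]

lemma integrable_pow_exp (k : ℕ) {b : ℝ} (hb : 0 < b) :
    Integrable (fun ξ : E => (1 + ‖ξ‖) ^ k * Real.exp (-b * ‖ξ‖ ^ 2)) := by
  refine ((integrable_exp_neg_sq (E := E) (half_pos hb)).const_mul
    (Real.exp (k ^ 2 / (4 * (b / 2))))).mono' (by fun_prop) ?_
  refine Filter.Eventually.of_forall fun ξ => ?_
  rw [Real.norm_of_nonneg (by positivity)]
  have := one_add_pow_mul_exp_le k (half_pos hb) (norm_nonneg ξ)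
  calc _ ≤ Real.exp (k ^ 2 / (4 * (b / 2))) * Real.exp (b / 2 * ‖ξ‖ ^ 2)
      * Real.exp (-b * ‖ξ‖ ^ 2) := by gcongr
    _ = _ := by rw [mul_assoc, ← Real.exp_add]; ring_nf

/-- Continuous weights with Gaussian decay. -/
structure GW (ψ : E → V) : Prop where
  cont : Continuous ψ
  bd : ∃ C : ℝ, 0 ≤ C ∧ ∀ ξ, ‖ψ ξ‖ ≤ C * Real.exp (-‖ξ‖ ^ 2 / 4)

lemma gau_pos (ξ : E) : 0 < gau ξ := by unfold gau; positivity

lemma continuous_gau : Continuous (gau : E → ℝ) := by unfold gau; fun_prop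

lemma gau_le (k : ℕ) (ξ : E) :
    (1 + ‖ξ‖) ^ k * gau ξ ≤
      (((√(2 * π))⁻¹) ^ (Module.finrank ℝ E) * Real.exp (k ^ 2)) * Real.exp (-‖ξ‖ ^ 2 / 4) := by
  have := one_add_pow_mul_exp_le k (b := 1 / 4) (by norm_num) (norm_nonneg ξ)
  unfold gau
  calc _ ≤ Real.exp (k ^ 2 / (4 * (1 / 4))) * Real.exp (1 / 4 * ‖ξ‖ ^ 2) *
        (((√(2 * π))⁻¹) ^ (Module.finrank ℝ E) * Real.exp (-‖ξ‖ ^ 2 / 2)) := by gcongr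
    _ = (((√(2 * π))⁻¹) ^ (Module.finrank ℝ E) * Real.exp (k ^ 2)) *
        (Real.exp (1 / 4 * ‖ξ‖ ^ 2) * Real.exp (-‖ξ‖ ^ 2 / 2)) := by
          norm_num; ring
    _ = _ := by rw [← Real.exp_add]; ring_nf

/-- A continuous weight bounded by a polynomial times the Gaussian has Gaussian decay. -/
lemma GW.of_poly {ψ : E → V} (hc : Continuous ψ) (k : ℕ) (C : ℝ)
    (h : ∀ ξ, ‖ψ ξ‖ ≤ C * ((1 + ‖ξ‖) ^ k * gau ξ)) : GW ψ := by
  have hC : 0 ≤ C := by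
    have := (norm_nonneg _).trans (h 0)
    have h2 : 0 < (1 + ‖(0 : E)‖) ^ k * gau (0 : E) := mul_pos (by positivity) (gau_pos _)
    exact nonneg_of_mul_nonneg_left this h2
  refine ⟨hc, C * (((√(2 * π))⁻¹) ^ (Module.finrank ℝ E) * Real.exp (k ^ 2)), by positivity,
    fun ξ => (h ξ).trans ?_⟩
  rw [mul_assoc]
  exact mul_le_mul_of_nonneg_left (gau_le k ξ) hC

lemma GW.integrable {ψ : E → V} (h : GW ψ) (k : ℕ) :
    Integrable (fun ξ => (1 + ‖ξ‖) ^ k * ‖ψ ξ‖) := by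
  obtain ⟨C, hC, hb⟩ := h.bd
  refine ((integrable_pow_exp (E := E) k (b := 1 / 4) (by norm_num)).const_mul C).mono' ?_ ?_
  · have := h.cont
    exact (by fun_prop : Continuous fun ξ => (1 + ‖ξ‖) ^ k * ‖ψ ξ‖).aestronglyMeasurable
  · refine Filter.Eventually.of_forall fun ξ => ?_
    rw [Real.norm_of_nonneg (by positivity)]
    calc (1 + ‖ξ‖) ^ k * ‖ψ ξ‖ ≤ (1 + ‖ξ‖) ^ k * (C * Real.exp (-‖ξ‖ ^ 2 / 4)) := by
          gcongr; exact hb ξ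
      _ = _ := by ring_nf

lemma gw_gau : GW (gau : E → ℝ) :=
  GW.of_poly continuous_gau 0 1 fun ξ => by simp [abs_of_pos (gau_pos ξ)]

/-- The `k`-th absolute moment (with `1 + ‖ξ‖`) of a weight. -/
noncomputable def mom (ψ : E → V) (k : ℕ) : ℝ := ∫ ξ, (1 + ‖ξ‖) ^ k * ‖ψ ξ‖

lemma mom_nonneg (ψ : E → V) (k : ℕ) : 0 ≤ mom ψ k :=
  integral_nonneg fun _ => by positivity

lemma gs_integrable {ψ : E → V} (h : GW ψ) {f : E → ℝ} (hf : Continuous f) {a : ℝ} {x : E}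
    {K : ℝ} (k : ℕ) (hK : ∀ ξ, |f (x + a • ξ)| ≤ K * (1 + ‖ξ‖) ^ k) :
    Integrable (fun ξ => f (x + a • ξ) • ψ ξ) := by
  refine ((h.integrable k).const_mul K).mono' ?_ ?_
  · have := h.cont
    exact (by fun_prop : Continuous fun ξ => f (x + a • ξ) • ψ ξ).aestronglyMeasurable
  · refine Filter.Eventually.of_forall fun ξ => ?_
    rw [norm_smul, Real.norm_eq_abs, ← mul_assoc]
    exact mul_le_mul_of_nonneg_right (hK ξ) (norm_nonneg _)

lemma norm_gs_le {ψ : E → V} (h : GW ψ) {f : E → ℝ} {a : ℝ} {x : E}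
    {K : ℝ} (k : ℕ) (hK : ∀ ξ, |f (x + a • ξ)| ≤ K * (1 + ‖ξ‖) ^ k) :
    ‖gs ψ f a x‖ ≤ K * mom ψ k := by
  unfold gs mom
  rw [← integral_const_mul]
  refine norm_integral_le_of_norm_le ((h.integrable k).const_mul K) ?_
  refine Filter.Eventually.of_forall fun ξ => ?_
  rw [norm_smul, Real.norm_eq_abs, ← mul_assoc]
  exact mul_le_mul_of_nonneg_right (hK ξ) (norm_nonneg _)

lemma lin_growth {f : E → ℝ} {K : ℝ} (hf : ∀ w, |f w| ≤ K * (1 + ‖w‖)) (a : ℝ) (x ξ : E) :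
    |f (x + a • ξ)| ≤ K * (1 + ‖x‖ + |a|) * (1 + ‖ξ‖) ^ 1 := by
  have hK : 0 ≤ K := by simpa using (abs_nonneg _).trans (hf 0)
  refine (hf _).trans ?_
  rw [mul_assoc]
  refine mul_le_mul_of_nonneg_left ?_ hK
  have : ‖x + a • ξ‖ ≤ ‖x‖ + |a| * ‖ξ‖ := by
    refine (norm_add_le _ _).trans ?_
    rw [norm_smul, Real.norm_eq_abs]
  nlinarith [norm_nonneg x, norm_nonneg ξ, abs_nonneg a, mul_nonneg (norm_nonneg x) (norm_nonneg ξ)]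

/-- Joint continuity of Gaussian averages in all parameters. -/
lemma continuous_gs {Z : Type*} [TopologicalSpace Z] [FirstCountableTopology Z]
    {ψ : E → V} (h : GW ψ) {f : Z → E → ℝ} (hf : Continuous (Function.uncurry f))
    {K a : Z → ℝ} {x : Z → E} (hK : Continuous K) (ha : Continuous a) (hx : Continuous x)
    (hb : ∀ z w, |f z w| ≤ K z * (1 + ‖w‖)) :
    Continuous fun z => gs ψ (f z) (a z) (x z) := by
  refine continuous_iff_continuousAt.2 fun z0 => ?_
  let R : Z → ℝ := fun z => K z * (1 + ‖x z‖ + |a z|)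
  have hR : Continuous R := by fun_prop
  have hψ := h.cont
  have key : Continuous fun q : Z × E => f q.1 (x q.1 + a q.1 • q.2) • ψ q.2 := by
    have : Continuous fun q : Z × E => f q.1 (x q.1 + a q.1 • q.2) :=
      hf.comp (f := fun q : Z × E => (q.1, x q.1 + a q.1 • q.2)) (by fun_prop)
    fun_prop
  refine continuousAt_of_dominated (bound := fun ξ => (R z0 + 1) * ((1 + ‖ξ‖) ^ 1 * ‖ψ ξ‖)) ?_ ?_
    ((h.integrable 1).const_mul _) ?_
  · exact Filter.Eventually.of_forall fun z =>
      (key.comp (by fun_prop : Continuous fun ξ => (z, ξ))).aestronglyMeasurable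
  · have : ∀ᶠ z in nhds z0, R z < R z0 + 1 := hR.continuousAt.eventually_lt
      continuousAt_const (by linarith)
    filter_upwards [this] with z hz
    refine Filter.Eventually.of_forall fun ξ => ?_
    rw [norm_smul, Real.norm_eq_abs, ← mul_assoc]
    refine mul_le_mul_of_nonneg_right ?_ (norm_nonneg _)
    refine (lin_growth (hb z) (a z) (x z) ξ).trans ?_
    exact mul_le_mul_of_nonneg_right hz.le (by positivity)
  · exact Filter.Eventually.of_forall fun ξ =>
      (key.comp (by fun_prop : Continuous fun z => (z, ξ))).continuousAt

end BlowUp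

namespace BlowUp

variable {E : Type*} [NormedAddCommGroup E] [InnerProductSpace ℝ E] [FiniteDimensional ℝ E]
  [MeasurableSpace E] [BorelSpace E]
variable {V : Type*} [NormedAddCommGroup V] [NormedSpace ℝ V]

lemma integral_gau : ∫ ξ : E, gau ξ = 1 := by
  unfold gau
  rw [integral_const_mul]
  have h := GaussianFourier.integral_rexp_neg_mul_sq_norm (V := E) (b := 1 / 2) (by norm_num)
  have e : ∀ ξ : E, Real.exp (-‖ξ‖ ^ 2 / 2) = Real.exp (-(1 / 2) * ‖ξ‖ ^ 2) := fun ξ => by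
    congr 1; ring
  simp_rw [e]
  rw [h, inv_pow, show π / (1 / 2) = 2 * π by ring, Real.sqrt_eq_rpow, ← Real.rpow_natCast,
    ← Real.rpow_mul (by positivity), show (1 / 2 : ℝ) * (Module.finrank ℝ E : ℝ)
      = (Module.finrank ℝ E : ℝ) / 2 by ring]
  exact inv_mul_cancel₀ (by positivity)

lemma gs_const (c a : ℝ) (x : E) : gs gau (fun _ => c) a x = c := by
  unfold gs
  simp only [smul_eq_mul]
  rw [integral_const_mul, integral_gau, mul_one]

lemma integral_comp_smul_pos {F : E → V} {a : ℝ} (ha : 0 < a) :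
    ∫ ξ, F (a • ξ) = (a ^ Module.finrank ℝ E)⁻¹ • ∫ ξ, F ξ := by
  rw [Measure.integral_comp_smul, abs_of_pos (by positivity)]

lemma pow_growth {f : E → ℝ} {K : ℝ} {k : ℕ} (hK : 0 ≤ K) (hf : ∀ w, |f w| ≤ K * (1 + ‖w‖) ^ k)
    (a : ℝ) (x ξ : E) :
    |f (x + a • ξ)| ≤ K * (1 + ‖x‖ + |a|) ^ k * (1 + ‖ξ‖) ^ k := by
  refine (hf _).trans ?_
  rw [mul_assoc, ← mul_pow]
  refine mul_le_mul_of_nonneg_left ?_ hK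
  have : ‖x + a • ξ‖ ≤ ‖x‖ + |a| * ‖ξ‖ := by
    refine (norm_add_le _ _).trans ?_
    rw [norm_smul, Real.norm_eq_abs]
  refine pow_le_pow_left₀ (by positivity) ?_ k
  nlinarith [norm_nonneg x, norm_nonneg ξ, abs_nonneg a, mul_nonneg (norm_nonneg x) (norm_nonneg ξ)]

/-- The Laplacian weight `(‖ξ‖² - d) * gau ξ`. -/
noncomputable def lgau (ξ : E) : ℝ := (‖ξ‖ ^ 2 - Module.finrank ℝ E) * gau ξ

lemma continuous_lgau : Continuous (lgau : E → ℝ) := by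
  have := continuous_gau (E := E)
  unfold lgau; fun_prop

lemma abs_lgau_le (ξ : E) :
    |lgau ξ| ≤ (1 + (Module.finrank ℝ E : ℝ)) * ((1 + ‖ξ‖) ^ 2 * gau ξ) := by
  have hg := gau_pos ξ
  unfold lgau
  rw [abs_mul, abs_of_pos hg, ← mul_assoc]
  refine mul_le_mul_of_nonneg_right ?_ hg.le
  have hd : (0 : ℝ) ≤ Module.finrank ℝ E := by positivity
  have hn := norm_nonneg ξ
  rw [abs_le]
  constructor <;> nlinarith [mul_nonneg hd hn, mul_nonneg hd (sq_nonneg ‖ξ‖)]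

lemma gw_lgau : GW (lgau : E → ℝ) :=
  GW.of_poly continuous_lgau 2 _ fun ξ => by simpa using abs_lgau_le ξ

lemma hasDerivAt_gs_gau {f : E → ℝ} (hf : Continuous f) {K : ℝ} {k : ℕ} (hK : 0 ≤ K)
    (hb : ∀ w, |f w| ≤ K * (1 + ‖w‖) ^ k) {a : ℝ} (ha : 0 < a) (x : E) :
    HasDerivAt (fun a => gs gau f a x) (a⁻¹ * gs lgau f a x) a := by
  set d := Module.finrank ℝ E with hd
  set c0 : ℝ := ((√(2 * π))⁻¹) ^ d with hc0
  have hc0p : 0 < c0 := by positivity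
  let J : ℝ → ℝ := fun r => ∫ η, f (x + η) * gau (r⁻¹ • η)
  have e1 : ∀ r : ℝ, 0 < r → gs gau f r x = (r ^ d)⁻¹ * J r := by
    intro r hr
    have := integral_comp_smul_pos (E := E) (F := fun η => f (x + η) * gau (r⁻¹ • η)) hr
    simp only [smul_smul, inv_mul_cancel₀ hr.ne', one_smul, smul_eq_mul] at this
    exact this
  let J' : ℝ := ∫ η, f (x + η) * (gau (a⁻¹ • η) * (‖η‖ ^ 2 / a ^ 3))
  have e2 : gs (fun ξ => ‖ξ‖ ^ 2 * gau ξ) f a x = (a ^ d)⁻¹ * (a * J') := by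
    have := integral_comp_smul_pos (E := E)
      (F := fun η => f (x + η) * (gau (a⁻¹ • η) * (‖η‖ ^ 2 / a ^ 3))) ha
    simp only [smul_smul, inv_mul_cancel₀ ha.ne', one_smul, smul_eq_mul] at this
    rw [mul_left_comm]
    change _ = a * ((a ^ d)⁻¹ * ∫ η, f (x + η) * (gau (a⁻¹ • η) * (‖η‖ ^ 2 / a ^ 3)))
    rw [← this, ← integral_const_mul]
    unfold gs
    congr 1
    ext ξ
    rw [norm_smul, Real.norm_of_nonneg ha.le, smul_eq_mul]
    field_simp
  have hJ : HasDerivAt J J' a := by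
    have hgau := continuous_gau (E := E)
    let bound : E → ℝ := fun η =>
      K * (1 + ‖x‖ + |1|) ^ k * (c0 * (8 / a ^ 3)) *
        ((1 + ‖η‖) ^ (k + 2) * Real.exp (-(1 / (8 * a ^ 2)) * ‖η‖ ^ 2))
    have hbd : ∀ η : E, ∀ r ∈ Ioo (a / 2) (2 * a), |f (x + η)| * gau (r⁻¹ • η) ≤
        K * (1 + ‖x‖ + |1|) ^ k * c0 *
        ((1 + ‖η‖) ^ k * Real.exp (-(1 / (8 * a ^ 2)) * ‖η‖ ^ 2)) := by
      intro η r hr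
      have hr0 : 0 < r := by linarith [hr.1]
      have h1 := pow_growth hK hb 1 x η
      rw [one_smul] at h1
      have h2 : gau (r⁻¹ • η) ≤ c0 * Real.exp (-(1 / (8 * a ^ 2)) * ‖η‖ ^ 2) := by
        unfold gau
        refine mul_le_mul_of_nonneg_left (Real.exp_le_exp.2 ?_) hc0p.le
        rw [norm_smul, Real.norm_of_nonneg (by positivity), mul_pow]
        have : 1 / (4 * a ^ 2) ≤ r⁻¹ ^ 2 := by
          rw [inv_pow, ← one_div]
          exact one_div_le_one_div_of_le (by positivity) (by nlinarith [hr.2])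
        have h3 : 1 / (8 * a ^ 2) = 1 / (4 * a ^ 2) / 2 := by field_simp; norm_num
        rw [h3]
        nlinarith [sq_nonneg ‖η‖]
      calc _ ≤ (K * (1 + ‖x‖ + |1|) ^ k * (1 + ‖η‖) ^ k) *
            (c0 * Real.exp (-(1 / (8 * a ^ 2)) * ‖η‖ ^ 2)) :=
            mul_le_mul h1 h2 (gau_pos _).le (by positivity)
        _ = _ := by ring
    have hmem : a ∈ Ioo (a / 2) (2 * a) := ⟨by linarith, by linarith⟩
    refine (hasDerivAt_integral_of_dominated_loc_of_deriv_le (bound := bound)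
      (F' := fun r η => f (x + η) * (gau (r⁻¹ • η) * (‖η‖ ^ 2 / r ^ 3)))
      (Ioo_mem_nhds hmem.1 hmem.2) ?_ ?_ ?_ ?_ ?_ ?_).2
    · exact Filter.Eventually.of_forall fun r =>
        (by fun_prop : Continuous fun η => f (x + η) * gau (r⁻¹ • η)).aestronglyMeasurable
    · refine ((integrable_pow_exp (E := E) k (b := 1 / (8 * a ^ 2)) (by positivity)).const_mul
        (K * (1 + ‖x‖ + |1|) ^ k * c0)).mono'
        (by fun_prop : Continuous fun η => f (x + η) * gau (a⁻¹ • η)).aestronglyMeasurable ?_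
      refine Filter.Eventually.of_forall fun η => ?_
      rw [norm_mul, Real.norm_eq_abs, Real.norm_of_nonneg (gau_pos _).le]
      exact hbd η a hmem
    · exact (by fun_prop : Continuous fun η =>
        f (x + η) * (gau (a⁻¹ • η) * (‖η‖ ^ 2 / a ^ 3))).aestronglyMeasurable
    · refine Filter.Eventually.of_forall fun η r hr => ?_
      have hr0 : 0 < r := by linarith [hr.1]
      have h1 := hbd η r hr
      have h3 : ‖η‖ ^ 2 / r ^ 3 ≤ (8 / a ^ 3) * (1 + ‖η‖) ^ 2 := by
        have h4 : (a / 2) ^ 3 ≤ r ^ 3 := pow_le_pow_left₀ (by positivity) hr.1.le 3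
        calc ‖η‖ ^ 2 / r ^ 3 ≤ (1 + ‖η‖) ^ 2 / (a / 2) ^ 3 := by
              gcongr; linarith
          _ = _ := by field_simp; norm_num
      rw [norm_mul, norm_mul, Real.norm_eq_abs, Real.norm_of_nonneg (gau_pos _).le,
        Real.norm_of_nonneg (by positivity), ← mul_assoc]
      calc _ ≤ (K * (1 + ‖x‖ + |1|) ^ k * c0 *
        ((1 + ‖η‖) ^ k * Real.exp (-(1 / (8 * a ^ 2)) * ‖η‖ ^ 2))) *
          ((8 / a ^ 3) * (1 + ‖η‖) ^ 2) := mul_le_mul h1 h3 (by positivity) (by positivity)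
        _ = bound η := by simp only [bound]; ring
    · exact (integrable_pow_exp (E := E) (k + 2) (by positivity)).const_mul _
    · refine Filter.Eventually.of_forall fun η r hr => ?_
      have hr0 : 0 < r := by linarith [hr.1]
      refine HasDerivAt.const_mul _ ?_
      have e3 : ∀ r : ℝ, gau (r⁻¹ • η) = c0 * Real.exp (-(r⁻¹ ^ 2 * ‖η‖ ^ 2) / 2) := by
        intro r
        unfold gau
        rw [norm_smul, mul_pow, Real.norm_eq_abs, sq_abs]
      simp_rw [e3]
      have h5 : HasDerivAt (fun r : ℝ => -(r⁻¹ ^ 2 * ‖η‖ ^ 2) / 2) (‖η‖ ^ 2 / r ^ 3) r := by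
        have := ((((hasDerivAt_inv hr0.ne').pow 2).mul_const (‖η‖ ^ 2)).neg).div_const 2
        refine this.congr_deriv ?_
        norm_num
        field_simp
      have := (h5.exp).const_mul c0
      refine this.congr_deriv ?_
      ring
  have hprod := ((hasDerivAt_pow d a).inv (by positivity : a ^ d ≠ 0)).mul hJ
  have hfin : HasDerivAt (fun r => gs gau f r x) _ a :=
    hprod.congr_of_eventuallyEq (by
      filter_upwards [lt_mem_nhds ha] with r hr
      simp [e1 r hr])
  refine hfin.congr_deriv ?_
  have hI1 : Integrable (fun ξ => f (x + a • ξ) • gau ξ) :=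
    gs_integrable gw_gau hf k (pow_growth hK hb a x)
  have hI2 : Integrable (fun ξ => f (x + a • ξ) • (‖ξ‖ ^ 2 * gau ξ)) := by
    refine gs_integrable (GW.of_poly (by have := continuous_gau (E := E); fun_prop) 2 1 ?_) hf k
      (pow_growth hK hb a x)
    intro ξ
    rw [norm_mul, norm_pow, norm_norm, Real.norm_of_nonneg (gau_pos _).le, one_mul]
    exact mul_le_mul_of_nonneg_right
      (pow_le_pow_left₀ (norm_nonneg _) (by linarith) 2) (gau_pos _).le
  have e4 : gs lgau f a x = gs (fun ξ => ‖ξ‖ ^ 2 * gau ξ) f a x - d * gs gau f a x := by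
    unfold gs lgau
    rw [← integral_const_mul, ← integral_sub hI2 (hI1.const_mul _)]
    congr 1
    ext ξ
    simp only [smul_eq_mul]
    ring
  rw [e4, e2, e1 a ha]
  rcases Nat.eq_zero_or_pos d with h0 | h0
  · simp [h0, ha.ne']
  · obtain ⟨n, hn⟩ : ∃ n, d = n + 1 := ⟨d - 1, by omega⟩
    rw [hn]
    simp only [Nat.add_sub_cancel, Pi.inv_apply]
    field_simp
    ring

/-- The second and fourth Gaussian moments. -/
lemma integral_lgau : ∫ ξ : E, lgau ξ = 0 := by
  have h := hasDerivAt_gs_gau (E := E) (f := fun _ => 1) continuous_const (K := 1) (k := 0)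
    zero_le_one (by simp) one_pos 0
  have h2 : (fun a : ℝ => gs gau (fun _ => 1) a (0 : E)) = fun _ => 1 := by
    ext a; exact gs_const 1 a 0
  rw [h2] at h
  have := h.unique (hasDerivAt_const 1 1)
  simpa [gs] using this

lemma integrable_gau_pow (k : ℕ) : Integrable (fun ξ : E => (1 + ‖ξ‖) ^ k * gau ξ) := by
  have := (gw_gau (E := E)).integrable k
  simpa [Real.norm_of_nonneg (gau_pos _).le] using this

lemma integrable_sq_gau : Integrable (fun ξ : E => ‖ξ‖ ^ 2 * gau ξ) := by
  refine (integrable_gau_pow (E := E) 2).mono'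
    (by have := continuous_gau (E := E); fun_prop) ?_
  refine Filter.Eventually.of_forall fun ξ => ?_
  rw [norm_mul, norm_pow, norm_norm, Real.norm_of_nonneg (gau_pos _).le]
  exact mul_le_mul_of_nonneg_right
    (pow_le_pow_left₀ (norm_nonneg _) (by linarith) 2) (gau_pos _).le

lemma integrable_gau : Integrable (gau : E → ℝ) := by
  simpa using integrable_gau_pow (E := E) 0

lemma integral_sq_gau : ∫ ξ : E, ‖ξ‖ ^ 2 * gau ξ = Module.finrank ℝ E := by
  have h := integral_lgau (E := E)
  have e : ∀ ξ : E, lgau ξ = ‖ξ‖ ^ 2 * gau ξ - Module.finrank ℝ E * gau ξ := fun ξ => by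
    unfold lgau; ring
  simp_rw [e] at h
  rw [integral_sub integrable_sq_gau (integrable_gau.const_mul _), integral_const_mul,
    integral_gau] at h
  linarith

lemma integral_sq_lgau : ∫ ξ : E, ‖ξ‖ ^ 2 * lgau ξ = 2 * Module.finrank ℝ E := by
  have h := hasDerivAt_gs_gau (E := E) (f := fun w => ‖w‖ ^ 2) (by fun_prop) (K := 1) (k := 2)
    zero_le_one (fun w => by
      rw [abs_of_nonneg (by positivity), one_mul]
      exact pow_le_pow_left₀ (norm_nonneg _) (by linarith) 2) one_pos 0
  have h2 : (fun a : ℝ => gs gau (fun w => ‖w‖ ^ 2) a (0 : E)) =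
      fun a : ℝ => a ^ 2 * (Module.finrank ℝ E : ℝ) := by
    ext a
    rw [← integral_sq_gau (E := E), ← integral_const_mul]
    unfold gs
    congr 1
    ext ξ
    simp only [zero_add, norm_smul, mul_pow, Real.norm_eq_abs, sq_abs, smul_eq_mul]
    ring
  rw [h2] at h
  have := h.unique ((hasDerivAt_pow 2 1).mul_const _)
  simpa [gs] using this

end BlowUp

namespace BlowUp

variable {E : Type*} [NormedAddCommGroup E] [InnerProductSpace ℝ E] [FiniteDimensional ℝ E]
  [MeasurableSpace E] [BorelSpace E]
variable {V : Type*} [NormedAddCommGroup V] [NormedSpace ℝ V]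

lemma gs_eq_translate (ψ : E → V) (f : E → ℝ) {a : ℝ} (ha : a ≠ 0) (x : E) :
    gs ψ f a x = ∫ η, f (a • η) • ψ (η - a⁻¹ • x) := by
  unfold gs
  rw [← integral_sub_right_eq_self (fun ξ => f (x + a • ξ) • ψ ξ) (a⁻¹ • x)]
  congr 1
  ext η
  rw [smul_sub, smul_smul, mul_inv_cancel₀ ha, one_smul, add_sub_cancel]

lemma hasFDerivAt_gs {ψ : E → V} {dψ : E → E →L[ℝ] V} (hψ : GW ψ) (hdψ : GW dψ)
    (hd : ∀ ξ, HasFDerivAt ψ (dψ ξ) ξ) {f : E → ℝ} (hf : Continuous f) {K : ℝ}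
    (hK : ∀ w, |f w| ≤ K * (1 + ‖w‖)) {a : ℝ} (ha : a ≠ 0) (x : E) :
    HasFDerivAt (gs ψ f a) (-a⁻¹ • gs dψ f a x) x := by
  have hK0 : 0 ≤ K := by simpa using (abs_nonneg _).trans (hK 0)
  obtain ⟨C, hC, hb⟩ := hdψ.bd
  have hψc := hψ.cont
  have hdc := hdψ.cont
  have e : gs ψ f a = fun x => ∫ η, f (a • η) • ψ (η - a⁻¹ • x) :=
    funext fun x => gs_eq_translate ψ f ha x
  have e' : -a⁻¹ • gs dψ f a x = ∫ η, -a⁻¹ • (f (a • η) • dψ (η - a⁻¹ • x)) := by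
    rw [integral_smul, gs_eq_translate dψ f ha x]
  rw [e', e]
  let bound : E → ℝ := fun η => |a|⁻¹ * (K * (1 + |a|) * (1 + ‖a⁻¹ • x‖) *
    (C * Real.exp (1 / 4))) * ((1 + ‖η - a⁻¹ • x‖) ^ 1 *
      Real.exp (-(1 / 8) * ‖η - a⁻¹ • x‖ ^ 2))
  refine hasFDerivAt_integral_of_dominated_of_fderiv_le (𝕜 := ℝ) (bound := bound)
    (F' := fun x η => -a⁻¹ • (f (a • η) • dψ (η - a⁻¹ • x)))
    (Metric.ball_mem_nhds x (abs_pos.2 ha)) ?_ ?_ ?_ ?_ ?_ ?_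
  · exact Filter.Eventually.of_forall fun y =>
      (by fun_prop : Continuous fun η => f (a • η) • ψ (η - a⁻¹ • y)).aestronglyMeasurable
  · have h1 := gs_integrable hψ hf (a := a) (x := x) 1 (lin_growth hK a x)
    have h2 := h1.comp_sub_right (a⁻¹ • x)
    refine h2.congr (Filter.Eventually.of_forall fun η => ?_)
    simp only
    rw [smul_sub, smul_smul, mul_inv_cancel₀ ha, one_smul, add_sub_cancel]
  · exact (by fun_prop :
      Continuous fun η => -a⁻¹ • (f (a • η) • dψ (η - a⁻¹ • x))).aestronglyMeasurable
  · refine Filter.Eventually.of_forall fun η y hy => ?_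
    rw [norm_smul, norm_smul, norm_neg, norm_inv, Real.norm_eq_abs, Real.norm_eq_abs]
    have h1 : |f (a • η)| ≤ K * (1 + |a|) * (1 + ‖a⁻¹ • x‖) * (1 + ‖η - a⁻¹ • x‖) ^ 1 := by
      refine (hK _).trans ?_
      rw [mul_assoc, mul_assoc]
      refine mul_le_mul_of_nonneg_left ?_ hK0
      rw [norm_smul, Real.norm_eq_abs]
      have h2 : ‖η‖ ≤ ‖η - a⁻¹ • x‖ + ‖a⁻¹ • x‖ := by
        simpa using norm_add_le (η - a⁻¹ • x) (a⁻¹ • x)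
      have h3 : 1 + ‖η‖ ≤ (1 + ‖a⁻¹ • x‖) * (1 + ‖η - a⁻¹ • x‖) ^ 1 := by
        nlinarith [norm_nonneg (a⁻¹ • x), norm_nonneg (η - a⁻¹ • x),
          mul_nonneg (norm_nonneg (a⁻¹ • x)) (norm_nonneg (η - a⁻¹ • x))]
      calc 1 + |a| * ‖η‖ ≤ (1 + |a|) * (1 + ‖η‖) := by
            nlinarith [abs_nonneg a, norm_nonneg η]
        _ ≤ _ := by gcongr
    have h2 : ‖dψ (η - a⁻¹ • y)‖ ≤ C * Real.exp (1 / 4) *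
        Real.exp (-(1 / 8) * ‖η - a⁻¹ • x‖ ^ 2) := by
      refine (hb _).trans ?_
      rw [mul_assoc, ← Real.exp_add]
      refine mul_le_mul_of_nonneg_left (Real.exp_le_exp.2 ?_) hC
      have h3 : ‖a⁻¹ • y - a⁻¹ • x‖ ≤ 1 := by
        rw [← smul_sub, norm_smul, norm_inv, Real.norm_eq_abs]
        have := (mem_ball_iff_norm.1 hy).le
        calc |a|⁻¹ * ‖y - x‖ ≤ |a|⁻¹ * |a| := by gcongr
          _ = 1 := inv_mul_cancel₀ (abs_pos.2 ha).ne'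
      have h4 : ‖η - a⁻¹ • x‖ ≤ ‖η - a⁻¹ • y‖ + 1 := by
        have : η - a⁻¹ • x = (η - a⁻¹ • y) + (a⁻¹ • y - a⁻¹ • x) := by abel
        rw [this]
        exact (norm_add_le _ _).trans (by linarith)
      nlinarith [norm_nonneg (η - a⁻¹ • x), norm_nonneg (η - a⁻¹ • y),
        sq_nonneg (‖η - a⁻¹ • y‖ - 1)]
    calc _ ≤ |a|⁻¹ * ((K * (1 + |a|) * (1 + ‖a⁻¹ • x‖) * (1 + ‖η - a⁻¹ • x‖) ^ 1) *
          (C * Real.exp (1 / 4) * Real.exp (-(1 / 8) * ‖η - a⁻¹ • x‖ ^ 2))) := by gcongr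
      _ = bound η := by simp only [bound]; ring
  · exact ((integrable_pow_exp (E := E) 1 (b := 1 / 8) (by norm_num)).comp_sub_right
      (a⁻¹ • x)).const_mul _
  · refine Filter.Eventually.of_forall fun η y _ => ?_
    have h1 : HasFDerivAt (fun y : E => η - a⁻¹ • y) (-(a⁻¹ • ContinuousLinearMap.id ℝ E)) y :=
      ((hasFDerivAt_id y).const_smul a⁻¹).const_sub η
    have h2 := ((hd (η - a⁻¹ • y)).comp y h1).const_smul (f (a • η))
    refine h2.congr_fderiv ?_
    ext v
    simp [smul_smul, mul_comm]

/-- The total integral of the derivative of a weight vanishes. -/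
lemma integral_deriv_weight {ψ : E → V} {dψ : E → E →L[ℝ] V} (hψ : GW ψ) (hdψ : GW dψ)
    (hd : ∀ ξ, HasFDerivAt ψ (dψ ξ) ξ) : ∫ ξ, dψ ξ = 0 := by
  have h := hasFDerivAt_gs hψ hdψ hd (f := fun _ => 1) continuous_const (K := 1)
    (by intro w; simp) one_ne_zero 0
  have h2 : gs ψ (fun _ => 1) 1 = fun _ : E => ∫ ξ, ψ ξ := by
    ext x; simp [gs]
  rw [h2] at h
  have := h.unique (hasFDerivAt_const _ _)
  simpa [gs] using this

/-- The gradient weight. -/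
noncomputable def dgau (ξ : E) : E := gau ξ • ξ

/-- Minus the differential of the gradient weight. -/
noncomputable def hgau (ξ : E) : E →L[ℝ] E :=
  gau ξ • (innerSL ℝ ξ).smulRight ξ - gau ξ • ContinuousLinearMap.id ℝ E

lemma continuous_dgau : Continuous (dgau : E → E) := by
  have := continuous_gau (E := E)
  unfold dgau; fun_prop

lemma norm_dgau_le (ξ : E) : ‖dgau ξ‖ ≤ 1 * ((1 + ‖ξ‖) ^ 1 * gau ξ) := by
  unfold dgau
  rw [norm_smul, Real.norm_of_nonneg (gau_pos ξ).le]
  nlinarith [gau_pos ξ]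

lemma gw_dgau : GW (dgau : E → E) := GW.of_poly continuous_dgau 1 1 norm_dgau_le

lemma hasFDerivAt_gau (ξ : E) : HasFDerivAt gau (-innerSL ℝ (dgau ξ)) ξ := by
  unfold gau
  have h1 : HasFDerivAt (fun ξ : E => -‖ξ‖ ^ 2 / 2) (-innerSL ℝ ξ) ξ := by
    have := ((hasStrictFDerivAt_norm_sq ξ).hasFDerivAt.neg).const_mul (1 / 2)
    refine (this.congr_fderiv ?_).congr_of_eventuallyEq (Filter.Eventually.of_forall ?_)
    · ext v; simp
    · intro y; simp; ring
  refine ((h1.exp).const_mul _).congr_fderiv ?_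
  ext v
  simp [dgau, gau]
  ring

lemma hasFDerivAt_dgau (ξ : E) : HasFDerivAt dgau (-hgau ξ) ξ := by
  have := (hasFDerivAt_gau ξ).smul (hasFDerivAt_id ξ)
  refine this.congr_fderiv ?_
  ext v
  simp [hgau, dgau, smul_smul]
  abel

lemma continuous_hgau : Continuous (hgau : E → E →L[ℝ] E) := by
  have h1 := continuous_gau (E := E)
  have h2 : Continuous fun ξ : E => (innerSL ℝ ξ).smulRight ξ := by
    have : Continuous fun ξ : E =>
        (ContinuousLinearMap.smulRightL ℝ E E (innerSL ℝ ξ)) ξ := by fun_prop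
    exact this
  unfold hgau
  fun_prop

lemma gw_hgau : GW (hgau : E → E →L[ℝ] E) := by
  refine GW.of_poly continuous_hgau 2 1 fun ξ => ?_
  unfold hgau
  rw [← smul_sub, norm_smul, Real.norm_of_nonneg (gau_pos ξ).le, mul_comm, one_mul]
  refine mul_le_mul_of_nonneg_right ?_ (gau_pos ξ).le
  refine (norm_sub_le _ _).trans ?_
  rw [ContinuousLinearMap.norm_smulRight_apply, innerSL_apply_norm]
  have := ContinuousLinearMap.norm_id_le (𝕜 := ℝ) (E := E)
  nlinarith [norm_nonneg ξ]

lemma GW.neg {ψ : E → V} (h : GW ψ) : GW (fun ξ => -ψ ξ) :=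
  ⟨h.cont.neg, by obtain ⟨C, hC, hb⟩ := h.bd; exact ⟨C, hC, by simpa using hb⟩⟩

lemma gs_neg (ψ : E → V) (f : E → ℝ) (a : ℝ) (x : E) :
    gs (fun ξ => -ψ ξ) f a x = -gs ψ f a x := by
  unfold gs; rw [← integral_neg]; simp

lemma integral_hgau : ∫ ξ : E, hgau ξ = 0 := by
  have := integral_deriv_weight (E := E) gw_dgau gw_hgau.neg hasFDerivAt_dgau
  rw [integral_neg] at this
  simpa using this

lemma hasFDerivAt_gs_dgau {f : E → ℝ} (hf : Continuous f) {K : ℝ}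
    (hK : ∀ w, |f w| ≤ K * (1 + ‖w‖)) {a : ℝ} (ha : a ≠ 0) (x : E) :
    HasFDerivAt (gs dgau f a) (a⁻¹ • gs hgau f a x) x := by
  have := hasFDerivAt_gs (E := E) gw_dgau gw_hgau.neg hasFDerivAt_dgau hf hK ha x
  rw [gs_neg] at this
  simpa using this

lemma innerSL_gs_dgau {f : E → ℝ} (hf : Continuous f) {K : ℝ}
    (hK : ∀ w, |f w| ≤ K * (1 + ‖w‖)) (a : ℝ) (x : E) :
    innerSL ℝ (gs dgau f a x) = gs (fun ξ => innerSL ℝ (dgau ξ)) f a x := by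
  unfold gs
  rw [← ContinuousLinearMap.integral_comp_comm _
    (gs_integrable gw_dgau hf 1 (lin_growth hK a x))]
  congr 1
  ext ξ v
  simp only [map_smul]

lemma hasFDerivAt_gs_gau {f : E → ℝ} (hf : Continuous f) {K : ℝ}
    (hK : ∀ w, |f w| ≤ K * (1 + ‖w‖)) {a : ℝ} (ha : a ≠ 0) (x : E) :
    HasFDerivAt (gs gau f a) (a⁻¹ • innerSL ℝ (gs dgau f a x)) x := by
  have hw : GW (fun ξ : E => innerSL ℝ (dgau ξ)) := by
    refine ⟨by have := continuous_dgau (E := E); fun_prop, ?_⟩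
    obtain ⟨C, hC, hb⟩ := (gw_dgau (E := E)).bd
    exact ⟨C, hC, fun ξ => by rw [innerSL_apply_norm]; exact hb ξ⟩
  have := hasFDerivAt_gs (E := E) gw_gau hw.neg hasFDerivAt_gau hf hK ha x
  rw [gs_neg, ← innerSL_gs_dgau hf hK] at this
  simpa using this

end BlowUp

namespace BlowUp

variable {E : Type*} [NormedAddCommGroup E] [InnerProductSpace ℝ E] [FiniteDimensional ℝ E]
  [MeasurableSpace E] [BorelSpace E]
variable {V : Type*} [NormedAddCommGroup V] [NormedSpace ℝ V]

/-- Radial functions. -/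
def Rad (φ : E → ℝ) : Prop := ∀ x y, ‖x‖ = ‖y‖ → φ x = φ y

lemma Rad.mul {φ χ : E → ℝ} (h : Rad φ) (h' : Rad χ) : Rad fun x => φ x * χ x :=
  fun x y hxy => by simp only [h x y hxy, h' x y hxy]

lemma rad_gau : Rad (gau : E → ℝ) := fun x y h => by simp only [gau, h]

lemma integral_isometry (U : E ≃ₗᵢ[ℝ] E) (f : E → V) : ∫ ξ, f (U ξ) = ∫ ξ, f ξ :=
  U.measurePreserving.integral_comp' (f := U.toHomeomorph.toMeasurableEquiv) f

lemma exists_isometry {x y : E} (h : ‖x‖ = ‖y‖) : ∃ U : E ≃ₗᵢ[ℝ] E, U x = y :=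
  ⟨_, Submodule.reflection_sub h⟩

lemma rad_gs_gau {f : E → ℝ} (hf : Rad f) (a : ℝ) : Rad (gs gau f a) := by
  intro x y hxy
  obtain ⟨U, rfl⟩ := exists_isometry hxy
  unfold gs
  rw [← integral_isometry U (fun ξ => f (U x + a • ξ) • gau ξ)]
  congr 1
  ext ξ
  rw [← map_smul, ← map_add, hf (U (x + a • ξ)) (x + a • ξ) (U.norm_map _),
    rad_gau (U ξ) ξ (U.norm_map _)]

lemma gs_dgau_isometry {f : E → ℝ} (hf : Rad f) (a : ℝ) (U : E ≃ₗᵢ[ℝ] E) (x : E) :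
    gs dgau f a (U x) = U (gs dgau f a x) := by
  unfold gs
  rw [← integral_isometry U (fun ξ => f (U x + a • ξ) • dgau ξ)]
  have := U.toContinuousLinearEquiv.integral_comp_comm (μ := volume) fun ξ => f (x + a • ξ) • dgau ξ
  refine Eq.trans ?_ this
  congr 1
  ext ξ
  rw [← map_smul, ← map_add, hf (U (x + a • ξ)) (x + a • ξ) (U.norm_map _)]
  simp [dgau, rad_gau (U ξ) ξ (U.norm_map _)]

lemma integral_smul_self_of_rad {φ : E → ℝ} (hφ : Rad φ) : ∫ ξ, φ ξ • ξ = 0 := by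
  have := integral_isometry (LinearIsometryEquiv.neg ℝ) (fun ξ : E => φ ξ • ξ)
  simp only [LinearIsometryEquiv.coe_neg, smul_neg] at this
  rw [integral_neg] at this
  have e : ∫ ξ : E, φ (-ξ) • ξ = ∫ ξ, φ ξ • ξ := by
    congr 1; ext ξ; rw [hφ (-ξ) ξ (norm_neg ξ)]
  rw [e] at this
  have h2 : (2 : ℝ) • ∫ ξ : E, φ ξ • ξ = 0 := by
    rw [two_smul]; nth_rewrite 1 [← this]; simp
  simpa using h2

lemma integral_inner_of_rad {φ : E → ℝ} (hφ : Rad φ) (ω : E)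
    (hi : Integrable fun ξ => φ ξ • ξ) : ∫ ξ, φ ξ * inner ℝ ξ ω = 0 := by
  have h := integral_smul_self_of_rad hφ
  have h2 := (innerSL ℝ ω).integral_comp_comm hi
  rw [h, map_zero] at h2
  rw [← h2]
  congr 1; ext ξ; simp [real_inner_comm]

lemma integrable_inner_sq {φ : E → ℝ} (hi : Integrable fun ξ => φ ξ * ‖ξ‖ ^ 2)
    (hm : AEStronglyMeasurable φ volume) (ω e : E) :
    Integrable fun ξ => φ ξ * (inner ℝ ξ ω * inner ℝ ξ e) := by
  refine ((hi.norm).mul_const (‖ω‖ * ‖e‖)).mono' ?_ ?_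
  · exact hm.mul (by fun_prop : Continuous fun ξ : E =>
      inner ℝ ξ ω * inner ℝ ξ e).aestronglyMeasurable
  · refine Filter.Eventually.of_forall fun ξ => ?_
    have h1 := abs_real_inner_le_norm ξ ω
    have h2 := abs_real_inner_le_norm ξ e
    rw [norm_mul, norm_mul, norm_mul, norm_pow, norm_norm, mul_assoc]
    refine mul_le_mul_of_nonneg_left ?_ (norm_nonneg _)
    calc _ ≤ (‖ξ‖ * ‖ω‖) * (‖ξ‖ * ‖e‖) := by
          simp only [Real.norm_eq_abs]; gcongr
      _ = _ := by ring

lemma integral_inner_sq_of_rad {φ : E → ℝ} (hφ : Rad φ)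
    (hi : Integrable fun ξ => φ ξ * ‖ξ‖ ^ 2) (hm : AEStronglyMeasurable φ volume) (ω : E) :
    Module.finrank ℝ E * ∫ ξ, φ ξ * inner ℝ ξ ω ^ 2 = ‖ω‖ ^ 2 * ∫ ξ, φ ξ * ‖ξ‖ ^ 2 := by
  have hI : ∀ x y : E, ‖x‖ = ‖y‖ →
      ∫ ξ, φ ξ * inner ℝ ξ x ^ 2 = ∫ ξ, φ ξ * inner ℝ ξ y ^ 2 := by
    intro x y hxy
    obtain ⟨U, rfl⟩ := exists_isometry hxy
    rw [← integral_isometry U (fun ξ => φ ξ * inner ℝ ξ (U x) ^ 2)]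
    congr 1; ext ξ
    rw [U.inner_map_map, hφ (U ξ) ξ (U.norm_map _)]
  let b := stdOrthonormalBasis ℝ E
  have h1 : ∀ i, ∫ ξ, φ ξ * inner ℝ ξ ω ^ 2 = ‖ω‖ ^ 2 * ∫ ξ, φ ξ * inner ℝ ξ (b i) ^ 2 := by
    intro i
    rw [hI ω (‖ω‖ • b i) (by rw [norm_smul, b.orthonormal.1 i]; simp), ← integral_const_mul]
    congr 1; ext ξ
    rw [inner_smul_right]; ring
  have h2 : ∑ i, ∫ ξ, φ ξ * inner ℝ ξ (b i) ^ 2 = ∫ ξ, φ ξ * ‖ξ‖ ^ 2 := by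
    rw [← integral_finsetSum]
    · congr 1; ext ξ
      rw [← Finset.mul_sum, ← b.sum_sq_norm_inner_left ξ]
      simp
    · intro i _
      simpa [sq] using integrable_inner_sq hi hm (b i) (b i)
  rw [← h2, Finset.mul_sum, ← Finset.sum_congr rfl fun i _ => h1 i]
  simp

lemma integral_inner_smul_of_rad {φ : E → ℝ} (hφ : Rad φ)
    (hi : Integrable fun ξ => φ ξ * ‖ξ‖ ^ 2) (hm : AEStronglyMeasurable φ volume) (ω : E) :
    (Module.finrank ℝ E : ℝ) • ∫ ξ, (φ ξ * inner ℝ ξ ω) • ξ = (∫ ξ, φ ξ * ‖ξ‖ ^ 2) • ω := by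
  have hint : Integrable fun ξ => (φ ξ * inner ℝ ξ ω) • ξ := by
    refine ((hi.norm).mul_const ‖ω‖).mono' ?_ ?_
    · exact (hm.mul (by fun_prop : Continuous fun ξ : E => inner ℝ ξ ω).aestronglyMeasurable).smul
        continuous_id.aestronglyMeasurable
    · refine Filter.Eventually.of_forall fun ξ => ?_
      have h1 := abs_real_inner_le_norm ξ ω
      rw [norm_smul, norm_mul, norm_mul, norm_pow, norm_norm, mul_assoc, mul_assoc]
      refine mul_le_mul_of_nonneg_left ?_ (norm_nonneg _)
      rw [Real.norm_eq_abs]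
      nlinarith [norm_nonneg ξ]
  refine ext_inner_right ℝ fun e => ?_
  have h3 : inner ℝ (∫ ξ, (φ ξ * inner ℝ ξ ω) • ξ) e =
      ∫ ξ, φ ξ * (inner ℝ ξ ω * inner ℝ ξ e) := by
    rw [real_inner_comm, ← innerSL_apply_apply ℝ, ← ContinuousLinearMap.integral_comp_comm _ hint]
    congr 1; ext ξ
    simp only [innerSL_apply_apply, inner_smul_right, real_inner_comm]
    ring
  rw [inner_smul_left, inner_smul_left, h3]
  have hp := integral_inner_sq_of_rad hφ hi hm (ω + e)
  have hq := integral_inner_sq_of_rad hφ hi hm (ω - e)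
  have h4 : ∫ ξ, φ ξ * (inner ℝ ξ ω * inner ℝ ξ e) =
      4⁻¹ * (∫ ξ, φ ξ * inner ℝ ξ (ω + e) ^ 2) - 4⁻¹ * ∫ ξ, φ ξ * inner ℝ ξ (ω - e) ^ 2 := by
    rw [← integral_const_mul, ← integral_const_mul, ← integral_sub]
    · congr 1; ext ξ
      rw [inner_add_right, inner_sub_right]; ring
    · have := (integrable_inner_sq hi hm (ω + e) (ω + e)).const_mul 4⁻¹
      simpa [sq] using this
    · have := (integrable_inner_sq hi hm (ω - e) (ω - e)).const_mul 4⁻¹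
      simpa [sq] using this
  rw [h4]
  have h5 := norm_add_sq_real ω e
  have h6 := norm_sub_sq_real ω e
  simp only [RCLike.conj_to_real]
  calc _ = 4⁻¹ * (Module.finrank ℝ E * ∫ ξ, φ ξ * inner ℝ ξ (ω + e) ^ 2)
      - 4⁻¹ * (Module.finrank ℝ E * ∫ ξ, φ ξ * inner ℝ ξ (ω - e) ^ 2) := by ring
    _ = _ := by rw [hp, hq, h5, h6]; ring

end BlowUp

namespace BlowUp

variable {E : Type*} [NormedAddCommGroup E] [InnerProductSpace ℝ E] [FiniteDimensional ℝ E]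
  [MeasurableSpace E] [BorelSpace E]
variable {V : Type*} [NormedAddCommGroup V] [NormedSpace ℝ V]

/-- The length of the integration interval in the variable `a = √(2(σ-τ))`. -/
noncomputable def len (T τ : ℝ) : ℝ := √(2 * (T - τ))

lemma len_nonneg (T τ : ℝ) : 0 ≤ len T τ := Real.sqrt_nonneg _

lemma continuous_len (T : ℝ) : Continuous (len T) := by unfold len; fun_prop

lemma len_sq {T τ : ℝ} (h : τ ≤ T) : len T τ ^ 2 = 2 * (T - τ) :=
  Real.sq_sqrt (by linarith)

/-- Duhamel integral (backward in `τ`). -/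
noncomputable def Dop (F : ℝ → E → ℝ) (T τ : ℝ) (x : E) : ℝ :=
  ∫ a in (0 : ℝ)..len T τ, a * gs gau (F (τ + a ^ 2 / 2)) a x

/-- Gradient of the Duhamel integral. -/
noncomputable def Gop (F : ℝ → E → ℝ) (T τ : ℝ) (x : E) : E :=
  ∫ a in (0 : ℝ)..len T τ, gs dgau (F (τ + a ^ 2 / 2)) a x

/-- Duhamel integral against a weight of mean zero carrying a factor `a⁻¹`. -/
noncomputable def Kop (ψ : E → V) (F : ℝ → E → ℝ) (T τ : ℝ) (x : E) : V :=
  ∫ a in (0 : ℝ)..len T τ, a⁻¹ • gs ψ (F (τ + a ^ 2 / 2)) a x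

lemma continuous_gs_path {Z : Type*} [TopologicalSpace Z] [FirstCountableTopology Z]
    {ψ : E → V} (h : GW ψ) {f : Z → ℝ → E → ℝ}
    (hf : Continuous fun q : Z × ℝ × E => f q.1 q.2.1 q.2.2)
    {K : Z → ℝ → ℝ} {x : Z → E} (hK : Continuous (Function.uncurry K)) (hx : Continuous x)
    (hb : ∀ z a w, |f z a w| ≤ K z a * (1 + ‖w‖)) :
    Continuous fun q : Z × ℝ => gs ψ (f q.1 q.2) q.2 (x q.1) := by
  refine continuous_gs (Z := Z × ℝ) h (f := fun q => f q.1 q.2) (K := fun q => K q.1 q.2)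
    (a := fun q => q.2) (x := fun q => x q.1) ?_ hK (by fun_prop) (by fun_prop)
    fun q w => hb q.1 q.2 w
  exact hf.comp (f := fun q : (Z × ℝ) × E => (q.1.1, q.1.2, q.2)) (by fun_prop)

lemma continuous_gau_path {Z : Type*} [TopologicalSpace Z] [FirstCountableTopology Z]
    {f : Z → ℝ → E → ℝ} (hf : Continuous fun q : Z × ℝ × E => f q.1 q.2.1 q.2.2)
    {K : Z → ℝ → ℝ} {x : Z → E} {l : Z → ℝ}
    (hK : Continuous (Function.uncurry K)) (hx : Continuous x) (hl : Continuous l)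
    (hb : ∀ z a w, |f z a w| ≤ K z a * (1 + ‖w‖)) :
    Continuous fun z => ∫ a in (0 : ℝ)..l z, a * gs gau (f z a) a (x z) := by
  have := continuous_gs_path gw_gau hf hK hx hb
  refine intervalIntegral.continuous_parametric_intervalIntegral_of_continuous ?_ hl
  exact (by fun_prop : Continuous fun q : Z × ℝ => q.2 * gs gau (f q.1 q.2) q.2 (x q.1))

lemma continuous_dgau_path {Z : Type*} [TopologicalSpace Z] [FirstCountableTopology Z]
    {f : Z → ℝ → E → ℝ} (hf : Continuous fun q : Z × ℝ × E => f q.1 q.2.1 q.2.2)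
    {K : Z → ℝ → ℝ} {x : Z → E} {l : Z → ℝ}
    (hK : Continuous (Function.uncurry K)) (hx : Continuous x) (hl : Continuous l)
    (hb : ∀ z a w, |f z a w| ≤ K z a * (1 + ‖w‖)) :
    Continuous fun z => ∫ a in (0 : ℝ)..l z, gs dgau (f z a) a (x z) :=
  intervalIntegral.continuous_parametric_intervalIntegral_of_continuous
    (continuous_gs_path gw_dgau hf hK hx hb) hl

/-- Continuous functions of linear growth in space. -/
structure LG (F : ℝ → E → ℝ) (K : ℝ) : Prop where
  cont : Continuous (Function.uncurry F)
  bd : ∀ σ w, |F σ w| ≤ K * (1 + ‖w‖)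

lemma LG.K_nonneg {F : ℝ → E → ℝ} {K : ℝ} (h : LG F K) : 0 ≤ K := by
  simpa using (abs_nonneg _).trans (h.bd 0 0)

lemma LG.slice {F : ℝ → E → ℝ} {K : ℝ} (h : LG F K) (σ : ℝ) : Continuous (F σ) :=
  h.cont.comp (f := fun w => (σ, w)) (by fun_prop)

lemma LG.continuous_gs {F : ℝ → E → ℝ} {K : ℝ} (h : LG F K) {ψ : E → V} (hψ : GW ψ) :
    Continuous fun q : (ℝ × E) × ℝ => gs ψ (F (q.1.1 + q.2 ^ 2 / 2)) q.2 q.1.2 := by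
  refine continuous_gs_path (Z := ℝ × E) hψ (f := fun z a w => F (z.1 + a ^ 2 / 2) w)
    (K := fun _ _ => K) (x := fun z => z.2) ?_ (by fun_prop) (by fun_prop) fun z a w => h.bd _ _
  exact h.cont.comp (f := fun q : (ℝ × E) × ℝ × E => (q.1.1 + q.2.1 ^ 2 / 2, q.2.2))
    (by fun_prop)

lemma LG.continuous_gs_left {F : ℝ → E → ℝ} {K : ℝ} (h : LG F K) {ψ : E → V} (hψ : GW ψ)
    (τ : ℝ) (x : E) : Continuous fun a : ℝ => gs ψ (F (τ + a ^ 2 / 2)) a x :=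
  (h.continuous_gs hψ).comp (f := fun a : ℝ => ((τ, x), a)) (by fun_prop)

lemma LG.continuous_Dop {F : ℝ → E → ℝ} {K : ℝ} (h : LG F K) (T : ℝ) :
    Continuous fun q : ℝ × E => Dop F T q.1 q.2 := by
  have h1 := h.continuous_gs gw_gau
  have h2 := continuous_len T
  refine intervalIntegral.continuous_parametric_intervalIntegral_of_continuous
    (f := fun (q : ℝ × E) a => a * gs gau (F (q.1 + a ^ 2 / 2)) a q.2) ?_ (by fun_prop)
  exact (continuous_snd.mul h1)

lemma LG.continuous_Gop {F : ℝ → E → ℝ} {K : ℝ} (h : LG F K) (T : ℝ) :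
    Continuous fun q : ℝ × E => Gop F T q.1 q.2 := by
  have h2 := continuous_len T
  exact intervalIntegral.continuous_parametric_intervalIntegral_of_continuous
    (f := fun (q : ℝ × E) a => gs dgau (F (q.1 + a ^ 2 / 2)) a q.2)
    (h.continuous_gs gw_dgau) (by fun_prop)

lemma LG.norm_gs_le {F : ℝ → E → ℝ} {K : ℝ} (h : LG F K) {ψ : E → V} (hψ : GW ψ) (σ : ℝ)
    {a A R : ℝ} {x : E} (ha : |a| ≤ A) (hx : ‖x‖ ≤ R) :
    ‖gs ψ (F σ) a x‖ ≤ K * (1 + R + A) * mom ψ 1 := by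
  refine (BlowUp.norm_gs_le hψ 1 (lin_growth (h.bd σ) a x)).trans ?_
  have := h.K_nonneg
  have := mom_nonneg ψ 1
  gcongr

lemma uIoc_len {T τ a : ℝ} (ha : a ∈ uIoc 0 (len T τ)) : 0 < a ∧ a ≤ len T τ := by
  rwa [uIoc_of_le (len_nonneg T τ)] at ha

lemma norm_lt_of_mem_ball {x0 x : E} (h : x ∈ Metric.ball x0 1) : ‖x‖ ≤ ‖x0‖ + 1 := by
  have h1 := mem_ball_iff_norm.1 h
  have h2 : ‖x‖ ≤ ‖x - x0‖ + ‖x0‖ := by simpa using norm_add_le (x - x0) x0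
  linarith

lemma LG.hasFDerivAt_Dop {F : ℝ → E → ℝ} {K : ℝ} (h : LG F K) (T τ : ℝ) (x0 : E) :
    HasFDerivAt (Dop F T τ) (innerSL ℝ (Gop F T τ x0)) x0 := by
  have hc := h.continuous_gs_left gw_gau τ
  have hc' := h.continuous_gs_left gw_dgau τ
  have key := intervalIntegral.hasFDerivAt_integral_of_dominated_of_fderiv_le (𝕜 := ℝ)
    (μ := volume) (a := 0) (b := len T τ)
    (F := fun x a => a * gs gau (F (τ + a ^ 2 / 2)) a x)
    (F' := fun x a => innerSL ℝ (gs dgau (F (τ + a ^ 2 / 2)) a x)) (x₀ := x0)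
    (bound := fun _ => K * (1 + (‖x0‖ + 1) + len T τ) * mom (dgau : E → E) 1)
    (Metric.ball_mem_nhds x0 one_pos) ?_ ?_ ?_ ?_ ?_ ?_
  · refine key.congr_fderiv ?_
    unfold Gop
    exact ContinuousLinearMap.intervalIntegral_comp_comm _ ((hc' x0).intervalIntegrable _ _)
  · exact Filter.Eventually.of_forall fun x =>
      (continuous_id.mul (hc x)).aestronglyMeasurable
  · exact (continuous_id.mul (hc x0)).intervalIntegrable _ _
  · exact ((innerSL ℝ).continuous.comp (hc' x0)).aestronglyMeasurable
  · refine Filter.Eventually.of_forall fun a ha x hx => ?_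
    obtain ⟨h0, h1⟩ := uIoc_len ha
    rw [innerSL_apply_norm]
    exact h.norm_gs_le gw_dgau _ (by rwa [abs_of_pos h0]) (norm_lt_of_mem_ball hx)
  · exact intervalIntegrable_const
  · refine Filter.Eventually.of_forall fun a ha x _ => ?_
    obtain ⟨h0, -⟩ := uIoc_len ha
    have := (hasFDerivAt_gs_gau (h.slice (τ + a ^ 2 / 2)) (h.bd _) h0.ne' x).const_mul a
    refine this.congr_fderiv ?_
    rw [smul_smul, mul_inv_cancel₀ h0.ne', one_smul]

lemma min_one_le_sqrt {t : ℝ} (ht : 0 ≤ t) : min 1 t ≤ √t := by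
  rcases le_total t 1 with h | h
  · rw [min_eq_right h]
    exact Real.le_sqrt_of_sq_le (by nlinarith)
  · rw [min_eq_left h]
    exact Real.one_le_sqrt.2 h

lemma LG.holder_gs_dgau {F : ℝ → E → ℝ} {K : ℝ} (h : LG F K) (σ : ℝ)
    {a A R : ℝ} {x y : E} (ha0 : 0 < a) (ha : a ≤ A) (hx : ‖x‖ ≤ R) (hy : ‖y‖ ≤ R) :
    ‖gs dgau (F σ) a y - gs dgau (F σ) a x‖ ≤
      2 * (K * (1 + R + A) * (mom (dgau : E → E) 1 + mom (hgau : E → E →L[ℝ] E) 1)) *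
        √‖y - x‖ * a ^ (-(1 / 2) : ℝ) := by
  have hR : 0 ≤ R := (norm_nonneg _).trans hx
  have hK := h.K_nonneg
  have hm1 := mom_nonneg (dgau : E → E) 1
  have hm2 := mom_nonneg (hgau : E → E →L[ℝ] E) 1
  set M := K * (1 + R + A) * (mom (dgau : E → E) 1 + mom (hgau : E → E →L[ℝ] E) 1) with hM
  have hA : 0 < A := ha0.trans_le ha
  have hM0 : 0 ≤ M := by positivity
  have h1 : ‖gs dgau (F σ) a y - gs dgau (F σ) a x‖ ≤ 2 * M * 1 := by
    have e1 := h.norm_gs_le gw_dgau σ (A := A) (by rwa [abs_of_pos ha0]) hx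
    have e2 := h.norm_gs_le gw_dgau σ (A := A) (by rwa [abs_of_pos ha0]) hy
    have e3 : K * (1 + R + A) * mom (dgau : E → E) 1 ≤ M := by
      rw [hM]; gcongr; linarith
    exact (norm_sub_le _ _).trans (by linarith)
  have h2 : ‖gs dgau (F σ) a y - gs dgau (F σ) a x‖ ≤ 2 * M * (‖y - x‖ / a) := by
    have := Convex.norm_image_sub_le_of_norm_hasFDerivWithin_le (𝕜 := ℝ) (f := gs dgau (F σ) a)
      (f' := fun z => a⁻¹ • gs hgau (F σ) a z) (C := a⁻¹ * M) (s := Metric.closedBall 0 R)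
      (x := x) (y := y)
      (fun z _ => (hasFDerivAt_gs_dgau (h.slice σ) (h.bd σ) ha0.ne' z).hasFDerivWithinAt)
      (fun z hz => by
        rw [norm_smul, norm_inv, Real.norm_of_nonneg ha0.le]
        have e2 := h.norm_gs_le gw_hgau σ (A := A) (a := a) (by rwa [abs_of_pos ha0])
          (mem_closedBall_zero_iff.1 hz)
        have e3 : K * (1 + R + A) * mom (hgau : E → E →L[ℝ] E) 1 ≤ M := by
          rw [hM]; gcongr; linarith
        exact mul_le_mul_of_nonneg_left (e2.trans e3) (by positivity))
      (convex_closedBall 0 R) (mem_closedBall_zero_iff.2 hx) (mem_closedBall_zero_iff.2 hy)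
    refine this.trans ?_
    have : 0 ≤ M * (‖y - x‖ / a) := by positivity
    calc a⁻¹ * M * ‖y - x‖ = M * (‖y - x‖ / a) := by ring
      _ ≤ _ := by linarith
  have h3 : ‖gs dgau (F σ) a y - gs dgau (F σ) a x‖ ≤ 2 * M * √(‖y - x‖ / a) := by
    refine le_trans ?_ (mul_le_mul_of_nonneg_left (min_one_le_sqrt (by positivity)) (by positivity))
    rcases min_choice 1 (‖y - x‖ / a) with e | e <;> rw [e] <;> assumption
  refine h3.trans (le_of_eq ?_)
  rw [Real.sqrt_div (norm_nonneg _), Real.rpow_neg ha0.le, ← Real.sqrt_eq_rpow]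
  ring

lemma integrable_neg_half (l : ℝ) :
    IntervalIntegrable (fun a : ℝ => a ^ (-(1 / 2) : ℝ)) volume 0 l :=
  intervalIntegral.intervalIntegrable_rpow' (by norm_num)

lemma LG.holder_Gop {F : ℝ → E → ℝ} {K : ℝ} (h : LG F K) (T R A : ℝ) :
    ∃ C, 0 ≤ C ∧ ∀ τ, len T τ ≤ A → ∀ x y : E, ‖x‖ ≤ R → ‖y‖ ≤ R →
      ‖Gop F T τ y - Gop F T τ x‖ ≤ C * √‖y - x‖ := by
  set M := 2 * (K * (1 + R + A) * (mom (dgau : E → E) 1 + mom (hgau : E → E →L[ℝ] E) 1)) with hM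
  refine ⟨|M * ∫ a in (0 : ℝ)..A, a ^ (-(1 / 2) : ℝ)|, abs_nonneg _, fun τ hA x y hx hy => ?_⟩
  have hl := len_nonneg T τ
  have hc' := h.continuous_gs_left gw_dgau τ
  have hR : 0 ≤ R := (norm_nonneg _).trans hx
  have hM0 : 0 ≤ M := by
    have hK := h.K_nonneg
    have hm1 := mom_nonneg (dgau : E → E) 1
    have hm2 := mom_nonneg (hgau : E → E →L[ℝ] E) 1
    have hA0 := hl.trans hA
    positivity
  unfold Gop
  rw [← intervalIntegral.integral_sub ((hc' y).intervalIntegrable _ _)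
    ((hc' x).intervalIntegrable _ _)]
  refine (intervalIntegral.norm_integral_le_of_norm_le hl (g := fun a =>
    M * √‖y - x‖ * a ^ (-(1 / 2) : ℝ)) ?_ ((integrable_neg_half _).const_mul _)).trans ?_
  · refine Filter.Eventually.of_forall fun a ha => ?_
    exact h.holder_gs_dgau _ ha.1 (ha.2.trans hA) hx hy
  · rw [intervalIntegral.integral_const_mul]
    have h1 : ∫ a in (0 : ℝ)..len T τ, a ^ (-(1 / 2) : ℝ) ≤ ∫ a in (0 : ℝ)..A, a ^ (-(1 / 2) : ℝ) := by
      refine intervalIntegral.integral_mono_interval le_rfl hl hA ?_ (integrable_neg_half _)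
      filter_upwards [ae_restrict_mem measurableSet_Ioc] with a ha
      exact Real.rpow_nonneg ha.1.le _
    calc _ = (M * ∫ a in (0 : ℝ)..len T τ, a ^ (-(1 / 2) : ℝ)) * √‖y - x‖ := by ring
      _ ≤ (M * ∫ a in (0 : ℝ)..A, a ^ (-(1 / 2) : ℝ)) * √‖y - x‖ := by gcongr
      _ ≤ _ := by gcongr; exact le_abs_self _

end BlowUp

namespace BlowUp

variable {E : Type*} [NormedAddCommGroup E] [InnerProductSpace ℝ E] [FiniteDimensional ℝ E]
  [MeasurableSpace E] [BorelSpace E]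
variable {V : Type*} [NormedAddCommGroup V] [NormedSpace ℝ V]

/-- Local Hölder continuity of exponent `1/2` in space, uniform in time. -/
def LH (F : ℝ → E → ℝ) : Prop :=
  ∀ R : ℝ, ∃ H, 0 ≤ H ∧ ∀ σ x y, ‖x‖ ≤ R → ‖y‖ ≤ R → |F σ y - F σ x| ≤ H * √‖y - x‖

lemma LG.increment {F : ℝ → E → ℝ} {K : ℝ} (h : LG F K) (hH : LH F) (R : ℝ) :
    ∃ H, 0 ≤ H ∧ ∀ σ x z, ‖x‖ ≤ R → |F σ (x + z) - F σ x| ≤ H * √‖z‖ * (1 + ‖z‖) := by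
  rcases lt_or_ge R 0 with hR | hR
  · exact ⟨0, le_rfl, fun σ x z hx => absurd ((norm_nonneg x).trans hx) (by linarith)⟩
  obtain ⟨H, hH0, hH1⟩ := hH (R + 1)
  have hK := h.K_nonneg
  refine ⟨H + K * (2 + 2 * R), by positivity, fun σ x z hx => ?_⟩
  have hs := Real.sqrt_nonneg ‖z‖
  rcases le_total ‖z‖ 1 with hz | hz
  · have h1 := hH1 σ x (x + z) (by linarith) ((norm_add_le _ _).trans (by linarith))
    rw [add_sub_cancel_left] at h1
    refine h1.trans ?_
    rw [mul_assoc, add_mul]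
    have h2 : H * √‖z‖ ≤ H * (√‖z‖ * (1 + ‖z‖)) := by
      gcongr; nlinarith [norm_nonneg z]
    have h3 : 0 ≤ K * (2 + 2 * R) * (√‖z‖ * (1 + ‖z‖)) := by positivity
    linarith
  · have h1 : 1 ≤ √‖z‖ := Real.one_le_sqrt.2 hz
    have h2 : |F σ (x + z) - F σ x| ≤ K * (2 + 2 * R) * (1 + ‖z‖) := by
      have e1 := h.bd σ (x + z)
      have e2 := h.bd σ x
      have e3 := norm_add_le x z
      refine (abs_sub _ _).trans ?_
      have e4 : K * (1 + ‖x + z‖) + K * (1 + ‖x‖) ≤ K * ((2 + 2 * R) * (1 + ‖z‖)) := by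
        rw [← mul_add]
        refine mul_le_mul_of_nonneg_left ?_ hK
        nlinarith [norm_nonneg z, mul_nonneg hR (norm_nonneg z)]
      linarith
    calc _ ≤ K * (2 + 2 * R) * (1 + ‖z‖) := h2
      _ ≤ (H + K * (2 + 2 * R)) * (√‖z‖ * (1 + ‖z‖)) := by
          refine mul_le_mul (by linarith) ?_ (by positivity) (by positivity)
          nlinarith [norm_nonneg z]
      _ = _ := by ring

lemma LG.norm_gs_le_sqrt {F : ℝ → E → ℝ} {K : ℝ} (h : LG F K) (hH : LH F) {ψ : E → V}
    (hψ : GW ψ) (h0 : ∫ ξ, ψ ξ = 0) (R A : ℝ) :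
    ∃ C, 0 ≤ C ∧ ∀ σ a x, 0 ≤ a → a ≤ A → ‖x‖ ≤ R → ‖gs ψ (F σ) a x‖ ≤ C * √a := by
  rcases lt_or_ge A 0 with hA | hA
  · exact ⟨0, le_rfl, fun σ a x h1 h2 => by linarith⟩
  obtain ⟨H, hH0, hH1⟩ := h.increment hH R
  have hm := mom_nonneg ψ 2
  refine ⟨H * (1 + A) * mom ψ 2, by positivity, fun σ a x ha haA hx => ?_⟩
  have hc := h.slice σ
  have e : gs ψ (F σ) a x = gs ψ (fun w => F σ w - F σ x) a x := by
    unfold gs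
    simp only [sub_smul]
    rw [integral_sub (gs_integrable hψ hc 1 (lin_growth (h.bd σ) a x)), integral_smul, h0,
      smul_zero, sub_zero]
    exact (by simpa using hψ.integrable 0 : Integrable fun ξ => ‖ψ ξ‖).mono'
      hψ.cont.aestronglyMeasurable (Filter.Eventually.of_forall fun _ => le_rfl)
      |>.smul (F σ x)
  rw [e]
  refine (BlowUp.norm_gs_le hψ (K := H * (1 + A) * √a) 2 fun ξ => ?_).trans (le_of_eq (by ring))
  refine (hH1 σ x (a • ξ) hx).trans ?_
  rw [norm_smul, Real.norm_of_nonneg ha, Real.sqrt_mul ha]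
  have h1 : √‖ξ‖ ≤ 1 + ‖ξ‖ := by
    rw [Real.sqrt_le_left (by positivity)]
    nlinarith [norm_nonneg ξ]
  have h2 : 1 + a * ‖ξ‖ ≤ (1 + A) * (1 + ‖ξ‖) := by
    nlinarith [norm_nonneg ξ, mul_le_mul_of_nonneg_right haA (norm_nonneg ξ)]
  calc H * (√a * √‖ξ‖) * (1 + a * ‖ξ‖) ≤ H * (√a * (1 + ‖ξ‖)) * ((1 + A) * (1 + ‖ξ‖)) := by
        gcongr
    _ = _ := by ring

lemma inv_mul_sqrt {a : ℝ} (ha : 0 < a) : a⁻¹ * √a = a ^ (-(1 / 2) : ℝ) := by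
  rw [Real.sqrt_eq_rpow, ← Real.rpow_neg_one, ← Real.rpow_add ha]
  norm_num

lemma LG.aesm {F : ℝ → E → ℝ} {K : ℝ} (h : LG F K) {ψ : E → V} (hψ : GW ψ) (τ : ℝ) (x : E)
    (μ : Measure ℝ) :
    AEStronglyMeasurable (fun a : ℝ => a⁻¹ • gs ψ (F (τ + a ^ 2 / 2)) a x) μ :=
  (measurable_inv.aestronglyMeasurable (μ := μ)).smul
    (h.continuous_gs_left hψ τ x).aestronglyMeasurable

lemma LG.hasFDerivAt_Gop {F : ℝ → E → ℝ} {K : ℝ} (h : LG F K) (hH : LH F) (T τ : ℝ) (x0 : E) :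
    HasFDerivAt (Gop F T τ) (Kop hgau F T τ x0) x0 := by
  have hc' := h.continuous_gs_left gw_dgau τ
  obtain ⟨C, hC, hb⟩ := h.norm_gs_le_sqrt hH (gw_hgau (E := E)) integral_hgau (‖x0‖ + 1) (len T τ)
  refine intervalIntegral.hasFDerivAt_integral_of_dominated_of_fderiv_le (𝕜 := ℝ)
    (μ := volume) (a := 0) (b := len T τ)
    (F := fun x a => gs dgau (F (τ + a ^ 2 / 2)) a x)
    (F' := fun x a => a⁻¹ • gs hgau (F (τ + a ^ 2 / 2)) a x) (x₀ := x0)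
    (bound := fun a => C * a ^ (-(1 / 2) : ℝ))
    (Metric.ball_mem_nhds x0 one_pos) ?_ ?_ ?_ ?_ ?_ ?_
  · exact Filter.Eventually.of_forall fun x => (hc' x).aestronglyMeasurable
  · exact (hc' x0).intervalIntegrable _ _
  · exact h.aesm gw_hgau τ x0 _
  · refine Filter.Eventually.of_forall fun a ha x hx => ?_
    obtain ⟨h0, h1⟩ := uIoc_len ha
    rw [norm_smul, norm_inv, Real.norm_of_nonneg h0.le]
    calc _ ≤ a⁻¹ * (C * √a) := by
          gcongr; exact hb _ a x h0.le h1 (norm_lt_of_mem_ball hx)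
      _ = C * (a⁻¹ * √a) := by ring
      _ = _ := by rw [inv_mul_sqrt h0]
  · exact (integrable_neg_half _).const_mul _
  · refine Filter.Eventually.of_forall fun a ha x _ => ?_
    obtain ⟨h0, -⟩ := uIoc_len ha
    exact hasFDerivAt_gs_dgau (h.slice (τ + a ^ 2 / 2)) (h.bd _) h0.ne' x

lemma Kop_eq {ψ : E → V} (h0 : ∫ ξ, ψ ξ = 0) (F : ℝ → E → ℝ) (T τ : ℝ) (x : E) :
    Kop ψ F T τ x = ∫ r in (0 : ℝ)..1,
      r⁻¹ • gs ψ (F (τ + (len T τ * r) ^ 2 / 2)) (len T τ * r) x := by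
  unfold Kop
  rcases (len_nonneg T τ).eq_or_lt with h | h
  · rw [← h]
    have : ∀ σ, gs ψ (F σ) 0 x = 0 := by
      intro σ
      unfold gs
      simp only [zero_smul, add_zero]
      rw [integral_smul, h0, smul_zero]
    simp [this]
  · have := intervalIntegral.smul_integral_comp_mul_left (a := 0) (b := 1)
      (fun a => a⁻¹ • gs ψ (F (τ + a ^ 2 / 2)) a x) (len T τ)
    rw [mul_zero, mul_one] at this
    rw [← this, ← intervalIntegral.integral_smul]
    congr 1
    ext r
    rw [smul_smul, mul_inv, ← mul_assoc, mul_inv_cancel₀ h.ne', one_mul]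

lemma LG.continuous_Kop {F : ℝ → E → ℝ} {K : ℝ} (h : LG F K) (hH : LH F) {ψ : E → V}
    (hψ : GW ψ) (h0 : ∫ ξ, ψ ξ = 0) (T : ℝ) :
    Continuous fun q : ℝ × E => Kop ψ F T q.1 q.2 := by
  simp_rw [Kop_eq h0]
  refine continuous_iff_continuousAt.2 fun q0 => ?_
  have hl := continuous_len T
  obtain ⟨C, hC, hb⟩ := h.norm_gs_le_sqrt hH hψ h0 (‖q0.2‖ + 1) (len T q0.1 + 1)
  have hcont : ∀ r : ℝ, Continuous fun q : ℝ × E =>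
      r⁻¹ • gs ψ (F (q.1 + (len T q.1 * r) ^ 2 / 2)) (len T q.1 * r) q.2 := by
    intro r
    refine Continuous.const_smul ?_ _
    refine BlowUp.continuous_gs hψ (Z := ℝ × E) (f := fun q => F (q.1 + (len T q.1 * r) ^ 2 / 2))
      (K := fun _ => K) ?_ (by fun_prop) (by fun_prop) (by fun_prop) fun q w => h.bd _ _
    exact h.cont.comp (f := fun q : (ℝ × E) × E => (q.1.1 + (len T q.1.1 * r) ^ 2 / 2, q.2))
      (by fun_prop)
  refine intervalIntegral.continuousAt_of_dominated_interval
    (bound := fun r => C * √(len T q0.1 + 1) * r ^ (-(1 / 2) : ℝ)) ?_ ?_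
    ((integrable_neg_half _).const_mul _) ?_
  · refine Filter.Eventually.of_forall fun q => ?_
    refine (measurable_inv.aestronglyMeasurable).smul (Continuous.aestronglyMeasurable ?_)
    have := (h.continuous_gs hψ).comp (f := fun r : ℝ => ((q.1, q.2), len T q.1 * r)) (by fun_prop)
    exact this
  · have e1 : ∀ᶠ q : ℝ × E in nhds q0, len T q.1 < len T q0.1 + 1 :=
      (by fun_prop : Continuous fun q : ℝ × E => len T q.1).continuousAt.eventually_lt
        continuousAt_const (by linarith)
    have e2 : ∀ᶠ q : ℝ × E in nhds q0, ‖q.2‖ < ‖q0.2‖ + 1 :=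
      (by fun_prop : Continuous fun q : ℝ × E => ‖q.2‖).continuousAt.eventually_lt
        continuousAt_const (by linarith)
    filter_upwards [e1, e2] with q h1 h2
    refine Filter.Eventually.of_forall fun r hr => ?_
    rw [uIoc_of_le zero_le_one] at hr
    have hl0 := len_nonneg T q.1
    rw [norm_smul, norm_inv, Real.norm_of_nonneg hr.1.le]
    have e3 := hb (q.1 + (len T q.1 * r) ^ 2 / 2) (len T q.1 * r) q.2
      (mul_nonneg hl0 hr.1.le) (by nlinarith [hr.1, hr.2]) h2.le
    rw [Real.sqrt_mul hl0] at e3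
    calc _ ≤ r⁻¹ * (C * (√(len T q0.1 + 1) * √r)) := by
          have := hr.1
          refine mul_le_mul_of_nonneg_left (e3.trans ?_) (by positivity)
          gcongr
      _ = C * √(len T q0.1 + 1) * (r⁻¹ * √r) := by ring
      _ = _ := by rw [inv_mul_sqrt hr.1]
  · exact Filter.Eventually.of_forall fun r _ => (hcont r).continuousAt

lemma LG.intervalIntegrable_lgau {F : ℝ → E → ℝ} {K : ℝ} (h : LG F K) (hH : LH F) (σ : ℝ) (x : E)
    {A : ℝ} (hA : 0 ≤ A) :
    IntervalIntegrable (fun α => α⁻¹ * gs lgau (F σ) α x) volume 0 A := by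
  obtain ⟨C, hC, hb⟩ := h.norm_gs_le_sqrt hH (gw_lgau (E := E)) integral_lgau ‖x‖ A
  refine ((integrable_neg_half A).const_mul C).mono_fun' ?_ ?_
  · refine (measurable_inv.aestronglyMeasurable).mul (Continuous.aestronglyMeasurable ?_)
    refine BlowUp.continuous_gs gw_lgau (Z := ℝ) (f := fun _ => F σ) (K := fun _ => K) ?_
      (by fun_prop) (by fun_prop) (by fun_prop) fun _ w => h.bd _ _
    exact (h.slice σ).comp continuous_snd
  · rw [uIoc_of_le hA]
    filter_upwards [ae_restrict_mem measurableSet_Ioc] with α hα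
    rw [norm_mul, norm_inv, Real.norm_of_nonneg hα.1.le, ← inv_mul_sqrt hα.1]
    have := hα.1
    calc _ ≤ α⁻¹ * (C * √α) := by gcongr; exact hb σ α x hα.1.le hα.2 le_rfl
      _ = _ := by ring

lemma LG.gs_gau_eq {F : ℝ → E → ℝ} {K : ℝ} (h : LG F K) (hH : LH F) (σ : ℝ) (x : E)
    {A : ℝ} (hA : 0 ≤ A) :
    gs gau (F σ) A x = F σ x + ∫ α in (0 : ℝ)..A, α⁻¹ * gs lgau (F σ) α x := by
  have h0 : gs gau (F σ) 0 x = F σ x := by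
    unfold gs
    simp only [zero_smul, add_zero, smul_eq_mul]
    rw [integral_const_mul, integral_gau, mul_one]
  rw [intervalIntegral.integral_eq_sub_of_hasDerivAt_of_le hA (f := fun a => gs gau (F σ) a x)
    ?_ ?_ (h.intervalIntegrable_lgau hH σ x hA), h0]
  · ring
  · refine (BlowUp.continuous_gs gw_gau (Z := ℝ) (f := fun _ => F σ) (K := fun _ => K) ?_
      (by fun_prop) (by fun_prop) (by fun_prop) fun _ w => h.bd _ _).continuousOn
    exact (h.slice σ).comp continuous_snd
  · intro a ha
    exact hasDerivAt_gs_gau (h.slice σ) h.K_nonneg (k := 1) (by simpa using h.bd σ) ha.1 x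

/-- The Duhamel integral in the original time variable. -/
lemma integral_len_eq (Φ : ℝ → ℝ → ℝ) (hΦ : Continuous (Function.uncurry Φ)) {T τ : ℝ}
    (hτ : τ ≤ T) :
    ∫ a in (0 : ℝ)..len T τ, a * Φ (τ + a ^ 2 / 2) a = ∫ σ in τ..T, Φ σ (√(2 * (σ - τ))) := by
  have hc : Continuous fun σ => Φ σ (√(2 * (σ - τ))) :=
    hΦ.comp (f := fun σ => (σ, √(2 * (σ - τ)))) (by fun_prop)
  have := intervalIntegral.integral_comp_mul_deriv (a := 0) (b := len T τ)
    (f := fun a => τ + a ^ 2 / 2) (f' := fun a => a) (g := fun σ => Φ σ (√(2 * (σ - τ))))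
    (fun a _ => by
      have := ((hasDerivAt_pow 2 a).div_const 2).const_add τ
      refine this.congr_deriv ?_
      norm_num) continuousOn_id hc
  rw [len_sq hτ, show τ + 0 ^ 2 / 2 = τ by ring, show τ + 2 * (T - τ) / 2 = T by ring] at this
  rw [← this]
  refine intervalIntegral.integral_congr fun a ha => ?_
  rw [uIcc_of_le (len_nonneg T τ)] at ha
  have e : 2 * (τ + a ^ 2 / 2 - τ) = a ^ 2 := by ring
  simp only [Function.comp_apply]
  rw [e, Real.sqrt_sq ha.1]
  ring

/-- Interchange of the order of integration on a triangle, after a shear. -/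
lemma triangle_swap {g : ℝ → ℝ → ℝ} (hg : Measurable (Function.uncurry g)) {τ T C : ℝ}
    (hτ : τ ≤ T) (hb : ∀ σ α, 0 < α → α ≤ len T τ → |g σ α| ≤ C * α ^ (-(1 / 2) : ℝ)) :
    ∫ σ in τ..T, ∫ α in (0 : ℝ)..√(2 * (σ - τ)), g σ α =
      ∫ σ in τ..T, ∫ α in (0 : ℝ)..len T σ, g (σ + α ^ 2 / 2) α := by
  let S : Set (ℝ × ℝ) := {q | 0 < q.2 ∧ τ + q.2 ^ 2 / 2 < q.1 ∧ q.1 ≤ T}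
  have hS : MeasurableSet S := by
    refine (measurableSet_lt measurable_const measurable_snd).inter
      ((measurableSet_lt ?_ measurable_fst).inter (measurableSet_le measurable_fst
        measurable_const))
    fun_prop
  let G : ℝ → ℝ → ℝ := fun σ α => S.indicator (Function.uncurry g) (σ, α)
  have hG : Measurable (Function.uncurry G) := hg.indicator hS
  let dom : ℝ × ℝ → ℝ := fun q => (Ioc τ T).indicator (fun _ => (1 : ℝ)) q.1 *
    (Ioc 0 (len T τ)).indicator (fun α => C * α ^ (-(1 / 2) : ℝ)) q.2
  have hdom : Integrable dom (volume.prod volume) := by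
    refine Integrable.mul_prod ?_ ?_
    · exact (integrable_indicator_iff measurableSet_Ioc).2 (by simp)
    · refine (integrable_indicator_iff measurableSet_Ioc).2 ?_
      exact ((intervalIntegrable_iff_integrableOn_Ioc_of_le (len_nonneg T τ)).1
        ((integrable_neg_half _).const_mul C))
  have hα : ∀ α : ℝ, 0 < α → α ^ 2 / 2 ≤ T - τ → α ≤ len T τ := fun α h0 h1 =>
    Real.le_sqrt_of_sq_le (by linarith)
  have hdn : ∀ q, 0 ≤ dom q := by
    intro q
    refine mul_nonneg (indicator_nonneg (fun _ _ => zero_le_one) _) (indicator_nonneg ?_ _)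
    intro α hα'
    exact (abs_nonneg _).trans (hb 0 α hα'.1 hα'.2)
  have hle1 : ∀ σ α, |G σ α| ≤ dom (σ, α) := by
    intro σ α
    by_cases h : (σ, α) ∈ S
    · have h1 : 0 < α := h.1
      have h2 : τ + α ^ 2 / 2 < σ := h.2.1
      have h3 : σ ≤ T := h.2.2
      have h4 := hα α h1 (by linarith)
      have h5 : σ ∈ Ioc τ T := ⟨by nlinarith [sq_nonneg α], h3⟩
      have h6 : α ∈ Ioc 0 (len T τ) := ⟨h1, h4⟩
      simp only [G, dom, indicator_of_mem h, indicator_of_mem h5, indicator_of_mem h6, one_mul]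
      exact hb σ α h1 h4
    · simp only [G, indicator_of_notMem h, abs_zero]
      exact hdn _
  have hle2 : ∀ σ α, |G (σ + α ^ 2 / 2) α| ≤ dom (σ, α) := by
    intro σ α
    by_cases h : (σ + α ^ 2 / 2, α) ∈ S
    · have h1 : 0 < α := h.1
      have h2 : τ + α ^ 2 / 2 < σ + α ^ 2 / 2 := h.2.1
      have h3 : σ + α ^ 2 / 2 ≤ T := h.2.2
      have h4 := hα α h1 (by linarith)
      have h5 : σ ∈ Ioc τ T := ⟨by linarith, by nlinarith [sq_nonneg α]⟩
      have h6 : α ∈ Ioc 0 (len T τ) := ⟨h1, h4⟩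
      simp only [G, dom, indicator_of_mem h, indicator_of_mem h5, indicator_of_mem h6, one_mul]
      exact hb _ α h1 h4
    · simp only [G, indicator_of_notMem h, abs_zero]
      exact hdn _
  have hI1 : Integrable (Function.uncurry G) (volume.prod volume) :=
    hdom.mono' hG.aestronglyMeasurable (Filter.Eventually.of_forall fun q => hle1 q.1 q.2)
  have hI2 : Integrable (Function.uncurry fun σ α => G (σ + α ^ 2 / 2) α) (volume.prod volume) := by
    refine hdom.mono' (Measurable.aestronglyMeasurable ?_)
      (Filter.Eventually.of_forall fun q => hle2 q.1 q.2)
    exact hG.comp (f := fun q : ℝ × ℝ => (q.1 + q.2 ^ 2 / 2, q.2)) (by fun_prop)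
  have hL : ∫ σ in τ..T, ∫ α in (0 : ℝ)..√(2 * (σ - τ)), g σ α = ∫ σ, ∫ α, G σ α := by
    rw [intervalIntegral.integral_of_le hτ, ← integral_indicator measurableSet_Ioc]
    congr 1; ext σ
    by_cases hσ : σ ∈ Ioc τ T
    · rw [indicator_of_mem hσ, intervalIntegral.integral_of_le (Real.sqrt_nonneg _),
        integral_Ioc_eq_integral_Ioo, ← integral_indicator measurableSet_Ioo]
      congr 1; ext α
      by_cases h : α ∈ Ioo 0 √(2 * (σ - τ))
      · have : (σ, α) ∈ S := ⟨h.1, by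
          have := (Real.lt_sqrt h.1.le).1 h.2
          simp only; linarith, hσ.2⟩
        simp only [G, indicator_of_mem h, indicator_of_mem this, Function.uncurry]
      · have : (σ, α) ∉ S := fun h' => h ⟨h'.1, (Real.lt_sqrt (le_of_lt h'.1)).2 (by
          have := h'.2.1
          simp only at this; linarith)⟩
        simp only [G, indicator_of_notMem h, indicator_of_notMem this]
    · rw [indicator_of_notMem hσ]
      have : ∀ α, G σ α = 0 := fun α => by
        refine indicator_of_notMem (fun h' => hσ ⟨?_, h'.2.2⟩) _
        have := h'.2.1
        simp only at this; nlinarith [sq_nonneg α]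
      simp [this]
  have hR : ∫ σ in τ..T, ∫ α in (0 : ℝ)..len T σ, g (σ + α ^ 2 / 2) α =
      ∫ σ, ∫ α, G (σ + α ^ 2 / 2) α := by
    rw [intervalIntegral.integral_of_le hτ, ← integral_indicator measurableSet_Ioc]
    congr 1; ext σ
    by_cases hσ : σ ∈ Ioc τ T
    · rw [indicator_of_mem hσ, intervalIntegral.integral_of_le (len_nonneg _ _),
        ← integral_indicator measurableSet_Ioc]
      congr 1; ext α
      by_cases h : α ∈ Ioc 0 (len T σ)
      · have : (σ + α ^ 2 / 2, α) ∈ S := ⟨h.1, by simp only; linarith [hσ.1], by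
          have := (Real.le_sqrt' h.1).1 h.2
          simp only; linarith⟩
        simp only [G, indicator_of_mem h, indicator_of_mem this, Function.uncurry]
      · have : (σ + α ^ 2 / 2, α) ∉ S := fun h' => h ⟨h'.1, Real.le_sqrt_of_sq_le (by
          have := h'.2.2
          simp only at this; linarith)⟩
        simp only [G, indicator_of_notMem h, indicator_of_notMem this]
    · rw [indicator_of_notMem hσ]
      have : ∀ α, G (σ + α ^ 2 / 2) α = 0 := fun α => by
        refine indicator_of_notMem (fun h' => hσ ⟨?_, ?_⟩) _
        · have := h'.2.1
          simp only at this; linarith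
        · have := h'.2.2
          simp only at this; nlinarith [sq_nonneg α]
      simp [this]
  rw [hL, hR, integral_integral_swap hI1, integral_integral_swap hI2]
  congr 1; ext α
  exact (integral_add_right_eq_self (fun σ => G σ α) (α ^ 2 / 2)).symm

lemma LG.continuous_gs_slice {F : ℝ → E → ℝ} {K : ℝ} (h : LG F K) {ψ : E → V} (hψ : GW ψ)
    (x : E) : Continuous (Function.uncurry fun σ a : ℝ => gs ψ (F σ) a x) := by
  refine BlowUp.continuous_gs hψ (Z := ℝ × ℝ) (f := fun q => F q.1) (K := fun _ => K)
    (a := fun q => q.2) (x := fun _ => x) ?_ (by fun_prop) (by fun_prop) (by fun_prop)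
    fun _ w => h.bd _ _
  exact h.cont.comp (f := fun q : (ℝ × ℝ) × E => (q.1.1, q.2)) (by fun_prop)

lemma LG.Dop_eq {F : ℝ → E → ℝ} {K : ℝ} (h : LG F K) (hH : LH F) {T τ : ℝ} (hτ : τ ≤ T) (x : E) :
    Dop F T τ x = ∫ σ in τ..T, (F σ x + Kop lgau F T σ x) := by
  have hcF : Continuous fun σ => F σ x := h.cont.comp (f := fun σ => (σ, x)) (by fun_prop)
  have hcg := h.continuous_gs_slice gw_gau x
  have hcl := h.continuous_gs_slice gw_lgau x
  have hcK : Continuous fun σ => Kop lgau F T σ x :=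
    (h.continuous_Kop hH gw_lgau integral_lgau T).comp (f := fun σ => (σ, x)) (by fun_prop)
  obtain ⟨C, hC, hb⟩ := h.norm_gs_le_sqrt hH (gw_lgau (E := E)) integral_lgau ‖x‖ (len T τ)
  rw [intervalIntegral.integral_add (hcF.intervalIntegrable _ _) (hcK.intervalIntegrable _ _)]
  unfold Dop Kop
  rw [integral_len_eq (fun σ a => gs gau (F σ) a x) hcg hτ]
  simp only [smul_eq_mul]
  rw [← triangle_swap (g := fun σ α => α⁻¹ * gs lgau (F σ) α x) (C := C) ?_ hτ ?_,
    ← sub_eq_iff_eq_add', ← intervalIntegral.integral_sub]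
  · refine intervalIntegral.integral_congr fun σ _ => ?_
    rw [h.gs_gau_eq hH σ x (Real.sqrt_nonneg _)]
    ring
  · exact (hcg.comp (f := fun σ => (σ, √(2 * (σ - τ)))) (by fun_prop)).intervalIntegrable _ _
  · exact hcF.intervalIntegrable _ _
  · exact (measurable_snd.inv).mul hcl.measurable
  · intro σ α h0 h1
    rw [abs_mul, abs_inv, abs_of_pos h0, ← inv_mul_sqrt h0]
    calc _ ≤ α⁻¹ * (C * √α) := by gcongr; exact hb σ α x h0.le h1 le_rfl
      _ = _ := by ring

lemma LG.hasDerivAt_Dop {F : ℝ → E → ℝ} {K : ℝ} (h : LG F K) (hH : LH F) {T τ : ℝ} (hτ : τ < T)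
    (x : E) : HasDerivAt (fun τ => Dop F T τ x) (-(F τ x + Kop lgau F T τ x)) τ := by
  have hcF : Continuous fun σ => F σ x := h.cont.comp (f := fun σ => (σ, x)) (by fun_prop)
  have hcK : Continuous fun σ => Kop lgau F T σ x :=
    (h.continuous_Kop hH gw_lgau integral_lgau T).comp (f := fun σ => (σ, x)) (by fun_prop)
  have hc := hcF.add hcK
  have := intervalIntegral.integral_hasDerivAt_left (hc.intervalIntegrable τ T)
    hc.stronglyMeasurable.stronglyMeasurableAtFilter hc.continuousAt
  refine this.congr_of_eventuallyEq ?_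
  filter_upwards [gt_mem_nhds hτ] with σ hσ
  exact h.Dop_eq hH hσ.le x

/-- The trace of the differential of the gradient is the Laplacian. -/
lemma LG.trace_Kop {F : ℝ → E → ℝ} {K : ℝ} (h : LG F K) (hH : LH F) (T τ : ℝ) (x : E)
    {ι : Type*} [Fintype ι] (b : OrthonormalBasis ι ℝ E) :
    ∑ i, inner ℝ (b i) (Kop hgau F T τ x (b i)) = Kop lgau F T τ x := by
  have hint : IntervalIntegrable (fun a => a⁻¹ • gs hgau (F (τ + a ^ 2 / 2)) a x) volume 0
      (len T τ) := by
    obtain ⟨C, hC, hb⟩ := h.norm_gs_le_sqrt hH (gw_hgau (E := E)) integral_hgau ‖x‖ (len T τ)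
    refine ((integrable_neg_half (len T τ)).const_mul C).mono_fun' (h.aesm gw_hgau τ x _) ?_
    rw [uIoc_of_le (len_nonneg T τ)]
    filter_upwards [ae_restrict_mem measurableSet_Ioc] with α hα
    rw [norm_smul, norm_inv, Real.norm_of_nonneg hα.1.le, ← inv_mul_sqrt hα.1]
    have := hα.1
    calc _ ≤ α⁻¹ * (C * √α) := by gcongr; exact hb _ α x hα.1.le hα.2 le_rfl
      _ = _ := by ring
  let tr : (E →L[ℝ] E) →L[ℝ] ℝ := ∑ i, (innerSL ℝ (b i)).comp
    (ContinuousLinearMap.apply ℝ E (b i))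
  have htr : ∀ A : E →L[ℝ] E, tr A = ∑ i, inner ℝ (b i) (A (b i)) := fun A => by
    simp [tr]
  rw [← htr]
  unfold Kop
  rw [← ContinuousLinearMap.intervalIntegral_comp_comm tr hint]
  congr 1; ext a
  rw [map_smul]
  congr 1
  unfold gs
  rw [← ContinuousLinearMap.integral_comp_comm tr
    (gs_integrable gw_hgau (h.slice _) 1 (lin_growth (h.bd _) a x))]
  congr 1; ext ξ
  rw [map_smul]
  congr 1
  rw [htr]
  have e1 : ∀ i, inner ℝ (b i) (hgau ξ (b i)) = gau ξ * (‖inner ℝ (b i) ξ‖ ^ 2 - 1) := by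
    intro i
    simp only [hgau, _root_.sub_apply, _root_.smul_apply,
      ContinuousLinearMap.smulRight_apply, innerSL_apply_apply, ContinuousLinearMap.id_apply,
      inner_sub_right, inner_smul_right, real_inner_self_eq_norm_sq, b.orthonormal.1 i]
    rw [real_inner_comm ξ (b i), Real.norm_eq_abs, sq_abs]
    ring
  simp_rw [e1]
  rw [← Finset.mul_sum, Finset.sum_sub_distrib, b.sum_sq_norm_inner_right]
  simp [lgau, Module.finrank_eq_card_basis b.toBasis, mul_comm]

end BlowUp

namespace BlowUp

variable {E : Type*} [NormedAddCommGroup E] [InnerProductSpace ℝ E] [FiniteDimensional ℝ E]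
  [MeasurableSpace E] [BorelSpace E]
variable {V : Type*} [NormedAddCommGroup V] [NormedSpace ℝ V]

/-- The logarithmic scale attached to a parabolic distance `Y`. -/
noncomputable def LL (T Y : ℝ) : ℝ := max (-Real.log T) (-2 * Real.log Y)

lemma one_le_neg_log {T : ℝ} (h0 : 0 < T) (h1 : T ≤ Real.exp (-1)) : 1 ≤ -Real.log T := by
  have := (Real.log_le_iff_le_exp h0).2 h1
  linarith

lemma one_le_LL {T : ℝ} (h0 : 0 < T) (h1 : T ≤ Real.exp (-1)) (Y : ℝ) : 1 ≤ LL T Y :=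
  (one_le_neg_log h0 h1).trans (le_max_left _ _)

lemma LL_le {T τ Y : ℝ} (hτ : 0 < τ) (hT : τ ≤ T) (h : √τ ≤ Y) : LL T Y ≤ -Real.log τ := by
  refine max_le (neg_le_neg (Real.log_le_log hτ hT)) ?_
  have h1 := Real.log_le_log (Real.sqrt_pos.2 hτ) h
  rw [Real.log_sqrt hτ.le] at h1
  linarith

lemma LL_slow {T Y Y' K : ℝ} (h0 : 0 < T) (h1 : T ≤ Real.exp (-1)) (hY : 0 < Y) (hY' : 0 < Y')
    (hK : 1 ≤ K) (h : Y' ≤ K * Y) : LL T Y ≤ 7 * K ^ (1 / 3 : ℝ) * LL T Y' := by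
  have hK0 : 0 < K := by linarith
  have hl := one_le_LL h0 h1 Y'
  have e1 : Real.log Y' ≤ Real.log K + Real.log Y := by
    rw [← Real.log_mul hK0.ne' hY.ne']
    exact Real.log_le_log hY' h
  have e2 : Real.log K ≤ 3 * K ^ (1 / 3 : ℝ) := by
    have := Real.log_le_rpow_div hK0.le (by norm_num : (0 : ℝ) < 1 / 3)
    linarith
  have e3 : 1 ≤ K ^ (1 / 3 : ℝ) := Real.one_le_rpow hK (by norm_num)
  have e4 : LL T Y ≤ LL T Y' + 6 * K ^ (1 / 3 : ℝ) := by
    refine max_le ?_ ?_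
    · have := le_max_left (-Real.log T) (-2 * Real.log Y')
      unfold LL; linarith
    · have := le_max_right (-Real.log T) (-2 * Real.log Y')
      unfold LL; linarith
  nlinarith

lemma LL_rpow_slow {T Y Y' K r : ℝ} (h0 : 0 < T) (h1 : T ≤ Real.exp (-1)) (hY : 0 < Y)
    (hY' : 0 < Y') (hK : 1 ≤ K) (h : Y' ≤ K * Y) (hr0 : 0 ≤ r) (hr : r ≤ 3 / 2) :
    LL T Y' ^ (-r) ≤ 20 * √K * LL T Y ^ (-r) := by
  have hK0 : 0 < K := by linarith
  have hl := one_le_LL h0 h1 Y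
  have hl' := one_le_LL h0 h1 Y'
  have e1 := Real.rpow_le_rpow (by linarith) (LL_slow h0 h1 hY hY' hK h) hr0
  rw [Real.mul_rpow (by positivity) (by linarith)] at e1
  have e2 : (7 * K ^ (1 / 3 : ℝ)) ^ r ≤ 20 * √K := by
    have e3 : 1 ≤ K ^ (1 / 3 : ℝ) := Real.one_le_rpow hK (by norm_num)
    calc (7 * K ^ (1 / 3 : ℝ)) ^ r ≤ (7 * K ^ (1 / 3 : ℝ)) ^ (3 / 2 : ℝ) :=
          Real.rpow_le_rpow_of_exponent_le (by nlinarith) hr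
      _ = 7 ^ (3 / 2 : ℝ) * √K := by
          rw [Real.mul_rpow (by norm_num) (by positivity), ← Real.rpow_mul hK0.le,
            Real.sqrt_eq_rpow]
          norm_num
      _ ≤ 20 * √K := by
          gcongr
          rw [show (3 / 2 : ℝ) = 3 * (1 / 2) by norm_num, Real.rpow_mul (by norm_num),
            ← Real.sqrt_eq_rpow, Real.sqrt_le_left (by norm_num)]
          norm_num
  rw [Real.rpow_neg (by linarith), Real.rpow_neg (by linarith)]
  have p1 : 0 < LL T Y ^ r := Real.rpow_pos_of_pos (by linarith) _
  have p2 : 0 < LL T Y' ^ r := Real.rpow_pos_of_pos (by linarith) _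
  rw [← div_eq_mul_inv, le_div_iff₀ p1, inv_mul_le_iff₀ p2]
  calc _ ≤ _ := e1
    _ ≤ 20 * √K * LL T Y' ^ r := by gcongr
    _ = _ := by ring

/-- Powers of the logarithm are dominated by small powers. -/
lemma log_rpow_le {k η : ℝ} (hk : 0 < k) (hη : 0 < η) {τ : ℝ} (h0 : 0 < τ) (h1 : τ ≤ 1) :
    (-Real.log τ) ^ k * τ ^ η ≤ (k / η) ^ k := by
  have hl : 0 ≤ -Real.log τ := by linarith [Real.log_nonpos h0.le h1]
  have h2 := (Real.abs_log_mul_self_rpow_lt τ (η / k) h0 h1 (by positivity)).le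
  rw [abs_mul, abs_of_pos (Real.rpow_pos_of_pos h0 _), abs_of_nonpos (by linarith), one_div_div]
    at h2
  have h3 := Real.rpow_le_rpow (by positivity) h2 hk.le
  rwa [Real.mul_rpow hl (by positivity), ← Real.rpow_mul h0.le, div_mul_cancel₀ _ hk.ne'] at h3

/-- The parabolic distance to the blow-up point. -/
noncomputable def YY (τ : ℝ) (x : E) : ℝ := ‖x‖ + √τ

/-- The self-similar weight of linear growth. -/
noncomputable def WW (τ : ℝ) (x : E) : ℝ := 1 + ‖x‖ / √τ

lemma YY_pos {τ : ℝ} (h : 0 < τ) (x : E) : 0 < YY τ x :=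
  add_pos_of_nonneg_of_pos (norm_nonneg _) (Real.sqrt_pos.2 h)

lemma sqrt_le_YY (τ : ℝ) (x : E) : √τ ≤ YY τ x := le_add_of_nonneg_left (norm_nonneg _)

lemma norm_le_YY (τ : ℝ) (x : E) : ‖x‖ ≤ YY τ x := le_add_of_nonneg_right (Real.sqrt_nonneg _)

lemma one_le_WW (τ : ℝ) (x : E) : 1 ≤ WW τ x :=
  le_add_of_nonneg_right (by positivity)

lemma YY_eq {τ : ℝ} (h : 0 < τ) (x : E) : YY τ x = √τ * WW τ x := by
  have := (Real.sqrt_pos.2 h).ne'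
  unfold YY WW; field_simp; ring

/-- The squared length scale which bounds the profile from below. -/
noncomputable def qq (T τ : ℝ) (x : E) : ℝ := τ + ‖x‖ ^ 2 / LL T (YY τ x)

lemma le_qq {T τ : ℝ} (h0 : 0 < T) (h1 : T ≤ Real.exp (-1)) (x : E) : τ ≤ qq T τ x := by
  have := one_le_LL h0 h1 (YY τ x)
  exact le_add_of_nonneg_right (by positivity)

lemma YY_sq_le_qq {T τ : ℝ} (h0 : 0 < T) (h1 : T ≤ Real.exp (-1)) (hτ : 0 < τ) (x : E) :
    YY τ x ^ 2 ≤ 2 * LL T (YY τ x) * qq T τ x := by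
  have h2 := one_le_LL h0 h1 (YY τ x)
  have h3 := Real.sq_sqrt hτ.le
  have h4 : LL T (YY τ x) * qq T τ x = LL T (YY τ x) * τ + ‖x‖ ^ 2 := by
    unfold qq; field_simp
  have h5 : YY τ x ^ 2 ≤ 2 * τ + 2 * ‖x‖ ^ 2 := by
    unfold YY; nlinarith [sq_nonneg (‖x‖ - √τ)]
  nlinarith

lemma qq_ge {T τ : ℝ} (h0 : 0 < T) (h1 : T ≤ Real.exp (-1)) (hτ : 0 < τ) (hT : τ ≤ T) (x : E) :
    τ + ‖x‖ ^ 2 / (-Real.log τ) ≤ qq T τ x := by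
  have h2 := one_le_LL h0 h1 (YY τ x)
  have h3 := LL_le hτ hT (sqrt_le_YY τ x)
  unfold qq
  gcongr

lemma quot_le {q τ X L θ : ℝ} (hτ : 0 < τ) (hq : τ ≤ q) (hX : 0 < X) (hL : 1 ≤ L)
    (h : X ≤ 2 * L * q) (h0 : 0 ≤ θ) (h1 : θ ≤ 1) :
    X / (L ^ 2 * q) ≤ 2 * L ^ (-1 - θ) * (X / τ) ^ θ := by
  have hq0 : 0 < q := by linarith
  have e1 : X / q = (X / q) ^ θ * (X / q) ^ (1 - θ) := by
    rw [← Real.rpow_add (by positivity)]; simp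
  have e2 : (X / q) ^ θ ≤ (X / τ) ^ θ := by gcongr
  have e3 : (X / q) ^ (1 - θ) ≤ (2 * L) ^ (1 - θ) :=
    Real.rpow_le_rpow (by positivity) ((div_le_iff₀ hq0).2 h) (by linarith)
  have e4 : (2 * L) ^ (1 - θ) ≤ 2 * L ^ (1 - θ) := by
    rw [Real.mul_rpow (by norm_num) (by linarith)]
    gcongr
    calc (2 : ℝ) ^ (1 - θ) ≤ 2 ^ (1 : ℝ) := by
          apply Real.rpow_le_rpow_of_exponent_le <;> linarith
      _ = 2 := by norm_num
  have e5 : L ^ (1 - θ) = L ^ 2 * L ^ (-1 - θ) := by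
    rw [← Real.rpow_natCast, ← Real.rpow_add (by linarith)]
    congr 1; push_cast; ring
  have hL0 : 0 < L := by linarith
  calc X / (L ^ 2 * q) = (L ^ 2)⁻¹ * (X / q) := by field_simp
    _ ≤ (L ^ 2)⁻¹ * ((X / τ) ^ θ * (2 * L ^ (1 - θ))) := by
        rw [e1]
        gcongr
        exact e3.trans e4
    _ = _ := by rw [e5]; field_simp

/-- The structural parameters of the equation. -/
structure Par (E : Type*) [NormedAddCommGroup E] [InnerProductSpace ℝ E] where
  P : ℝ
  μ : ℝ
  m : ℝ
  hP : 0 < P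
  hd : 0 < Module.finrank ℝ E
  hm1 : (Module.finrank ℝ E : ℝ) / 2 < m
  hm2 : m < (Module.finrank ℝ E : ℝ) / 2 + 1 / 2

namespace Par
variable (a : Par E)

noncomputable def c : ℝ := (a.P + 1) / a.P
noncomputable def b : ℝ := a.P ^ 2 / (4 * (a.P + 1))
noncomputable def C1 : ℝ := 8 * a.b + 1
noncomputable def c1 : ℝ := min (a.P / 2) (a.b / 4)
noncomputable def γ : ℝ := 1 / 2 + (Module.finrank ℝ E : ℝ) / 2 - a.m

lemma c_pos : 0 < a.c := by have := a.hP; unfold c; positivity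
lemma b_pos : 0 < a.b := by have := a.hP; unfold b; positivity
lemma C1_pos : 0 < a.C1 := by have := a.b_pos; unfold C1; positivity
lemma c1_pos : 0 < a.c1 := by have := a.b_pos; have := a.hP; unfold c1; positivity
lemma γ_pos : 0 < a.γ := by have := a.hm2; unfold γ; linarith
lemma m_pos : 0 < a.m := by
  have := a.hm1
  have : (0 : ℝ) ≤ Module.finrank ℝ E := by positivity
  linarith

/-- The solution, truncated from below. -/
noncomputable def vcl (T τ : ℝ) (v : E → ℝ) (x : E) : ℝ := max (v x) (a.c1 * qq T τ x)

/-- The length of the gradient, truncated from above. -/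
noncomputable def Gcl (T τ : ℝ) (g : ℝ) (x : E) : ℝ := min |g| (a.C1 * YY τ x / LL T (YY τ x))

/-- The nonlocal term. -/
noncomputable def nl (T τ : ℝ) (v : E → ℝ) (x : E) : ℝ :=
  ∫ y in Metric.ball (0 : E) ‖x‖, a.vcl T τ v y ^ (-a.m)

/-- The truncated nonlinearity. -/
noncomputable def Ftr (T τ : ℝ) (v : E → ℝ) (g : ℝ) (x : E) : ℝ :=
  a.c * a.Gcl T τ g x ^ 2 / a.vcl T τ v x + a.μ * a.Gcl T τ g x * a.nl T τ v x

variable {a}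
variable {T τ : ℝ} (h0 : 0 < T) (h1 : T ≤ Real.exp (-1)) (hτ : 0 < τ) (hT : τ ≤ T)
include h0 h1

lemma Gcl_le (g : ℝ) (x : E) : a.Gcl T τ g x ≤ a.C1 * YY τ x / LL T (YY τ x) := min_le_right _ _

include hτ in
lemma Gcl_nonneg (g : ℝ) (x : E) : 0 ≤ a.Gcl T τ g x := by
  have := one_le_LL h0 h1 (YY τ x)
  have := a.C1_pos
  have := YY_pos hτ x
  exact le_min (abs_nonneg _) (by positivity)

include hτ in
lemma qq_pos (x : E) : 0 < qq T τ x := hτ.trans_le (le_qq h0 h1 x)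

include hτ in
lemma vcl_pos (v : E → ℝ) (x : E) : 0 < a.vcl T τ v x :=
  (mul_pos a.c1_pos (qq_pos h0 h1 hτ x)).trans_le (le_max_right _ _)

omit h0 h1 in
lemma vcl_ge (v : E → ℝ) (x : E) : a.c1 * qq T τ x ≤ a.vcl T τ v x := le_max_right _ _

end Par

end BlowUp

namespace BlowUp

variable {E : Type*} [NormedAddCommGroup E] [InnerProductSpace ℝ E] [FiniteDimensional ℝ E]
  [MeasurableSpace E] [BorelSpace E]
variable {V : Type*} [NormedAddCommGroup V] [NormedSpace ℝ V]

lemma abs_rpow_neg_sub_le {m l x y : ℝ} (hm : 0 ≤ m) (hl : 0 < l) (hx : l ≤ x) (hy : l ≤ y) :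
    |x ^ (-m) - y ^ (-m)| ≤ m * l ^ (-m - 1) * |x - y| := by
  have := (convex_Ici l).norm_image_sub_le_of_norm_hasDerivWithin_le (𝕜 := ℝ)
    (f := fun t : ℝ => t ^ (-m)) (f' := fun t => -m * t ^ (-m - 1)) (C := m * l ^ (-m - 1))
    (x := y) (y := x) (fun t ht => ?_) (fun t ht => ?_) hy hx
  · simpa using this
  · exact (Real.hasDerivAt_rpow_const (Or.inl (hl.trans_le ht).ne')).hasDerivWithinAt
  · have ht0 : 0 < t := hl.trans_le ht
    rw [norm_mul, norm_neg, Real.norm_of_nonneg hm,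
      Real.norm_of_nonneg (Real.rpow_pos_of_pos ht0 _).le]
    exact mul_le_mul_of_nonneg_left (Real.rpow_le_rpow_of_nonpos hl ht (by linarith)) hm

/-- The mass of the limiting nonlocal kernel. -/
noncomputable def JJ (E : Type*) [NormedAddCommGroup E] [InnerProductSpace ℝ E]
    [FiniteDimensional ℝ E] [MeasurableSpace E] [BorelSpace E] (m : ℝ) : ℝ :=
  ∫ z : E, (1 + ‖z‖ ^ 2) ^ (-m)

lemma JJ_nonneg (m : ℝ) : 0 ≤ JJ E m := integral_nonneg fun _ => by positivity

lemma integrable_scaled {m s τ : ℝ} (hm : (Module.finrank ℝ E : ℝ) / 2 < m) (hs : 0 < s)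
    (hτ : 0 < τ) :
    Integrable (fun y : E => (τ + ‖y‖ ^ 2 / s) ^ (-m)) ∧
      ∫ y : E, (τ + ‖y‖ ^ 2 / s) ^ (-m) =
        s ^ ((Module.finrank ℝ E : ℝ) / 2) * τ ^ ((Module.finrank ℝ E : ℝ) / 2 - m) * JJ E m := by
  have hst : 0 < s * τ := by positivity
  have hr : 0 < (√(s * τ))⁻¹ := by positivity
  have e : (fun y : E => (τ + ‖y‖ ^ 2 / s) ^ (-m)) = fun y =>
      τ ^ (-m) * (fun z : E => (1 + ‖z‖ ^ 2) ^ (-m)) ((√(s * τ))⁻¹ • y) := by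
    ext y
    simp only
    rw [← Real.mul_rpow hτ.le (by positivity), norm_smul, Real.norm_of_nonneg hr.le, mul_pow,
      inv_pow, Real.sq_sqrt hst.le]
    congr 1
    field_simp
  have hi : Integrable (fun z : E => (1 + ‖z‖ ^ 2) ^ (-m)) := by
    have := integrable_rpow_neg_one_add_norm_sq (E := E) (μ := volume) (r := 2 * m) (by linarith)
    refine this.congr (Filter.Eventually.of_forall fun z => ?_)
    simp only
    congr 1; ring
  rw [e]
  refine ⟨(hi.comp_smul hr.ne').const_mul _, ?_⟩
  have e3 := integral_comp_smul_pos (F := fun z : E => (1 + ‖z‖ ^ 2) ^ (-m)) hr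
  rw [integral_const_mul, e3, smul_eq_mul, inv_pow, inv_inv]
  have e2 : √(s * τ) ^ Module.finrank ℝ E = s ^ ((Module.finrank ℝ E : ℝ) / 2) *
      τ ^ ((Module.finrank ℝ E : ℝ) / 2) := by
    rw [← Real.mul_rpow hs.le hτ.le, Real.sqrt_eq_rpow, ← Real.rpow_natCast, ← Real.rpow_mul hst.le]
    congr 1; ring
  rw [e2, sub_eq_add_neg, Real.rpow_add hτ]
  unfold JJ
  ring

lemma abs_setIntegral_le {m s τ K : ℝ} (hm : (Module.finrank ℝ E : ℝ) / 2 < m) (hs : 0 < s)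
    (hτ : 0 < τ) (hK : 0 ≤ K) {f : E → ℝ} (hf : ∀ y, |f y| ≤ K * (τ + ‖y‖ ^ 2 / s) ^ (-m))
    (S : Set E) :
    |∫ y in S, f y| ≤ K * (s ^ ((Module.finrank ℝ E : ℝ) / 2) *
      τ ^ ((Module.finrank ℝ E : ℝ) / 2 - m) * JJ E m) := by
  obtain ⟨hi, he⟩ := integrable_scaled (E := E) hm hs hτ
  rw [← he, ← integral_const_mul]
  refine (norm_integral_le_of_norm_le ((hi.const_mul K).mono_measure Measure.restrict_le_self)
    (Filter.Eventually.of_forall fun y => (Real.norm_eq_abs _).trans_le (hf y))).trans ?_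
  exact setIntegral_le_integral (hi.const_mul K)
    (Filter.Eventually.of_forall fun y => by positivity)

namespace Par
variable {a : Par E}

lemma vcl_rpow_le {T τ : ℝ} (h0 : 0 < T) (h1 : T ≤ Real.exp (-1)) (hτ : 0 < τ) (hT : τ ≤ T)
    (v : E → ℝ) (y : E) :
    a.vcl T τ v y ^ (-a.m) ≤ a.c1 ^ (-a.m) * (τ + ‖y‖ ^ 2 / (-Real.log τ)) ^ (-a.m) := by
  have hs : 0 < -Real.log τ := by linarith [one_le_neg_log hτ (hT.trans h1)]
  rw [← Real.mul_rpow a.c1_pos.le (by positivity)]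
  refine Real.rpow_le_rpow_of_nonpos (mul_pos a.c1_pos (by positivity)) ?_ (by linarith [a.m_pos])
  exact (mul_le_mul_of_nonneg_left (qq_ge h0 h1 hτ hT y) a.c1_pos.le).trans (vcl_ge v y)

lemma nl_nonneg {T τ : ℝ} (h0 : 0 < T) (h1 : T ≤ Real.exp (-1)) (hτ : 0 < τ)
    (v : E → ℝ) (x : E) : 0 ≤ a.nl T τ v x :=
  integral_nonneg fun y => Real.rpow_nonneg (vcl_pos h0 h1 hτ v y).le _

lemma half_sub_m : (Module.finrank ℝ E : ℝ) / 2 - a.m = a.γ - 1 / 2 := by unfold γ; ring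

lemma nl_le {T τ : ℝ} (h0 : 0 < T) (h1 : T ≤ Real.exp (-1)) (hτ : 0 < τ) (hT : τ ≤ T)
    (v : E → ℝ) (x : E) :
    a.nl T τ v x ≤ a.c1 ^ (-a.m) * ((-Real.log τ) ^ ((Module.finrank ℝ E : ℝ) / 2) *
      τ ^ (a.γ - 1 / 2) * JJ E a.m) := by
  have hs : 0 < -Real.log τ := by linarith [one_le_neg_log hτ (hT.trans h1)]
  have := abs_setIntegral_le a.hm1 hs hτ (Real.rpow_nonneg a.c1_pos.le (-a.m))
    (f := fun y => a.vcl T τ v y ^ (-a.m)) (fun y => by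
      rw [abs_of_nonneg (Real.rpow_nonneg (vcl_pos h0 h1 hτ v y).le _)]
      exact vcl_rpow_le h0 h1 hτ hT v y) (Metric.ball 0 ‖x‖)
  rw [half_sub_m] at this
  exact (le_abs_self _).trans this

variable (a) in
/-- A bound for the logarithms absorbed by the subcritical nonlocal term. -/
lemma exists_log_bound : ∃ C, 0 < C ∧ ∀ τ, 0 < τ → τ ≤ Real.exp (-1) →
    (-Real.log τ) ^ ((Module.finrank ℝ E : ℝ) / 2 + 1 / 2) * τ ^ (a.γ / 2) ≤ C := by
  have hk : 0 < (Module.finrank ℝ E : ℝ) / 2 + 1 / 2 := by positivity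
  have hg := a.γ_pos
  exact ⟨_, by positivity, fun τ h0 h1 => log_rpow_le hk (half_pos hg) h0
    (h1.trans (Real.exp_le_one_iff.2 (by norm_num)))⟩

lemma sqrt_mul_rpow {τ : ℝ} (hτ : 0 < τ) (γ : ℝ) : √τ * τ ^ (γ - 1 / 2) = τ ^ γ := by
  rw [Real.sqrt_eq_rpow, ← Real.rpow_add hτ]; congr 1; ring

variable (a) in
/-- Pointwise bounds on the truncated nonlinearity. -/
lemma exists_Ftr_bound : ∃ A, 0 < A ∧ ∀ T τ : ℝ, 0 < T → T ≤ Real.exp (-1) → 0 < τ → τ ≤ T →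
    ∀ (v : E → ℝ) (g : ℝ) (x : E),
      |a.Ftr T τ v g x| ≤ A * (LL T (YY τ x) ^ (-(3 / 2) : ℝ) * WW τ x) ∧
      |a.Ftr T τ v g x| ≤ A * (LL T (YY τ x) ^ (-(5 / 4) : ℝ) * √(WW τ x) +
        LL T (YY τ x) ^ (-(3 / 2) : ℝ) * (τ ^ (a.γ / 2) * WW τ x)) ∧
      |a.μ * a.Gcl T τ g x * a.nl T τ v x| ≤
        A * (LL T (YY τ x) ^ (-(3 / 2) : ℝ) * (τ ^ (a.γ / 2) * WW τ x)) := by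
  obtain ⟨C0, hC0, hlog⟩ := a.exists_log_bound
  have hc := a.c_pos
  have hc1 := a.c1_pos
  have hC1 := a.C1_pos
  have hJ := JJ_nonneg (E := E) a.m
  set A1 := 2 * (a.c * a.C1 ^ 2 / a.c1) with hA1
  set A2 := |a.μ| * a.C1 * a.c1 ^ (-a.m) * C0 * JJ E a.m with hA2
  have hA1p : 0 < A1 := by positivity
  have hA2p : 0 ≤ A2 := by positivity
  refine ⟨A1 + A2, by positivity, fun T τ h0 h1 hτ hT v g x => ?_⟩
  have hs := one_le_neg_log hτ (hT.trans h1)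
  set s := -Real.log τ with hsd
  set L := LL T (YY τ x) with hLd
  have hL : 1 ≤ L := one_le_LL h0 h1 _
  have hLs : L ≤ s := LL_le hτ hT (sqrt_le_YY τ x)
  have hL0 : 0 < L := by linarith
  have hY := YY_pos hτ x
  have hW := one_le_WW τ x
  have hq := qq_pos h0 h1 hτ x
  have hG := Gcl_le h0 h1 (a := a) (τ := τ) g x
  have hG0 := Gcl_nonneg h0 h1 hτ (a := a) g x
  have hv := vcl_ge (a := a) (T := T) (τ := τ) v x
  have hvp := vcl_pos (a := a) h0 h1 hτ v x
  have hγ := a.γ_pos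
  have hτ1 : τ ≤ 1 := (hT.trans h1).trans (Real.exp_le_one_iff.2 (by norm_num))
  have hYW : YY τ x ^ 2 / τ = WW τ x ^ 2 := by
    rw [YY_eq hτ, mul_pow, Real.sq_sqrt hτ.le]; field_simp
  -- the local term
  have F1 : ∀ θ : ℝ, 0 ≤ θ → θ ≤ 1 → |a.c * a.Gcl T τ g x ^ 2 / a.vcl T τ v x| ≤
      A1 * (L ^ (-1 - θ) * (WW τ x ^ 2) ^ θ) := by
    intro θ hθ0 hθ1
    rw [abs_of_nonneg (by positivity)]
    have := quot_le hτ (le_qq h0 h1 x) (by positivity) hL (YY_sq_le_qq h0 h1 hτ x) hθ0 hθ1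
    rw [hYW] at this
    calc a.c * a.Gcl T τ g x ^ 2 / a.vcl T τ v x
        ≤ a.c * (a.C1 * YY τ x / L) ^ 2 / (a.c1 * qq T τ x) := by gcongr
      _ = a.c * a.C1 ^ 2 / a.c1 * (YY τ x ^ 2 / (L ^ 2 * qq T τ x)) := by field_simp
      _ ≤ a.c * a.C1 ^ 2 / a.c1 * (2 * L ^ (-1 - θ) * (WW τ x ^ 2) ^ θ) := by gcongr
      _ = _ := by rw [hA1]; ring
  have hF1a := F1 (1 / 2) (by norm_num) (by norm_num)
  rw [← Real.sqrt_eq_rpow, Real.sqrt_sq (by linarith)] at hF1a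
  norm_num at hF1a
  have hF1b := F1 (1 / 4) (by norm_num) (by norm_num)
  have e4 : (WW τ x ^ 2) ^ (1 / 4 : ℝ) = √(WW τ x) := by
    rw [← Real.rpow_natCast, ← Real.rpow_mul (by linarith), Real.sqrt_eq_rpow]
    norm_num
  rw [e4, show (-1 - 1 / 4 : ℝ) = -(5 / 4) by norm_num] at hF1b
  -- the nonlocal term
  have F2 : |a.μ * a.Gcl T τ g x * a.nl T τ v x| ≤
      A2 * (L ^ (-(3 / 2) : ℝ) * (τ ^ (a.γ / 2) * WW τ x)) := by
    rw [abs_mul, abs_mul, abs_of_nonneg hG0, abs_of_nonneg (nl_nonneg h0 h1 hτ v x)]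
    have e1 := nl_le (a := a) h0 h1 hτ hT v x
    rw [← hsd] at e1
    have e2 : L⁻¹ * s ^ ((Module.finrank ℝ E : ℝ) / 2) ≤
        L ^ (-(3 / 2) : ℝ) * s ^ ((Module.finrank ℝ E : ℝ) / 2 + 1 / 2) := by
      rw [Real.rpow_add (by linarith), show (-(3 / 2) : ℝ) = -1 + -(1 / 2) by norm_num,
        Real.rpow_add hL0, Real.rpow_neg_one]
      have : 1 ≤ L ^ (-(1 / 2) : ℝ) * s ^ (1 / 2 : ℝ) := by
        rw [Real.rpow_neg hL0.le, inv_mul_eq_div, one_le_div (by positivity)]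
        gcongr
      calc L⁻¹ * s ^ ((Module.finrank ℝ E : ℝ) / 2) =
          L⁻¹ * s ^ ((Module.finrank ℝ E : ℝ) / 2) * 1 := by ring
        _ ≤ L⁻¹ * s ^ ((Module.finrank ℝ E : ℝ) / 2) * (L ^ (-(1 / 2) : ℝ) * s ^ (1 / 2 : ℝ)) := by
            gcongr
        _ = _ := by ring
    have e3 := hlog τ hτ (hT.trans h1)
    rw [← hsd] at e3
    have e4 := sqrt_mul_rpow hτ a.γ
    have e5 : τ ^ a.γ = τ ^ (a.γ / 2) * τ ^ (a.γ / 2) := by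
      rw [← Real.rpow_add hτ]; congr 1; ring
    calc |a.μ| * a.Gcl T τ g x * a.nl T τ v x
        ≤ |a.μ| * (a.C1 * YY τ x / L) * (a.c1 ^ (-a.m) *
          (s ^ ((Module.finrank ℝ E : ℝ) / 2) * τ ^ (a.γ - 1 / 2) * JJ E a.m)) := by
          gcongr
          exact nl_nonneg h0 h1 hτ v x
      _ = |a.μ| * a.C1 * a.c1 ^ (-a.m) * JJ E a.m * (√τ * τ ^ (a.γ - 1 / 2)) * WW τ x *
          (L⁻¹ * s ^ ((Module.finrank ℝ E : ℝ) / 2)) := by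
          rw [YY_eq hτ]; field_simp
      _ ≤ |a.μ| * a.C1 * a.c1 ^ (-a.m) * JJ E a.m * (√τ * τ ^ (a.γ - 1 / 2)) * WW τ x *
          (L ^ (-(3 / 2) : ℝ) * s ^ ((Module.finrank ℝ E : ℝ) / 2 + 1 / 2)) := by gcongr
      _ = |a.μ| * a.C1 * a.c1 ^ (-a.m) * JJ E a.m * τ ^ (a.γ / 2) * WW τ x * L ^ (-(3 / 2) : ℝ) *
          (s ^ ((Module.finrank ℝ E : ℝ) / 2 + 1 / 2) * τ ^ (a.γ / 2)) := by rw [e4, e5]; ring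
      _ ≤ |a.μ| * a.C1 * a.c1 ^ (-a.m) * JJ E a.m * τ ^ (a.γ / 2) * WW τ x * L ^ (-(3 / 2) : ℝ) *
          C0 := by gcongr
      _ = _ := by rw [hA2]; ring
  have hτγ : τ ^ (a.γ / 2) ≤ 1 := Real.rpow_le_one hτ.le hτ1 (by linarith)
  have p1 : 0 < L ^ (-(3 / 2) : ℝ) := by positivity
  have p2 : 0 < L ^ (-(5 / 4) : ℝ) := by positivity
  have p3 : 0 < τ ^ (a.γ / 2) := by positivity
  have p4 : L ^ (-(3 / 2) : ℝ) * (τ ^ (a.γ / 2) * WW τ x) ≤ L ^ (-(3 / 2) : ℝ) * WW τ x := by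
    gcongr; nlinarith
  refine ⟨?_, ?_, ?_⟩
  · refine (abs_add_le _ _).trans ((add_le_add hF1a F2).trans ?_)
    rw [add_mul]
    gcongr
  · refine (abs_add_le _ _).trans ((add_le_add hF1b F2).trans ?_)
    rw [mul_add]
    gcongr <;> linarith
  · refine F2.trans ?_
    gcongr; linarith

end Par

end BlowUp

namespace BlowUp

variable {E : Type*} [NormedAddCommGroup E] [InnerProductSpace ℝ E] [FiniteDimensional ℝ E]
  [MeasurableSpace E] [BorelSpace E]
variable {V : Type*} [NormedAddCommGroup V] [NormedSpace ℝ V]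

lemma abs_max_sub_max_le' (x y c : ℝ) : |max x c - max y c| ≤ |x - y| := by
  have := abs_max_sub_max_le_max x c y c
  simpa using this

lemma abs_min_sub_min_le' (x y c : ℝ) : |min x c - min y c| ≤ |x - y| := by
  have := abs_min_sub_min_le_max x c y c
  simpa using this

namespace Par
variable {a : Par E}

lemma abs_Gcl_sub_le (T τ g1 g2 : ℝ) (x : E) : |a.Gcl T τ g1 x - a.Gcl T τ g2 x| ≤ |g1 - g2| :=
  (abs_min_sub_min_le' _ _ _).trans (abs_abs_sub_abs_le g1 g2)

lemma abs_vcl_sub_le (T τ : ℝ) (v1 v2 : E → ℝ) (x : E) :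
    |a.vcl T τ v1 x - a.vcl T τ v2 x| ≤ |v1 x - v2 x| := abs_max_sub_max_le' _ _ _

lemma WW_le {T τ : ℝ} (h0 : 0 < T) (h1 : T ≤ Real.exp (-1)) (hτ : 0 < τ) (hT : τ ≤ T) (y : E) :
    (qq T τ y)⁻¹ * WW τ y ≤ √(2 * (-Real.log τ)) / τ := by
  have hs := one_le_neg_log hτ (hT.trans h1)
  have hq := qq_pos h0 h1 hτ y
  have hW := one_le_WW τ y
  have e1 := YY_sq_le_qq h0 h1 hτ y
  have e2 := LL_le hτ hT (sqrt_le_YY τ y)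
  rw [inv_mul_le_iff₀ hq, mul_div_assoc', le_div_iff₀ hτ, ← Real.sqrt_sq hq.le,
    ← Real.sqrt_mul (by positivity)]
  refine Real.le_sqrt_of_sq_le ?_
  have e3 : (WW τ y * τ) ^ 2 = YY τ y ^ 2 * τ := by
    rw [YY_eq hτ, mul_pow, mul_pow, Real.sq_sqrt hτ.le]; ring
  rw [e3]
  have e4 := le_qq (τ := τ) h0 h1 y
  have e5 : 0 < LL T (YY τ y) := by linarith [one_le_LL h0 h1 (YY τ y)]
  calc YY τ y ^ 2 * τ ≤ (2 * LL T (YY τ y) * qq T τ y) * qq T τ y := by gcongr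
    _ ≤ (2 * (-Real.log τ) * qq T τ y) * qq T τ y := by gcongr
    _ = _ := by ring

lemma measurable_vcl {T τ : ℝ} {v : E → ℝ} (hv : Continuous v) : Measurable (a.vcl T τ v) := by
  have hY : Measurable (YY τ : E → ℝ) := by unfold YY; fun_prop
  have hL : Measurable fun x : E => LL T (YY τ x) := by
    unfold LL
    exact measurable_const.max (measurable_const.mul hY.log)
  unfold vcl qq
  exact hv.measurable.max (measurable_const.mul (measurable_const.add
    ((measurable_norm.pow_const 2).div hL)))

lemma integrable_vcl {T τ : ℝ} (h0 : 0 < T) (h1 : T ≤ Real.exp (-1)) (hτ : 0 < τ) (hT : τ ≤ T)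
    {v : E → ℝ} (hv : Continuous v) : Integrable fun y => a.vcl T τ v y ^ (-a.m) := by
  have hs : 0 < -Real.log τ := by linarith [one_le_neg_log hτ (hT.trans h1)]
  refine ((integrable_scaled a.hm1 hs hτ).1.const_mul (a.c1 ^ (-a.m))).mono'
    ((measurable_vcl hv).pow_const _).aestronglyMeasurable (Filter.Eventually.of_forall fun y => ?_)
  rw [Real.norm_of_nonneg (Real.rpow_nonneg (vcl_pos h0 h1 hτ v y).le _)]
  exact vcl_rpow_le h0 h1 hτ hT v y

lemma abs_nl_sub_le {T τ : ℝ} (h0 : 0 < T) (h1 : T ≤ Real.exp (-1)) (hτ : 0 < τ) (hT : τ ≤ T)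
    {v1 v2 : E → ℝ} (hv1 : Continuous v1) (hv2 : Continuous v2) {η : ℝ} (hη : 0 ≤ η)
    (h : ∀ y, |v1 y - v2 y| ≤ η * WW τ y) (x : E) :
    |a.nl T τ v1 x - a.nl T τ v2 x| ≤ a.m * a.c1 ^ (-a.m - 1) * (√(2 * (-Real.log τ)) / τ) * η *
      ((-Real.log τ) ^ ((Module.finrank ℝ E : ℝ) / 2) * τ ^ (a.γ - 1 / 2) * JJ E a.m) := by
  have hs : 0 < -Real.log τ := by linarith [one_le_neg_log hτ (hT.trans h1)]
  have hm := a.m_pos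
  have hc1 := a.c1_pos
  unfold nl
  rw [← integral_sub (integrable_vcl h0 h1 hτ hT hv1).integrableOn
    (integrable_vcl h0 h1 hτ hT hv2).integrableOn, ← half_sub_m]
  refine abs_setIntegral_le a.hm1 hs hτ (by positivity) (fun y => ?_) _
  have hq := qq_pos h0 h1 hτ y
  have e1 := abs_rpow_neg_sub_le hm.le (mul_pos hc1 hq) (vcl_ge (a := a) v1 y) (vcl_ge (a := a) v2 y)
  have e2 := WW_le h0 h1 hτ hT y
  have e3 := one_le_WW τ y
  have e4 : qq T τ y ^ (-a.m) ≤ (τ + ‖y‖ ^ 2 / (-Real.log τ)) ^ (-a.m) :=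
    Real.rpow_le_rpow_of_nonpos (by positivity) (qq_ge h0 h1 hτ hT y) (by linarith)
  refine e1.trans ?_
  calc a.m * (a.c1 * qq T τ y) ^ (-a.m - 1) * |a.vcl T τ v1 y - a.vcl T τ v2 y|
      ≤ a.m * (a.c1 * qq T τ y) ^ (-a.m - 1) * (η * WW τ y) := by
        gcongr
        exact (abs_vcl_sub_le _ _ _ _ _).trans (h y)
    _ = a.m * a.c1 ^ (-a.m - 1) * ((qq T τ y)⁻¹ * WW τ y) * η * qq T τ y ^ (-a.m) := by
        rw [Real.mul_rpow hc1.le hq.le, Real.rpow_sub_one hq.ne', div_eq_mul_inv]; ring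
    _ ≤ a.m * a.c1 ^ (-a.m - 1) * (√(2 * (-Real.log τ)) / τ) * η *
        (τ + ‖y‖ ^ 2 / (-Real.log τ)) ^ (-a.m) := by gcongr

variable (a) in
set_option maxHeartbeats 4000000 in
/-- Lipschitz dependence of the truncated nonlinearity on the solution and its gradient. -/
lemma exists_Ftr_lip : ∃ B, 0 < B ∧ ∀ T τ : ℝ, 0 < T → T ≤ Real.exp (-1) → 0 < τ → τ ≤ T →
    ∀ (v1 v2 : E → ℝ) (g1 g2 : ℝ) (x : E) (η ζ : ℝ), Continuous v1 → Continuous v2 →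
      0 ≤ η → (∀ y, |v1 y - v2 y| ≤ η * WW τ y) → |g1 - g2| ≤ ζ * WW τ x →
      |a.Ftr T τ v1 g1 x - a.Ftr T τ v2 g2 x| ≤ B * (τ⁻¹ * η + (√τ)⁻¹ * ζ) * WW τ x := by
  obtain ⟨C0, hC0, hlog⟩ := a.exists_log_bound
  have hc := a.c_pos
  have hc1 := a.c1_pos
  have hC1 := a.C1_pos
  have hm := a.m_pos
  have hJ := JJ_nonneg (E := E) a.m
  set B1 := a.c * (4 * a.C1 / a.c1) with hB1
  set B2 := a.c * (2 * a.C1 ^ 2 / a.c1 ^ 2) with hB2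
  set B3 := |a.μ| * (a.c1 ^ (-a.m) * C0 * JJ E a.m) with hB3
  set B4 := |a.μ| * (a.C1 * (a.m * a.c1 ^ (-a.m - 1) * 2 * (C0 * JJ E a.m))) with hB4
  have hB1p : 0 < B1 := by positivity
  have hB2p : 0 < B2 := by positivity
  have hB3p : 0 ≤ B3 := by positivity
  have hB4p : 0 ≤ B4 := by positivity
  refine ⟨B1 + B2 + B3 + B4, by positivity, fun T τ h0 h1 hτ hT v1 v2 g1 g2 x η ζ hv1 hv2 hη hv hg => ?_⟩
  have hs := one_le_neg_log hτ (hT.trans h1)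
  set s := -Real.log τ with hsd
  set L := LL T (YY τ x) with hLd
  have hL : 1 ≤ L := one_le_LL h0 h1 _
  have hL0 : 0 < L := by linarith
  have hY := YY_pos hτ x
  have hW := one_le_WW τ x
  have hq := qq_pos h0 h1 hτ x
  have hG1 : a.Gcl T τ g1 x ≤ a.C1 * YY τ x / L := Gcl_le h0 h1 (a := a) (τ := τ) g1 x
  have hG2 : a.Gcl T τ g2 x ≤ a.C1 * YY τ x / L := Gcl_le h0 h1 (a := a) (τ := τ) g2 x
  have hG10 := Gcl_nonneg h0 h1 hτ (a := a) g1 x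
  have hG20 := Gcl_nonneg h0 h1 hτ (a := a) g2 x
  have hV1 := vcl_ge (a := a) (T := T) (τ := τ) v1 x
  have hV2 := vcl_ge (a := a) (T := T) (τ := τ) v2 x
  have hV10 := vcl_pos (a := a) h0 h1 hτ v1 x
  have hV20 := vcl_pos (a := a) h0 h1 hτ v2 x
  have hdG : |a.Gcl T τ g1 x - a.Gcl T τ g2 x| ≤ ζ * WW τ x := (abs_Gcl_sub_le _ _ _ _ _).trans hg
  have hdV : |a.vcl T τ v1 x - a.vcl T τ v2 x| ≤ η * WW τ x :=
    (abs_vcl_sub_le _ _ _ _ _).trans (hv x)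
  have hζ : 0 ≤ ζ * WW τ x := (abs_nonneg _).trans hg
  have hγ := a.γ_pos
  have hτ1 : τ ≤ 1 := (hT.trans h1).trans (Real.exp_le_one_iff.2 (by norm_num))
  have hsq := Real.sqrt_pos.2 hτ
  set q := qq T τ x
  have hYq : YY τ x ^ 2 ≤ 2 * L * q := YY_sq_le_qq h0 h1 hτ x
  have hτq : τ ≤ q := le_qq h0 h1 x
  set G1 := a.Gcl T τ g1 x
  set G2 := a.Gcl T τ g2 x
  set V1 := a.vcl T τ v1 x
  set V2 := a.vcl T τ v2 x
  have k1 : YY τ x / (L * q) ≤ 2 * (√τ)⁻¹ := by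
    rw [← div_eq_mul_inv, div_le_div_iff₀ (by positivity) hsq]
    refine abs_le_of_sq_le_sq' ?_ (by positivity) |>.2
    rw [mul_pow, Real.sq_sqrt hτ.le]
    calc YY τ x ^ 2 * τ ≤ (2 * L * q) * q := by gcongr
      _ ≤ (2 * (L * q)) ^ 2 := by nlinarith [mul_pos (mul_pos hL0 hq) hq]
  have k2 : YY τ x ^ 2 / (L ^ 2 * q ^ 2) ≤ 2 * τ⁻¹ := by
    rw [← div_eq_mul_inv, div_le_div_iff₀ (by positivity) hτ]
    calc YY τ x ^ 2 * τ ≤ (2 * L * q) * q := by gcongr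
      _ ≤ 2 * (L ^ 2 * q ^ 2) := by nlinarith [mul_pos (mul_pos hL0 hq) hq]
  have hlog' : s ^ ((Module.finrank ℝ E : ℝ) / 2) * √s * τ ^ a.γ ≤ C0 := by
    refine le_trans ?_ (hlog τ hτ (hT.trans h1))
    rw [← hsd, Real.sqrt_eq_rpow, ← Real.rpow_add (by linarith)]
    gcongr ?_ * ?_
    exact Real.rpow_le_rpow_of_exponent_ge hτ hτ1 (by linarith)
  have hlog2 : s ^ ((Module.finrank ℝ E : ℝ) / 2) * τ ^ a.γ ≤ C0 := by
    refine le_trans ?_ hlog'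
    gcongr
    exact le_mul_of_one_le_right (by positivity) (Real.one_le_sqrt.2 hs)
  have t1 : |a.c * G1 ^ 2 / V1 - a.c * G2 ^ 2 / V2| ≤
      B1 * ((√τ)⁻¹ * (ζ * WW τ x)) + B2 * (τ⁻¹ * (η * WW τ x)) := by
    have e : a.c * G1 ^ 2 / V1 - a.c * G2 ^ 2 / V2 =
        a.c * ((G1 - G2) * ((G1 + G2) / V1) + G2 ^ 2 / (V1 * V2) * (V2 - V1)) := by
      field_simp; ring
    have e1 : (G1 + G2) / V1 ≤ 4 * a.C1 / a.c1 * (√τ)⁻¹ := by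
      calc (G1 + G2) / V1 ≤ (a.C1 * YY τ x / L + a.C1 * YY τ x / L) / (a.c1 * q) := by gcongr
        _ = 2 * a.C1 / a.c1 * (YY τ x / (L * q)) := by field_simp; ring
        _ ≤ 2 * a.C1 / a.c1 * (2 * (√τ)⁻¹) := by gcongr
        _ = _ := by ring
    have e2 : G2 ^ 2 / (V1 * V2) ≤ 2 * a.C1 ^ 2 / a.c1 ^ 2 * τ⁻¹ := by
      calc G2 ^ 2 / (V1 * V2) ≤ (a.C1 * YY τ x / L) ^ 2 / ((a.c1 * q) * (a.c1 * q)) := by gcongr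
        _ = a.C1 ^ 2 / a.c1 ^ 2 * (YY τ x ^ 2 / (L ^ 2 * q ^ 2)) := by field_simp
        _ ≤ a.C1 ^ 2 / a.c1 ^ 2 * (2 * τ⁻¹) := by gcongr
        _ = _ := by ring
    rw [e, abs_mul, abs_of_pos hc]
    calc a.c * |(G1 - G2) * ((G1 + G2) / V1) + G2 ^ 2 / (V1 * V2) * (V2 - V1)|
        ≤ a.c * (|G1 - G2| * ((G1 + G2) / V1) + G2 ^ 2 / (V1 * V2) * |V1 - V2|) := by
          refine mul_le_mul_of_nonneg_left ((abs_add_le _ _).trans (le_of_eq ?_)) hc.le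
          rw [abs_mul, abs_mul, abs_of_nonneg (div_nonneg (add_nonneg hG10 hG20) hV10.le),
            abs_of_nonneg (div_nonneg (sq_nonneg G2) (mul_pos hV10 hV20).le), abs_sub_comm V2 V1]
      _ ≤ a.c * ((ζ * WW τ x) * (4 * a.C1 / a.c1 * (√τ)⁻¹) +
          2 * a.C1 ^ 2 / a.c1 ^ 2 * τ⁻¹ * (η * WW τ x)) := by gcongr
      _ = _ := by rw [hB1, hB2]; ring
  have t2 : |a.μ * G1 * a.nl T τ v1 x - a.μ * G2 * a.nl T τ v2 x| ≤
      B3 * ((√τ)⁻¹ * (ζ * WW τ x)) + B4 * (τ⁻¹ * (η * WW τ x)) := by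
    have n1 := nl_le (a := a) h0 h1 hτ hT v1 x
    have n10 := nl_nonneg (a := a) h0 h1 hτ v1 x
    have n2 := abs_nl_sub_le (a := a) h0 h1 hτ hT hv1 hv2 hη hv x
    rw [← hsd] at n1 n2
    have er : √τ * τ ^ (a.γ - 1 / 2) = τ ^ a.γ := sqrt_mul_rpow hτ _
    have er' : τ ^ (a.γ - 1 / 2) = (√τ)⁻¹ * τ ^ a.γ := by rw [← er]; field_simp
    have n1' : a.nl T τ v1 x ≤ a.c1 ^ (-a.m) * C0 * JJ E a.m * (√τ)⁻¹ := by
      refine n1.trans ?_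
      rw [er']
      calc _ = a.c1 ^ (-a.m) * (s ^ ((Module.finrank ℝ E : ℝ) / 2) * τ ^ a.γ) * JJ E a.m *
            (√τ)⁻¹ := by ring
        _ ≤ _ := by gcongr
    have n2' : G2 * |a.nl T τ v1 x - a.nl T τ v2 x| ≤
        a.C1 * (a.m * a.c1 ^ (-a.m - 1) * 2 * (C0 * JJ E a.m)) * (τ⁻¹ * (η * WW τ x)) := by
      have hG2' : G2 ≤ a.C1 * (√τ * WW τ x) := by
        rw [← YY_eq hτ]
        refine hG2.trans (div_le_self (by positivity) hL)
      have h2s : √(2 * s) ≤ 2 * √s := by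
        rw [Real.sqrt_mul (by norm_num)]
        gcongr
        rw [Real.sqrt_le_left (by norm_num)]; norm_num
      calc _ ≤ a.C1 * (√τ * WW τ x) * (a.m * a.c1 ^ (-a.m - 1) * (2 * √s / τ) * η *
            (s ^ ((Module.finrank ℝ E : ℝ) / 2) * τ ^ (a.γ - 1 / 2) * JJ E a.m)) := by
            gcongr
            refine n2.trans ?_
            gcongr
        _ = a.C1 * (a.m * a.c1 ^ (-a.m - 1) * 2 *
            ((s ^ ((Module.finrank ℝ E : ℝ) / 2) * √s * τ ^ a.γ) * JJ E a.m)) *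
            (τ⁻¹ * (η * WW τ x)) := by rw [← er]; field_simp
        _ ≤ _ := by gcongr
    have e : a.μ * G1 * a.nl T τ v1 x - a.μ * G2 * a.nl T τ v2 x =
        a.μ * ((G1 - G2) * a.nl T τ v1 x + G2 * (a.nl T τ v1 x - a.nl T τ v2 x)) := by ring
    rw [e, abs_mul]
    calc _ ≤ |a.μ| * (|G1 - G2| * a.nl T τ v1 x + G2 * |a.nl T τ v1 x - a.nl T τ v2 x|) := by
          refine mul_le_mul_of_nonneg_left ((abs_add_le _ _).trans (le_of_eq ?_)) (abs_nonneg _)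
          rw [abs_mul, abs_mul, abs_of_nonneg n10, abs_of_nonneg hG20]
      _ ≤ |a.μ| * ((ζ * WW τ x) * (a.c1 ^ (-a.m) * C0 * JJ E a.m * (√τ)⁻¹) +
          a.C1 * (a.m * a.c1 ^ (-a.m - 1) * 2 * (C0 * JJ E a.m)) * (τ⁻¹ * (η * WW τ x))) := by
          gcongr
      _ = _ := by rw [hB3, hB4]; ring
  have e : a.Ftr T τ v1 g1 x - a.Ftr T τ v2 g2 x = (a.c * G1 ^ 2 / V1 - a.c * G2 ^ 2 / V2) +
      (a.μ * G1 * a.nl T τ v1 x - a.μ * G2 * a.nl T τ v2 x) := by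
    unfold Ftr; ring
  rw [e]
  refine (abs_add_le _ _).trans ((add_le_add t1 t2).trans ?_)
  have p1 : 0 ≤ (√τ)⁻¹ * (ζ * WW τ x) := by positivity
  have p2 : 0 ≤ τ⁻¹ * (η * WW τ x) := by positivity
  calc _ = (B1 + B3) * ((√τ)⁻¹ * (ζ * WW τ x)) + (B2 + B4) * (τ⁻¹ * (η * WW τ x)) := by ring
    _ ≤ (B1 + B2 + B3 + B4) * ((√τ)⁻¹ * (ζ * WW τ x)) +
        (B1 + B2 + B3 + B4) * (τ⁻¹ * (η * WW τ x)) := by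
        exact add_le_add (mul_le_mul_of_nonneg_right (by linarith) p1)
          (mul_le_mul_of_nonneg_right (by linarith) p2)
    _ = _ := by ring

end Par

end BlowUp

namespace BlowUp

variable {E : Type*} [NormedAddCommGroup E] [InnerProductSpace ℝ E] [FiniteDimensional ℝ E]
  [MeasurableSpace E] [BorelSpace E]
variable {V : Type*} [NormedAddCommGroup V] [NormedSpace ℝ V]

section cont
variable {Z : Type*} [TopologicalSpace Z]

lemma continuous_LL (T : ℝ) {Y : Z → ℝ} (hY : Continuous Y) (h : ∀ z, 0 < Y z) :
    Continuous fun z => LL T (Y z) := by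
  unfold LL
  exact continuous_const.max (continuous_const.mul (hY.log fun z => (h z).ne'))

lemma continuous_YY {τ : Z → ℝ} {x : Z → E} (hτ : Continuous τ) (hx : Continuous x) :
    Continuous fun z => YY (τ z) (x z) := by
  unfold YY; fun_prop

lemma continuous_qq {T : ℝ} (h0 : 0 < T) (h1 : T ≤ Real.exp (-1)) {τ : Z → ℝ} {x : Z → E}
    (hτ : Continuous τ) (hx : Continuous x) (hp : ∀ z, 0 < τ z) :
    Continuous fun z => qq T (τ z) (x z) := by
  unfold qq
  refine hτ.add ((hx.norm.pow 2).div (continuous_LL T (continuous_YY hτ hx)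
    fun z => YY_pos (hp z) _) fun z => ?_)
  linarith [one_le_LL h0 h1 (YY (τ z) (x z))]

namespace Par
variable {a : Par E} {T : ℝ}

lemma continuous_vcl (h0 : 0 < T) (h1 : T ≤ Real.exp (-1)) {τ : Z → ℝ} {v : Z → E → ℝ} {x : Z → E}
    (hτ : Continuous τ) (hp : ∀ z, 0 < τ z) (hv : Continuous fun z => v z (x z))
    (hx : Continuous x) : Continuous fun z => a.vcl T (τ z) (v z) (x z) := by
  unfold vcl
  exact hv.max (continuous_const.mul (continuous_qq h0 h1 hτ hx hp))

lemma continuous_nl [FirstCountableTopology Z] (h0 : 0 < T) (h1 : T ≤ Real.exp (-1)) {τ : Z → ℝ}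
    {v : Z → E → ℝ} {x : Z → E} (hτ : Continuous τ) (hp : ∀ z, 0 < τ z) (hT : ∀ z, τ z ≤ T)
    (hv : Continuous fun q : Z × E => v q.1 q.2) (hx : Continuous x) :
    Continuous fun z => a.nl T (τ z) (v z) (x z) := by
  have hm := a.m_pos
  have : Nontrivial E := Module.nontrivial_of_finrank_pos a.hd
  refine continuous_iff_continuousAt.2 fun z0 => ?_
  have hint : ∀ z, a.nl T (τ z) (v z) (x z) =
      ∫ y, (Metric.ball (0 : E) ‖x z‖).indicator (fun y => a.vcl T (τ z) (v z) y ^ (-a.m)) y :=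
    fun z => (integral_indicator measurableSet_ball).symm
  simp_rw [hint]
  have hvz : ∀ z, Continuous (v z) := fun z => hv.comp (Continuous.prodMk_right z)
  set t := τ z0 / 2 with ht
  have ht0 : 0 < t := half_pos (hp z0)
  have htT : t ≤ T := by linarith [hp z0, hT z0]
  have hs := one_le_neg_log ht0 (htT.trans h1)
  have hev : ∀ᶠ z in nhds z0, t < τ z :=
    hτ.continuousAt.eventually (lt_mem_nhds (half_lt_self (hp z0)))
  have hvc := continuous_vcl (a := a) h0 h1 (hτ.comp continuous_fst) (fun q : Z × E => hp q.1)
    (v := fun q => v q.1) hv continuous_snd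
  refine continuousAt_of_dominated (bound := fun y : E =>
    a.c1 ^ (-a.m) * (t + ‖y‖ ^ 2 / (-Real.log t)) ^ (-a.m)) ?_ ?_ ?_ ?_
  · exact Filter.Eventually.of_forall fun z => (((measurable_vcl (hvz z)).pow_const _).indicator
      measurableSet_ball).aestronglyMeasurable
  · filter_upwards [hev] with z hz
    refine Filter.Eventually.of_forall fun y => ?_
    have hs' := one_le_neg_log (hp z) ((hT z).trans h1)
    have hls : -Real.log (τ z) ≤ -Real.log t := neg_le_neg (Real.log_le_log ht0 hz.le)
    refine (norm_indicator_le_norm_self _ _).trans ?_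
    rw [Real.norm_of_nonneg (Real.rpow_nonneg (vcl_pos h0 h1 (hp z) (v z) y).le _)]
    refine (vcl_rpow_le h0 h1 (hp z) (hT z) (v z) y).trans ?_
    refine mul_le_mul_of_nonneg_left ?_ (Real.rpow_nonneg a.c1_pos.le _)
    refine Real.rpow_le_rpow_of_nonpos (by positivity) ?_ (by linarith)
    gcongr
  · exact (integrable_scaled a.hm1 (by linarith) ht0).1.const_mul _
  · have hsph : ∀ᵐ y : E, y ∉ Metric.sphere (0 : E) ‖x z0‖ := by
      rw [ae_iff]
      simp only [not_not]
      exact Measure.addHaar_sphere volume (0 : E) ‖x z0‖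
    filter_upwards [hsph] with y hy
    have hcy : ContinuousAt (fun z => a.vcl T (τ z) (v z) y ^ (-a.m)) z0 := by
      refine ContinuousAt.rpow_const ?_ (Or.inl (vcl_pos h0 h1 (hp z0) (v z0) y).ne')
      exact (hvc.comp (Continuous.prodMk_left y)).continuousAt
    rw [mem_sphere_zero_iff_norm] at hy
    rcases lt_or_gt_of_ne hy with h | h
    · refine hcy.congr ?_
      filter_upwards [hx.norm.continuousAt.eventually (lt_mem_nhds h)] with z hz
      rw [indicator_of_mem (by simpa using hz)]
    · refine (continuousAt_const (y := (0 : ℝ))).congr ?_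
      filter_upwards [hx.norm.continuousAt.eventually (gt_mem_nhds h)] with z hz
      rw [indicator_of_notMem (by simpa using hz.le)]

lemma continuous_Ftr [FirstCountableTopology Z] (h0 : 0 < T) (h1 : T ≤ Real.exp (-1)) {τ : Z → ℝ}
    {v : Z → E → ℝ} {g : Z → ℝ} {x : Z → E} (hτ : Continuous τ) (hp : ∀ z, 0 < τ z)
    (hT : ∀ z, τ z ≤ T) (hv : Continuous fun q : Z × E => v q.1 q.2) (hg : Continuous g)
    (hx : Continuous x) : Continuous fun z => a.Ftr T (τ z) (v z) (g z) (x z) := by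
  have hY := continuous_YY hτ hx
  have hL := continuous_LL T hY fun z => YY_pos (hp z) _
  have hG : Continuous fun z => a.Gcl T (τ z) (g z) (x z) := by
    unfold Gcl
    refine hg.abs.min ((continuous_const.mul hY).div hL fun z => ?_)
    linarith [one_le_LL h0 h1 (YY (τ z) (x z))]
  unfold Ftr
  exact ((continuous_const.mul (hG.pow 2)).div (continuous_vcl (v := v) (x := x) h0 h1 hτ hp
    (hv.comp (continuous_id.prodMk hx)) hx) fun z => (vcl_pos h0 h1 (hp z) _ _).ne').add
    ((continuous_const.mul hG).mul (continuous_nl h0 h1 hτ hp hT hv hx))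

end Par
end cont

/-- Uniformly bounded and Hölder-`1/2` continuous in space on a ball. -/
def HB (I : Set ℝ) (R : ℝ) (f : ℝ → E → ℝ) : Prop :=
  ∃ C, 0 ≤ C ∧ ∀ σ ∈ I, ∀ x y, ‖x‖ ≤ R → ‖y‖ ≤ R → |f σ x| ≤ C ∧ |f σ y - f σ x| ≤ C * √‖y - x‖

namespace HB
variable {I : Set ℝ} {R : ℝ} {f g : ℝ → E → ℝ}

lemma add (hf : HB I R f) (hg : HB I R g) : HB I R fun σ x => f σ x + g σ x := by
  obtain ⟨C, hC, h⟩ := hf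
  obtain ⟨D, hD, h'⟩ := hg
  refine ⟨C + D, by positivity, fun σ hσ x y hx hy => ⟨?_, ?_⟩⟩
  · exact (abs_add_le _ _).trans (add_le_add (h σ hσ x y hx hy).1 (h' σ hσ x y hx hy).1)
  · rw [add_sub_add_comm, add_mul]
    exact (abs_add_le _ _).trans (add_le_add (h σ hσ x y hx hy).2 (h' σ hσ x y hx hy).2)

lemma mul (hf : HB I R f) (hg : HB I R g) : HB I R fun σ x => f σ x * g σ x := by
  obtain ⟨C, hC, h⟩ := hf
  obtain ⟨D, hD, h'⟩ := hg
  refine ⟨2 * (C * D), by positivity, fun σ hσ x y hx hy => ⟨?_, ?_⟩⟩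
  · rw [abs_mul]
    have := mul_le_mul (h σ hσ x y hx hy).1 (h' σ hσ x y hx hy).1 (abs_nonneg _) hC
    nlinarith [mul_nonneg hC hD]
  · have e : f σ y * g σ y - f σ x * g σ x = f σ y * (g σ y - g σ x) + (f σ y - f σ x) * g σ x := by
      ring
    rw [e]
    refine (abs_add_le _ _).trans ?_
    rw [abs_mul, abs_mul]
    have h1 := mul_le_mul (h σ hσ y x hy hx).1 (h' σ hσ x y hx hy).2 (abs_nonneg _) hC
    have h2 := mul_le_mul (h σ hσ x y hx hy).2 (h' σ hσ x y hx hy).1 (abs_nonneg _) (by positivity)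
    nlinarith

/-- Composition with a function which is bounded and Lipschitz on the range. -/
lemma comp (hf : HB I R f) (S : Set ℝ) (hS : ∀ σ ∈ I, ∀ x, ‖x‖ ≤ R → f σ x ∈ S) {φ : ℝ → ℝ}
    (hφ : ∀ C, ∃ D, 0 ≤ D ∧ ∀ s ∈ S, ∀ t ∈ S, |s| ≤ C → |t| ≤ C →
      |φ s| ≤ D ∧ |φ t - φ s| ≤ D * |t - s|) : HB I R fun σ x => φ (f σ x) := by
  obtain ⟨C, hC, h⟩ := hf
  obtain ⟨D, hD, h'⟩ := hφ C
  refine ⟨D + D * C, by positivity, fun σ hσ x y hx hy => ?_⟩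
  obtain ⟨e1, e2⟩ := h' _ (hS σ hσ x hx) _ (hS σ hσ y hy) (h σ hσ x y hx hy).1 (h σ hσ y x hy hx).1
  refine ⟨e1.trans (by nlinarith), e2.trans ?_⟩
  have := mul_le_mul_of_nonneg_left (h σ hσ x y hx hy).2 hD
  nlinarith [mul_nonneg hD (Real.sqrt_nonneg ‖y - x‖)]

lemma const (c : ℝ) : HB I R fun (_ : ℝ) (_ : E) => c :=
  ⟨|c|, abs_nonneg _, fun σ _ x y _ _ => ⟨le_rfl, by simp; positivity⟩⟩

lemma time {φ : ℝ → ℝ} {C : ℝ} (hC : 0 ≤ C) (h : ∀ σ ∈ I, |φ σ| ≤ C) :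
    HB I R fun σ (_ : E) => φ σ :=
  ⟨C, hC, fun σ hσ x y _ _ => ⟨h σ hσ, by simp; positivity⟩⟩

lemma max (hf : HB I R f) (hg : HB I R g) : HB I R fun σ x => max (f σ x) (g σ x) := by
  obtain ⟨C, hC, h⟩ := hf
  obtain ⟨D, hD, h'⟩ := hg
  refine ⟨C + D, by positivity, fun σ hσ x y hx hy => ⟨?_, ?_⟩⟩
  · exact abs_max_le_max_abs_abs.trans (max_le (by linarith [(h σ hσ x y hx hy).1])
      (by linarith [(h' σ hσ x y hx hy).1]))
  · refine (abs_max_sub_max_le_max _ _ _ _).trans ((max_le_add_of_nonneg (abs_nonneg _)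
      (abs_nonneg _)).trans ?_)
    rw [add_mul]
    exact add_le_add (h σ hσ x y hx hy).2 (h' σ hσ x y hx hy).2

lemma min (hf : HB I R f) (hg : HB I R g) : HB I R fun σ x => min (f σ x) (g σ x) := by
  obtain ⟨C, hC, h⟩ := hf
  obtain ⟨D, hD, h'⟩ := hg
  refine ⟨C + D, by positivity, fun σ hσ x y hx hy => ⟨?_, ?_⟩⟩
  · exact abs_min_le_max_abs_abs.trans (max_le (by linarith [(h σ hσ x y hx hy).1])
      (by linarith [(h' σ hσ x y hx hy).1]))
  · refine (abs_min_sub_min_le_max _ _ _ _).trans ((max_le_add_of_nonneg (abs_nonneg _)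
      (abs_nonneg _)).trans ?_)
    rw [add_mul]
    exact add_le_add (h σ hσ x y hx hy).2 (h' σ hσ x y hx hy).2

lemma inv (hf : HB I R f) {l : ℝ} (hl : 0 < l) (h : ∀ σ ∈ I, ∀ x, ‖x‖ ≤ R → l ≤ f σ x) :
    HB I R fun σ x => (f σ x)⁻¹ := by
  refine hf.comp (Ici l) h fun C => ⟨l⁻¹ + l⁻¹ * l⁻¹, by positivity, fun s hs t ht _ _ => ?_⟩
  have hs0 : 0 < s := hl.trans_le hs
  have ht0 : 0 < t := hl.trans_le ht
  have i1 : s⁻¹ ≤ l⁻¹ := inv_anti₀ hl hs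
  have i2 : t⁻¹ ≤ l⁻¹ := inv_anti₀ hl ht
  constructor
  · rw [abs_of_pos (by positivity)]
    have : 0 < l⁻¹ * l⁻¹ := by positivity
    linarith
  · rw [inv_sub_inv ht0.ne' hs0.ne', abs_div, abs_of_pos (mul_pos ht0 hs0), div_eq_mul_inv, mul_inv,
      mul_comm, abs_sub_comm s t]
    refine mul_le_mul_of_nonneg_right ?_ (abs_nonneg _)
    have := mul_le_mul i2 i1 (by positivity) (by positivity)
    have : 0 < l⁻¹ := by positivity
    linarith

lemma log (hf : HB I R f) {l : ℝ} (hl : 0 < l) (h : ∀ σ ∈ I, ∀ x, ‖x‖ ≤ R → l ≤ f σ x) :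
    HB I R fun σ x => Real.log (f σ x) := by
  have key : ∀ s t : ℝ, l ≤ s → l ≤ t → |Real.log t - Real.log s| ≤ l⁻¹ * |t - s| := by
    have : ∀ s t : ℝ, l ≤ s → l ≤ t → Real.log t - Real.log s ≤ l⁻¹ * |t - s| := by
      intro s t hs ht
      have hs0 : 0 < s := hl.trans_le hs
      have ht0 : 0 < t := hl.trans_le ht
      rw [← Real.log_div ht0.ne' hs0.ne']
      calc Real.log (t / s) ≤ t / s - 1 := Real.log_le_sub_one_of_pos (by positivity)
        _ = s⁻¹ * (t - s) := by field_simp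
        _ ≤ s⁻¹ * |t - s| := by gcongr; exact le_abs_self _
        _ ≤ _ := by gcongr
    intro s t hs ht
    rw [abs_le']
    refine ⟨this s t hs ht, ?_⟩
    rw [neg_sub, abs_sub_comm]; exact this t s ht hs
  refine hf.comp (Ici l) h fun C => ⟨|Real.log l| + l⁻¹ * (|C| + l) + l⁻¹, by positivity,
    fun s hs t ht hsC _ => ⟨?_, (key s t hs ht).trans ?_⟩⟩
  · have h1 := key l s le_rfl hs
    have h2 : |Real.log s| ≤ |Real.log l| + |Real.log s - Real.log l| := by
      simpa using abs_add_le (Real.log l) (Real.log s - Real.log l)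
    have h3 : |s - l| ≤ |C| + l := (abs_sub _ _).trans (by
      rw [abs_of_pos hl]; linarith [le_abs_self C])
    have h4 := mul_le_mul_of_nonneg_left h3 (by positivity : 0 ≤ l⁻¹)
    have : 0 < l⁻¹ := by positivity
    linarith
  · refine mul_le_mul_of_nonneg_right ?_ (abs_nonneg _)
    have : 0 ≤ |Real.log l| + l⁻¹ * (|C| + l) := by positivity
    linarith

lemma congr (hf : HB I R f) (h : ∀ σ ∈ I, ∀ x, ‖x‖ ≤ R → g σ x = f σ x) : HB I R g := by
  obtain ⟨C, hC, h'⟩ := hf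
  refine ⟨C, hC, fun σ hσ x y hx hy => ?_⟩
  rw [h σ hσ x hx, h σ hσ y hy]
  exact h' σ hσ x y hx hy

lemma norm : HB I R fun (_ : ℝ) (x : E) => ‖x‖ := by
  refine ⟨|R| + √(2 * |R|), by positivity, fun σ _ x y hx hy => ⟨?_, ?_⟩⟩
  · rw [abs_of_nonneg (norm_nonneg x)]
    linarith [le_abs_self R, Real.sqrt_nonneg (2 * |R|)]
  · refine (abs_norm_sub_norm_le y x).trans ?_
    have h1 : ‖y - x‖ ≤ 2 * |R| := (norm_sub_le _ _).trans (by linarith [le_abs_self R])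
    calc ‖y - x‖ = √‖y - x‖ * √‖y - x‖ := (Real.mul_self_sqrt (norm_nonneg _)).symm
      _ ≤ √(2 * |R|) * √‖y - x‖ := by gcongr
      _ ≤ _ := by gcongr; linarith [abs_nonneg R]

lemma pow (hf : HB I R f) (n : ℕ) : HB I R fun σ x => f σ x ^ n := by
  induction n with
  | zero => simpa using const (E := E) 1
  | succ n ih => exact (ih.mul hf).congr fun σ _ x _ => pow_succ _ _

end HB

section holder
variable {I : Set ℝ} {R T t0 : ℝ}

lemma hb_YY (hI : ∀ σ ∈ I, t0 ≤ σ ∧ σ ≤ T) : HB I R (YY : ℝ → E → ℝ) :=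
  HB.norm.add (HB.time (Real.sqrt_nonneg T) fun σ hσ => by
    rw [abs_of_nonneg (Real.sqrt_nonneg σ)]; exact Real.sqrt_le_sqrt (hI σ hσ).2)

lemma hb_LL (ht0 : 0 < t0) (hI : ∀ σ ∈ I, t0 ≤ σ ∧ σ ≤ T) :
    HB I R fun σ (x : E) => LL T (YY σ x) := by
  unfold LL
  exact (HB.const _).max ((HB.const _).mul ((hb_YY hI).log (Real.sqrt_pos.2 ht0)
    fun σ hσ x _ => (Real.sqrt_le_sqrt (hI σ hσ).1).trans (sqrt_le_YY σ x)))

lemma hb_qq (h0 : 0 < T) (h1 : T ≤ Real.exp (-1)) (ht0 : 0 < t0) (hI : ∀ σ ∈ I, t0 ≤ σ ∧ σ ≤ T) :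
    HB I R fun σ (x : E) => qq T σ x := by
  unfold qq
  refine (HB.time (C := T) h0.le fun σ hσ => ?_).add ((HB.norm.pow 2).mul ((hb_LL ht0 hI).inv one_pos
    fun σ _ x _ => one_le_LL h0 h1 _))
  rw [abs_of_pos (ht0.trans_le (hI σ hσ).1)]; exact (hI σ hσ).2

namespace Par
variable {a : Par E}

lemma hb_vcl (h0 : 0 < T) (h1 : T ≤ Real.exp (-1)) (ht0 : 0 < t0) (hI : ∀ σ ∈ I, t0 ≤ σ ∧ σ ≤ T)
    {v : ℝ → E → ℝ} (hv : HB I R v) : HB I R fun σ x => a.vcl T σ (v σ) x := by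
  unfold vcl
  exact hv.max ((HB.const _).mul (hb_qq h0 h1 ht0 hI))

lemma hb_nl (h0 : 0 < T) (h1 : T ≤ Real.exp (-1)) (ht0 : 0 < t0) (hI : ∀ σ ∈ I, t0 ≤ σ ∧ σ ≤ T)
    {v : ℝ → E → ℝ} (hv : ∀ σ ∈ I, Continuous (v σ)) : HB I R fun σ x => a.nl T σ (v σ) x := by
  have : Nontrivial E := Module.nontrivial_of_finrank_pos a.hd
  have hm := a.m_pos
  have hc1 := a.c1_pos
  set M := (a.c1 * t0) ^ (-a.m) with hM
  have hM0 : 0 ≤ M := by positivity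
  set ω := (volume : Measure E).real (Metric.ball 0 1)
  have hω : 0 ≤ ω := measureReal_nonneg
  have hvol : ∀ r : ℝ, 0 ≤ r →
      (volume : Measure E).real (Metric.ball 0 r) = r ^ Module.finrank ℝ E * ω := by
    intro r hr
    rw [measureReal_def, Measure.addHaar_ball _ _ hr, ENNReal.toReal_mul,
      ENNReal.toReal_ofReal (by positivity)]; rfl
  have hbd : ∀ σ ∈ I, ∀ y : E, ‖a.vcl T σ (v σ) y ^ (-a.m)‖ ≤ M := by
    intro σ hσ y
    have hσ0 := ht0.trans_le (hI σ hσ).1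
    rw [Real.norm_of_nonneg (Real.rpow_nonneg (vcl_pos h0 h1 hσ0 _ y).le _)]
    refine Real.rpow_le_rpow_of_nonpos (by positivity) ?_ (by linarith)
    exact (mul_le_mul_of_nonneg_left ((hI σ hσ).1.trans (le_qq h0 h1 y)) hc1.le).trans (vcl_ge _ _)
  obtain ⟨C, hC, h⟩ := HB.norm (E := E) (I := I) (R := R) |>.pow (Module.finrank ℝ E)
  refine ⟨M * ω * C, by positivity, fun σ hσ x y hx hy => ⟨?_, ?_⟩⟩
  · have e := norm_setIntegral_le_of_norm_le_const (μ := (volume : Measure E))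
      (s := Metric.ball (0 : E) ‖x‖) measure_ball_lt_top (fun y _ => hbd σ hσ y)
    rw [hvol _ (norm_nonneg x)] at e
    refine e.trans ?_
    have h1 := (h σ hσ x y hx hy).1
    rw [abs_of_nonneg (by positivity)] at h1
    nlinarith [mul_nonneg hM0 hω]
  · have key : ∀ x y : E, ‖x‖ ≤ ‖y‖ → |a.nl T σ (v σ) y - a.nl T σ (v σ) x| ≤
        M * ω * |‖y‖ ^ Module.finrank ℝ E - ‖x‖ ^ Module.finrank ℝ E| := by
      intro x y hxy
      have hσ0 := ht0.trans_le (hI σ hσ).1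
      have hsub : Metric.ball (0 : E) ‖x‖ ⊆ Metric.ball 0 ‖y‖ := Metric.ball_subset_ball hxy
      have hi := integrable_vcl (a := a) h0 h1 hσ0 (hI σ hσ).2 (hv σ hσ)
      unfold nl
      rw [← setIntegral_sdiff measurableSet_ball hi.integrableOn hsub]
      have hfin : (volume : Measure E) (Metric.ball (0 : E) ‖y‖ \ Metric.ball 0 ‖x‖) < ⊤ :=
        (measure_mono sdiff_subset).trans_lt measure_ball_lt_top
      refine (norm_setIntegral_le_of_norm_le_const hfin (fun y _ => hbd σ hσ y)).trans ?_
      rw [measureReal_sdiff hsub measurableSet_ball, hvol _ (norm_nonneg x), hvol _ (norm_nonneg y),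
        ← sub_mul]
      have := le_abs_self (‖y‖ ^ Module.finrank ℝ E - ‖x‖ ^ Module.finrank ℝ E)
      nlinarith [mul_nonneg hM0 hω]
    have h2 := mul_le_mul_of_nonneg_left (h σ hσ x y hx hy).2 (mul_nonneg hM0 hω)
    rw [← mul_assoc] at h2
    refine le_trans ?_ h2
    rcases le_total ‖x‖ ‖y‖ with h3 | h3
    · exact key x y h3
    · rw [abs_sub_comm, abs_sub_comm (‖y‖ ^ _)]; exact key y x h3

lemma hb_Ftr (h0 : 0 < T) (h1 : T ≤ Real.exp (-1)) (ht0 : 0 < t0) (hI : ∀ σ ∈ I, t0 ≤ σ ∧ σ ≤ T)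
    {v : ℝ → E → ℝ} {g : ℝ → E → ℝ} (hv : ∀ σ ∈ I, Continuous (v σ)) (hvH : HB I R v)
    (hg0 : ∀ σ ∈ I, ∀ x, 0 ≤ g σ x) (hg : HB I R g) :
    HB I R fun σ x => a.Ftr T σ (v σ) (g σ x) x := by
  have hc1 := a.c1_pos
  have hL : HB I R fun σ (x : E) => (LL T (YY σ x))⁻¹ :=
    (hb_LL ht0 hI).inv one_pos fun σ _ x _ => one_le_LL h0 h1 _
  have hG : HB I R fun σ x => a.Gcl T σ (g σ x) x := by
    refine (hg.min (((HB.const a.C1).mul (hb_YY hI)).mul hL)).congr fun σ hσ x _ => ?_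
    rw [Gcl, abs_of_nonneg (hg0 σ hσ x), div_eq_mul_inv]
  have hV : HB I R fun σ x => (a.vcl T σ (v σ) x)⁻¹ :=
    (hb_vcl h0 h1 ht0 hI hvH).inv (mul_pos hc1 ht0) fun σ hσ x _ =>
      (mul_le_mul_of_nonneg_left ((hI σ hσ).1.trans (le_qq h0 h1 x)) hc1.le).trans (vcl_ge _ _)
  refine ((((HB.const a.c).mul (hG.pow 2)).mul hV).add
    (((HB.const a.μ).mul hG).mul (hb_nl (a := a) h0 h1 ht0 hI hv))).congr fun σ _ x _ => ?_
  rw [Ftr, div_eq_mul_inv]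

end Par
end holder

end BlowUp

namespace BlowUp

variable {E : Type*} [NormedAddCommGroup E] [InnerProductSpace ℝ E] [FiniteDimensional ℝ E]
  [MeasurableSpace E] [BorelSpace E]
variable {V : Type*} [NormedAddCommGroup V] [NormedSpace ℝ V]

/-- A source frozen before time `t0`. -/
def cut (F : ℝ → E → ℝ) (t0 σ : ℝ) : E → ℝ := F (max σ t0)

/-- Sources of linear growth away from time `0`. -/
def Adm (F : ℝ → E → ℝ) : Prop := ∀ t0, 0 < t0 → ∃ K, LG (cut F t0) K

lemma Dop_cut (F : ℝ → E → ℝ) {T t0 τ : ℝ} (h : t0 ≤ τ) (x : E) :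
    Dop (cut F t0) T τ x = Dop F T τ x := by
  unfold Dop cut
  congr! 5 with a
  rw [max_eq_left]; nlinarith [sq_nonneg a]

lemma Gop_cut (F : ℝ → E → ℝ) {T t0 τ : ℝ} (h : t0 ≤ τ) (x : E) :
    Gop (cut F t0) T τ x = Gop F T τ x := by
  unfold Gop cut
  congr! 4 with a
  rw [max_eq_left]; nlinarith [sq_nonneg a]

lemma add_sq_half_le {T τ a : ℝ} (hτ : τ ≤ T) (ha0 : 0 ≤ a) (ha : a ≤ len T τ) :
    τ + a ^ 2 / 2 ≤ T := by
  have := len_sq hτ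
  nlinarith

/-- The weight is comparable along the parabolic average. -/
lemma WW_shift_le {τ σ a : ℝ} (hτ : 0 < τ) (hσ : τ ≤ σ) (ha : a ^ 2 ≤ 2 * σ) (x ξ : E) :
    WW σ (x + a • ξ) ≤ 2 * WW τ x * (1 + ‖ξ‖) ^ 1 := by
  have hσ0 : 0 < σ := by linarith
  have hs := Real.sqrt_pos.2 hσ0
  have hs' := Real.sqrt_pos.2 hτ
  have h1 : |a| ≤ 2 * √σ := by
    refine abs_le_of_sq_le_sq (a := a) ?_ (by positivity)
    rw [mul_pow, Real.sq_sqrt hσ0.le]; linarith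
  have h2 : ‖x + a • ξ‖ / √σ ≤ ‖x‖ / √τ + 2 * ‖ξ‖ := by
    calc ‖x + a • ξ‖ / √σ ≤ (‖x‖ + |a| * ‖ξ‖) / √σ := by
          gcongr
          refine (norm_add_le _ _).trans ?_
          rw [norm_smul, Real.norm_eq_abs]
      _ ≤ ‖x‖ / √σ + (2 * √σ) * ‖ξ‖ / √σ := by rw [add_div]; gcongr
      _ ≤ ‖x‖ / √τ + 2 * ‖ξ‖ := by
          gcongr ?_ + ?_
          · gcongr
          · rw [div_le_iff₀ hs]; nlinarith
  unfold WW
  have h3 : 0 ≤ ‖x‖ / √τ := by positivity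
  nlinarith [norm_nonneg ξ, mul_nonneg h3 (norm_nonneg ξ)]

lemma integral_rpow_path_le {τ l M : ℝ} (hτ : 0 < τ) (hM : 0 < M) :
    ∫ a in (0 : ℝ)..l, a * (τ + a ^ 2 / 2) ^ (-1 - M) ≤ τ ^ (-M) / M := by
  have hpos : ∀ a : ℝ, 0 < τ + a ^ 2 / 2 := fun a => by positivity
  have hd : ∀ a ∈ uIcc 0 l, HasDerivAt (fun a : ℝ => -(τ + a ^ 2 / 2) ^ (-M) / M)
      (a * (τ + a ^ 2 / 2) ^ (-1 - M)) a := by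
    intro a _
    have h1 : HasDerivAt (fun a : ℝ => τ + a ^ 2 / 2) a a := by
      simpa using ((hasDerivAt_pow 2 a).div_const 2).const_add τ
    have h2 := (h1.rpow_const (p := -M) (Or.inl (hpos a).ne')).neg.div_const M
    refine h2.congr_deriv ?_
    rw [show -M - 1 = -1 - M by ring]; field_simp
  have hc : Continuous fun a : ℝ => a * (τ + a ^ 2 / 2) ^ (-1 - M) :=
    continuous_id.mul (Continuous.rpow_const (by fun_prop) fun a => Or.inl (hpos a).ne')
  rw [intervalIntegral.integral_eq_sub_of_hasDerivAt hd (hc.intervalIntegrable _ _)]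
  have : 0 ≤ (τ + l ^ 2 / 2) ^ (-M) / M := by have := hpos l; positivity
  simp only [ne_eq, OfNat.ofNat_ne_zero, not_false_eq_true, zero_pow, zero_div, add_zero]
  rw [neg_div, neg_div]; linarith

lemma integral_rpow_path_le' {τ l M : ℝ} (hτ : 0 < τ) (hl : 0 ≤ l) (hM : 0 < M) :
    ∫ a in (0 : ℝ)..l, (τ + a ^ 2 / 2) ^ (-1 - M) ≤ 2 * (τ ^ (-M) * (√τ)⁻¹ / √M) := by
  have hpos : ∀ a : ℝ, 0 < τ + a ^ 2 / 2 := fun a => by positivity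
  have hst := Real.sqrt_pos.2 hτ
  have hsM := Real.sqrt_pos.2 hM
  set c := √M / √τ with hc
  have hc0 : 0 < c := by positivity
  have hcont : Continuous fun a : ℝ => (τ + a ^ 2 / 2) ^ (-1 - M) :=
    Continuous.rpow_const (by fun_prop) fun a => Or.inl (hpos a).ne'
  have h1 : ∫ a in (0 : ℝ)..l, (τ + a ^ 2 / 2) ^ (-1 - M) ≤
      ∫ a in (0 : ℝ)..l, (c * (a * (τ + a ^ 2 / 2) ^ (-1 - M)) + τ ^ (-1 - M) * Real.exp (-c * a)) := by
    refine intervalIntegral.integral_mono_on hl (hcont.intervalIntegrable _ _)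
      (Continuous.intervalIntegrable (by fun_prop) _ _) fun a ha => ?_
    have e1 : 1 ≤ c * a + Real.exp (-c * a) := by
      have := Real.add_one_le_exp (-c * a); linarith
    have e2 : (τ + a ^ 2 / 2) ^ (-1 - M) ≤ τ ^ (-1 - M) :=
      Real.rpow_le_rpow_of_nonpos hτ (by nlinarith [sq_nonneg a]) (by linarith)
    have e3 : 0 < (τ + a ^ 2 / 2) ^ (-1 - M) := Real.rpow_pos_of_pos (hpos a) _
    calc (τ + a ^ 2 / 2) ^ (-1 - M) ≤ (c * a + Real.exp (-c * a)) * (τ + a ^ 2 / 2) ^ (-1 - M) :=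
          le_mul_of_one_le_left e3.le e1
      _ = c * (a * (τ + a ^ 2 / 2) ^ (-1 - M)) + (τ + a ^ 2 / 2) ^ (-1 - M) * Real.exp (-c * a) := by
          ring
      _ ≤ _ := by gcongr
  have h2 : ∫ a in (0 : ℝ)..l, Real.exp (-c * a) ≤ c⁻¹ := by
    have hd : ∀ a ∈ uIcc 0 l, HasDerivAt (fun a : ℝ => -c⁻¹ * Real.exp (-c * a))
        (Real.exp (-c * a)) a := by
      intro a _
      have := (((hasDerivAt_id a).const_mul (-c)).exp).const_mul (-c⁻¹)
      refine this.congr_deriv ?_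
      simp only [id]; field_simp
    rw [intervalIntegral.integral_eq_sub_of_hasDerivAt hd
      (Continuous.intervalIntegrable (by fun_prop) _ _)]
    have : 0 ≤ c⁻¹ * Real.exp (-c * l) := by positivity
    simp only [mul_zero, Real.exp_zero]; linarith
  refine h1.trans ?_
  rw [intervalIntegral.integral_add (Continuous.intervalIntegrable (by fun_prop) _ _)
    (Continuous.intervalIntegrable (by fun_prop) _ _), intervalIntegral.integral_const_mul,
    intervalIntegral.integral_const_mul]
  have e1 := mul_le_mul_of_nonneg_left (integral_rpow_path_le (l := l) hτ hM) hc0.le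
  have e2 := mul_le_mul_of_nonneg_left h2 (Real.rpow_nonneg hτ.le (-1 - M))
  refine (add_le_add e1 e2).trans (le_of_eq ?_)
  have e3 : τ ^ (-1 - M) = τ ^ (-M) * (√τ)⁻¹ * (√τ)⁻¹ := by
    rw [show -1 - M = -M - 1 by ring, Real.rpow_sub_one hτ.ne', mul_assoc, ← mul_inv,
      Real.mul_self_sqrt hτ.le]; rfl
  rw [e3, hc]
  have : M = √M * √M := (Real.mul_self_sqrt hM.le).symm
  rw [show τ ^ (-M) / M = τ ^ (-M) / (√M * √M) by rw [← this]]
  field_simp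
  ring

section diff
variable {F1 F2 : ℝ → E → ℝ} {T τ δ M : ℝ}

lemma gs_sub_le {ψ : E → V} (hψ : GW ψ) (hF1 : Adm F1) (hF2 : Adm F2) (hτ : 0 < τ) (hT : τ ≤ T)
    (hδ : ∀ σ, τ ≤ σ → σ ≤ T → ∀ w, |F1 σ w - F2 σ w| ≤ δ * (σ ^ (-1 - M) * WW σ w)) (hδ0 : 0 ≤ δ)
    {a : ℝ} (ha0 : 0 ≤ a) (ha : a ≤ len T τ) (x : E) :
    ‖gs ψ (F1 (τ + a ^ 2 / 2)) a x - gs ψ (F2 (τ + a ^ 2 / 2)) a x‖ ≤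
      2 * δ * mom ψ 1 * WW τ x * (τ + a ^ 2 / 2) ^ (-1 - M) := by
  have hσ : τ ≤ τ + a ^ 2 / 2 := by nlinarith [sq_nonneg a]
  have hσT := add_sq_half_le hT ha0 ha
  set σ := τ + a ^ 2 / 2 with hσd
  have hσ0 : 0 < σ := by linarith
  have hint : ∀ {F : ℝ → E → ℝ}, Adm F → Continuous (F σ) ∧ Integrable fun ξ => F σ (x + a • ξ) • ψ ξ := by
    intro F hF
    obtain ⟨K, hK⟩ := hF τ hτ
    have e : cut F τ σ = F σ := by unfold cut; rw [max_eq_left hσ]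
    have hc := hK.slice σ
    have hb := hK.bd σ
    rw [e] at hc hb
    exact ⟨hc, gs_integrable hψ hc 1 (lin_growth hb a x)⟩
  have e : gs ψ (F1 σ) a x - gs ψ (F2 σ) a x = gs ψ (fun w => F1 σ w - F2 σ w) a x := by
    unfold gs
    rw [← integral_sub (hint hF1).2 (hint hF2).2]
    simp_rw [sub_smul]
  rw [e]
  refine (norm_gs_le hψ 1 (K := 2 * δ * WW τ x * σ ^ (-1 - M)) fun ξ => ?_).trans (le_of_eq (by ring))
  refine (hδ σ hσ hσT _).trans ?_
  have h1 := WW_shift_le hτ hσ (a := a) (by rw [hσd]; linarith) x ξ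
  have h2 : 0 ≤ σ ^ (-1 - M) := Real.rpow_nonneg hσ0.le _
  calc δ * (σ ^ (-1 - M) * WW σ (x + a • ξ)) ≤ δ * (σ ^ (-1 - M) * (2 * WW τ x * (1 + ‖ξ‖) ^ 1)) := by
        gcongr
    _ = _ := by ring

lemma Adm.continuous_path {F : ℝ → E → ℝ} (hF : Adm F) {ψ : E → V} (hψ : GW ψ) (hτ : 0 < τ) (x : E) :
    Continuous fun a : ℝ => gs ψ (F (τ + a ^ 2 / 2)) a x := by
  obtain ⟨K, hK⟩ := hF τ hτ
  have := hK.continuous_gs_left hψ τ x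
  unfold cut at this
  convert this using 4 with a
  rw [max_eq_left]; nlinarith [sq_nonneg a]

lemma Dop_sub_le (hF1 : Adm F1) (hF2 : Adm F2) (hτ : 0 < τ) (hT : τ ≤ T) (hM : 0 < M)
    (hδ : ∀ σ, τ ≤ σ → σ ≤ T → ∀ w, |F1 σ w - F2 σ w| ≤ δ * (σ ^ (-1 - M) * WW σ w)) (hδ0 : 0 ≤ δ)
    (x : E) : |Dop F1 T τ x - Dop F2 T τ x| ≤
      2 * δ * mom (gau : E → ℝ) 1 * (τ ^ (-M) / M) * WW τ x := by
  have hW : 0 ≤ WW τ x := zero_le_one.trans (one_le_WW τ x)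
  have hm := mom_nonneg (gau : E → ℝ) 1
  have c1 := hF1.continuous_path gw_gau hτ x
  have c2 := hF2.continuous_path gw_gau hτ x
  have hpos : ∀ a : ℝ, 0 < τ + a ^ 2 / 2 := fun a => by positivity
  unfold Dop
  have d1 : Continuous fun a : ℝ => a * gs gau (F1 (τ + a ^ 2 / 2)) a x := by fun_prop
  have d2 : Continuous fun a : ℝ => a * gs gau (F2 (τ + a ^ 2 / 2)) a x := by fun_prop
  rw [← intervalIntegral.integral_sub (d1.intervalIntegrable _ _) (d2.intervalIntegrable _ _),
    ← Real.norm_eq_abs]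
  refine (intervalIntegral.norm_integral_le_of_norm_le (len_nonneg T τ)
    (g := fun a => 2 * δ * mom (gau : E → ℝ) 1 * WW τ x * (a * (τ + a ^ 2 / 2) ^ (-1 - M))) ?_ ?_).trans ?_
  · refine Filter.Eventually.of_forall fun a ha => ?_
    have := gs_sub_le gw_gau hF1 hF2 hτ hT hδ hδ0 ha.1.le ha.2 x
    rw [← mul_sub, norm_mul, Real.norm_of_nonneg ha.1.le]
    calc _ ≤ _ := mul_le_mul_of_nonneg_left this ha.1.le
      _ = _ := by ring
  · exact Continuous.intervalIntegrable (continuous_const.mul (continuous_id.mul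
      (Continuous.rpow_const (by fun_prop) fun a => Or.inl (hpos a).ne'))) _ _
  · rw [intervalIntegral.integral_const_mul]
    calc _ ≤ 2 * δ * mom (gau : E → ℝ) 1 * WW τ x * (τ ^ (-M) / M) := by
          gcongr
          exact integral_rpow_path_le hτ hM
      _ = _ := by ring

lemma Gop_sub_le (hF1 : Adm F1) (hF2 : Adm F2) (hτ : 0 < τ) (hT : τ ≤ T) (hM : 0 < M)
    (hδ : ∀ σ, τ ≤ σ → σ ≤ T → ∀ w, |F1 σ w - F2 σ w| ≤ δ * (σ ^ (-1 - M) * WW σ w)) (hδ0 : 0 ≤ δ)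
    (x : E) : ‖Gop F1 T τ x - Gop F2 T τ x‖ ≤
      2 * δ * mom (dgau : E → E) 1 * (2 * (τ ^ (-M) * (√τ)⁻¹ / √M)) * WW τ x := by
  have hW : 0 ≤ WW τ x := zero_le_one.trans (one_le_WW τ x)
  have hm := mom_nonneg (dgau : E → E) 1
  have c1 := hF1.continuous_path gw_dgau hτ x
  have c2 := hF2.continuous_path gw_dgau hτ x
  have hpos : ∀ a : ℝ, 0 < τ + a ^ 2 / 2 := fun a => by positivity
  unfold Gop
  rw [← intervalIntegral.integral_sub (c1.intervalIntegrable _ _) (c2.intervalIntegrable _ _)]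
  refine (intervalIntegral.norm_integral_le_of_norm_le (len_nonneg T τ)
    (g := fun a => 2 * δ * mom (dgau : E → E) 1 * WW τ x * (τ + a ^ 2 / 2) ^ (-1 - M)) ?_ ?_).trans ?_
  · exact Filter.Eventually.of_forall fun a ha =>
      gs_sub_le gw_dgau hF1 hF2 hτ hT hδ hδ0 ha.1.le ha.2 x
  · exact Continuous.intervalIntegrable (continuous_const.mul
      (Continuous.rpow_const (by fun_prop) fun a => Or.inl (hpos a).ne')) _ _
  · rw [intervalIntegral.integral_const_mul]
    calc _ ≤ 2 * δ * mom (dgau : E → E) 1 * WW τ x * (2 * (τ ^ (-M) * (√τ)⁻¹ / √M)) := by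
          gcongr
          exact integral_rpow_path_le' hτ (len_nonneg T τ) hM
      _ = _ := by ring

end diff

end BlowUp

namespace BlowUp

variable {E : Type*} [NormedAddCommGroup E] [InnerProductSpace ℝ E] [FiniteDimensional ℝ E]
  [MeasurableSpace E] [BorelSpace E]
variable {V : Type*} [NormedAddCommGroup V] [NormedSpace ℝ V]

open scoped BoundedContinuousFunction

/-- Radial sources with a weight singular at time `0`. -/
noncomputable def FF (M T : ℝ) (Ψ : (ℝ × ℝ × ℝ) →ᵇ ℝ) (k σ : ℝ) (w : E) : ℝ :=
  (min σ T) ^ (-1 - M) * WW (min σ T) w * Ψ (k, -Real.log (min σ T), ‖w‖)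

section FF
variable {M T : ℝ} {Ψ : (ℝ × ℝ × ℝ) →ᵇ ℝ}

lemma continuous_FF (h0 : 0 < T) {Z : Type*} [TopologicalSpace Z] {k σ : Z → ℝ} {w : Z → E}
    (hk : Continuous k) (hσ : Continuous σ) (hw : Continuous w) (hp : ∀ z, 0 < σ z) :
    Continuous fun z => FF M T Ψ (k z) (σ z) (w z) := by
  have hm : Continuous fun z => min (σ z) T := hσ.min continuous_const
  have hmp : ∀ z, 0 < min (σ z) T := fun z => lt_min (hp z) h0
  unfold FF WW
  refine ((hm.rpow_const fun z => Or.inl (hmp z).ne').mul (continuous_const.add (hw.norm.div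
    hm.sqrt fun z => (Real.sqrt_pos.2 (hmp z)).ne'))).mul (Ψ.continuous.comp ?_)
  exact hk.prodMk ((hm.log fun z => (hmp z).ne').neg.prodMk hw.norm)

lemma abs_FF_le {t k σ : ℝ} (hM : 0 ≤ M) (ht : 0 < t) (h : t ≤ min σ T) (w : E) :
    |FF M T Ψ k σ w| ≤ t ^ (-1 - M) * (1 + (√t)⁻¹) * ‖Ψ‖ * (1 + ‖w‖) := by
  have hm : 0 < min σ T := ht.trans_le h
  have hst := Real.sqrt_pos.2 ht
  unfold FF
  have hW : WW (min σ T) w ≤ (1 + (√t)⁻¹) * (1 + ‖w‖) := by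
    unfold WW
    have h1 : ‖w‖ / √(min σ T) ≤ ‖w‖ * (√t)⁻¹ := by
      rw [div_eq_mul_inv]
      gcongr
    have : 0 < (√t)⁻¹ := by positivity
    nlinarith [norm_nonneg w]
  have hW0 : 0 ≤ WW (min σ T) w := zero_le_one.trans (one_le_WW _ _)
  have h2 : (min σ T) ^ (-1 - M) ≤ t ^ (-1 - M) :=
    Real.rpow_le_rpow_of_nonpos ht h (by linarith)
  have h3 := Ψ.norm_coe_le_norm (k, -Real.log (min σ T), ‖w‖)
  rw [Real.norm_eq_abs] at h3
  rw [abs_mul, abs_mul, abs_of_pos (Real.rpow_pos_of_pos hm _), abs_of_nonneg hW0]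
  calc _ ≤ t ^ (-1 - M) * ((1 + (√t)⁻¹) * (1 + ‖w‖)) * ‖Ψ‖ := by gcongr
    _ = _ := by ring

lemma adm_FF (hM : 0 ≤ M) (h0 : 0 < T) (k : ℝ) : Adm (FF M T Ψ k : ℝ → E → ℝ) := by
  intro t0 ht0
  refine ⟨(min t0 T) ^ (-1 - M) * (1 + (√(min t0 T))⁻¹) * ‖Ψ‖, ?_, fun σ w => ?_⟩
  · unfold cut Function.uncurry
    exact continuous_FF h0 continuous_const (continuous_fst.max continuous_const) continuous_snd
      fun z => ht0.trans_le (le_max_right _ _)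
  · exact abs_FF_le hM (lt_min ht0 h0) (min_le_min_right _ (le_max_right _ _)) w

lemma rad_FF (k σ : ℝ) : Rad (FF M T Ψ k σ : E → ℝ) := fun x y h => by
  unfold FF WW; rw [h]

lemma FF_sub_le (Ψ' : (ℝ × ℝ × ℝ) →ᵇ ℝ) {k σ : ℝ} (hσ : 0 < σ) (hT : σ ≤ T) (w : E) :
    |FF M T Ψ k σ w - FF M T Ψ' k σ w| ≤ dist Ψ Ψ' * (σ ^ (-1 - M) * WW σ w) := by
  have hW0 : 0 ≤ WW σ w := zero_le_one.trans (one_le_WW _ _)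
  unfold FF
  rw [min_eq_left hT, ← mul_sub, abs_mul, abs_of_nonneg (mul_nonneg (Real.rpow_nonneg hσ.le _) hW0),
    mul_comm]
  gcongr
  rw [← Real.dist_eq]
  exact BoundedContinuousFunction.dist_coe_le_dist _

variable {Z : Type*} [TopologicalSpace Z] [FirstCountableTopology Z] {k τ : Z → ℝ} {x : Z → E}

lemma continuous_Dop_FF (hM : 0 ≤ M) (h0 : 0 < T) (hk : Continuous k) (hτ : Continuous τ)
    (hx : Continuous x) (hp : ∀ z, 0 < τ z) (hT : ∀ z, τ z ≤ T) :
    Continuous fun z => Dop (FF M T Ψ (k z)) T (τ z) (x z) := by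
  unfold Dop
  refine continuous_gau_path (f := fun z a w => FF M T Ψ (k z) (τ z + a ^ 2 / 2) w)
    (K := fun z _ => (τ z) ^ (-1 - M) * (1 + (√(τ z))⁻¹) * ‖Ψ‖) ?_ ?_ hx
    ((continuous_len T).comp hτ) fun z a w => ?_
  · exact continuous_FF h0 (hk.comp continuous_fst) (by fun_prop) (by fun_prop)
      fun q => by have := hp q.1; positivity
  · unfold Function.uncurry
    have h1 : Continuous fun z => τ z ^ (-1 - M) := hτ.rpow_const fun z => Or.inl (hp z).ne'
    have h2 : Continuous fun z => (√(τ z))⁻¹ := hτ.sqrt.inv₀ fun z => (Real.sqrt_pos.2 (hp z)).ne'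
    exact ((h1.mul (continuous_const.add h2)).mul continuous_const).comp continuous_fst
  · exact abs_FF_le hM (hp z) (le_min (by nlinarith [sq_nonneg a]) (hT z)) w

lemma continuous_Gop_FF (hM : 0 ≤ M) (h0 : 0 < T) (hk : Continuous k) (hτ : Continuous τ)
    (hx : Continuous x) (hp : ∀ z, 0 < τ z) (hT : ∀ z, τ z ≤ T) :
    Continuous fun z => Gop (FF M T Ψ (k z)) T (τ z) (x z) := by
  unfold Gop
  refine continuous_dgau_path (f := fun z a w => FF M T Ψ (k z) (τ z + a ^ 2 / 2) w)
    (K := fun z _ => (τ z) ^ (-1 - M) * (1 + (√(τ z))⁻¹) * ‖Ψ‖) ?_ ?_ hx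
    ((continuous_len T).comp hτ) fun z a w => ?_
  · exact continuous_FF h0 (hk.comp continuous_fst) (by fun_prop) (by fun_prop)
      fun q => by have := hp q.1; positivity
  · unfold Function.uncurry
    have h1 : Continuous fun z => τ z ^ (-1 - M) := hτ.rpow_const fun z => Or.inl (hp z).ne'
    have h2 : Continuous fun z => (√(τ z))⁻¹ := hτ.sqrt.inv₀ fun z => (Real.sqrt_pos.2 (hp z)).ne'
    exact ((h1.mul (continuous_const.add h2)).mul continuous_const).comp continuous_fst
  · exact abs_FF_le hM (hp z) (le_min (by nlinarith [sq_nonneg a]) (hT z)) w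

end FF

namespace Par
variable (a : Par E)

/-- The initial value of the coefficient of the quadratic part. -/
noncomputable def B0 (T : ℝ) : ℝ := a.b / (-Real.log T)

/-- The solution generated by the source `F`. -/
noncomputable def vv (T k : ℝ) (F : ℝ → E → ℝ) (τ : ℝ) (x : E) : ℝ :=
  k + a.P * τ + a.B0 T * (‖x‖ ^ 2 - 2 * Module.finrank ℝ E * τ) - Dop F T τ x

/-- Its gradient. -/
noncomputable def gg (T : ℝ) (F : ℝ → E → ℝ) (τ : ℝ) (x : E) : E :=
  (2 * a.B0 T) • x - Gop F T τ x

/-- The nonlinearity evaluated along the solution generated by `F`. -/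
noncomputable def src (T k : ℝ) (F : ℝ → E → ℝ) (τ : ℝ) (x : E) : ℝ :=
  a.Ftr T τ (a.vv T k F τ) ‖a.gg T F τ x‖ x

variable {a} {M T : ℝ}

lemma continuous_vv {T k τ : ℝ} {F : ℝ → E → ℝ} (hF : Adm F) (hτ : 0 < τ) :
    Continuous (a.vv T k F τ) := by
  obtain ⟨K, hK⟩ := hF τ hτ
  have h1 := (hK.continuous_Dop T).comp (Continuous.prodMk_right τ)
  have h2 : Continuous fun x => Dop F T τ x := by
    refine h1.congr fun x => ?_
    exact Dop_cut F le_rfl x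
  unfold vv
  fun_prop

lemma continuous_src_FF {Ψ : (ℝ × ℝ × ℝ) →ᵇ ℝ} {Z : Type*} [TopologicalSpace Z]
    [FirstCountableTopology Z] {k τ : Z → ℝ} {x : Z → E} (hM : 0 ≤ M) (h0 : 0 < T)
    (h1 : T ≤ Real.exp (-1)) (hk : Continuous k) (hτ : Continuous τ)
    (hx : Continuous x) (hp : ∀ z, 0 < τ z) (hT : ∀ z, τ z ≤ T) :
    Continuous fun z => a.src T (k z) (FF M T Ψ (k z)) (τ z) (x z) := by
  unfold src
  refine continuous_Ftr h0 h1 hτ hp hT (v := fun z => a.vv T (k z) (FF M T Ψ (k z)) (τ z)) ?_ ?_ hx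
  · have := continuous_Dop_FF (Ψ := Ψ) (E := E) hM h0 (hk.comp continuous_fst)
      (hτ.comp continuous_fst) continuous_snd (fun q : Z × E => hp q.1) (fun q => hT q.1)
    unfold vv
    fun_prop
  · have := continuous_Gop_FF (Ψ := Ψ) hM h0 hk hτ hx hp hT
    unfold gg
    fun_prop

/-- Contraction estimate for the source. -/
lemma exists_src_contract (a : Par E) : ∃ M : ℝ, 0 < M ∧ ∀ T : ℝ, 0 < T → T ≤ Real.exp (-1) →
    ∀ (k δ : ℝ) (F1 F2 : ℝ → E → ℝ), Adm F1 → Adm F2 → 0 ≤ δ →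
    (∀ σ, 0 < σ → σ ≤ T → ∀ w, |F1 σ w - F2 σ w| ≤ δ * (σ ^ (-1 - M) * WW σ w)) →
    ∀ τ, 0 < τ → τ ≤ T → ∀ x, |a.src T k F1 τ x - a.src T k F2 τ x| ≤
      (1 / 2) * δ * (τ ^ (-1 - M) * WW τ x) := by
  obtain ⟨B, hB, hlip⟩ := a.exists_Ftr_lip
  set m1 := mom (gau : E → ℝ) 1
  set m2 := mom (dgau : E → E) 1
  have hm1 : 0 ≤ m1 := mom_nonneg _ _
  have hm2 : 0 ≤ m2 := mom_nonneg _ _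
  set A := 2 * B * (2 * m1 + 4 * m2) with hA
  have hA0 : 0 ≤ A := by positivity
  set M := A ^ 2 + 1 with hM
  have hM0 : 0 < M := by positivity
  refine ⟨M, hM0, fun T h0 h1 k δ F1 F2 hF1 hF2 hδ h τ hτ hT x => ?_⟩
  have hsq := Real.sqrt_pos.2 hτ
  have hh : ∀ σ, τ ≤ σ → σ ≤ T → ∀ w, |F1 σ w - F2 σ w| ≤ δ * (σ ^ (-1 - M) * WW σ w) :=
    fun σ hσ hσT => h σ (hτ.trans_le hσ) hσT
  have hW0 : 0 ≤ WW τ x := zero_le_one.trans (one_le_WW _ _)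
  have key := hlip T τ h0 h1 hτ hT (a.vv T k F1 τ) (a.vv T k F2 τ) ‖a.gg T F1 τ x‖ ‖a.gg T F2 τ x‖ x
    (2 * δ * m1 * (τ ^ (-M) / M)) (2 * δ * m2 * (2 * (τ ^ (-M) * (√τ)⁻¹ / √M)))
    (continuous_vv hF1 hτ) (continuous_vv hF2 hτ) (by positivity) (fun y => ?_) ?_
  · refine key.trans ?_
    have hsM : 1 ≤ √M := Real.one_le_sqrt.2 (by rw [hM]; nlinarith [sq_nonneg A])
    have hsM0 : 0 < √M := by linarith
    have hAM : A ≤ √M := Real.le_sqrt_of_sq_le (by rw [hM]; linarith)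
    have e1 : τ ^ (-1 - M) = τ⁻¹ * τ ^ (-M) := by
      rw [show -1 - M = -1 + -M by ring, Real.rpow_add hτ, Real.rpow_neg_one]
    have e2 : (√τ)⁻¹ * (√τ)⁻¹ = τ⁻¹ := by rw [← mul_inv, Real.mul_self_sqrt hτ.le]
    have e3 : τ ^ (-M) / M ≤ τ ^ (-M) / √M := by
      gcongr
      have := Real.mul_self_sqrt hM0.le
      nlinarith
    have e4 : B * (2 * m1 + 4 * m2) / √M ≤ 1 / 2 := by
      rw [div_le_iff₀ hsM0]; rw [hA] at hAM; linarith
    calc B * (τ⁻¹ * (2 * δ * m1 * (τ ^ (-M) / M)) + (√τ)⁻¹ * (2 * δ * m2 *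
            (2 * (τ ^ (-M) * (√τ)⁻¹ / √M)))) * WW τ x
        ≤ B * (τ⁻¹ * (2 * δ * m1 * (τ ^ (-M) / √M)) + (√τ)⁻¹ * (2 * δ * m2 *
            (2 * (τ ^ (-M) * (√τ)⁻¹ / √M)))) * WW τ x := by gcongr
      _ = B * (2 * m1 * τ⁻¹ + 4 * m2 * ((√τ)⁻¹ * (√τ)⁻¹)) / √M * (δ * (τ ^ (-M) * WW τ x)) := by ring
      _ = (B * (2 * m1 + 4 * m2) / √M) * (δ * (τ ^ (-1 - M) * WW τ x)) := by rw [e2, e1]; ring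
      _ ≤ (1 / 2) * (δ * (τ ^ (-1 - M) * WW τ x)) := by gcongr
      _ = _ := by ring
  · have e : a.vv T k F1 τ y - a.vv T k F2 τ y = -(Dop F1 T τ y - Dop F2 T τ y) := by unfold vv; ring
    rw [e, abs_neg]
    exact Dop_sub_le hF1 hF2 hτ hT hM0 hh hδ y
  · have e : a.gg T F1 τ x - a.gg T F2 τ x = -(Gop F1 T τ x - Gop F2 T τ x) := by unfold gg; abel
    refine (abs_norm_sub_norm_le _ _).trans ?_
    rw [e, norm_neg]
    exact Gop_sub_le hF1 hF2 hτ hT hM0 hh hδ x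

end Par

lemma rad_Dop {F : ℝ → E → ℝ} (hF : ∀ σ, Rad (F σ)) (T τ : ℝ) : Rad (Dop F T τ) := by
  intro x y h
  unfold Dop
  congr 1 with a
  rw [rad_gs_gau (hF _) a x y h]

lemma Gop_isometry {F : ℝ → E → ℝ} (hF : ∀ σ, Rad (F σ)) (T τ : ℝ) (U : E ≃ₗᵢ[ℝ] E) (x : E) :
    Gop F T τ (U x) = U (Gop F T τ x) := by
  unfold Gop
  rw [intervalIntegral.integral_of_le (len_nonneg _ _), intervalIntegral.integral_of_le
    (len_nonneg _ _)]
  have := (U.toContinuousLinearEquiv : E ≃L[ℝ] E).integral_comp_comm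
    (fun a => gs dgau (F (τ + a ^ 2 / 2)) a x) (μ := volume.restrict (Ioc 0 (len T τ)))
  simp only [LinearIsometryEquiv.coe_toContinuousLinearEquiv] at this
  rw [← this]
  congr 1 with a
  exact gs_dgau_isometry (hF _) a U x

namespace Par
variable {a : Par E}

lemma rad_src {T k : ℝ} {F : ℝ → E → ℝ} (hF : ∀ σ, Rad (F σ)) (τ : ℝ) :
    Rad (a.src T k F τ) := by
  intro x y h
  have hv : Rad (a.vv T k F τ) := fun x y h => by unfold vv; rw [h, rad_Dop hF T τ x y h]
  have hg : ‖a.gg T F τ x‖ = ‖a.gg T F τ y‖ := by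
    obtain ⟨U, rfl⟩ := exists_isometry h
    unfold gg
    rw [Gop_isometry hF, ← U.map_smul, ← U.map_sub, U.norm_map]
  unfold src Ftr Gcl vcl nl qq YY
  rw [hg, hv x y h, h]

end Par

end BlowUp

namespace BlowUp

variable {E : Type*} [NormedAddCommGroup E] [InnerProductSpace ℝ E] [FiniteDimensional ℝ E]
  [MeasurableSpace E] [BorelSpace E]
variable {V : Type*} [NormedAddCommGroup V] [NormedSpace ℝ V]

open scoped BoundedContinuousFunction

lemma WW_pos (τ : ℝ) (x : E) : 0 < WW τ x := zero_lt_one.trans_le (one_le_WW τ x)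

namespace Par

/-- One step of the Picard iteration, in the variables `(k, -log σ, ‖x‖)`. -/
noncomputable def pic (a : Par E) (M T : ℝ) (e : E) (Ψ : (ℝ × ℝ × ℝ) →ᵇ ℝ) (z : ℝ × ℝ × ℝ) : ℝ :=
  (min (Real.exp (-z.2.1)) T ^ (-1 - M) * WW (min (Real.exp (-z.2.1)) T) (z.2.2 • e))⁻¹ *
    a.src T z.1 (FF M T Ψ z.1) (min (Real.exp (-z.2.1)) T) (z.2.2 • e)

variable {a : Par E} {M T : ℝ} {e : E}

lemma continuous_pic (hM : 0 ≤ M) (h0 : 0 < T) (h1 : T ≤ Real.exp (-1)) (Ψ : (ℝ × ℝ × ℝ) →ᵇ ℝ) :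
    Continuous (a.pic M T e Ψ) := by
  have hτ : Continuous fun z : ℝ × ℝ × ℝ => min (Real.exp (-z.2.1)) T := by fun_prop
  have hp : ∀ z : ℝ × ℝ × ℝ, 0 < min (Real.exp (-z.2.1)) T := fun z => lt_min (Real.exp_pos _) h0
  have hx : Continuous fun z : ℝ × ℝ × ℝ => z.2.2 • e := by fun_prop
  have h := continuous_src_FF (a := a) (Ψ := Ψ) hM h0 h1 continuous_fst hτ hx hp
    (fun z => min_le_right _ _)
  refine Continuous.mul (Continuous.inv₀ ?_ fun z => ?_) h
  · unfold WW
    exact (hτ.rpow_const fun z => Or.inl (hp z).ne').mul (continuous_const.add (hx.norm.div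
      hτ.sqrt fun z => (Real.sqrt_pos.2 (hp z)).ne'))
  · exact (mul_pos (Real.rpow_pos_of_pos (hp z) _) (WW_pos _ _)).ne'

/-- Existence of solutions of the truncated integral equation. -/
lemma exists_fixed (a : Par E) : ∃ A M : ℝ, 0 < A ∧ 0 < M ∧ ∀ T : ℝ, 0 < T → T ≤ Real.exp (-1) →
    ∃ Ψ : (ℝ × ℝ × ℝ) →ᵇ ℝ, ∀ k τ : ℝ, 0 < τ → τ ≤ T → ∀ x : E,
      FF M T Ψ k τ x = a.src T k (FF M T Ψ k) τ x := by
  obtain ⟨A, hA, hbd⟩ := a.exists_Ftr_bound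
  obtain ⟨M, hM, hcon⟩ := a.exists_src_contract
  refine ⟨A, M, hA, hM, fun T h0 h1 => ?_⟩
  have hT1 : T ≤ 1 := h1.trans (Real.exp_le_one_iff.2 (by norm_num))
  have : Nontrivial E := Module.finrank_pos_iff.1 a.hd
  obtain ⟨e, he⟩ := exists_norm_eq E zero_le_one
  have hp : ∀ z : ℝ × ℝ × ℝ, 0 < min (Real.exp (-z.2.1)) T := fun z => lt_min (Real.exp_pos _) h0
  have hw : ∀ z : ℝ × ℝ × ℝ, 0 < min (Real.exp (-z.2.1)) T ^ (-1 - M) *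
      WW (min (Real.exp (-z.2.1)) T) (z.2.2 • e) := fun z =>
    mul_pos (Real.rpow_pos_of_pos (hp z) _) (WW_pos _ _)
  have hb : ∀ Ψ z, ‖a.pic M T e Ψ z‖ ≤ A := by
    intro Ψ z
    have h2 := (hbd T _ h0 h1 (hp z) (min_le_right _ _)
      (a.vv T z.1 (FF M T Ψ z.1) (min (Real.exp (-z.2.1)) T))
      ‖a.gg T (FF M T Ψ z.1) (min (Real.exp (-z.2.1)) T) (z.2.2 • e)‖ (z.2.2 • e)).1
    unfold pic
    rw [norm_mul, norm_inv, Real.norm_of_nonneg (hw z).le, inv_mul_le_iff₀ (hw z), Real.norm_eq_abs]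
    refine h2.trans ?_
    rw [mul_comm _ A]
    have h3 := Real.rpow_le_one_of_one_le_of_nonpos (one_le_LL h0 h1
      (YY (min (Real.exp (-z.2.1)) T) (z.2.2 • e))) (by norm_num : (-(3 / 2) : ℝ) ≤ 0)
    have h4 := Real.one_le_rpow_of_pos_of_le_one_of_nonpos (hp z) ((min_le_right _ _).trans hT1)
      (by linarith : -1 - M ≤ 0)
    have := WW_pos (min (Real.exp (-z.2.1)) T) (z.2.2 • e)
    gcongr
    exact h3.trans h4
  let Φ : ((ℝ × ℝ × ℝ) →ᵇ ℝ) → ((ℝ × ℝ × ℝ) →ᵇ ℝ) := fun Ψ =>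
    BoundedContinuousFunction.ofNormedAddCommGroup (a.pic M T e Ψ) (continuous_pic hM.le h0 h1 Ψ) A
      (hb Ψ)
  have hΦ : ContractingWith (1 / 2) Φ := by
    refine ⟨by rw [← NNReal.coe_lt_coe]; norm_num, LipschitzWith.of_dist_le_mul fun Ψ Ψ' => ?_⟩
    rw [BoundedContinuousFunction.dist_le (by positivity)]
    intro z
    have h2 := hcon T h0 h1 z.1 (dist Ψ Ψ') (FF M T Ψ z.1) (FF M T Ψ' z.1)
      (adm_FF hM.le h0 _) (adm_FF hM.le h0 _) dist_nonneg
      (fun σ hσ hσT w => FF_sub_le Ψ' hσ hσT w) _ (hp z) (min_le_right _ _) (z.2.2 • e)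
    change dist (a.pic M T e Ψ z) (a.pic M T e Ψ' z) ≤ _
    rw [Real.dist_eq]
    unfold pic
    rw [← mul_sub, abs_mul, abs_inv, abs_of_pos (hw z), inv_mul_le_iff₀ (hw z)]
    refine h2.trans (le_of_eq ?_)
    push_cast
    ring
  refine ⟨hΦ.fixedPoint, fun k τ hτ hT x => ?_⟩
  have hfix : Φ hΦ.fixedPoint = hΦ.fixedPoint := hΦ.fixedPoint_isFixedPt
  set Ψ := hΦ.fixedPoint
  have hz : Ψ (k, -Real.log τ, ‖x‖) = a.pic M T e Ψ (k, -Real.log τ, ‖x‖) := by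
    conv_lhs => rw [← hfix]
    rfl
  have hx : ‖(‖x‖ • e)‖ = ‖x‖ := by rw [norm_smul, he]; simp
  have hW : WW τ (‖x‖ • e) = WW τ x := by unfold WW; rw [hx]
  have hs := rad_src (a := a) (T := T) (k := k) (F := FF M T Ψ k) (fun σ => rad_FF k σ) τ _ _ hx
  have hpos : 0 < τ ^ (-1 - M) * WW τ x := mul_pos (Real.rpow_pos_of_pos hτ _) (WW_pos _ _)
  conv_lhs => unfold FF
  rw [min_eq_left hT, hz]
  unfold pic
  simp only [neg_neg, Real.exp_log hτ, min_eq_left hT]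
  rw [hW, hs, mul_inv_cancel_left₀ hpos.ne']

end Par

lemma Adm.continuousOn_gs {F : ℝ → E → ℝ} (hF : Adm F) {ψ : E → V} (hψ : GW ψ) (x : E) :
    ContinuousOn (fun σ => gs ψ (F σ) (√(2 * σ)) x) (Ioi 0) := by
  intro σ hσ
  rw [mem_Ioi] at hσ
  obtain ⟨K, hK⟩ := hF (σ / 2) (by positivity)
  have h : Continuous fun σ' => gs ψ (cut F (σ / 2) σ') (√(2 * σ')) x :=
    BlowUp.continuous_gs hψ hK.cont (K := fun _ => K) continuous_const (by fun_prop) continuous_const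
      hK.bd
  refine (h.continuousAt.congr ?_).continuousWithinAt
  filter_upwards [lt_mem_nhds (half_lt_self hσ)] with σ' h'
  unfold cut
  rw [max_eq_left h'.le]

lemma WW_center_le {σ : ℝ} (hσ : 0 < σ) (ξ : E) :
    WW σ ((0 : E) + √(2 * σ) • ξ) ≤ 2 * (1 + ‖ξ‖) ^ 1 := by
  have := WW_shift_le hσ le_rfl (a := √(2 * σ)) (by rw [Real.sq_sqrt (by positivity)]) 0 ξ
  unfold WW at this ⊢
  simpa using this

/-- A solution of the truncated integral equation which vanishes at the blow-up point. -/
structure Sol (a : Par E) (A T k : ℝ) (F : ℝ → E → ℝ) : Prop where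
  h0 : 0 < T
  h1 : T ≤ Real.exp (-1)
  adm : Adm F
  rad : ∀ σ, Rad (F σ)
  frz : ∀ σ, F (min σ T) = F σ
  fix : ∀ τ, 0 < τ → τ ≤ T → ∀ x, F τ x = a.src T k F τ x
  bd : ∀ τ, 0 < τ → τ ≤ T → ∀ x, |F τ x| ≤ A * WW τ x
  bd1 : ∀ τ, 0 < τ → τ ≤ T → ∀ x, |F τ x| ≤ A * (LL T (YY τ x) ^ (-(3 / 2) : ℝ) * WW τ x)
  bd2 : ∀ τ, 0 < τ → τ ≤ T → ∀ x, |F τ x| ≤ A * (LL T (YY τ x) ^ (-(5 / 4) : ℝ) * √(WW τ x) +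
    LL T (YY τ x) ^ (-(3 / 2) : ℝ) * (τ ^ (a.γ / 2) * WW τ x))
  kint : k = ∫ σ in (0 : ℝ)..T, gs gau (F σ) (√(2 * σ)) 0

lemma abs_gs_center_le {F : ℝ → E → ℝ} {ψ : E → V} (hψ : GW ψ) {A σ : ℝ} (hA : 0 ≤ A) (hσ : 0 < σ)
    (h : ∀ x, |F σ x| ≤ A * WW σ x) : ‖gs ψ (F σ) (√(2 * σ)) 0‖ ≤ 2 * A * mom ψ 1 := by
  refine BlowUp.norm_gs_le hψ 1 fun ξ => (h _).trans ?_
  calc _ ≤ A * (2 * (1 + ‖ξ‖) ^ 1) := by gcongr; exact WW_center_le hσ ξ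
    _ = _ := by ring

lemma Par.exists_sol (a : Par E) : ∃ A : ℝ, 0 < A ∧ ∀ T : ℝ, 0 < T → T ≤ Real.exp (-1) →
    ∃ (k : ℝ) (F : ℝ → E → ℝ), Sol a A T k F := by
  obtain ⟨A, hA, hbd⟩ := a.exists_Ftr_bound
  obtain ⟨_, M, -, hM, hfix⟩ := a.exists_fixed
  refine ⟨A, hA, fun T h0 h1 => ?_⟩
  obtain ⟨Ψ, hΨ⟩ := hfix T h0 h1
  have hB : ∀ k τ, 0 < τ → τ ≤ T → ∀ x : E, |FF M T Ψ k τ x| ≤ A * WW τ x := by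
    intro k τ hτ hT x
    rw [hΨ k τ hτ hT x]
    refine (hbd T τ h0 h1 hτ hT _ _ x).1.trans ?_
    have h3 := Real.rpow_le_one_of_one_le_of_nonpos (one_le_LL h0 h1 (YY τ x))
      (by norm_num : (-(3 / 2) : ℝ) ≤ 0)
    have := WW_pos τ x
    gcongr
    nlinarith
  set K := 2 * A * mom (gau : E → ℝ) 1 with hK
  have hK0 : 0 ≤ K := by have := mom_nonneg (gau : E → ℝ) 1; positivity
  set h : ℝ → ℝ := fun k => ∫ σ in (0 : ℝ)..T, gs gau (FF M T Ψ k σ) (√(2 * σ)) (0 : E) with hh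
  have hbk : ∀ k σ, σ ∈ uIoc 0 T → ‖gs gau (FF M T Ψ k σ) (√(2 * σ)) (0 : E)‖ ≤ K := by
    intro k σ hσ
    rw [uIoc_of_le h0.le] at hσ
    exact abs_gs_center_le gw_gau hA.le hσ.1 (hB k σ hσ.1 hσ.2)
  have hc : Continuous h := by
    refine intervalIntegral.continuous_of_dominated_interval (bound := fun _ => K) (fun k => ?_)
      (fun k => Filter.Eventually.of_forall (hbk k)) (by simp)
      (Filter.Eventually.of_forall fun σ hσ => ?_)
    · rw [uIoc_of_le h0.le]
      exact (((adm_FF hM.le h0 k).continuousOn_gs gw_gau 0).mono fun σ hσ => hσ.1).aestronglyMeasurable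
        measurableSet_Ioc
    · rw [uIoc_of_le h0.le] at hσ
      refine BlowUp.continuous_gs gw_gau (f := fun k => FF M T Ψ k σ) ?_
        (K := fun _ => σ ^ (-1 - M) * (1 + (√σ)⁻¹) * ‖Ψ‖) continuous_const continuous_const
        continuous_const fun k w => abs_FF_le hM.le hσ.1 (le_min le_rfl hσ.2) w
      unfold Function.uncurry
      exact continuous_FF h0 continuous_fst continuous_const continuous_snd fun _ => hσ.1
  have hbh : ∀ k, |h k| ≤ K * T := by
    intro k
    have := intervalIntegral.norm_integral_le_of_norm_le_const (hbk k)
    rwa [sub_zero, abs_of_pos h0] at this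
  obtain ⟨k, -, hk⟩ : ∃ k ∈ Icc (-(K * T)) (K * T), k - h k = 0 := by
    have := intermediate_value_Icc (f := fun k => k - h k)
      (by nlinarith : -(K * T) ≤ K * T) (by fun_prop)
    exact this ⟨by linarith [(abs_le.1 (hbh (-(K * T)))).1], by linarith [(abs_le.1 (hbh (K * T))).2]⟩
  exact ⟨k, FF M T Ψ k, h0, h1, adm_FF hM.le h0 k, rad_FF k,
    fun σ => by ext w; simp [FF], hΨ k, hB k,
    fun τ hτ hT x => (hΨ k τ hτ hT x).symm ▸ (hbd T τ h0 h1 hτ hT _ _ x).1,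
    fun τ hτ hT x => (hΨ k τ hτ hT x).symm ▸ (hbd T τ h0 h1 hτ hT _ _ x).2.1, by linarith⟩

end BlowUp

namespace BlowUp

variable {E : Type*} [NormedAddCommGroup E] [InnerProductSpace ℝ E] [FiniteDimensional ℝ E]
  [MeasurableSpace E] [BorelSpace E]
variable {V : Type*} [NormedAddCommGroup V] [NormedSpace ℝ V]

lemma exists_bound_cylinder {φ : ℝ × E → V} (h : Continuous φ) (s t R : ℝ) :
    ∃ C, 0 ≤ C ∧ ∀ σ ∈ Icc s t, ∀ x, ‖x‖ ≤ R → ‖φ (σ, x)‖ ≤ C := by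
  obtain ⟨C, hC⟩ := (isCompact_Icc.prod (isCompact_closedBall (0 : E) R)).exists_bound_of_continuousOn
    (s := Icc s t ×ˢ Metric.closedBall (0 : E) R) h.continuousOn
  refine ⟨max C 0, le_max_right _ _, fun σ hσ x hx => (hC (σ, x) ⟨hσ, ?_⟩).trans (le_max_left _ _)⟩
  simpa using hx

lemma le_sqrt_mul_sqrt {R : ℝ} {x y : E} (hx : ‖x‖ ≤ R) (hy : ‖y‖ ≤ R) :
    ‖y - x‖ ≤ √(2 * R) * √‖y - x‖ := by
  have h1 : ‖y - x‖ ≤ 2 * R := (norm_sub_le _ _).trans (by linarith)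
  calc ‖y - x‖ = √‖y - x‖ * √‖y - x‖ := (Real.mul_self_sqrt (norm_nonneg _)).symm
    _ ≤ _ := by gcongr

lemma Kop_cut (ψ : E → V) (F : ℝ → E → ℝ) {T t0 τ : ℝ} (h : t0 ≤ τ) (x : E) :
    Kop ψ (cut F t0) T τ x = Kop ψ F T τ x := by
  unfold Kop cut
  congr! 5 with a
  rw [max_eq_left]; nlinarith [sq_nonneg a]

lemma gg_cut (a : Par E) {T t0 τ : ℝ} (F : ℝ → E → ℝ) (h : t0 ≤ τ) :
    a.gg T (cut F t0) τ = a.gg T F τ := by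
  ext1 x; unfold Par.gg; rw [Gop_cut F h]

lemma vv_cut (a : Par E) {T k t0 τ : ℝ} (F : ℝ → E → ℝ) (h : t0 ≤ τ) :
    a.vv T k (cut F t0) τ = a.vv T k F τ := by
  ext1 x; unfold Par.vv; rw [Dop_cut F h]

section LG
variable {a : Par E} {T k K : ℝ} {F : ℝ → E → ℝ} (h : LG F K)
include h

lemma LG.continuous_vv : Continuous fun q : ℝ × E => a.vv T k F q.1 q.2 := by
  have := h.continuous_Dop T
  unfold Par.vv
  fun_prop

lemma LG.continuous_gg : Continuous fun q : ℝ × E => a.gg T F q.1 q.2 := by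
  have := h.continuous_Gop T
  unfold Par.gg
  fun_prop

lemma LG.hasFDerivAt_vv (τ : ℝ) (x : E) :
    HasFDerivAt (a.vv T k F τ) (innerSL ℝ (a.gg T F τ x)) x := by
  have h1 := h.hasFDerivAt_Dop T τ x
  have h2 : HasFDerivAt (fun x : E => ‖x‖ ^ 2) (2 • innerSL ℝ x) x :=
    (hasStrictFDerivAt_norm_sq x).hasFDerivAt
  have h3 := ((((h2.sub_const (2 * Module.finrank ℝ E * τ)).const_mul (a.B0 T)).const_add
    (k + a.P * τ)).sub h1)
  refine h3.congr_fderiv ?_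
  ext y
  simp only [Par.gg, map_sub, map_smul]
  simp
  ring

lemma LG.hb_vv {s t : ℝ} (R : ℝ) : HB (Icc s t) R (a.vv T k F) := by
  obtain ⟨C, hC, h1⟩ := exists_bound_cylinder (h.continuous_vv (a := a) (T := T) (k := k)) s t R
  obtain ⟨D, hD, h2⟩ := exists_bound_cylinder (h.continuous_gg (a := a) (T := T)) s t R
  refine ⟨max C (D * √(2 * R)), hC.trans (le_max_left _ _), fun σ hσ x y hx hy =>
    ⟨(h1 σ hσ x hx).trans (le_max_left _ _), ?_⟩⟩
  have h3 := Convex.norm_image_sub_le_of_norm_hasFDerivWithin_le (s := Metric.closedBall (0 : E) R)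
    (f := a.vv T k F σ) (f' := fun x => innerSL ℝ (a.gg T F σ x)) (C := D)
    (fun z _ => (h.hasFDerivAt_vv σ z).hasFDerivWithinAt)
    (fun z hz => by rw [innerSL_apply_norm]; exact h2 σ hσ z (by simpa using hz))
    (convex_closedBall _ _) (x := x) (y := y) (by simpa using hx) (by simpa using hy)
  rw [Real.norm_eq_abs] at h3
  calc _ ≤ D * ‖y - x‖ := h3
    _ ≤ D * (√(2 * R) * √‖y - x‖) := by gcongr; exact le_sqrt_mul_sqrt hx hy
    _ = D * √(2 * R) * √‖y - x‖ := by ring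
    _ ≤ _ := by gcongr; exact le_max_right _ _

lemma LG.hb_norm_gg {s t : ℝ} (R : ℝ) : HB (Icc s t) R fun σ x => ‖a.gg T F σ x‖ := by
  obtain ⟨D, hD, h2⟩ := exists_bound_cylinder (h.continuous_gg (a := a) (T := T)) s t R
  obtain ⟨C, hC, h3⟩ := h.holder_Gop T R (len T s)
  refine ⟨max D (|2 * a.B0 T| * √(2 * R) + C), hD.trans (le_max_left _ _), fun σ hσ x y hx hy =>
    ⟨by rw [abs_norm]; exact (h2 σ hσ x hx).trans (le_max_left _ _), ?_⟩⟩
  have h4 := h3 σ (by unfold len; gcongr; exact hσ.1) x y hx hy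
  calc _ ≤ ‖a.gg T F σ y - a.gg T F σ x‖ := abs_norm_sub_norm_le _ _
    _ = ‖(2 * a.B0 T) • (y - x) - (Gop F T σ y - Gop F T σ x)‖ := by
        unfold Par.gg; rw [smul_sub]; congr 1; abel
    _ ≤ |2 * a.B0 T| * ‖y - x‖ + C * √‖y - x‖ := by
        refine (norm_sub_le _ _).trans ?_
        rw [norm_smul, Real.norm_eq_abs]
        gcongr
    _ ≤ |2 * a.B0 T| * (√(2 * R) * √‖y - x‖) + C * √‖y - x‖ := by
        gcongr; exact le_sqrt_mul_sqrt hx hy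
    _ = (|2 * a.B0 T| * √(2 * R) + C) * √‖y - x‖ := by ring
    _ ≤ _ := by gcongr; exact le_max_right _ _

/-- The Hessian of the solution generated by `F`. -/
lemma LG.hasFDerivAt_gg (hH : LH F) (τ : ℝ) (x : E) : HasFDerivAt (a.gg T F τ)
    ((2 * a.B0 T) • ContinuousLinearMap.id ℝ E - Kop hgau F T τ x) x :=
  ((hasFDerivAt_id x).const_smul (2 * a.B0 T)).sub (h.hasFDerivAt_Gop hH T τ x)

lemma LG.contDiff_vv (hH : LH F) (τ : ℝ) : ContDiff ℝ 2 (a.vv T k F τ) := by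
  refine (contDiff_succ_iff_hasFDerivAt (n := 1)).2 ⟨fun x => innerSL ℝ (a.gg T F τ x), ?_,
    fun x => h.hasFDerivAt_vv τ x⟩
  refine (innerSL ℝ).contDiff.comp (contDiff_one_iff_hasFDerivAt.2
    ⟨_, ?_, fun x => h.hasFDerivAt_gg hH τ x⟩)
  exact continuous_const.sub ((h.continuous_Kop hH gw_hgau integral_hgau T).comp
    (Continuous.prodMk_right τ))

lemma LG.hasDerivAt_vv (hH : LH F) {τ : ℝ} (hτ : τ < T) (x : E) :
    HasDerivAt (fun τ => a.vv T k F τ x)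
      (a.P - 2 * Module.finrank ℝ E * a.B0 T + (F τ x + Kop lgau F T τ x)) τ := by
  have h1 := h.hasDerivAt_Dop hH hτ x
  have h2 : HasDerivAt (fun τ : ℝ => k + a.P * τ + a.B0 T * (‖x‖ ^ 2 - 2 * Module.finrank ℝ E * τ))
      (a.P + a.B0 T * (-(2 * Module.finrank ℝ E))) τ := by
    have e1 := ((hasDerivAt_id τ).const_mul a.P).const_add k
    have e2 := ((((hasDerivAt_id τ).const_mul (2 * (Module.finrank ℝ E : ℝ))).const_sub
      (‖x‖ ^ 2)).const_mul (a.B0 T))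
    refine (e1.add e2).congr_deriv ?_
    simp
  have h3 := h2.sub h1
  refine h3.congr_deriv ?_
  ring

end LG

namespace Sol
variable {a : Par E} {A T k : ℝ} {F : ℝ → E → ℝ} (h : Sol a A T k F)
include h

lemma lh_cut {t0 : ℝ} (ht0 : 0 < t0) (hT : t0 ≤ T) : LH (cut F t0) := by
  intro R
  obtain ⟨K, hK⟩ := h.adm t0 ht0
  have h1 := Par.hb_Ftr (a := a) (R := R) h.h0 h.h1 ht0 (I := Icc t0 T) (fun σ hσ => hσ)
    (v := a.vv T k (cut F t0)) (g := fun σ x => ‖a.gg T (cut F t0) σ x‖)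
    (fun σ _ => hK.continuous_vv.comp (Continuous.prodMk_right σ)) (hK.hb_vv R)
    (fun σ _ x => norm_nonneg _) (hK.hb_norm_gg R)
  obtain ⟨C, hC, h2⟩ := h1
  refine ⟨C, hC, fun σ x y hx hy => ?_⟩
  set σ' := min (max σ t0) T with hσ'
  have hm : σ' ∈ Icc t0 T := ⟨le_min (le_max_right _ _) hT, min_le_right _ _⟩
  have h3 : ∀ z, cut F t0 σ z = a.Ftr T σ' (a.vv T k (cut F t0) σ')
      ‖a.gg T (cut F t0) σ' z‖ z := by
    intro z
    unfold cut
    rw [← h.frz, ← hσ', h.fix σ' (ht0.trans_le hm.1) hm.2]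
    unfold Par.src
    have e1 := vv_cut a (k := k) (T := T) F hm.1
    have e2 := gg_cut a (T := T) F hm.1
    unfold cut at e1 e2
    rw [e1, e2]
  rw [h3, h3]
  exact (h2 σ' hm x y hx hy).2

variable {τ : ℝ} (hτ : 0 < τ) (hT : τ ≤ T)
include hτ hT

lemma contDiff_vv : ContDiff ℝ 2 (a.vv T k F τ) := by
  obtain ⟨K, hK⟩ := h.adm τ hτ
  rw [← vv_cut a F le_rfl]
  exact hK.contDiff_vv (h.lh_cut hτ hT) τ

lemma hasFDerivAt_vv (x : E) : HasFDerivAt (a.vv T k F τ) (innerSL ℝ (a.gg T F τ x)) x := by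
  obtain ⟨K, hK⟩ := h.adm τ hτ
  rw [← vv_cut a F le_rfl, ← gg_cut a F le_rfl]
  exact hK.hasFDerivAt_vv τ x

lemma hasFDerivAt_gg (x : E) : HasFDerivAt (a.gg T F τ)
    ((2 * a.B0 T) • ContinuousLinearMap.id ℝ E - Kop hgau F T τ x) x := by
  obtain ⟨K, hK⟩ := h.adm τ hτ
  rw [← gg_cut a F le_rfl, ← Kop_cut _ F le_rfl]
  exact hK.hasFDerivAt_gg (h.lh_cut hτ hT) τ x

lemma trace_Kop (x : E) {ι : Type*} [Fintype ι] (b : OrthonormalBasis ι ℝ E) :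
    ∑ i, inner ℝ (b i) (Kop hgau F T τ x (b i)) = Kop lgau F T τ x := by
  obtain ⟨K, hK⟩ := h.adm τ hτ
  rw [← Kop_cut _ F le_rfl, ← Kop_cut _ F le_rfl]
  exact hK.trace_Kop (h.lh_cut hτ hT) T τ x b

omit hT in
lemma hasDerivAt_vv (hT : τ < T) (x : E) : HasDerivAt (fun τ => a.vv T k F τ x)
    (a.P - 2 * Module.finrank ℝ E * a.B0 T + (F τ x + Kop lgau F T τ x)) τ := by
  have hτ2 : 0 < τ / 2 := by positivity
  have hlt := half_lt_self hτ
  obtain ⟨K, hK⟩ := h.adm (τ / 2) hτ2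
  have h1 := hK.hasDerivAt_vv (a := a) (k := k) (h.lh_cut hτ2 (by linarith)) hT x
  have e : cut F (τ / 2) τ x = F τ x := by unfold cut; rw [max_eq_left hlt.le]
  rw [Kop_cut _ F hlt.le, e] at h1
  refine h1.congr_of_eventuallyEq ?_
  filter_upwards [lt_mem_nhds hlt] with σ hσ
  rw [vv_cut a F hσ.le]

omit hτ hT in
lemma continuousOn_dt (x : E) : ContinuousOn (fun τ => a.P - 2 * Module.finrank ℝ E * a.B0 T +
    (F τ x + Kop lgau F T τ x)) (Ioc 0 T) := by
  intro τ hτ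
  have hτ2 : 0 < τ / 2 := half_pos hτ.1
  have hlt := half_lt_self hτ.1
  obtain ⟨K, hK⟩ := h.adm (τ / 2) hτ2
  have h1 := (hK.continuous_Kop (h.lh_cut hτ2 (by linarith [hτ.2])) gw_lgau integral_lgau T).comp
    (Continuous.prodMk_left x)
  have h2 := hK.cont.comp (Continuous.prodMk_left x)
  have h3 := (continuous_const (y := a.P - 2 * Module.finrank ℝ E * a.B0 T)).add (h2.add h1)
  refine (h3.continuousAt.congr ?_).continuousWithinAt
  filter_upwards [lt_mem_nhds hlt] with σ hσ
  have e : cut F (τ / 2) σ x = F σ x := by unfold cut; rw [max_eq_left hσ.le]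
  rw [← Kop_cut _ F hσ.le, ← e]
  rfl

end Sol

end BlowUp

namespace BlowUp

variable {E : Type*} [NormedAddCommGroup E] [InnerProductSpace ℝ E] [FiniteDimensional ℝ E]
  [MeasurableSpace E] [BorelSpace E]
variable {V : Type*} [NormedAddCommGroup V] [NormedSpace ℝ V]

lemma abs_exp_sub_quadratic_le (x : ℝ) :
    |Real.exp x - (1 + x + x ^ 2 / 2)| ≤ |x| ^ 3 * Real.exp |x| := by
  have h := Complex.norm_exp_sub_sum_le_norm_mul_exp (x : ℂ) 3
  have e : Complex.exp (x : ℂ) - ∑ m ∈ Finset.range 3, (x : ℂ) ^ m / (m.factorial : ℂ) =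
      ((Real.exp x - (1 + x + x ^ 2 / 2) : ℝ) : ℂ) := by
    simp [Finset.sum_range_succ, Nat.factorial]
  rw [e, Complex.norm_real, Complex.norm_real] at h
  exact h

/-- Quotient of two nearby Gaussians. -/
noncomputable def KK (δ : ℝ) (ω ξ : E) : ℝ :=
  (√(1 - δ) ^ Module.finrank ℝ E)⁻¹ * Real.exp (‖ξ‖ ^ 2 / 2 - ‖(√(1 - δ))⁻¹ • (ξ - ω)‖ ^ 2 / 2)

lemma gau_mul_KK (δ : ℝ) (ω ξ : E) :
    gau ξ * KK δ ω ξ = (√(1 - δ) ^ Module.finrank ℝ E)⁻¹ * gau ((√(1 - δ))⁻¹ • (ξ - ω)) := by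
  unfold gau KK
  have : Real.exp (‖ξ‖ ^ 2 / 2 - ‖(√(1 - δ))⁻¹ • (ξ - ω)‖ ^ 2 / 2) =
    Real.exp (‖ξ‖ ^ 2 / 2) * Real.exp (-‖(√(1 - δ))⁻¹ • (ξ - ω)‖ ^ 2 / 2) := by
    rw [← Real.exp_add]; ring_nf
  have e2 : Real.exp (-‖ξ‖ ^ 2 / 2) * Real.exp (‖ξ‖ ^ 2 / 2) = 1 := by
    rw [← Real.exp_add]; ring_nf; simp
  rw [this]
  linear_combination ((√(2 * π))⁻¹ ^ Module.finrank ℝ E * (√(1 - δ) ^ Module.finrank ℝ E)⁻¹ *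
    Real.exp (-‖(√(1 - δ))⁻¹ • (ξ - ω)‖ ^ 2 / 2)) * e2

lemma KK_eq {δ : ℝ} (h1 : δ < 1) (ω ξ : E) : KK δ ω ξ =
    Real.exp (Module.finrank ℝ E / 2 * (-Real.log (1 - δ)) - δ / (1 - δ) / 2 * ‖ξ‖ ^ 2 +
      (1 + δ / (1 - δ)) * inner ℝ ξ ω - (1 + δ / (1 - δ)) * ‖ω‖ ^ 2 / 2) := by
  have h2 : 0 < 1 - δ := by linarith
  have h3 := Real.sqrt_pos.2 h2
  have e1 : (√(1 - δ) ^ Module.finrank ℝ E)⁻¹ =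
      Real.exp (Module.finrank ℝ E / 2 * (-Real.log (1 - δ))) := by
    rw [← Real.exp_log h3, ← Real.exp_nat_mul, ← Real.exp_neg, Real.log_sqrt h2.le]
    ring_nf
  unfold KK
  rw [e1, ← Real.exp_add, norm_smul, norm_inv, Real.norm_of_nonneg h3.le, mul_pow, inv_pow,
    Real.sq_sqrt h2.le, @norm_sub_sq_real]
  congr 1
  field_simp
  ring

set_option maxHeartbeats 1600000 in
/-- Third order expansion of the quotient of two Gaussians. -/
lemma exists_KK_expansion (E : Type*) [NormedAddCommGroup E] [InnerProductSpace ℝ E]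
    [FiniteDimensional ℝ E] [MeasurableSpace E] [BorelSpace E] : ∃ C : ℝ, 0 < C ∧ ∀ (δ ε : ℝ) (ω ξ : E), 0 ≤ δ → δ ≤ ε ^ 2 →
      0 ≤ ε → ε ≤ 1 / 8 → ‖ω‖ ≤ ε →
      |KK δ ω ξ - (1 + inner ℝ ξ ω + (inner ℝ ξ ω ^ 2 - ‖ω‖ ^ 2) / 2 -
        δ / 2 * (‖ξ‖ ^ 2 - Module.finrank ℝ E))| ≤
          C * ε ^ 3 * ((1 + ‖ξ‖) ^ 8 * Real.exp (‖ξ‖ ^ 2 / 4)) ∧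
      ‖(KK δ ω ξ * (√(1 - δ))⁻¹) • (ξ - ω) - (ξ + inner ℝ ξ ω • ξ - ω)‖ ≤
          C * ε ^ 2 * ((1 + ‖ξ‖) ^ 8 * Real.exp (‖ξ‖ ^ 2 / 4)) := by
  set d : ℝ := ((Module.finrank ℝ E : ℕ) : ℝ) with hd
  have hd0 : 0 ≤ d := by positivity
  set C1 := (d + 3) ^ 3 * Real.exp (d + 2) + (d + 3) + (d + 4) ^ 2 with hC1
  have hC1p : 0 < C1 := by positivity
  refine ⟨2 * (C1 + d + 1) + 6, by positivity, fun δ ε ω ξ hδ hδε hε hε8 hω => ?_⟩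
  set t := ‖ξ‖ with ht
  have ht0 : 0 ≤ t := norm_nonneg _
  set s := (inner ℝ ξ ω : ℝ) with hs
  have hsb : |s| ≤ t * ε := (abs_real_inner_le_norm ξ ω).trans (by gcongr)
  set w := ‖ω‖ ^ 2 with hw
  have hw0 : 0 ≤ w := by positivity
  have hwε : w ≤ ε ^ 2 := by rw [hw]; gcongr
  have hε2 : ε ^ 2 ≤ 1 / 64 := by have := mul_le_mul hε8 hε8 hε (by norm_num); linarith
  have hδ1 : δ < 1 := by linarith
  set ρ := δ / (1 - δ) with hρ
  have hρ0 : 0 ≤ ρ := div_nonneg hδ (by linarith)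
  have hρeq : ρ - δ = δ * ρ := by rw [hρ]; field_simp [show (1 - δ) ≠ 0 by linarith]; ring
  have hρ2 : ρ ≤ 2 * δ := by nlinarith
  have hρε : ρ ≤ 2 * ε ^ 2 := by linarith
  set l := -Real.log (1 - δ) with hl
  have hlδ : δ ≤ l := by
    have := Real.log_le_sub_one_of_pos (show 0 < 1 - δ by linarith); linarith
  have hlρ : l ≤ ρ := by
    have h2 : 0 < 1 - δ := by linarith
    have := Real.log_le_sub_one_of_pos (inv_pos.2 h2)
    rw [Real.log_inv] at this
    have e : (1 - δ)⁻¹ - 1 = ρ := by rw [hρ]; field_simp; ring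
    linarith
  set X := d / 2 * l - ρ / 2 * t ^ 2 + (1 + ρ) * s - (1 + ρ) * w / 2 with hX
  have hK : KK δ ω ξ = Real.exp X := KK_eq hδ1 ω ξ
  set u := 1 + t with hu
  have hu1 : 1 ≤ u := by linarith
  obtain ⟨hs1, hs2⟩ := abs_le.1 hsb
  have hε3 : ε ^ 3 ≤ ε ^ 2 / 8 := by have := mul_le_mul_of_nonneg_left hε8 (sq_nonneg ε); linarith
  have hε4 : ε ^ 4 ≤ ε ^ 3 / 8 := by have := mul_le_mul_of_nonneg_left hε8 (pow_nonneg hε 3); linarith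
  have hρs : |ρ * s| ≤ 2 * ε ^ 3 * t := by
    rw [abs_mul, abs_of_nonneg hρ0]
    calc ρ * |s| ≤ 2 * ε ^ 2 * (t * ε) := by gcongr
      _ = _ := by ring
  obtain ⟨hρs1, hρs2⟩ := abs_le.1 hρs
  have ep2 := sq_nonneg ε
  have ep3 := pow_nonneg hε 3
  have hu2 : u ^ 2 = 1 + 2 * t + t ^ 2 := by rw [hu]; ring
  have hdl0 : 0 ≤ d / 2 * l := by have : 0 ≤ l := by linarith
                                  positivity
  have hdl : d / 2 * l ≤ d * ε ^ 2 := by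
    calc d / 2 * l ≤ d / 2 * (2 * ε ^ 2) := by gcongr; linarith
      _ = _ := by ring
  have hρt0 : 0 ≤ ρ / 2 * t ^ 2 := by positivity
  have hρt : ρ / 2 * t ^ 2 ≤ ε ^ 2 * t ^ 2 := by gcongr; linarith
  have hρw0 : 0 ≤ ρ * w := by positivity
  have hρw : ρ * w ≤ ε ^ 3 := by
    calc ρ * w ≤ 2 * ε ^ 2 * ε ^ 2 := by gcongr
      _ = 2 * ε ^ 4 := by ring
      _ ≤ _ := by linarith
  have hXs : |X - s| ≤ (d + 2) * ε ^ 2 * u ^ 2 := by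
    have e : X - s = d / 2 * l - ρ / 2 * t ^ 2 + ρ * s - (w + ρ * w) / 2 := by rw [hX]; ring
    have e1 : 0 ≤ d * ε ^ 2 * (2 * t + t ^ 2) := by positivity
    have e2 : ε ^ 3 * t ≤ ε ^ 2 / 8 * t := by gcongr
    have e3 : 0 ≤ ε ^ 2 * t := by positivity
    have e4 : 0 ≤ ε ^ 2 * t ^ 2 := by positivity
    have e5 : (d + 2) * ε ^ 2 * u ^ 2 = d * ε ^ 2 * (2 * t + t ^ 2) + d * ε ^ 2 + 2 * ε ^ 2 +
      4 * (ε ^ 2 * t) + 2 * (ε ^ 2 * t ^ 2) := by rw [hu2]; ring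
    rw [e5, e, abs_le]
    constructor <;> linarith
  have hXb : |X| ≤ (d + 3) * ε * u ^ 2 := by
    have e : |X| ≤ |X - s| + |s| := by simpa using abs_add_le (X - s) s
    have e1 : (d + 2) * ε ^ 2 * u ^ 2 ≤ (d + 2) * ε * u ^ 2 := by gcongr; nlinarith
    have e2 : t * ε ≤ ε * u ^ 2 := by rw [hu2]; nlinarith
    calc |X| ≤ (d + 2) * ε * u ^ 2 + ε * u ^ 2 := by linarith
      _ = _ := by ring
  have hR : |X - s - (δ / 2 * (d - t ^ 2) - w / 2)| ≤ (d + 3) * ε ^ 3 * u ^ 2 := by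
    have e : X - s - (δ / 2 * (d - t ^ 2) - w / 2) =
        d / 2 * (l - δ) - (ρ - δ) / 2 * t ^ 2 + ρ * s - ρ * w / 2 := by rw [hX]; ring
    have e0 : ρ - δ ≤ ε ^ 3 := by
      rw [hρeq]
      calc δ * ρ ≤ ε ^ 2 * (2 * ε ^ 2) := by gcongr
        _ = 2 * ε ^ 4 := by ring
        _ ≤ _ := by linarith
    have e00 : 0 ≤ ρ - δ := by linarith
    have e1 : 0 ≤ d / 2 * (l - δ) := by have : 0 ≤ l - δ := by linarith
                                        positivity
    have e2 : d / 2 * (l - δ) ≤ d * ε ^ 3 := by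
      calc d / 2 * (l - δ) ≤ d / 2 * ε ^ 3 := by gcongr; linarith
        _ ≤ _ := by nlinarith
    have e3 : 0 ≤ (ρ - δ) / 2 * t ^ 2 := by positivity
    have e4 : (ρ - δ) / 2 * t ^ 2 ≤ ε ^ 3 * t ^ 2 := by gcongr; linarith
    have e5 : (d + 3) * ε ^ 3 * u ^ 2 = d * ε ^ 3 * (2 * t + t ^ 2) + d * ε ^ 3 + 3 * ε ^ 3 +
      6 * (ε ^ 3 * t) + 3 * (ε ^ 3 * t ^ 2) := by rw [hu2]; ring
    have e6 : 0 ≤ d * ε ^ 3 * (2 * t + t ^ 2) := by positivity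
    have e7 : 0 ≤ ε ^ 3 * t := by positivity
    have e8 : 0 ≤ ε ^ 3 * t ^ 2 := by positivity
    rw [e5, e, abs_le]
    constructor <;> linarith
  have hsq : |X ^ 2 - s ^ 2| ≤ 2 * (d + 4) ^ 2 * ε ^ 3 * u ^ 4 := by
    have e : X ^ 2 - s ^ 2 = (X - s) * (X + s) := by ring
    have e1 : |X + s| ≤ (d + 4) * ε * u ^ 2 := by
      have e2 : t * ε ≤ ε * u ^ 2 := by rw [hu2]; nlinarith
      calc |X + s| ≤ |X| + |s| := abs_add_le _ _
        _ ≤ (d + 3) * ε * u ^ 2 + ε * u ^ 2 := by linarith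
        _ = _ := by ring
    rw [e, abs_mul]
    calc |X - s| * |X + s| ≤ ((d + 2) * ε ^ 2 * u ^ 2) * ((d + 4) * ε * u ^ 2) := by gcongr
      _ = (d + 2) * (d + 4) * (ε ^ 3 * u ^ 4) := by ring
      _ ≤ 2 * (d + 4) ^ 2 * (ε ^ 3 * u ^ 4) := by
          apply mul_le_mul_of_nonneg_right _ (by positivity)
          rw [show 2 * (d + 4) ^ 2 = (d + 2) * (d + 4) + (d ^ 2 + 10 * d + 24) by ring]
          exact le_add_of_nonneg_right (by positivity)
      _ = _ := by ring
  have hXe : |X| ≤ d + 2 + t ^ 2 / 4 := by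
    have e1 : t * ε ≤ t / 8 := by
      have := mul_le_mul_of_nonneg_left hε8 ht0
      linarith
    have e2 : 2 * ε ^ 3 * t ≤ t / 8 := by
      have := mul_le_mul_of_nonneg_right (show 2 * ε ^ 3 ≤ 1 / 8 by linarith) ht0
      linarith
    have e3 : d * ε ^ 2 ≤ d := mul_le_of_le_one_right hd0 (by linarith)
    have e4 : ε ^ 2 * t ^ 2 ≤ t ^ 2 / 64 := by
      have := mul_le_mul_of_nonneg_right hε2 (sq_nonneg t)
      linarith
    have e5 := sq_nonneg (t - 1)
    have e6 : ρ * w ≤ 1 := by linarith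
    rw [hX, abs_le]
    constructor <;> linarith
  have hex1 : 1 ≤ Real.exp (t ^ 2 / 4) := Real.one_le_exp (by positivity)
  have hp : ∀ n ≤ 7, u ^ n ≤ u ^ 7 * Real.exp (t ^ 2 / 4) := fun n hn => by
    have := pow_le_pow_right₀ hu1 hn
    exact this.trans (le_mul_of_one_le_right (by positivity) hex1)
  have main : |KK δ ω ξ - (1 + s + (s ^ 2 - w) / 2 - δ / 2 * (t ^ 2 - d))| ≤
      C1 * ε ^ 3 * (u ^ 7 * Real.exp (t ^ 2 / 4)) := by
    have e : KK δ ω ξ - (1 + s + (s ^ 2 - w) / 2 - δ / 2 * (t ^ 2 - d)) =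
      (Real.exp X - (1 + X + X ^ 2 / 2)) + (X - s - (δ / 2 * (d - t ^ 2) - w / 2)) +
        (X ^ 2 - s ^ 2) / 2 := by rw [hK]; ring
    have a1 : |Real.exp X - (1 + X + X ^ 2 / 2)| ≤
        (d + 3) ^ 3 * Real.exp (d + 2) * ε ^ 3 * (u ^ 7 * Real.exp (t ^ 2 / 4)) := by
      refine (abs_exp_sub_quadratic_le X).trans ?_
      calc |X| ^ 3 * Real.exp |X| ≤ ((d + 3) * ε * u ^ 2) ^ 3 * Real.exp (d + 2 + t ^ 2 / 4) := by
            gcongr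
        _ = (d + 3) ^ 3 * Real.exp (d + 2) * ε ^ 3 * (u ^ 6 * Real.exp (t ^ 2 / 4)) := by
            rw [Real.exp_add]; ring
        _ ≤ _ := by gcongr; norm_num
    have a2 := hR.trans (mul_le_mul_of_nonneg_left (hp 2 (by norm_num))
      (by positivity : 0 ≤ (d + 3) * ε ^ 3))
    have a3 := hsq.trans (mul_le_mul_of_nonneg_left (hp 4 (by norm_num))
      (by positivity : 0 ≤ 2 * (d + 4) ^ 2 * ε ^ 3))
    rw [e]
    refine (abs_add_le _ _).trans ((add_le_add (abs_add_le _ _) le_rfl).trans ?_)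
    rw [abs_div, abs_two]
    calc _ ≤ (d + 3) ^ 3 * Real.exp (d + 2) * ε ^ 3 * (u ^ 7 * Real.exp (t ^ 2 / 4)) +
          (d + 3) * ε ^ 3 * (u ^ 7 * Real.exp (t ^ 2 / 4)) +
          (2 * (d + 4) ^ 2 * ε ^ 3 * (u ^ 7 * Real.exp (t ^ 2 / 4))) / 2 := by gcongr
      _ = _ := by rw [hC1]; ring
  set Z := u ^ 7 * Real.exp (t ^ 2 / 4) with hZ
  have hZ0 : 0 < Z := by positivity
  have hZu : u ^ 8 * Real.exp (t ^ 2 / 4) = u * Z := by rw [hZ]; ring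
  have hZ1 : Z ≤ u * Z := le_mul_of_one_le_left hZ0.le hu1
  rw [hZu]
  refine ⟨main.trans ?_, ?_⟩
  · gcongr; linarith
  have hKs : |KK δ ω ξ - (1 + s)| ≤ (C1 + d + 1) * ε ^ 2 * Z := by
    have e : KK δ ω ξ - (1 + s) = (KK δ ω ξ - (1 + s + (s ^ 2 - w) / 2 - δ / 2 * (t ^ 2 - d))) +
      ((s ^ 2 - w) / 2 - δ / 2 * (t ^ 2 - d)) := by ring
    have e1 : |(s ^ 2 - w) / 2 - δ / 2 * (t ^ 2 - d)| ≤ (d + 1) * ε ^ 2 * u ^ 2 := by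
      have f1 : s ^ 2 ≤ ε ^ 2 * t ^ 2 := by
        rw [← sq_abs, show ε ^ 2 * t ^ 2 = (t * ε) ^ 2 by ring]
        gcongr
      have f2 : 0 ≤ s ^ 2 := sq_nonneg s
      have f3 : δ / 2 * t ^ 2 ≤ ε ^ 2 * t ^ 2 := by gcongr; linarith
      have f4 : 0 ≤ δ / 2 * t ^ 2 := by positivity
      have f5 : δ / 2 * d ≤ ε ^ 2 * d := by gcongr; linarith
      have f6 : 0 ≤ δ / 2 * d := by positivity
      have f7 : (d + 1) * ε ^ 2 * u ^ 2 = ε ^ 2 * d + ε ^ 2 + d * ε ^ 2 * (2 * t + t ^ 2) +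
        ε ^ 2 * t ^ 2 + ε ^ 2 * (2 * t) := by rw [hu2]; ring
      have f8 : 0 ≤ d * ε ^ 2 * (2 * t + t ^ 2) := by positivity
      have f9 : 0 ≤ ε ^ 2 * (2 * t) := by positivity
      have f10 : s ^ 2 / 2 + δ / 2 * t ^ 2 ≤ ε ^ 2 * t ^ 2 := by
        have : δ * t ^ 2 ≤ ε ^ 2 * t ^ 2 := by gcongr
        linarith
      rw [f7, abs_le]
      constructor <;> linarith
    have e2 := e1.trans (mul_le_mul_of_nonneg_left (hp 2 (by norm_num))
      (by positivity : 0 ≤ (d + 1) * ε ^ 2))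
    have e3 : C1 * ε ^ 3 * Z ≤ C1 * ε ^ 2 * Z := by gcongr ?_ * Z; exact mul_le_mul_of_nonneg_left (by linarith) hC1p.le
    rw [e]
    refine (abs_add_le _ _).trans ?_
    calc _ ≤ C1 * ε ^ 2 * Z + (d + 1) * ε ^ 2 * Z := by gcongr; exact main.trans e3
      _ = _ := by ring
  have hωt : ‖ξ - ω‖ ≤ u := (norm_sub_le _ _).trans (by linarith)
  set r := √(1 - δ) with hr
  have hr0 : 0 < r := Real.sqrt_pos.2 (by linarith)
  have hr2 : r ^ 2 = 1 - δ := Real.sq_sqrt (by linarith)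
  have hr1 : r ≤ 1 := Real.sqrt_le_one.2 (by linarith)
  have hri : r⁻¹ ≤ 2 := by
    rw [inv_le_comm₀ hr0 (by norm_num)]
    exact Real.le_sqrt_of_sq_le (by linarith)
  have hri1 : 1 ≤ r⁻¹ := (one_le_inv₀ hr0).2 hr1
  have hriε : r⁻¹ - 1 ≤ 2 * ε ^ 2 := by
    have : r * r⁻¹ = 1 := mul_inv_cancel₀ hr0.ne'
    have h3 : 1 - r ≤ δ := by
      have := mul_le_mul_of_nonneg_left hr1 hr0.le
      linarith
    have h4 : r⁻¹ - 1 = r⁻¹ * (1 - r) := by linear_combination this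
    rw [h4]
    exact mul_le_mul hri (by linarith) (by linarith) (by norm_num)
  have e : (KK δ ω ξ * r⁻¹) • (ξ - ω) - (ξ + s • ξ - ω) =
      (r⁻¹ * (KK δ ω ξ - (1 + s))) • (ξ - ω) + ((r⁻¹ - 1) * (1 + s)) • (ξ - ω) - s • ω := by
    module
  have hs1u : |1 + s| ≤ u := by
    have e1 : t * ε ≤ t := mul_le_of_le_one_right ht0 (by linarith)
    rw [abs_le]; constructor <;> linarith
  have g1 : ‖(r⁻¹ * (KK δ ω ξ - (1 + s))) • (ξ - ω)‖ ≤
      2 * ((C1 + d + 1) * ε ^ 2 * Z) * u := by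
    rw [norm_smul, norm_mul, Real.norm_of_nonneg (by positivity : 0 ≤ r⁻¹), Real.norm_eq_abs]
    gcongr
  have g2 : ‖((r⁻¹ - 1) * (1 + s)) • (ξ - ω)‖ ≤ 2 * ε ^ 2 * u * u := by
    rw [norm_smul, norm_mul, Real.norm_of_nonneg (by linarith : 0 ≤ r⁻¹ - 1), Real.norm_eq_abs]
    gcongr
  have g3 : ‖s • ω‖ ≤ ε ^ 2 * u * 1 := by
    rw [norm_smul, Real.norm_eq_abs]
    calc |s| * ‖ω‖ ≤ (t * ε) * ε := by gcongr
      _ = ε ^ 2 * t * 1 := by ring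
      _ ≤ _ := by gcongr; linarith
  have g4 : u ≤ Z := by simpa using hp 1 (by norm_num)
  rw [e]
  refine (norm_sub_le _ _).trans ((add_le_add (norm_add_le _ _) le_rfl).trans ?_)
  have h5 : 2 * ε ^ 2 * u * u ≤ 2 * ε ^ 2 * Z * u := by gcongr
  have h6 : ε ^ 2 * u * 1 ≤ ε ^ 2 * Z * u := by gcongr
  have h7 : 0 ≤ ε ^ 2 * Z * u := by positivity
  calc _ ≤ 2 * ((C1 + d + 1) * ε ^ 2 * Z) * u + 2 * ε ^ 2 * Z * u + ε ^ 2 * Z * u := by linarith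
    _ = (2 * (C1 + d + 1) + 3) * (ε ^ 2 * Z * u) := by ring
    _ ≤ (2 * (C1 + d + 1) + 6) * (ε ^ 2 * Z * u) := by gcongr; norm_num
    _ = _ := by ring

end BlowUp

namespace BlowUp

variable {E : Type*} [NormedAddCommGroup E] [InnerProductSpace ℝ E] [FiniteDimensional ℝ E]
  [MeasurableSpace E] [BorelSpace E]
variable {V : Type*} [NormedAddCommGroup V] [NormedSpace ℝ V]

lemma continuous_KK (δ : ℝ) (ω : E) : Continuous (KK δ ω) := by
  unfold KK; fun_prop

/-- Continuous densities dominated by polynomials times the Gaussian are integrable. -/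
lemma integrable_of_le_gau {g : E → V} (hg : Continuous g) {C : ℝ} (k : ℕ)
    (h : ∀ ξ, ‖g ξ‖ ≤ C * ((1 + ‖ξ‖) ^ k * gau ξ)) : Integrable g :=
  ((integrable_gau_pow k).const_mul C).mono' hg.aestronglyMeasurable (.of_forall h)

lemma integrable_expansion_weight : Integrable fun ξ : E =>
    (1 + ‖ξ‖) ^ 2 * gau ξ * ((1 + ‖ξ‖) ^ 8 * Real.exp (‖ξ‖ ^ 2 / 4)) := by
  have h := (integrable_pow_exp (E := E) 10 (b := 1 / 4) (by norm_num)).const_mul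
    (((√(2 * π))⁻¹) ^ (Module.finrank ℝ E))
  refine h.congr (.of_forall fun ξ => ?_)
  have : Real.exp (-(1 / 4) * ‖ξ‖ ^ 2) = Real.exp (-‖ξ‖ ^ 2 / 2) * Real.exp (‖ξ‖ ^ 2 / 4) := by
    rw [← Real.exp_add]; ring_nf
  simp only [gau, this]
  ring

lemma exists_average_expansion (E : Type*) [NormedAddCommGroup E] [InnerProductSpace ℝ E]
    [FiniteDimensional ℝ E] [MeasurableSpace E] [BorelSpace E] (hd : 0 < Module.finrank ℝ E) :
    ∃ C : ℝ, 0 < C ∧ ∀ (f : E → ℝ) (Q δ ε : ℝ) (ω : E), Continuous f → Rad f →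
      (∀ ξ, |f ξ| ≤ Q * (1 + ‖ξ‖) ^ 2) → 0 ≤ δ → δ ≤ ε ^ 2 →
      0 ≤ ε → ε ≤ 1 / 8 → ‖ω‖ ≤ ε →
      |(∫ ξ, f ξ * (gau ξ * KK δ ω ξ)) - (∫ ξ, f ξ * gau ξ) -
        (‖ω‖ ^ 2 / (2 * Module.finrank ℝ E) - δ / 2) * ∫ ξ, f ξ * lgau ξ| ≤ C * Q * ε ^ 3 ∧
      ‖(∫ ξ, (f ξ * (gau ξ * KK δ ω ξ) * (√(1 - δ))⁻¹) • (ξ - ω)) -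
        ((Module.finrank ℝ E : ℝ)⁻¹ * ∫ ξ, f ξ * lgau ξ) • ω‖ ≤ C * Q * ε ^ 2 := by
  obtain ⟨C, hC, hexp⟩ := exists_KK_expansion E
  set W : E → ℝ := fun ξ => (1 + ‖ξ‖) ^ 2 * gau ξ * ((1 + ‖ξ‖) ^ 8 * Real.exp (‖ξ‖ ^ 2 / 4))
    with hW
  have hWi : Integrable W := integrable_expansion_weight
  have hW0 : ∀ ξ, 0 ≤ W ξ := fun ξ => by have := (gau_pos ξ).le; positivity
  have hW1 : 0 ≤ ∫ ξ, W ξ := integral_nonneg (fun ξ => hW0 ξ)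
  refine ⟨C * (∫ ξ, W ξ) + 1, by positivity,
    fun f Q δ ε ω hf hr hQ hδ hδε hε hε8 hω => ?_⟩
  set d : ℝ := ((Module.finrank ℝ E : ℕ) : ℝ) with hdd
  have hd0 : 0 < d := by rw [hdd]; exact_mod_cast hd
  have hQ0 : 0 ≤ Q := by have := (abs_nonneg _).trans (hQ 0); simpa using this
  set G : E → ℝ := fun ξ => f ξ * gau ξ with hG
  have hGc : Continuous G := hf.mul continuous_gau
  have hGr : Rad G := hr.mul rad_gau
  have hGb : ∀ ξ, |G ξ| ≤ Q * ((1 + ‖ξ‖) ^ 2 * gau ξ) := fun ξ => by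
    have := (gau_pos ξ).le
    rw [hG]; simp only; rw [abs_mul, abs_of_nonneg this]
    calc _ ≤ Q * (1 + ‖ξ‖) ^ 2 * gau ξ := by gcongr; exact hQ ξ
      _ = _ := by ring
  have hnn : ∀ ξ : E, 0 ≤ ‖ξ‖ := norm_nonneg
  have hi0 : Integrable G := integrable_of_le_gau hGc 2 hGb
  have hi2 : Integrable fun ξ => G ξ * ‖ξ‖ ^ 2 := by
    refine integrable_of_le_gau (by fun_prop) (C := Q) 4 fun ξ => ?_
    have := (gau_pos ξ).le
    rw [norm_mul, norm_pow, norm_norm, Real.norm_eq_abs]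
    calc |G ξ| * ‖ξ‖ ^ 2 ≤ (Q * ((1 + ‖ξ‖) ^ 2 * gau ξ)) * (1 + ‖ξ‖) ^ 2 := by
          gcongr
          · exact hGb ξ
          · linarith
      _ = _ := by ring
  have hi1 : Integrable fun ξ => G ξ • ξ := by
    refine integrable_of_le_gau (by fun_prop) (C := Q) 3 fun ξ => ?_
    have := (gau_pos ξ).le
    rw [norm_smul, Real.norm_eq_abs]
    calc |G ξ| * ‖ξ‖ ≤ (Q * ((1 + ‖ξ‖) ^ 2 * gau ξ)) * (1 + ‖ξ‖) := by
          gcongr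
          · exact hGb ξ
          · linarith
      _ = _ := by ring
  have his : Integrable fun ξ => G ξ * inner ℝ ξ ω := by
    refine (hi1.inner_const ω).congr (.of_forall fun ξ => ?_)
    simp [inner_smul_left]
  have hiss : Integrable fun ξ => G ξ * inner ℝ ξ ω ^ 2 := by
    refine (integrable_inner_sq hi2 hGc.aestronglyMeasurable ω ω).congr (.of_forall fun ξ => ?_)
    simp only; ring
  have hisv : Integrable fun ξ => (G ξ * inner ℝ ξ ω) • ξ := by
    refine integrable_of_le_gau (by fun_prop) (C := Q * ‖ω‖) 4 fun ξ => ?_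
    have := (gau_pos ξ).le
    rw [norm_smul, norm_mul, Real.norm_eq_abs, Real.norm_eq_abs]
    calc |G ξ| * |inner ℝ ξ ω| * ‖ξ‖ ≤
        (Q * ((1 + ‖ξ‖) ^ 2 * gau ξ)) * ((1 + ‖ξ‖) * ‖ω‖) * (1 + ‖ξ‖) := by
          gcongr
          · exact hGb ξ
          · exact (abs_real_inner_le_norm ξ ω).trans (by gcongr; linarith)
          · linarith
      _ = _ := by ring
  have el : ∫ ξ, f ξ * lgau ξ = (∫ ξ, G ξ * ‖ξ‖ ^ 2) - d * ∫ ξ, G ξ := by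
    rw [← integral_const_mul, ← integral_sub hi2 (hi0.const_mul d)]
    congr 1; ext ξ; simp only [hG, lgau, ← hdd]; ring
  have hKc := continuous_KK (E := E) δ ω
  constructor
  · set A : E → ℝ := fun ξ => 1 + inner ℝ ξ ω + (inner ℝ ξ ω ^ 2 - ‖ω‖ ^ 2) / 2 -
        δ / 2 * (‖ξ‖ ^ 2 - d) with hA
    have hb : ∀ ξ, ‖G ξ * (KK δ ω ξ - A ξ)‖ ≤ (C * Q * ε ^ 3) * W ξ := fun ξ => by
      have := (gau_pos ξ).le
      rw [norm_mul, Real.norm_eq_abs, Real.norm_eq_abs]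
      calc |G ξ| * |KK δ ω ξ - A ξ| ≤ (Q * ((1 + ‖ξ‖) ^ 2 * gau ξ)) *
          (C * ε ^ 3 * ((1 + ‖ξ‖) ^ 8 * Real.exp (‖ξ‖ ^ 2 / 4))) :=
            mul_le_mul (hGb ξ) (hexp δ ε ω ξ hδ hδε hε hε8 hω).1 (abs_nonneg _) (by positivity)
        _ = _ := by simp only [hW]; ring
    have hAc : Continuous A := by fun_prop
    have hiK : Integrable fun ξ => G ξ * (KK δ ω ξ - A ξ) :=
      (hWi.const_mul _).mono' (by fun_prop) (.of_forall hb)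
    have e1 : ∫ ξ, G ξ * A ξ = (∫ ξ, G ξ) +
        (‖ω‖ ^ 2 / (2 * d) - δ / 2) * ∫ ξ, f ξ * lgau ξ := by
      have hsq := integral_inner_sq_of_rad hGr hi2 hGc.aestronglyMeasurable ω
      have hs := integral_inner_of_rad hGr ω hi1
      have : ∀ ξ, G ξ * A ξ = (1 - ‖ω‖ ^ 2 / 2 + δ / 2 * d) * G ξ + G ξ * inner ℝ ξ ω +
          (1 / 2) * (G ξ * inner ℝ ξ ω ^ 2) - (δ / 2) * (G ξ * ‖ξ‖ ^ 2) := fun ξ => by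
        simp only [hA]; ring
      simp_rw [this]
      have a1 : Integrable fun ξ => (1 - ‖ω‖ ^ 2 / 2 + δ / 2 * d) * G ξ := hi0.const_mul _
      have a2 : Integrable fun ξ => (1 - ‖ω‖ ^ 2 / 2 + δ / 2 * d) * G ξ + G ξ * inner ℝ ξ ω :=
        a1.add his
      have a3 : Integrable fun ξ => (1 - ‖ω‖ ^ 2 / 2 + δ / 2 * d) * G ξ + G ξ * inner ℝ ξ ω +
          (1 / 2) * (G ξ * inner ℝ ξ ω ^ 2) := a2.add (hiss.const_mul _)
      rw [integral_sub a3 (hi2.const_mul _), integral_add a2 (hiss.const_mul _),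
        integral_add a1 his, integral_const_mul, integral_const_mul,
        integral_const_mul, hs, el]
      have : ∫ ξ, G ξ * inner ℝ ξ ω ^ 2 = ‖ω‖ ^ 2 / d * ∫ ξ, G ξ * ‖ξ‖ ^ 2 := by
        field_simp; linarith
      rw [this]
      field_simp
      ring
    have hiA : Integrable fun ξ => G ξ * A ξ := by
      have : ∀ ξ, G ξ * A ξ = (1 - ‖ω‖ ^ 2 / 2 + δ / 2 * d) * G ξ + G ξ * inner ℝ ξ ω +
          (1 / 2) * (G ξ * inner ℝ ξ ω ^ 2) - (δ / 2) * (G ξ * ‖ξ‖ ^ 2) := fun ξ => by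
        simp only [hA]; ring
      simp_rw [this]
      exact ((((hi0.const_mul _).add his).add (hiss.const_mul _))).sub (hi2.const_mul _)
    have e2 : ∫ ξ, f ξ * (gau ξ * KK δ ω ξ) =
        (∫ ξ, G ξ * (KK δ ω ξ - A ξ)) + ∫ ξ, G ξ * A ξ := by
      rw [← integral_add hiK hiA]; congr 1; ext ξ; simp only [hG]; ring
    have e3 : (∫ ξ, f ξ * (gau ξ * KK δ ω ξ)) - (∫ ξ, f ξ * gau ξ) -
        (‖ω‖ ^ 2 / (2 * d) - δ / 2) * ∫ ξ, f ξ * lgau ξ = ∫ ξ, G ξ * (KK δ ω ξ - A ξ) := by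
      rw [e2, e1]; ring
    rw [e3, ← Real.norm_eq_abs]
    refine (norm_integral_le_of_norm_le (hWi.const_mul _) (.of_forall hb)).trans ?_
    rw [integral_const_mul]
    have : 0 ≤ Q * ε ^ 3 := by positivity
    linarith
  · set A : E → E := fun ξ => ξ + (inner ℝ ξ ω : ℝ) • ξ - ω with hA
    set B : E → E := fun ξ => (KK δ ω ξ * (√(1 - δ))⁻¹) • (ξ - ω) with hB
    have hb : ∀ ξ, ‖G ξ • (B ξ - A ξ)‖ ≤ (C * Q * ε ^ 2) * W ξ := fun ξ => by
      have := (gau_pos ξ).le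
      rw [norm_smul, Real.norm_eq_abs]
      calc |G ξ| * ‖B ξ - A ξ‖ ≤ (Q * ((1 + ‖ξ‖) ^ 2 * gau ξ)) *
          (C * ε ^ 2 * ((1 + ‖ξ‖) ^ 8 * Real.exp (‖ξ‖ ^ 2 / 4))) :=
            mul_le_mul (hGb ξ) (hexp δ ε ω ξ hδ hδε hε hε8 hω).2 (norm_nonneg _) (by positivity)
        _ = _ := by simp only [hW]; ring
    have hAc : Continuous A := by fun_prop
    have hBc : Continuous B := by fun_prop
    have hiK : Integrable fun ξ => G ξ • (B ξ - A ξ) :=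
      (hWi.const_mul _).mono' (by fun_prop) (.of_forall hb)
    have this : ∀ ξ, G ξ • A ξ = G ξ • ξ + (G ξ * inner ℝ ξ ω) • ξ - G ξ • ω := fun ξ => by
      simp only [hA]; module
    have hiA : Integrable fun ξ => G ξ • A ξ := by
      simp_rw [this]
      exact (hi1.add hisv).sub (hi0.smul_const ω)
    have e1 : ∫ ξ, G ξ • A ξ = (d⁻¹ * ∫ ξ, f ξ * lgau ξ) • ω := by
      have hsq := integral_inner_smul_of_rad hGr hi2 hGc.aestronglyMeasurable ω
      have hs := integral_smul_self_of_rad hGr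
      simp_rw [this]
      have a1 : Integrable fun ξ => G ξ • ξ + (G ξ * inner ℝ ξ ω) • ξ := hi1.add hisv
      rw [integral_sub a1 (hi0.smul_const ω), integral_add hi1 hisv, hs,
        integral_smul_const, el]
      have : ∫ ξ, (G ξ * inner ℝ ξ ω) • ξ = (d⁻¹ * ∫ ξ, G ξ * ‖ξ‖ ^ 2) • ω := by
        rw [mul_smul, ← hsq, ← hdd, smul_smul, inv_mul_cancel₀ hd0.ne', one_smul]
      rw [this, zero_add, ← sub_smul]
      congr 1
      field_simp
    have e2 : ∫ ξ, (f ξ * (gau ξ * KK δ ω ξ) * (√(1 - δ))⁻¹) • (ξ - ω) =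
        (∫ ξ, G ξ • (B ξ - A ξ)) + ∫ ξ, G ξ • A ξ := by
      rw [← integral_add hiK hiA]; congr 1; ext ξ; simp only [hG, hB]; module
    rw [e2, e1, add_sub_cancel_right]
    refine (norm_integral_le_of_norm_le (hWi.const_mul _) (.of_forall hb)).trans ?_
    rw [integral_const_mul]
    have : 0 ≤ Q * ε ^ 2 := by positivity
    linarith

end BlowUp

namespace BlowUp

variable {E : Type*} [NormedAddCommGroup E] [InnerProductSpace ℝ E] [FiniteDimensional ℝ E]
  [MeasurableSpace E] [BorelSpace E]
variable {V : Type*} [NormedAddCommGroup V] [NormedSpace ℝ V]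

lemma gs_rescale (ψ : E → V) (f : E → ℝ) {R r : ℝ} (hR : 0 < R) (hr : 0 < r) (x : E) :
    gs ψ f (R * r) x = ∫ ξ, (f (R • ξ) * (r ^ Module.finrank ℝ E)⁻¹) •
      ψ (r⁻¹ • (ξ - R⁻¹ • x)) := by
  rw [gs_eq_translate ψ f (mul_pos hR hr).ne' x]
  have h := integral_comp_smul_pos (F := fun η : E => f ((R * r) • η) • ψ (η - (R * r)⁻¹ • x))
    (inv_pos.2 hr)
  have hp : 0 < r ^ Module.finrank ℝ E := by positivity
  rw [inv_pow, inv_inv] at h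
  have h2 := congrArg (fun z => (r ^ Module.finrank ℝ E)⁻¹ • z) h
  simp only [smul_smul, inv_mul_cancel₀ hp.ne', one_smul] at h2
  rw [← h2, ← integral_smul]
  congr 1; ext ξ
  have e1 : (R * r * r⁻¹) = R := by field_simp
  have e2 : r⁻¹ • ξ - (R * r)⁻¹ • x = r⁻¹ • (ξ - R⁻¹ • x) := by
    rw [mul_inv, smul_sub, smul_smul, mul_comm]
  rw [e1, e2, smul_smul, mul_comm]

lemma exists_gs_expansion (E : Type*) [NormedAddCommGroup E] [InnerProductSpace ℝ E]
    [FiniteDimensional ℝ E] [MeasurableSpace E] [BorelSpace E] (hd : 0 < Module.finrank ℝ E) :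
    ∃ C : ℝ, 0 < C ∧ ∀ (f : E → ℝ) (Q τ σ ε : ℝ) (x : E), Continuous f → Rad f →
      (∀ ξ, |f (√(2 * σ) • ξ)| ≤ Q * (1 + ‖ξ‖) ^ 2) → 0 < τ → τ < σ → τ ≤ ε ^ 2 * σ →
      0 ≤ ε → ε ≤ 1 / 8 → ‖x‖ ≤ ε * √(2 * σ) →
      |gs gau f (√(2 * (σ - τ))) x - gs gau f (√(2 * σ)) 0 -
        gs lgau f (√(2 * σ)) 0 / (4 * Module.finrank ℝ E * σ) *
          (‖x‖ ^ 2 - 2 * Module.finrank ℝ E * τ)| ≤ C * Q * ε ^ 3 ∧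
      ‖gs dgau f (√(2 * (σ - τ))) x - (gs lgau f (√(2 * σ)) 0 * √(2 * (σ - τ)) /
        (2 * Module.finrank ℝ E * σ)) • x‖ ≤ C * Q * ε ^ 2 := by
  obtain ⟨C, hC, hav⟩ := exists_average_expansion E hd
  have hm := mom_nonneg (lgau : E → ℝ) 2
  refine ⟨C + mom (lgau : E → ℝ) 2, by positivity,
    fun f Q τ σ ε x hf hr hQ hτ hτσ hτε hε hε8 hx => ?_⟩
  set d : ℝ := ((Module.finrank ℝ E : ℕ) : ℝ) with hdd
  have hd1 : 1 ≤ d := by rw [hdd]; exact_mod_cast hd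
  have hd0 : 0 < d := by linarith
  have hQ0 : 0 ≤ Q := by have := (abs_nonneg _).trans (hQ 0); simpa using this
  have hσ : 0 < σ := hτ.trans hτσ
  set R := √(2 * σ) with hR
  have hR0 : 0 < R := Real.sqrt_pos.2 (by positivity)
  have hR2 : R ^ 2 = 2 * σ := Real.sq_sqrt (by positivity)
  set δ := τ / σ with hδ
  have hδ0 : 0 ≤ δ := by positivity
  have hδ1 : δ < 1 := (div_lt_one hσ).2 hτσ
  have hδε : δ ≤ ε ^ 2 := (div_le_iff₀ hσ).2 hτε
  set r := √(1 - δ) with hrr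
  have hr0 : 0 < r := Real.sqrt_pos.2 (by linarith)
  have ha : √(2 * (σ - τ)) = R * r := by
    rw [hR, hrr, ← Real.sqrt_mul (by positivity)]
    congr 1; rw [hδ]; field_simp
  set ω := R⁻¹ • x with hω
  have hωn : ‖ω‖ = ‖x‖ / R := by
    rw [hω, norm_smul, norm_inv, Real.norm_of_nonneg hR0.le, inv_mul_eq_div]
  have hωε : ‖ω‖ ≤ ε := by rw [hωn]; exact (div_le_iff₀ hR0).2 hx
  have hφr : Rad fun ξ => f (R • ξ) := fun y z h => hr _ _ (by simp [norm_smul, h])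
  obtain ⟨h1, h2⟩ := hav (fun ξ => f (R • ξ)) Q δ ε ω (by fun_prop) hφr hQ hδ0 hδε hε hε8 hωε
  have g0 : gs gau f R 0 = ∫ ξ, f (R • ξ) * gau ξ := by simp [gs]
  have gl : gs lgau f R 0 = ∫ ξ, f (R • ξ) * lgau ξ := by simp [gs]
  have g1 : gs gau f (R * r) x = ∫ ξ, f (R • ξ) * (gau ξ * KK δ ω ξ) := by
    rw [gs_rescale _ _ hR0 hr0]
    congr 1; ext ξ
    rw [gau_mul_KK, ← hrr, smul_eq_mul, mul_assoc]
  have g2 : gs dgau f (R * r) x = ∫ ξ, (f (R • ξ) * (gau ξ * KK δ ω ξ) * r⁻¹) • (ξ - ω) := by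
    rw [gs_rescale _ _ hR0 hr0]
    congr 1; ext ξ
    rw [gau_mul_KK, ← hrr]
    simp only [dgau, smul_smul]
    congr 1; ring
  have hN : |gs lgau f R 0| ≤ Q * mom (lgau : E → ℝ) 2 :=
    norm_gs_le gw_lgau 2 fun ξ => by simpa using hQ ξ
  rw [ha, g1, g2, g0]
  rw [← gl] at h1 h2
  set N := gs lgau f R 0 with hNN
  have hmQ : 0 ≤ mom (lgau : E → ℝ) 2 * Q := by positivity
  constructor
  · have e : N / (4 * d * σ) * (‖x‖ ^ 2 - 2 * d * τ) = (‖ω‖ ^ 2 / (2 * d) - δ / 2) * N := by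
      rw [hωn, div_pow, hR2, hδ]; field_simp; ring
    rw [e]
    refine h1.trans ?_
    have : 0 ≤ mom (lgau : E → ℝ) 2 * Q * ε ^ 3 := by positivity
    linarith
  · have e : (N * (R * r) / (2 * d * σ)) • x = (d⁻¹ * N) • ω - (d⁻¹ * N * (1 - r)) • ω := by
      rw [hω, ← sub_smul, smul_smul]
      congr 1
      have : σ = R ^ 2 / 2 := by linarith
      rw [this]; field_simp; ring
    rw [e, ← sub_add]
    refine (norm_add_le _ _).trans ?_
    have hr1 : r ≤ 1 := Real.sqrt_le_one.2 (by linarith)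
    have hr2 : 1 - r ≤ ε ^ 2 := by
      have e1 : r ^ 2 = 1 - δ := Real.sq_sqrt (by linarith)
      nlinarith
    have : ‖(d⁻¹ * N * (1 - r)) • ω‖ ≤ 1 * (Q * mom (lgau : E → ℝ) 2) * ε ^ 2 * 1 := by
      rw [norm_smul, norm_mul, norm_mul, Real.norm_eq_abs N, Real.norm_of_nonneg (by linarith :
        0 ≤ 1 - r), norm_inv, Real.norm_of_nonneg hd0.le]
      have : d⁻¹ ≤ 1 := inv_le_one_of_one_le₀ hd1
      have : 0 ≤ 1 - r := by linarith
      gcongr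
      linarith
    linarith

end BlowUp

namespace BlowUp

variable {E : Type*} [NormedAddCommGroup E] [InnerProductSpace ℝ E] [FiniteDimensional ℝ E]
  [MeasurableSpace E] [BorelSpace E]
variable {V : Type*} [NormedAddCommGroup V] [NormedSpace ℝ V]

lemma LL_rpow_slow_lin {T Y Y' t r : ℝ} (h0 : 0 < T) (h1 : T ≤ Real.exp (-1)) (hY : 0 < Y)
    (hY' : 0 < Y') (ht : 0 ≤ t) (h : Y' ≤ 23 * Y * (1 + t)) (hr0 : 0 ≤ r) (hr : r ≤ 3 / 2) :
    LL T Y' ^ (-r) ≤ 100 * (1 + t) * LL T Y ^ (-r) := by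
  have hL : 0 ≤ LL T Y ^ (-r) := Real.rpow_nonneg (by have := one_le_LL h0 h1 Y; linarith) _
  refine (LL_rpow_slow h0 h1 hY hY' (K := 23 * (1 + t)) (by linarith) (by linarith) hr0 hr).trans ?_
  have : √(23 * (1 + t)) ≤ 5 * (1 + t) := by
    rw [Real.sqrt_le_left (by linarith)]; nlinarith
  calc _ ≤ 20 * (5 * (1 + t)) * LL T Y ^ (-r) := by gcongr
    _ = _ := by ring

namespace Sol

variable {a : Par E} {A T k : ℝ} {F : ℝ → E → ℝ}

lemma abs_le_near (h : Sol a A T k F) (hA : 0 ≤ A) {σ Y t : ℝ} (hσ : 0 < σ) (hσT : σ ≤ T)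
    (hY : 0 < Y) (ht : 0 ≤ t) {w : E} (hw : YY σ w ≤ 23 * Y * (1 + t)) :
    |F σ w| ≤ 2300 * A * LL T Y ^ (-(3 / 2) : ℝ) * (Y / √σ) * (1 + t) ^ 2 ∧
    |F σ w| ≤ 2300 * A * (LL T Y ^ (-(5 / 4) : ℝ) * √(Y / √σ) +
      LL T Y ^ (-(3 / 2) : ℝ) * (σ ^ (a.γ / 2) * (Y / √σ))) * (1 + t) ^ 2 := by
  have hs : 0 < √σ := Real.sqrt_pos.2 hσ
  have hL := one_le_LL h.h0 h.h1 Y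
  have l1 := LL_rpow_slow_lin h.h0 h.h1 hY (YY_pos hσ w) ht hw (r := 3 / 2) (by norm_num) le_rfl
  have l2 := LL_rpow_slow_lin h.h0 h.h1 hY (YY_pos hσ w) ht hw (r := 5 / 4) (by norm_num)
    (by norm_num)
  have hW : WW σ w ≤ 23 * (Y / √σ) * (1 + t) := by
    have e : WW σ w = YY σ w / √σ := by rw [YY_eq hσ]; field_simp
    rw [e, div_le_iff₀ hs]
    calc _ ≤ _ := hw
      _ = _ := by field_simp
  have hW0 := (WW_pos σ w).le
  have hq : 0 < Y / √σ := by positivity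
  have hW2 : √(WW σ w) ≤ 23 * √(Y / √σ) * (1 + t) := by
    rw [Real.sqrt_le_left (by positivity), mul_pow, mul_pow, Real.sq_sqrt hq.le]
    refine hW.trans ?_
    calc 23 * (Y / √σ) * (1 + t) = 23 * (Y / √σ) * (1 + t) * 1 := by ring
      _ ≤ 23 * (Y / √σ) * (1 + t) * (23 * (1 + t)) := by gcongr; linarith
      _ = _ := by ring
  have p1 : 0 ≤ LL T Y ^ (-(3 / 2) : ℝ) := Real.rpow_nonneg (by linarith) _
  have p2 : 0 ≤ LL T Y ^ (-(5 / 4) : ℝ) := Real.rpow_nonneg (by linarith) _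
  have p3 : 0 ≤ σ ^ (a.γ / 2) := Real.rpow_nonneg hσ.le _
  have m1 : LL T (YY σ w) ^ (-(3 / 2) : ℝ) * WW σ w ≤
      2300 * LL T Y ^ (-(3 / 2) : ℝ) * (Y / √σ) * (1 + t) ^ 2 := by
    calc _ ≤ (100 * (1 + t) * LL T Y ^ (-(3 / 2) : ℝ)) * (23 * (Y / √σ) * (1 + t)) := by gcongr
      _ = _ := by ring
  have m2 : LL T (YY σ w) ^ (-(5 / 4) : ℝ) * √(WW σ w) ≤
      2300 * LL T Y ^ (-(5 / 4) : ℝ) * √(Y / √σ) * (1 + t) ^ 2 := by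
    calc _ ≤ (100 * (1 + t) * LL T Y ^ (-(5 / 4) : ℝ)) * (23 * √(Y / √σ) * (1 + t)) := by gcongr
      _ = _ := by ring
  constructor
  · refine (h.bd1 σ hσ hσT w).trans ?_
    calc _ ≤ A * (2300 * LL T Y ^ (-(3 / 2) : ℝ) * (Y / √σ) * (1 + t) ^ 2) := by gcongr
      _ = _ := by ring
  · refine (h.bd2 σ hσ hσT w).trans ?_
    calc _ ≤ A * (2300 * LL T Y ^ (-(5 / 4) : ℝ) * √(Y / √σ) * (1 + t) ^ 2 +
          σ ^ (a.γ / 2) * (2300 * LL T Y ^ (-(3 / 2) : ℝ) * (Y / √σ) * (1 + t) ^ 2)) := by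
          refine mul_le_mul_of_nonneg_left (add_le_add m2 ?_) hA
          rw [mul_left_comm]
          exact mul_le_mul_of_nonneg_left m1 p3
      _ = _ := by ring

lemma abs_le_far (h : Sol a A T k F) (hA : 0 ≤ A) {σ Y r : ℝ} (hσ : 0 < σ) (hσT : σ ≤ T)
    (hY : 0 < Y) (hr : 16 * Y ≤ r) (hσr : √σ ≤ r) (ξ : E) :
    |F σ (√(2 * σ) • ξ)| ≤
      80 * A * LL T Y ^ (-(3 / 2) : ℝ) * (√(2 * Y / r))⁻¹ * (1 + ‖ξ‖) ^ 2 := by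
  have hs : 0 < √σ := Real.sqrt_pos.2 hσ
  have hr0 : 0 < r := by linarith
  have hL := one_le_LL h.h0 h.h1 Y
  have p1 : 0 ≤ LL T Y ^ (-(3 / 2) : ℝ) := Real.rpow_nonneg (by linarith) _
  have ht : 0 ≤ ‖ξ‖ := norm_nonneg ξ
  have h2 : 0 < √2 := by positivity
  have h22 : √2 ^ 2 = 2 := Real.sq_sqrt (by norm_num)
  have h23 : √2 ≤ 2 := by nlinarith
  have h24 : 1 ≤ √2 := by nlinarith
  set z := 1 + √2 * ‖ξ‖ with hz
  have hz1 : 1 ≤ z := by have : 0 ≤ √2 * ‖ξ‖ := by positivity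
                         linarith
  have hz2 : z ^ 2 ≤ 2 * (1 + ‖ξ‖) ^ 2 := by
    have : z ^ 2 = 1 + 2 * √2 * ‖ξ‖ + √2 ^ 2 * ‖ξ‖ ^ 2 := by rw [hz]; ring
    rw [this, h22]; nlinarith
  set w := √(2 * σ) • ξ with hw
  have hwn : ‖w‖ = √2 * √σ * ‖ξ‖ := by
    rw [hw, norm_smul, Real.norm_of_nonneg (Real.sqrt_nonneg _), Real.sqrt_mul (by norm_num)]
  have hWW : WW σ w = z := by
    unfold WW; rw [hwn]; field_simp; rw [hz]
  have hYY : YY σ w = √σ * z := by rw [YY_eq hσ, hWW]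
  have hslow := LL_rpow_slow h.h0 h.h1 hY (YY_pos hσ w) (K := z * (2 * (2 * Y / r)⁻¹)) (r := 3 / 2)
    (by
      have : 1 ≤ 2 * (2 * Y / r)⁻¹ := by rw [inv_div]; field_simp; linarith
      nlinarith) (by
      rw [hYY]
      have : z * (2 * (2 * Y / r)⁻¹) * Y = r * z := by rw [inv_div]; field_simp
      rw [this]; gcongr) (by norm_num) le_rfl
  have hsq : √(z * (2 * (2 * Y / r)⁻¹)) ≤ z * 2 * (√(2 * Y / r))⁻¹ := by
    rw [← mul_assoc, Real.sqrt_mul (by positivity), Real.sqrt_inv]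
    gcongr
    rw [Real.sqrt_le_left (by positivity)]
    nlinarith
  refine (h.bd1 σ hσ hσT w).trans ?_
  rw [hWW]
  have p2 : 0 ≤ (√(2 * Y / r))⁻¹ := by positivity
  calc A * (LL T (YY σ w) ^ (-(3 / 2) : ℝ) * z) ≤
      A * ((20 * (z * 2 * (√(2 * Y / r))⁻¹) * LL T Y ^ (-(3 / 2) : ℝ)) * z) := by
        gcongr; exact hslow.trans (by gcongr)
    _ = (40 * A * LL T Y ^ (-(3 / 2) : ℝ) * (√(2 * Y / r))⁻¹) * z ^ 2 := by ring
    _ ≤ (40 * A * LL T Y ^ (-(3 / 2) : ℝ) * (√(2 * Y / r))⁻¹) * (2 * (1 + ‖ξ‖) ^ 2) := by gcongr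
    _ = _ := by ring

end Sol

lemma YY_near {τ r Y : ℝ} {x : E} (hτ : 0 < τ) (hr : 0 ≤ r) (hY : YY τ x ≤ Y)
    (hσ : τ + r ^ 2 / 2 ≤ 256 * Y ^ 2) (ξ : E) :
    YY (τ + r ^ 2 / 2) (x + r • ξ) ≤ 23 * Y * (1 + ‖ξ‖) := by
  have hY0 : 0 < Y := (YY_pos hτ x).trans_le hY
  have h1 : √(τ + r ^ 2 / 2) ≤ 16 * Y := by
    rw [Real.sqrt_le_left (by positivity)]; nlinarith
  have h2 : r ≤ 23 * Y := by
    refine abs_le_of_sq_le_sq' ?_ (by positivity) |>.2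
    nlinarith
  have h3 : ‖x‖ ≤ Y := (norm_le_YY τ x).trans hY
  have h4 : ‖r • ξ‖ ≤ 23 * Y * ‖ξ‖ := by
    rw [norm_smul, Real.norm_of_nonneg hr]; gcongr
  unfold YY
  have := norm_add_le x (r • ξ)
  have : 0 ≤ Y * ‖ξ‖ := by positivity
  linarith

lemma YY_near_center {σ Y : ℝ} (hY : 0 < Y) (hσ0 : 0 < σ) (hσ : σ ≤ 256 * Y ^ 2) (ξ : E) :
    YY σ ((0 : E) + √(2 * σ) • ξ) ≤ 23 * Y * (1 + ‖ξ‖) := by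
  have h1 : √σ ≤ 16 * Y := by
    rw [Real.sqrt_le_left (by positivity)]; nlinarith
  have h2 : √(2 * σ) ≤ 23 * Y := by
    rw [Real.sqrt_le_left (by positivity)]; nlinarith
  have h4 : ‖√(2 * σ) • ξ‖ ≤ 23 * Y * ‖ξ‖ := by
    rw [norm_smul, Real.norm_of_nonneg (Real.sqrt_nonneg _)]; gcongr
  unfold YY
  rw [zero_add]
  linarith

end BlowUp

namespace BlowUp

variable {E : Type*} [NormedAddCommGroup E] [InnerProductSpace ℝ E] [FiniteDimensional ℝ E]
  [MeasurableSpace E] [BorelSpace E]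
variable {V : Type*} [NormedAddCommGroup V] [NormedSpace ℝ V]

lemma rpow_neg_half' {r : ℝ} (hr : 0 ≤ r) : r ^ (-(1 / 2) : ℝ) = (√r)⁻¹ := by
  rw [Real.rpow_neg hr, ← Real.sqrt_eq_rpow]

lemma rpow_neg_three_halves {r : ℝ} (hr : 0 < r) : r ^ (-(3 / 2) : ℝ) = r⁻¹ * (√r)⁻¹ := by
  rw [← rpow_neg_half' hr.le, ← Real.rpow_neg_one, ← Real.rpow_add hr]; norm_num

lemma norm_integral_far_le {g : ℝ → V} {α β Y K : ℝ} (hY : 0 < Y) (hαβ : α ≤ β) (hK : 0 ≤ K)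
    (hα : α < β → 16 * Y ≤ α) (hg : ∀ r ∈ Ioc α β, ‖g r‖ ≤ K * (r⁻¹ * (√r)⁻¹)) :
    ‖∫ r in α..β, g r‖ ≤ K * (√Y)⁻¹ / 2 := by
  rcases hαβ.eq_or_lt with rfl | hlt
  · simp; positivity
  have h16 := hα hlt
  have hα0 : 0 < α := by linarith
  have hb0 : 0 < β := by linarith
  have hni : (0 : ℝ) ∉ uIcc α β := by rw [uIcc_of_le hαβ]; exact fun h => by linarith [h.1]
  refine (intervalIntegral.norm_integral_le_of_norm_le (g := fun r => K * r ^ (-(3 / 2) : ℝ)) hαβ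
    (.of_forall fun r hr => ?_) ?_).trans ?_
  · rw [rpow_neg_three_halves (hα0.trans hr.1)]; exact hg r hr
  · exact (intervalIntegral.intervalIntegrable_rpow (Or.inr hni)).const_mul K
  · rw [intervalIntegral.integral_const_mul, integral_rpow (Or.inr ⟨by norm_num, hni⟩)]
    have e1 : (-(3 / 2) + 1 : ℝ) = -(1 / 2) := by norm_num
    rw [e1, rpow_neg_half' hα0.le, rpow_neg_half' hb0.le]
    have h1 : 0 ≤ (√β)⁻¹ := by positivity
    have h2 : (√α)⁻¹ ≤ (√Y)⁻¹ / 4 := by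
      have : 4 * √Y ≤ √α := by
        rw [show (4 : ℝ) = √16 by rw [show (16 : ℝ) = 4 ^ 2 by norm_num]; simp,
          ← Real.sqrt_mul (by norm_num)]
        exact Real.sqrt_le_sqrt h16
      have hs : 0 < √Y := Real.sqrt_pos.2 hY
      calc (√α)⁻¹ ≤ (4 * √Y)⁻¹ := inv_anti₀ (by positivity) this
        _ = _ := by rw [mul_inv]; ring
    calc _ = K * (2 * (√α)⁻¹ - 2 * (√β)⁻¹) := by ring
      _ ≤ K * (2 * ((√Y)⁻¹ / 4)) := by gcongr; linarith
      _ = _ := by ring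

lemma norm_integral_near_le {g : ℝ → V} {β Y K : ℝ} (hβ : 0 ≤ β) (hβY : β ≤ 23 * Y)
    (hK : 0 ≤ K) (hg : ∀ r ∈ Ioc 0 β, ‖g r‖ ≤ K * (√r)⁻¹) :
    ‖∫ r in (0 : ℝ)..β, g r‖ ≤ 10 * K * √Y := by
  have hY : 0 ≤ Y := by linarith
  refine (intervalIntegral.norm_integral_le_of_norm_le (g := fun r => K * r ^ (-(1 / 2) : ℝ)) hβ
    (.of_forall fun r hr => ?_) ?_).trans ?_
  · rw [rpow_neg_half' hr.1.le]; exact hg r hr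
  · exact (intervalIntegral.intervalIntegrable_rpow' (by norm_num)).const_mul K
  · rw [intervalIntegral.integral_const_mul, integral_rpow (Or.inl (by norm_num))]
    have e1 : (-(1 / 2) + 1 : ℝ) = 1 / 2 := by norm_num
    rw [e1, ← Real.sqrt_eq_rpow, Real.zero_rpow (by norm_num)]
    have : √β ≤ 5 * √Y := by
      rw [Real.sqrt_le_left (by positivity), mul_pow, Real.sq_sqrt hY]; linarith
    calc _ = K * (2 * √β) := by ring
      _ ≤ K * (2 * (5 * √Y)) := by gcongr
      _ = _ := by ring

lemma integral_eq_integral_len {h : ℝ → ℝ} {τ S T : ℝ} (hτ : 0 < τ) (hS : τ ≤ S) (hT : S ≤ T)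
    (hh : ContinuousOn h (Ioi 0)) :
    ∫ σ in S..T, h σ = ∫ r in len S τ..len T τ, r * h (τ + r ^ 2 / 2) := by
  have e : ∀ R, τ ≤ R → τ + len R τ ^ 2 / 2 = R := fun R hR => by rw [len_sq hR]; ring
  have := intervalIntegral.integral_comp_mul_deriv'' (a := len S τ) (b := len T τ)
    (f := fun r => τ + r ^ 2 / 2) (f' := fun r => r) (g := h) (by fun_prop)
    (fun x _ => by
      have := (((hasDerivAt_id x).pow 2).div_const 2).const_add τ
      have e : (fun r : ℝ => τ + r ^ 2 / 2) = fun y => τ + (id ^ 2) y / 2 := by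
        funext y; simp
      rw [e]
      refine (this.congr_deriv ?_).hasDerivWithinAt
      simp) (by fun_prop) (hh.mono (by
        rintro _ ⟨r, -, rfl⟩
        simp only [mem_Ioi]; positivity))
  simp only [e S hS, e T (hS.trans hT)] at this
  rw [← this]
  congr 1; ext r; simp [mul_comm]

/-- The neutral-mode source. -/
noncomputable def NN (F : ℝ → E → ℝ) (σ : ℝ) : ℝ :=
  gs lgau (F σ) (√(2 * σ)) 0 / (4 * Module.finrank ℝ E * σ)

/-- The coefficient of the quadratic mode at scale `ζ`. -/
noncomputable def Par.BB (a : Par E) (T : ℝ) (F : ℝ → E → ℝ) (ζ : ℝ) : ℝ :=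
  a.B0 T - ∫ σ in ζ..T, NN F σ

/-- The scale separating the inner and outer regions. -/
noncomputable def SS (T Y : ℝ) : ℝ := min (256 * Y ^ 2) T

lemma le_SS {T τ : ℝ} {x : E} (hτ : 0 < τ) (hT : τ ≤ T) : τ ≤ SS T (YY τ x) := by
  refine le_min ?_ hT
  have := sqrt_le_YY τ x
  have h2 := Real.sq_sqrt hτ.le
  have : √τ ^ 2 ≤ YY τ x ^ 2 := by gcongr
  nlinarith

lemma len_SS_le {T τ : ℝ} {x : E} (hτ : 0 < τ) : len (SS T (YY τ x)) τ ≤ 23 * YY τ x := by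
  have := YY_pos hτ x
  unfold len
  rw [Real.sqrt_le_left (by positivity)]
  have : SS T (YY τ x) ≤ 256 * YY τ x ^ 2 := min_le_left _ _
  nlinarith

lemma le_len_SS {T τ : ℝ} {x : E} (hτ : 0 < τ)
    (h : len (SS T (YY τ x)) τ < len T τ) : 16 * YY τ x ≤ len (SS T (YY τ x)) τ := by
  have h0 := YY_pos hτ x
  have hS : SS T (YY τ x) = 256 * YY τ x ^ 2 := by
    unfold SS at h ⊢
    refine min_eq_left ?_
    by_contra! h2
    rw [min_eq_right h2.le] at h
    exact lt_irrefl _ h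
  have h1 : τ ≤ YY τ x ^ 2 := by
    have := sqrt_le_YY τ x
    have h3 := Real.sq_sqrt hτ.le
    have : √τ ^ 2 ≤ YY τ x ^ 2 := by gcongr
    linarith
  rw [hS, len]
  refine Real.le_sqrt_of_sq_le ?_
  nlinarith

namespace Sol

variable {a : Par E} {A T k : ℝ} {F : ℝ → E → ℝ}

lemma continuousOn_NN (h : Sol a A T k F) : ContinuousOn (NN F) (Ioi 0) := by
  have := a.hd
  have h1 := h.adm.continuousOn_gs gw_lgau 0
  unfold NN
  refine h1.div (by fun_prop) fun σ hσ => ?_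
  have : (0 : ℝ) < Module.finrank ℝ E := by exact_mod_cast this
  have : 0 < σ := hσ
  positivity

lemma continuousOn_center (h : Sol a A T k F) :
    ContinuousOn (fun σ => gs gau (F σ) (√(2 * σ)) 0) (Ioi 0) :=
  h.adm.continuousOn_gs gw_gau 0

end Sol
end BlowUp

namespace BlowUp

variable {E : Type*} [NormedAddCommGroup E] [InnerProductSpace ℝ E] [FiniteDimensional ℝ E]
  [MeasurableSpace E] [BorelSpace E]
variable {V : Type*} [NormedAddCommGroup V] [NormedSpace ℝ V]

lemma Adm.continuous_slice {F : ℝ → E → ℝ} (hF : Adm F) {σ : ℝ} (hσ : 0 < σ) :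
    Continuous (F σ) := by
  obtain ⟨K, hK⟩ := hF σ hσ
  simpa [cut] using hK.slice σ

namespace Sol

variable {a : Par E} {A T k : ℝ} {F : ℝ → E → ℝ}

/-- Constants for which the far-field Taylor expansion holds. -/
def Expands (E : Type*) [NormedAddCommGroup E] [InnerProductSpace ℝ E] [FiniteDimensional ℝ E]
    [MeasurableSpace E] [BorelSpace E] (C : ℝ) : Prop :=
  ∀ (f : E → ℝ) (Q τ σ ε : ℝ) (x : E), Continuous f → Rad f →
      (∀ ξ, |f (√(2 * σ) • ξ)| ≤ Q * (1 + ‖ξ‖) ^ 2) → 0 < τ → τ < σ → τ ≤ ε ^ 2 * σ →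
      0 ≤ ε → ε ≤ 1 / 8 → ‖x‖ ≤ ε * √(2 * σ) →
      |gs gau f (√(2 * (σ - τ))) x - gs gau f (√(2 * σ)) 0 -
        gs lgau f (√(2 * σ)) 0 / (4 * Module.finrank ℝ E * σ) *
          (‖x‖ ^ 2 - 2 * Module.finrank ℝ E * τ)| ≤ C * Q * ε ^ 3 ∧
      ‖gs dgau f (√(2 * (σ - τ))) x - (gs lgau f (√(2 * σ)) 0 * √(2 * (σ - τ)) /
        (2 * Module.finrank ℝ E * σ)) • x‖ ≤ C * Q * ε ^ 2

lemma far_le (h : Sol a A T k F) (hA : 0 ≤ A) {C : ℝ} (hC : Expands E C)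
    {τ r : ℝ} (hτ : 0 < τ) (hrT : τ + r ^ 2 / 2 ≤ T) (x : E) (hr : 16 * YY τ x ≤ r) :
    |r * (gs gau (F (τ + r ^ 2 / 2)) r x - gs gau (F (τ + r ^ 2 / 2)) (√(2 * (τ + r ^ 2 / 2))) 0 -
      NN F (τ + r ^ 2 / 2) * (‖x‖ ^ 2 - 2 * Module.finrank ℝ E * τ))| ≤
      320 * C * A * LL T (YY τ x) ^ (-(3 / 2) : ℝ) * YY τ x ^ 2 * √(2 * YY τ x) *
        (r⁻¹ * (√r)⁻¹) ∧
    ‖gs dgau (F (τ + r ^ 2 / 2)) r x - (2 * (r * NN F (τ + r ^ 2 / 2))) • x‖ ≤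
      160 * C * A * LL T (YY τ x) ^ (-(3 / 2) : ℝ) * YY τ x * √(2 * YY τ x) *
        (r⁻¹ * (√r)⁻¹) := by
  set Y := YY τ x with hYd
  have hY : 0 < Y := YY_pos hτ x
  have hr0 : 0 < r := by linarith
  set σ := τ + r ^ 2 / 2 with hσd
  have hστ : σ - τ = r ^ 2 / 2 := by rw [hσd]; ring
  have hsr : √(2 * (σ - τ)) = r := by
    rw [hστ, show 2 * (r ^ 2 / 2) = r ^ 2 by ring, Real.sqrt_sq hr0.le]
  have hσ0 : 0 < σ := by positivity
  have hτY : τ ≤ Y ^ 2 := by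
    have h1 := sqrt_le_YY τ x
    have h2 := Real.sq_sqrt hτ.le
    have : √τ ^ 2 ≤ YY τ x ^ 2 := by gcongr
    linarith
  have hYr : Y ^ 2 * 256 ≤ r ^ 2 := by
    have : (16 * Y) ^ 2 ≤ r ^ 2 := by gcongr
    linarith
  have hsσ : √σ ≤ r := by
    rw [Real.sqrt_le_left hr0.le]; linarith [sq_nonneg r, sq_nonneg Y]
  have hrσ : r ≤ √(2 * σ) := by
    refine Real.le_sqrt_of_sq_le ?_; linarith
  set L := LL T Y ^ (-(3 / 2) : ℝ) with hLd
  have hL : 0 ≤ L := Real.rpow_nonneg (by have := one_le_LL h.h0 h.h1 Y; linarith) _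
  set ε := 2 * Y / r with hε
  have hε0 : 0 < ε := by positivity
  have hε1 : ε ≤ 1 / 8 := by rw [hε, div_le_iff₀ hr0]; linarith
  have hεr : ε * r = 2 * Y := by rw [hε]; field_simp
  have hse : 0 < √ε := Real.sqrt_pos.2 hε0
  have hse2 : √ε ^ 2 = ε := Real.sq_sqrt hε0.le
  have hses : √ε = √(2 * Y) * (√r)⁻¹ := by
    rw [hε, Real.sqrt_div (by positivity), div_eq_mul_inv]
  have hinv : (√ε)⁻¹ * ε = √ε := by field_simp; exact hse2.symm
  obtain ⟨e1, e2⟩ := hC (F σ) (80 * A * L * (√ε)⁻¹) τ σ ε x (h.adm.continuous_slice hσ0)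
    (h.rad σ) (fun ξ => h.abs_le_far hA hσ0 hrT hY hr hsσ ξ) hτ
    (by rw [hσd]; have : 0 < r ^ 2 := by positivity
        linarith)
    (by
      have : ε ^ 2 * (r ^ 2 / 2) ≤ ε ^ 2 * σ := by gcongr; linarith
      have h2 : ε ^ 2 * (r ^ 2 / 2) = 2 * Y ^ 2 := by
        rw [show ε ^ 2 * (r ^ 2 / 2) = (ε * r) ^ 2 / 2 by ring, hεr]; ring
      linarith [sq_nonneg Y]) hε0.le hε1
    (by
      have h1 : ε * r ≤ ε * √(2 * σ) := by gcongr
      have := norm_le_YY τ x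
      linarith)
  rw [hsr] at e1 e2
  constructor
  · rw [abs_mul, abs_of_pos hr0]
    calc _ ≤ r * (C * (80 * A * L * (√ε)⁻¹) * ε ^ 3) := mul_le_mul_of_nonneg_left e1 hr0.le
      _ = 80 * C * A * L * r * ε ^ 2 * ((√ε)⁻¹ * ε) := by ring
      _ = 80 * C * A * L * (ε * r) ^ 2 * (r⁻¹ * √ε) := by rw [hinv]; field_simp
      _ = _ := by rw [hεr, hses]; ring
  · have e3 : gs lgau (F σ) (√(2 * σ)) 0 * r / (2 * Module.finrank ℝ E * σ) = 2 * (r * NN F σ) := by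
      unfold NN; ring_nf
    rw [e3] at e2
    calc _ ≤ _ := e2
      _ = 80 * C * A * L * ε * ((√ε)⁻¹ * ε) := by ring
      _ = 80 * C * A * L * (ε * r) * (r⁻¹ * √ε) := by rw [hinv]; field_simp
      _ = _ := by rw [hεr, hses]; ring

lemma near_center_le (h : Sol a A T k F) (hA : 0 ≤ A) {ψ : E → V} (hψ : GW ψ) {Y σ : ℝ} (hY : 0 < Y) (hσ : 0 < σ)
    (hσY : σ ≤ 256 * Y ^ 2) (hσT : σ ≤ T) :
    ‖gs ψ (F σ) (√(2 * σ)) 0‖ ≤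
      200 * A * LL T Y ^ (-(3 / 2) : ℝ) * mom ψ 2 := by
  refine BlowUp.norm_gs_le hψ 2 fun ξ => ?_
  have l1 := LL_rpow_slow_lin h.h0 h.h1 hY (YY_pos hσ _) (norm_nonneg ξ)
    (YY_near_center hY hσ hσY ξ) (r := 3 / 2) (by norm_num) le_rfl
  have l2 := WW_center_le hσ ξ
  have hL : 0 ≤ LL T Y ^ (-(3 / 2) : ℝ) :=
    Real.rpow_nonneg (by have := one_le_LL h.h0 h.h1 Y; linarith) _
  refine (h.bd1 σ hσ hσT _).trans ?_
  calc _ ≤ A * ((100 * (1 + ‖ξ‖) * LL T Y ^ (-(3 / 2) : ℝ)) * (2 * (1 + ‖ξ‖) ^ 1)) :=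
        mul_le_mul_of_nonneg_left (mul_le_mul l1 l2 (WW_pos _ _).le (by positivity)) hA
    _ = _ := by ring

/-- The center value of the source is integrable. -/
lemma intervalIntegrable_center (h : Sol a A T k F) (hA : 0 ≤ A) {S : ℝ} (hS : 0 ≤ S)
    (hST : S ≤ T) :
    IntervalIntegrable (fun σ => gs gau (F σ) (√(2 * σ)) 0) volume 0 S := by
  rw [intervalIntegrable_iff_integrableOn_Ioc_of_le hS]
  refine Integrable.of_bound ?_ (2 * A * mom (gau : E → ℝ) 1) ?_
  · exact (h.continuousOn_center.mono fun z hz => hz.1).aestronglyMeasurable measurableSet_Ioc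
  · refine (ae_restrict_iff' measurableSet_Ioc).2 (.of_forall fun σ hσ => ?_)
    exact abs_gs_center_le gw_gau hA hσ.1 fun x => h.bd σ hσ.1 (hσ.2.trans hST) x

lemma vv_split (h : Sol a A T k F) (hA : 0 ≤ A) {τ S : ℝ} (hτ : 0 < τ) (hS : τ ≤ S)
    (hST : S ≤ T) (x : E) :
    a.vv T k F τ x - a.P * τ - a.BB T F S * (‖x‖ ^ 2 - 2 * Module.finrank ℝ E * τ) =
      (∫ σ in (0 : ℝ)..S, gs gau (F σ) (√(2 * σ)) 0) -
      (∫ r in (0 : ℝ)..len S τ, r * gs gau (F (τ + r ^ 2 / 2)) r x) -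
      ∫ r in len S τ..len T τ, r * (gs gau (F (τ + r ^ 2 / 2)) r x -
        gs gau (F (τ + r ^ 2 / 2)) (√(2 * (τ + r ^ 2 / 2))) 0 -
        NN F (τ + r ^ 2 / 2) * (‖x‖ ^ 2 - 2 * Module.finrank ℝ E * τ)) := by
  have hS0 : 0 < S := hτ.trans_le hS
  have hcI := h.intervalIntegrable_center hA (S := S) hS0.le hST
  have hc2 : IntervalIntegrable (fun σ => gs gau (F σ) (√(2 * σ)) 0) volume S T := by
    refine ContinuousOn.intervalIntegrable (h.continuousOn_center.mono ?_)
    rw [uIcc_of_le hST]; exact fun z hz => hS0.trans_le hz.1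
  have hk : k = (∫ σ in (0 : ℝ)..S, gs gau (F σ) (√(2 * σ)) 0) +
      ∫ σ in S..T, gs gau (F σ) (√(2 * σ)) 0 := by
    rw [intervalIntegral.integral_add_adjacent_intervals hcI hc2, ← h.kint]
  have p1 := integral_eq_integral_len hτ hS hST h.continuousOn_center
  have p2 := integral_eq_integral_len hτ hS hST h.continuousOn_NN
  have cq : Continuous fun r : ℝ => τ + r ^ 2 / 2 := by fun_prop
  have mp : MapsTo (fun r : ℝ => τ + r ^ 2 / 2) univ (Ioi 0) := fun r _ => by
    simp only [mem_Ioi]; positivity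
  have c1 : Continuous fun r : ℝ => r * gs gau (F (τ + r ^ 2 / 2)) r x :=
    continuous_id.mul (h.adm.continuous_path gw_gau hτ x)
  have c2 : Continuous fun r : ℝ => r * gs gau (F (τ + r ^ 2 / 2)) (√(2 * (τ + r ^ 2 / 2))) 0 :=
    continuous_id.mul (continuousOn_univ.1 (h.continuousOn_center.comp cq.continuousOn mp))
  have c3 : Continuous fun r : ℝ => r * NN F (τ + r ^ 2 / 2) :=
    continuous_id.mul (continuousOn_univ.1 (h.continuousOn_NN.comp cq.continuousOn mp))
  have hD : Dop F T τ x = (∫ r in (0 : ℝ)..len S τ, r * gs gau (F (τ + r ^ 2 / 2)) r x) +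
      ∫ r in len S τ..len T τ, r * gs gau (F (τ + r ^ 2 / 2)) r x :=
    (intervalIntegral.integral_add_adjacent_intervals (c1.intervalIntegrable _ _)
      (c1.intervalIntegrable _ _)).symm
  have e : ∀ r, r * (gs gau (F (τ + r ^ 2 / 2)) r x -
        gs gau (F (τ + r ^ 2 / 2)) (√(2 * (τ + r ^ 2 / 2))) 0 -
        NN F (τ + r ^ 2 / 2) * (‖x‖ ^ 2 - 2 * Module.finrank ℝ E * τ)) =
      r * gs gau (F (τ + r ^ 2 / 2)) r x -
        r * gs gau (F (τ + r ^ 2 / 2)) (√(2 * (τ + r ^ 2 / 2))) 0 -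
        (r * NN F (τ + r ^ 2 / 2)) * (‖x‖ ^ 2 - 2 * Module.finrank ℝ E * τ) := fun r => by ring
  simp_rw [e]
  have i12 : IntervalIntegrable (fun r => r * gs gau (F (τ + r ^ 2 / 2)) r x -
      r * gs gau (F (τ + r ^ 2 / 2)) (√(2 * (τ + r ^ 2 / 2))) 0) volume (len S τ) (len T τ) :=
    (c1.sub c2).intervalIntegrable _ _
  have i3 : IntervalIntegrable (fun r => (r * NN F (τ + r ^ 2 / 2)) *
      (‖x‖ ^ 2 - 2 * Module.finrank ℝ E * τ)) volume (len S τ) (len T τ) :=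
    (c3.mul continuous_const).intervalIntegrable _ _
  rw [intervalIntegral.integral_sub i12 i3,
    intervalIntegral.integral_sub (c1.intervalIntegrable _ _) (c2.intervalIntegrable _ _),
    intervalIntegral.integral_mul_const, ← p1, ← p2]
  unfold Par.vv Par.BB
  rw [hD]
  linear_combination hk

lemma gg_split (h : Sol a A T k F) {τ S : ℝ} (hτ : 0 < τ) (hS : τ ≤ S)
    (hST : S ≤ T) (x : E) :
    a.gg T F τ x - (2 * a.BB T F S) • x =
      - (∫ r in (0 : ℝ)..len S τ, gs dgau (F (τ + r ^ 2 / 2)) r x) -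
      ∫ r in len S τ..len T τ, (gs dgau (F (τ + r ^ 2 / 2)) r x -
        (2 * (r * NN F (τ + r ^ 2 / 2))) • x) := by
  have p2 := integral_eq_integral_len hτ hS hST h.continuousOn_NN
  have cq : Continuous fun r : ℝ => τ + r ^ 2 / 2 := by fun_prop
  have mp : MapsTo (fun r : ℝ => τ + r ^ 2 / 2) univ (Ioi 0) := fun r _ => by
    simp only [mem_Ioi]; positivity
  have c1 : Continuous fun r : ℝ => gs dgau (F (τ + r ^ 2 / 2)) r x :=
    h.adm.continuous_path gw_dgau hτ x
  have c3 : Continuous fun r : ℝ => 2 * (r * NN F (τ + r ^ 2 / 2)) :=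
    continuous_const.mul (continuous_id.mul
      (continuousOn_univ.1 (h.continuousOn_NN.comp cq.continuousOn mp)))
  have hD : Gop F T τ x = (∫ r in (0 : ℝ)..len S τ, gs dgau (F (τ + r ^ 2 / 2)) r x) +
      ∫ r in len S τ..len T τ, gs dgau (F (τ + r ^ 2 / 2)) r x :=
    (intervalIntegral.integral_add_adjacent_intervals (c1.intervalIntegrable _ _)
      (c1.intervalIntegrable _ _)).symm
  have i3 : IntervalIntegrable (fun r => (2 * (r * NN F (τ + r ^ 2 / 2))) • x) volume
      (len S τ) (len T τ) := (c3.smul continuous_const).intervalIntegrable _ _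
  rw [intervalIntegral.integral_sub (c1.intervalIntegrable _ _) i3, intervalIntegral.integral_smul_const,
    intervalIntegral.integral_const_mul, ← p2]
  unfold Par.gg Par.BB
  rw [hD]
  module

end Sol
end BlowUp

namespace BlowUp

variable {E : Type*} [NormedAddCommGroup E] [InnerProductSpace ℝ E] [FiniteDimensional ℝ E]
  [MeasurableSpace E] [BorelSpace E]
variable {V : Type*} [NormedAddCommGroup V] [NormedSpace ℝ V]

lemma half_le_sqrt {τ r : ℝ} (hτ : 0 ≤ τ) : r / 2 ≤ √(τ + r ^ 2 / 2) := by
  refine Real.le_sqrt_of_sq_le ?_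
  linarith [sq_nonneg r]

lemma sqrt_div_sqrt_le {τ r Y : ℝ} (hτ : 0 < τ) (hr : 0 < r) (hY : 0 ≤ Y) :
    √(Y / √(τ + r ^ 2 / 2)) ≤ √(2 * Y) * (√r)⁻¹ := by
  have h := half_le_sqrt (r := r) hτ.le
  rw [← div_eq_mul_inv, ← Real.sqrt_div (by positivity)]
  apply Real.sqrt_le_sqrt
  calc Y / √(τ + r ^ 2 / 2) ≤ Y / (r / 2) := by gcongr
    _ = _ := by field_simp

lemma div_sqrt_le {τ r Y : ℝ} (hτ : 0 < τ) (hr : 0 < r) (hY : 0 ≤ Y) :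
    Y / √(τ + r ^ 2 / 2) ≤ 2 * Y * (√(√τ))⁻¹ * (√r)⁻¹ := by
  have h := half_le_sqrt (r := r) hτ.le
  set w := √(τ + r ^ 2 / 2) with hw
  have hw0 : 0 < w := by linarith
  have h2 : √τ ≤ w := Real.sqrt_le_sqrt (by have := sq_nonneg r; linarith)
  have hs : 0 < √(√τ) := by positivity
  have hr' : 0 < √r := by positivity
  have h3 : √(√τ) * √r ≤ 2 * w := by
    rw [← Real.sqrt_mul (Real.sqrt_nonneg _), Real.sqrt_le_left (by positivity)]
    calc √τ * r ≤ w * (2 * w) := by gcongr; linarith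
      _ ≤ (2 * w) ^ 2 := by nlinarith
  rw [div_le_iff₀ hw0]
  calc Y = Y * (√(√τ) * √r) * ((√(√τ))⁻¹ * (√r)⁻¹) := by field_simp
    _ ≤ Y * (2 * w) * ((√(√τ))⁻¹ * (√r)⁻¹) := by gcongr
    _ = _ := by ring

lemma rpow_div_sqrt_le {τ r γ : ℝ} (hτ : 0 < τ) (hr : 0 < r) (hγ0 : 0 ≤ γ) (hγ : γ ≤ 1) :
    (τ + r ^ 2 / 2) ^ (γ / 2) / √(τ + r ^ 2 / 2) ≤ 2 * r ^ (γ - 1) := by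
  set σ := τ + r ^ 2 / 2 with hσ
  have hσ0 : 0 < σ := by positivity
  have h := half_le_sqrt (r := r) hτ.le
  have e : σ ^ (γ / 2) / √σ = √σ ^ (γ - 1) := by
    rw [Real.sqrt_eq_rpow, ← Real.rpow_sub hσ0, ← Real.rpow_mul hσ0.le]; congr 1; ring
  rw [e]
  calc √σ ^ (γ - 1) ≤ (r / 2) ^ (γ - 1) :=
        Real.rpow_le_rpow_of_nonpos (by positivity) h (by linarith)
    _ = 2 ^ (1 - γ) * r ^ (γ - 1) := by
        rw [div_eq_inv_mul, Real.mul_rpow (by norm_num) hr.le, Real.inv_rpow (by norm_num),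
          ← Real.rpow_neg (by norm_num)]; congr 2; ring
    _ ≤ 2 ^ (1 : ℝ) * r ^ (γ - 1) := by
        gcongr
        · norm_num
        · linarith
    _ = _ := by rw [Real.rpow_one]

lemma sqrt_two_mul_mul_inv {Y : ℝ} (hY : 0 < Y) : √(2 * Y) * (√Y)⁻¹ ≤ 2 := by
  have : 0 < √Y := by positivity
  rw [Real.sqrt_mul (by norm_num), mul_assoc, mul_inv_cancel₀ this.ne', mul_one,
    Real.sqrt_le_left (by norm_num)]
  norm_num

lemma LL_sqrt {T σ : ℝ} (hσ : 0 < σ) (hT : σ ≤ T) : LL T (√σ) = -Real.log σ := by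
  unfold LL
  rw [Real.log_sqrt hσ.le, max_eq_right]
  · ring
  · have := Real.log_le_log hσ hT
    linarith

namespace Sol

variable {a : Par E} {A T k : ℝ} {F : ℝ → E → ℝ}

section
variable (h : Sol a A T k F) (hA : 0 ≤ A) {C : ℝ} (hC0 : 0 ≤ C) (hC : Expands E C)
  {τ : ℝ} (hτ : 0 < τ) (hτT : τ ≤ T) (x : E)
include h hA hC0 hC hτ hτT

lemma vv_approx :
    |a.vv T k F τ x - a.P * τ -
      a.BB T F (SS T (YY τ x)) * (‖x‖ ^ 2 - 2 * Module.finrank ℝ E * τ)| ≤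
    (157000 * mom (gau : E → ℝ) 2 + 320 * C) * A * (YY τ x ^ 2 * LL T (YY τ x) ^ (-(3 / 2) : ℝ)) := by
  set Y := YY τ x with hYd
  have hY : 0 < Y := YY_pos hτ x
  set S := SS T Y with hSd
  have hτS : τ ≤ S := le_SS hτ hτT
  have hST : S ≤ T := min_le_right _ _
  have hSY : S ≤ 256 * Y ^ 2 := min_le_left _ _
  have hl : len S τ ≤ 23 * Y := len_SS_le hτ
  have hl0 : 0 ≤ len S τ := len_nonneg _ _
  have hlT : len S τ ≤ len T τ := by unfold len; gcongr
  set L := LL T Y ^ (-(3 / 2) : ℝ) with hLd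
  have hL : 0 ≤ L := Real.rpow_nonneg (by have := one_le_LL h.h0 h.h1 Y; linarith) _
  set m := mom (gau : E → ℝ) 2 with hm
  have hm0 : 0 ≤ m := mom_nonneg _ _
  rw [h.vv_split hA hτ hτS hST x]
  have b1 : ‖∫ σ in (0 : ℝ)..S, gs gau (F σ) (√(2 * σ)) 0‖ ≤ 200 * A * L * m * (256 * Y ^ 2) := by
    have := intervalIntegral.norm_integral_le_of_norm_le_const (a := 0) (b := S)
      (f := fun σ => gs gau (F σ) (√(2 * σ)) 0) (C := 200 * A * L * m) (fun σ hσ => by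
        rw [uIoc_of_le (hτ.le.trans hτS)] at hσ
        exact h.near_center_le hA gw_gau hY hσ.1 (hσ.2.trans hSY) (hσ.2.trans hST))
    refine this.trans ?_
    rw [sub_zero, abs_of_pos (hτ.trans_le hτS)]
    gcongr
  have b2 : ‖∫ r in (0 : ℝ)..len S τ, r * gs gau (F (τ + r ^ 2 / 2)) r x‖ ≤
      4600 * A * L * m * Y * (23 * Y) := by
    have := intervalIntegral.norm_integral_le_of_norm_le_const (a := 0) (b := len S τ)
      (f := fun r => r * gs gau (F (τ + r ^ 2 / 2)) r x) (C := 4600 * A * L * m * Y) (fun r hr => by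
        rw [uIoc_of_le hl0] at hr
        have hS2 : τ + r ^ 2 / 2 ≤ S := add_sq_half_le hτS hr.1.le hr.2
        have hσ : 0 < τ + r ^ 2 / 2 := by positivity
        have hsσ : 0 < √(τ + r ^ 2 / 2) := by positivity
        have := BlowUp.norm_gs_le gw_gau (f := F (τ + r ^ 2 / 2)) (a := r) (x := x)
          (K := 2300 * A * L * (Y / √(τ + r ^ 2 / 2))) 2 fun ξ =>
          (h.abs_le_near hA hσ (hS2.trans hST) hY (norm_nonneg ξ)
            (YY_near hτ hr.1.le le_rfl (hS2.trans hSY) ξ)).1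
        rw [norm_mul, Real.norm_of_nonneg hr.1.le]
        have h2 : r * (Y / √(τ + r ^ 2 / 2)) ≤ 2 * Y := by
          have := half_le_sqrt (r := r) hτ.le
          rw [← mul_div_assoc, div_le_iff₀ hsσ]
          calc r * Y ≤ (2 * √(τ + r ^ 2 / 2)) * Y := by gcongr; linarith
            _ = _ := by ring
        calc _ ≤ r * (2300 * A * L * (Y / √(τ + r ^ 2 / 2)) * m) :=
              mul_le_mul_of_nonneg_left this hr.1.le
          _ = 2300 * A * L * m * (r * (Y / √(τ + r ^ 2 / 2))) := by ring
          _ ≤ 2300 * A * L * m * (2 * Y) := by gcongr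
          _ = _ := by ring)
    refine this.trans ?_
    rw [sub_zero, abs_of_nonneg hl0]
    gcongr
  have b3 := norm_integral_far_le (hY := hY) hlT (K := 320 * C * A * L * Y ^ 2 * √(2 * Y))
    (by positivity) (fun h => le_len_SS hτ h) (g := fun r => r * (gs gau (F (τ + r ^ 2 / 2)) r x -
        gs gau (F (τ + r ^ 2 / 2)) (√(2 * (τ + r ^ 2 / 2))) 0 -
        NN F (τ + r ^ 2 / 2) * (‖x‖ ^ 2 - 2 * Module.finrank ℝ E * τ))) (fun r hr =>
      (h.far_le hA hC hτ (add_sq_half_le hτT (hl0.trans hr.1.le) hr.2) x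
        ((le_len_SS hτ (hr.1.trans_le hr.2)).trans hr.1.le)).1)
  have b4 : 320 * C * A * L * Y ^ 2 * √(2 * Y) * (√Y)⁻¹ / 2 ≤ 320 * C * A * L * Y ^ 2 := by
    have := sqrt_two_mul_mul_inv hY
    calc _ = 160 * C * A * L * Y ^ 2 * (√(2 * Y) * (√Y)⁻¹) := by ring
      _ ≤ 160 * C * A * L * Y ^ 2 * 2 := by gcongr
      _ = _ := by ring
  rw [← Real.norm_eq_abs]
  refine (norm_sub_le _ _).trans ((add_le_add (norm_sub_le _ _) b3).trans ?_)
  calc _ ≤ 200 * A * L * m * (256 * Y ^ 2) + 4600 * A * L * m * Y * (23 * Y) +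
        320 * C * A * L * Y ^ 2 := add_le_add (add_le_add b1 b2) b4
    _ = (157000 * m + 320 * C) * A * (Y ^ 2 * L) := by ring

lemma gg_far_le :
    ‖∫ r in len (SS T (YY τ x)) τ..len T τ, (gs dgau (F (τ + r ^ 2 / 2)) r x -
        (2 * (r * NN F (τ + r ^ 2 / 2))) • x)‖ ≤
      160 * C * A * (YY τ x * LL T (YY τ x) ^ (-(3 / 2) : ℝ)) := by
  set Y := YY τ x with hYd
  have hY : 0 < Y := YY_pos hτ x
  set S := SS T Y with hSd
  have hST : S ≤ T := min_le_right _ _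
  have hl0 : 0 ≤ len S τ := len_nonneg _ _
  have hlT : len S τ ≤ len T τ := by unfold len; gcongr
  set L := LL T Y ^ (-(3 / 2) : ℝ) with hLd
  have hL : 0 ≤ L := Real.rpow_nonneg (by have := one_le_LL h.h0 h.h1 Y; linarith) _
  refine (norm_integral_far_le (hY := hY) hlT (K := 160 * C * A * L * Y * √(2 * Y))
    (by positivity) (fun h => le_len_SS hτ h) (fun r hr =>
      (h.far_le hA hC hτ (add_sq_half_le hτT (hl0.trans hr.1.le) hr.2) x
        ((le_len_SS hτ (hr.1.trans_le hr.2)).trans hr.1.le)).2)).trans ?_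
  have := sqrt_two_mul_mul_inv hY
  calc _ = 80 * C * A * L * Y * (√(2 * Y) * (√Y)⁻¹) := by ring
    _ ≤ 80 * C * A * L * Y * 2 := by gcongr
    _ = _ := by ring

lemma gg_approx_sharp :
    ‖a.gg T F τ x - (2 * a.BB T F (SS T (YY τ x))) • x‖ ≤
      (46000 * mom (dgau : E → E) 2 + 160 * C) * A *
        (LL T (YY τ x) ^ (-(3 / 2) : ℝ) * YY τ x * (√(YY τ x) * (√(√τ))⁻¹)) := by
  set Y := YY τ x with hYd
  have hY : 0 < Y := YY_pos hτ x
  have b2 := h.gg_far_le hA hC0 hC hτ hτT x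
  rw [← hYd] at b2
  set S := SS T Y with hSd
  have hτS : τ ≤ S := le_SS hτ hτT
  have hST : S ≤ T := min_le_right _ _
  have hSY : S ≤ 256 * Y ^ 2 := min_le_left _ _
  have hl : len S τ ≤ 23 * Y := len_SS_le hτ
  have hl0 : 0 ≤ len S τ := len_nonneg _ _
  set L := LL T Y ^ (-(3 / 2) : ℝ) with hLd
  have hL : 0 ≤ L := Real.rpow_nonneg (by have := one_le_LL h.h0 h.h1 Y; linarith) _
  set m := mom (dgau : E → E) 2 with hm
  have hm0 : 0 ≤ m := mom_nonneg _ _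
  have hss : 0 < √(√τ) := by positivity
  rw [h.gg_split hτ hτS hST x]
  have b1 := norm_integral_near_le (g := fun r => gs dgau (F (τ + r ^ 2 / 2)) r x) hl0 hl
    (K := 4600 * A * L * m * Y * (√(√τ))⁻¹) (by positivity) (fun r hr => by
      have hS2 : τ + r ^ 2 / 2 ≤ S := add_sq_half_le hτS hr.1.le hr.2
      have hσ : 0 < τ + r ^ 2 / 2 := by positivity
      have := BlowUp.norm_gs_le gw_dgau (f := F (τ + r ^ 2 / 2)) (a := r) (x := x)
          (K := 2300 * A * L * (Y / √(τ + r ^ 2 / 2))) 2 fun ξ =>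
          (h.abs_le_near hA hσ (hS2.trans hST) hY (norm_nonneg ξ)
            (YY_near hτ hr.1.le le_rfl (hS2.trans hSY) ξ)).1
      have h2 := div_sqrt_le hτ hr.1 hY.le
      calc _ ≤ _ := this
        _ ≤ 2300 * A * L * (2 * Y * (√(√τ))⁻¹ * (√r)⁻¹) * m := by gcongr
        _ = _ := by ring)
  have h1 : 1 ≤ √Y * (√(√τ))⁻¹ := by
    rw [← div_eq_mul_inv, one_le_div hss]
    exact Real.sqrt_le_sqrt (sqrt_le_YY τ x)
  refine (norm_sub_le _ _).trans ?_
  rw [norm_neg]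
  refine (add_le_add b1 b2).trans ?_
  have h3 : 160 * C * A * (Y * L) * 1 ≤ 160 * C * A * (Y * L) * (√Y * (√(√τ))⁻¹) := by gcongr
  calc _ ≤ 10 * (4600 * A * L * m * Y * (√(√τ))⁻¹) * √Y +
        160 * C * A * (Y * L) * (√Y * (√(√τ))⁻¹) := by linarith
    _ = _ := by ring

lemma gg_approx :
    ‖a.gg T F τ x - (2 * a.BB T F (SS T (YY τ x))) • x‖ ≤
      ((46000 + 4600 / a.γ) * mom (dgau : E → E) 2 + 160 * C) * A *
        (LL T (YY τ x) ^ (-(5 / 4) : ℝ) * YY τ x) := by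
  set Y := YY τ x with hYd
  have hY : 0 < Y := YY_pos hτ x
  have b2 := h.gg_far_le hA hC0 hC hτ hτT x
  rw [← hYd] at b2
  set S := SS T Y with hSd
  have hτS : τ ≤ S := le_SS hτ hτT
  have hST : S ≤ T := min_le_right _ _
  have hSY : S ≤ 256 * Y ^ 2 := min_le_left _ _
  have hl : len S τ ≤ 23 * Y := len_SS_le hτ
  have hl0 : 0 ≤ len S τ := len_nonneg _ _
  have hL1 := one_le_LL h.h0 h.h1 Y
  set L := LL T Y ^ (-(3 / 2) : ℝ) with hLd
  have hL : 0 ≤ L := Real.rpow_nonneg (by linarith) _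
  set L' := LL T Y ^ (-(5 / 4) : ℝ) with hLd'
  have hLL : L ≤ L' := Real.rpow_le_rpow_of_exponent_le hL1 (by norm_num)
  have hL' : 0 ≤ L' := hL.trans hLL
  set m := mom (dgau : E → E) 2 with hm
  have hm0 : 0 ≤ m := mom_nonneg _ _
  have hγ := a.γ_pos
  have hγ1 : a.γ ≤ 1 := by
    have := a.hm1
    unfold Par.γ; linarith
  rw [h.gg_split hτ hτS hST x]
  have b1 : ‖∫ r in (0 : ℝ)..len S τ, gs dgau (F (τ + r ^ 2 / 2)) r x‖ ≤
      (46000 + 4600 / a.γ) * m * A * (L' * Y) := by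
    refine (intervalIntegral.norm_integral_le_of_norm_le (g := fun r =>
      2300 * A * L' * m * √(2 * Y) * r ^ (-(1 / 2) : ℝ) + 4600 * A * L' * m * Y * r ^ (a.γ - 1)) hl0
      (.of_forall fun r hr => ?_) ?_).trans ?_
    · have hS2 : τ + r ^ 2 / 2 ≤ S := add_sq_half_le hτS hr.1.le hr.2
      have hσ : 0 < τ + r ^ 2 / 2 := by positivity
      refine (BlowUp.norm_gs_le gw_dgau 2 fun ξ =>
          (h.abs_le_near hA hσ (hS2.trans hST) hY (norm_nonneg ξ)
            (YY_near hτ hr.1.le le_rfl (hS2.trans hSY) ξ)).2).trans ?_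
      have h2 := sqrt_div_sqrt_le hτ hr.1 hY.le
      have h3 := rpow_div_sqrt_le hτ hr.1 hγ.le hγ1
      have h4 : (τ + r ^ 2 / 2) ^ (a.γ / 2) * (Y / √(τ + r ^ 2 / 2)) ≤ 2 * r ^ (a.γ - 1) * Y := by
        calc _ = (τ + r ^ 2 / 2) ^ (a.γ / 2) / √(τ + r ^ 2 / 2) * Y := by ring
          _ ≤ _ := by gcongr
      have hrr : 0 ≤ 2 * r ^ (a.γ - 1) * Y := by
        have := Real.rpow_nonneg hr.1.le (a.γ - 1); positivity
      rw [rpow_neg_half' hr.1.le]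
      calc _ ≤ 2300 * A * (L' * (√(2 * Y) * (√r)⁻¹) + L' * (2 * r ^ (a.γ - 1) * Y)) * m := by
            refine mul_le_mul_of_nonneg_right (mul_le_mul_of_nonneg_left (add_le_add ?_ ?_)
              (by positivity)) hm0
            · exact mul_le_mul_of_nonneg_left h2 hL'
            · exact (mul_le_mul_of_nonneg_left h4 hL).trans (mul_le_mul_of_nonneg_right hLL hrr)
        _ = _ := by ring
    · exact ((intervalIntegral.intervalIntegrable_rpow' (by norm_num)).const_mul _).add
        ((intervalIntegral.intervalIntegrable_rpow' (by linarith)).const_mul _)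
    · rw [intervalIntegral.integral_add
        ((intervalIntegral.intervalIntegrable_rpow' (by norm_num)).const_mul _)
        ((intervalIntegral.intervalIntegrable_rpow' (by linarith)).const_mul _),
        intervalIntegral.integral_const_mul, intervalIntegral.integral_const_mul,
        integral_rpow (Or.inl (by norm_num)), integral_rpow (Or.inl (by linarith))]
      have e1 : (-(1 / 2) + 1 : ℝ) = 1 / 2 := by norm_num
      rw [e1, ← Real.sqrt_eq_rpow, Real.zero_rpow (by norm_num), sub_add_cancel,
        Real.zero_rpow hγ.ne']
      have hl1 : len S τ ≤ 1 := by
        unfold len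
        rw [Real.sqrt_le_left (by norm_num)]
        have : T ≤ 1 / 2 := h.h1.trans (by
          rw [Real.exp_neg, one_div]
          exact inv_anti₀ (by norm_num) (by have := Real.add_one_le_exp 1; linarith))
        linarith
      have h5 : len S τ ^ a.γ ≤ 1 := Real.rpow_le_one hl0 hl1 hγ.le
      have h6 : √(2 * Y) * √(len S τ) ≤ 10 * Y := by
        rw [← Real.sqrt_mul (by positivity), Real.sqrt_le_left (by positivity)]
        calc 2 * Y * len S τ ≤ 2 * Y * (23 * Y) := by gcongr
          _ ≤ (10 * Y) ^ 2 := by nlinarith [sq_nonneg Y]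
      calc _ = 4600 * A * L' * m * (√(2 * Y) * √(len S τ)) +
            4600 * A * L' * m * Y * (len S τ ^ a.γ / a.γ) := by ring
        _ ≤ 4600 * A * L' * m * (10 * Y) + 4600 * A * L' * m * Y * (1 / a.γ) := by gcongr
        _ = _ := by ring
  refine (norm_sub_le _ _).trans ?_
  rw [norm_neg]
  refine (add_le_add b1 b2).trans ?_
  have h3 : 160 * C * A * (Y * L) ≤ 160 * C * A * (Y * L') := by gcongr
  calc _ ≤ (46000 + 4600 / a.γ) * m * A * (L' * Y) + 160 * C * A * (Y * L') := by linarith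
    _ = _ := by ring
end

end Sol
end BlowUp

namespace BlowUp

variable {E : Type*} [NormedAddCommGroup E] [InnerProductSpace ℝ E] [FiniteDimensional ℝ E]
  [MeasurableSpace E] [BorelSpace E]
variable {V : Type*} [NormedAddCommGroup V] [NormedSpace ℝ V]

lemma log_SS_div_le {T τ : ℝ} (hτ : 0 < τ) (hτT : τ ≤ T) (x : E) :
    Real.log (SS T (YY τ x) / τ) ≤ 8 * WW τ x := by
  have hW := one_le_WW τ x
  have hS : SS T (YY τ x) / τ ≤ 256 * WW τ x ^ 2 := by
    rw [div_le_iff₀ hτ]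
    refine (min_le_left _ _).trans ?_
    rw [YY_eq hτ, mul_pow, Real.sq_sqrt hτ.le]; linarith
  have hS0 : 0 < SS T (YY τ x) / τ := div_pos (hτ.trans_le (le_SS hτ hτT)) hτ
  refine (Real.log_le_log hS0 hS).trans ?_
  rw [Real.log_mul (by norm_num) (by positivity), Real.log_pow,
    show (256 : ℝ) = 2 ^ 8 by norm_num, Real.log_pow]
  have := Real.log_two_lt_d9
  have := Real.log_le_sub_one_of_pos (WW_pos τ x)
  push_cast
  linarith

lemma LL_YY_rpow_le {T τ r : ℝ} (h0 : 0 < T) (h1 : T ≤ Real.exp (-1)) (hτ : 0 < τ) (hτT : τ ≤ T)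
    (x : E) (hr0 : 0 ≤ r) (hr : r ≤ 3 / 2) :
    LL T (YY τ x) ^ (-r) ≤ 20 * WW τ x * (-Real.log τ) ^ (-r) := by
  have hW := one_le_WW τ x
  have := LL_rpow_slow h0 h1 (Y := √τ) (by positivity) (YY_pos hτ x) hW
    (by rw [YY_eq hτ, mul_comm]) hr0 hr
  rw [LL_sqrt hτ hτT] at this
  have hs : 1 ≤ -Real.log τ := one_le_neg_log hτ (hτT.trans h1)
  have : √(WW τ x) ≤ WW τ x := by
    rw [Real.sqrt_le_left (by linarith)]; nlinarith
  refine ‹_ ≤ 20 * √(WW τ x) * _›.trans ?_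
  have hp : 0 ≤ (-Real.log τ) ^ (-r) := Real.rpow_nonneg (by linarith) _
  gcongr

namespace Sol

variable {a : Par E} {A T k : ℝ} {F : ℝ → E → ℝ}

lemma BB_sub (h : Sol a A T k F) {τ S : ℝ} (hτ : 0 < τ) (hS : τ ≤ S) (hST : S ≤ T) :
    a.BB T F S - a.BB T F τ = ∫ σ in τ..S, NN F σ := by
  have i1 : IntervalIntegrable (NN F) volume τ S :=
    (h.continuousOn_NN.mono fun z hz => by
      rw [uIcc_of_le hS] at hz; exact hτ.trans_le hz.1).intervalIntegrable
  have i2 : IntervalIntegrable (NN F) volume S T :=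
    (h.continuousOn_NN.mono fun z hz => by
      rw [uIcc_of_le hST] at hz; exact hτ.trans_le (hS.trans hz.1)).intervalIntegrable
  unfold Par.BB
  rw [← intervalIntegral.integral_add_adjacent_intervals i1 i2]
  ring

lemma abs_BB_sub_le (h : Sol a A T k F) (hA : 0 ≤ A) {τ : ℝ} (hτ : 0 < τ) (hτT : τ ≤ T) (x : E) :
    |a.BB T F (SS T (YY τ x)) - a.BB T F τ| ≤
      400 * A * mom (lgau : E → ℝ) 2 * (WW τ x * LL T (YY τ x) ^ (-(3 / 2) : ℝ)) := by
  set Y := YY τ x with hYd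
  have hY : 0 < Y := YY_pos hτ x
  set S := SS T Y with hSd
  have hτS : τ ≤ S := le_SS hτ hτT
  have hST : S ≤ T := min_le_right _ _
  have hSY : S ≤ 256 * Y ^ 2 := min_le_left _ _
  set L := LL T Y ^ (-(3 / 2) : ℝ) with hLd
  have hL : 0 ≤ L := Real.rpow_nonneg (by have := one_le_LL h.h0 h.h1 Y; linarith) _
  set m := mom (lgau : E → ℝ) 2 with hm
  have hm0 : 0 ≤ m := mom_nonneg _ _
  have hni : (0 : ℝ) ∉ uIcc τ S := by rw [uIcc_of_le hτS]; exact fun h => by linarith [h.1]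
  have hd : (1 : ℝ) ≤ Module.finrank ℝ E := by exact_mod_cast a.hd
  rw [h.BB_sub hτ hτS hST, ← Real.norm_eq_abs]
  refine (intervalIntegral.norm_integral_le_of_norm_le (g := fun σ => 50 * A * L * m * σ⁻¹) hτS
    (.of_forall fun σ hσ => ?_) ?_).trans ?_
  · have hσ0 : 0 < σ := hτ.trans hσ.1
    have := h.near_center_le hA gw_lgau hY hσ0 (hσ.2.trans hSY) (hσ.2.trans hST)
    unfold NN
    rw [norm_div, Real.norm_of_nonneg (r := 4 * (Module.finrank ℝ E : ℝ) * σ) (by positivity),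
      div_le_iff₀ (by positivity)]
    refine this.trans ?_
    have e : 50 * A * L * m * σ⁻¹ * (4 * Module.finrank ℝ E * σ) =
      200 * A * L * m * Module.finrank ℝ E := by field_simp; ring
    rw [e]
    exact le_mul_of_one_le_right (by positivity) hd
  · refine ((continuousOn_inv₀.mono fun z hz => ?_).intervalIntegrable).const_mul _
    rintro rfl; exact hni hz
  · rw [intervalIntegral.integral_const_mul, integral_inv hni]
    calc _ ≤ 50 * A * L * m * (8 * WW τ x) := by
          gcongr; exact log_SS_div_le hτ hτT x
      _ = _ := by ring

/-- All consequences of the Duhamel analysis needed below, with one constant. -/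
structure Approx (a : Par E) (K T k : ℝ) (F : ℝ → E → ℝ) (τ : ℝ) (x : E) : Prop where
  v : |a.vv T k F τ x - a.P * τ -
    a.BB T F (SS T (YY τ x)) * (‖x‖ ^ 2 - 2 * Module.finrank ℝ E * τ)| ≤
      K * (τ * WW τ x ^ 2 * LL T (YY τ x) ^ (-(3 / 2) : ℝ))
  g : ‖a.gg T F τ x - (2 * a.BB T F (SS T (YY τ x))) • x‖ ≤
      K * (√τ * WW τ x * LL T (YY τ x) ^ (-(5 / 4) : ℝ))
  gsharp : ‖a.gg T F τ x - (2 * a.BB T F (SS T (YY τ x))) • x‖ ≤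
      K * (√τ * (WW τ x * √(WW τ x)) * LL T (YY τ x) ^ (-(3 / 2) : ℝ))
  B : |a.BB T F (SS T (YY τ x)) - a.BB T F τ| ≤ K * (WW τ x * LL T (YY τ x) ^ (-(3 / 2) : ℝ))
  nonloc : |a.μ * a.Gcl T τ ‖a.gg T F τ x‖ x * a.nl T τ (a.vv T k F τ) x| ≤
      K * (τ ^ (a.γ / 2) * WW τ x)

end Sol

open Sol in
lemma Par.exists_approx (a : Par E) {A : ℝ} (hA : 0 ≤ A) : ∃ K : ℝ, 1 ≤ K ∧ ∀ (T k : ℝ) (F : ℝ → E → ℝ),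
    Sol a A T k F → ∀ τ, 0 < τ → τ ≤ T → ∀ x, Approx a K T k F τ x := by
  obtain ⟨C, hC0, hC⟩ := exists_gs_expansion E a.hd
  obtain ⟨A', hA', hF⟩ := a.exists_Ftr_bound
  have m1 := mom_nonneg (gau : E → ℝ) 2
  have m2 := mom_nonneg (lgau : E → ℝ) 2
  have m3 := mom_nonneg (dgau : E → E) 2
  have hγ := a.γ_pos
  set K1 := (157000 * mom (gau : E → ℝ) 2 + 320 * C) * A with hK1
  set K2 := ((46000 + 4600 / a.γ) * mom (dgau : E → E) 2 + 160 * C) * A with hK2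
  set K3 := (46000 * mom (dgau : E → E) 2 + 160 * C) * A with hK3
  set K4 := 400 * A * mom (lgau : E → ℝ) 2 with hK4
  have p1 : 0 ≤ K1 := by positivity
  have p2 : 0 ≤ K2 := by positivity
  have p3 : 0 ≤ K3 := by positivity
  have p4 : 0 ≤ K4 := by positivity
  refine ⟨1 + K1 + K2 + K3 + K4 + A', by linarith, fun T k F h τ hτ hτT x => ?_⟩
  set K := 1 + K1 + K2 + K3 + K4 + A' with hK
  have hW := one_le_WW τ x
  have hL1 := one_le_LL h.h0 h.h1 (YY τ x)
  have hL : 0 ≤ LL T (YY τ x) ^ (-(3 / 2) : ℝ) := Real.rpow_nonneg (by linarith) _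
  have hL' : 0 ≤ LL T (YY τ x) ^ (-(5 / 4) : ℝ) := Real.rpow_nonneg (by linarith) _
  have hLle : LL T (YY τ x) ^ (-(3 / 2) : ℝ) ≤ 1 :=
    Real.rpow_le_one_of_one_le_of_nonpos hL1 (by norm_num)
  have hq : 0 ≤ τ ^ (a.γ / 2) := Real.rpow_nonneg hτ.le _
  have hYW := YY_eq hτ x
  constructor
  · refine (h.vv_approx hA hC0.le hC hτ hτT x).trans ?_
    rw [hYW, mul_pow, Real.sq_sqrt hτ.le, ← hYW]
    exact mul_le_mul_of_nonneg_right (by linarith) (by positivity)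
  · refine (h.gg_approx hA hC0.le hC hτ hτT x).trans ?_
    rw [mul_comm (LL T (YY τ x) ^ (-(5 / 4) : ℝ)) (YY τ x)]
    nth_rw 1 [hYW]
    exact mul_le_mul_of_nonneg_right (by linarith) (by positivity)
  · refine (h.gg_approx_sharp hA hC0.le hC hτ hτT x).trans ?_
    have e : √(YY τ x) * (√(√τ))⁻¹ = √(WW τ x) := by
      rw [hYW, Real.sqrt_mul (by positivity)]; field_simp
    rw [e]
    calc _ = K3 * (√τ * (WW τ x * √(WW τ x)) * LL T (YY τ x) ^ (-(3 / 2) : ℝ)) := by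
          rw [← hK3]; nth_rw 2 [hYW]; ring
      _ ≤ _ := mul_le_mul_of_nonneg_right (by linarith) (by positivity)
  · refine (h.abs_BB_sub_le hA hτ hτT x).trans ?_
    exact mul_le_mul_of_nonneg_right (by linarith) (by positivity)
  · refine (hF T τ h.h0 h.h1 hτ hτT _ _ x).2.2.trans ?_
    calc _ ≤ A' * (1 * (τ ^ (a.γ / 2) * WW τ x)) := by gcongr
      _ = A' * (τ ^ (a.γ / 2) * WW τ x) := by ring
      _ ≤ _ := mul_le_mul_of_nonneg_right (by linarith) (by positivity)

end BlowUp

namespace BlowUp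

variable {E : Type*} [NormedAddCommGroup E] [InnerProductSpace ℝ E] [FiniteDimensional ℝ E]
  [MeasurableSpace E] [BorelSpace E]
variable {V : Type*} [NormedAddCommGroup V] [NormedSpace ℝ V]

lemma abs_quot_sub_le {c c1 P τ ς vcl G G0 M e1 e2 : ℝ} (hc : 0 ≤ c) (hc1 : 0 < c1) (hP : 0 < P)
    (hτ : 0 < τ) (hς : ς ^ 2 = τ) (hv : c1 * τ ≤ vcl) (hG : 0 ≤ G) (hG0 : 0 ≤ G0)
    (hGM : G ≤ M * ς) (hG0M : G0 ≤ M * ς) (h1 : |G - G0| ≤ e1 * ς) (h2 : |vcl - P * τ| ≤ e2 * τ) :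
    |c * G ^ 2 / vcl - c * G0 ^ 2 / (P * τ)| ≤ c * (2 * M * e1 / c1 + M ^ 2 * e2 / (c1 * P)) := by
  have hv0 : 0 < vcl := by have : 0 < c1 * τ := by positivity
                           linarith
  have e : c * G ^ 2 / vcl - c * G0 ^ 2 / (P * τ) =
      c * ((G - G0) * (G + G0) / vcl + G0 ^ 2 * (P * τ - vcl) / (vcl * (P * τ))) := by
    field_simp; ring
  rw [e, abs_mul, abs_of_nonneg hc]
  refine mul_le_mul_of_nonneg_left ((abs_add_le _ _).trans (add_le_add ?_ ?_)) hc
  · rw [abs_div, abs_mul, abs_of_pos hv0, abs_of_nonneg (add_nonneg hG hG0)]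
    have hn : 0 ≤ e1 * ς := (abs_nonneg _).trans h1
    have hn2 : 0 ≤ M * ς := hG.trans hGM
    calc _ ≤ (e1 * ς) * (2 * (M * ς)) / (c1 * τ) := by
          apply div_le_div₀ (by positivity) _ (by positivity) hv
          exact mul_le_mul h1 (by linarith) (add_nonneg hG hG0) hn
      _ = 2 * M * e1 * (ς ^ 2 / τ) / c1 := by field_simp
      _ = _ := by rw [hς, div_self hτ.ne', mul_one]
  · rw [abs_div, abs_mul, abs_of_nonneg (sq_nonneg G0), abs_of_pos (a := vcl * (P * τ)) (by positivity),
      abs_sub_comm]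
    have hn : 0 ≤ e2 * τ := (abs_nonneg _).trans h2
    calc _ ≤ (M * ς) ^ 2 * (e2 * τ) / (c1 * τ * (P * τ)) := by
          apply div_le_div₀ (by positivity) _ (by positivity)
            (mul_le_mul_of_nonneg_right hv (by positivity))
          exact mul_le_mul (by gcongr) h2 (abs_nonneg _) (by positivity)
      _ = M ^ 2 * e2 * (ς ^ 2 / τ) / (c1 * P) := by field_simp
      _ = _ := by rw [hς, div_self hτ.ne', mul_one]

lemma abs_max_sub_le {v q p e : ℝ} (he : 0 ≤ e) (h : q ≤ p + e) :
    |max v q - p| ≤ |v - p| + e := by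
  have := abs_nonneg (v - p)
  rcases le_total v q with hvq | hvq
  · rw [max_eq_right hvq, abs_le]
    constructor
    · have := neg_abs_le (v - p); linarith
    · linarith
  · rw [max_eq_left hvq]; linarith

lemma abs_min_sub_le {g c g0 : ℝ} (h : g0 ≤ c) : |min g c - g0| ≤ |g - g0| := by
  rcases le_total g c with hg | hg
  · rw [min_eq_left hg]
  · rw [min_eq_right hg, abs_of_nonneg (sub_nonneg.2 h)]
    exact (by linarith : c - g0 ≤ g - g0).trans (le_abs_self _)

lemma c1_le_P (a : Par E) : a.c1 ≤ a.P := by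
  have := a.hP
  unfold Par.c1
  exact (min_le_left _ _).trans (by linarith)

lemma norm_le_sqrt_mul_WW {τ : ℝ} (hτ : 0 < τ) (x : E) : ‖x‖ ≤ √τ * WW τ x := by
  rw [← YY_eq hτ]; exact norm_le_YY τ x

namespace Sol

variable {a : Par E} {A T k : ℝ} {F : ℝ → E → ℝ}

section
variable (h : Sol a A T k F) {K : ℝ} (hK : 1 ≤ K) {τ : ℝ} (hτ : 0 < τ) (hτT : τ ≤ T) {x : E}
  (ha : Approx a K T k F τ x)
include h hK hτ hτT ha

lemma norm_gg_sub_le :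
    ‖a.gg T F τ x - (2 * a.BB T F τ) • x‖ ≤
      60 * K * WW τ x ^ 3 * (-Real.log τ) ^ (-(3 / 2) : ℝ) * √τ := by
  have hW := one_le_WW τ x
  set W := WW τ x
  set ς := √τ with hς
  have hς0 : 0 ≤ ς := Real.sqrt_nonneg _
  have hL := LL_YY_rpow_le h.h0 h.h1 hτ hτT x (r := 3 / 2) (by norm_num) le_rfl
  set L := LL T (YY τ x) ^ (-(3 / 2) : ℝ) with hLd
  have hL0 : 0 ≤ L := Real.rpow_nonneg (by have := one_le_LL h.h0 h.h1 (YY τ x); linarith) _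
  set B := a.BB T F (SS T (YY τ x))
  have hsq : √W ≤ W := by
    rw [Real.sqrt_le_left (by linarith)]; nlinarith
  have hx := norm_le_sqrt_mul_WW hτ x
  have e : a.gg T F τ x - (2 * a.BB T F τ) • x =
      (a.gg T F τ x - (2 * B) • x) + (2 * (B - a.BB T F τ)) • x := by module
  rw [e]
  have h1 : ‖(2 * (B - a.BB T F τ)) • x‖ ≤ 2 * (K * (W * L)) * (ς * W) := by
    rw [norm_smul, norm_mul, Real.norm_of_nonneg (by norm_num : (0 : ℝ) ≤ 2)]
    have := ha.B
    rw [← Real.norm_eq_abs] at this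
    gcongr
  calc _ ≤ K * (ς * (W * √W) * L) + 2 * (K * (W * L)) * (ς * W) :=
        (norm_add_le _ _).trans (add_le_add ha.gsharp h1)
    _ ≤ K * (ς * (W * W) * L) + 2 * (K * (W * L)) * (ς * W) := by gcongr
    _ = 3 * K * W ^ 2 * ς * L := by ring
    _ ≤ 3 * K * W ^ 2 * ς * (20 * W * (-Real.log τ) ^ (-(3 / 2) : ℝ)) := by gcongr
    _ = _ := by ring

lemma abs_vv_sub_le (hB : |a.BB T F τ| ≤ 2 * a.b * (-Real.log τ)⁻¹) :
    |a.vv T k F τ x - a.P * τ| ≤ (20 * K + (2 * a.b + 20 * K) * (1 + 2 * Module.finrank ℝ E)) *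
      WW τ x ^ 4 * (-Real.log τ)⁻¹ * τ := by
  have hW := one_le_WW τ x
  have hbp := a.b_pos
  have hs : 1 ≤ -Real.log τ := one_le_neg_log hτ (hτT.trans h.h1)
  set s := -Real.log τ with hsd
  have hL := LL_YY_rpow_le h.h0 h.h1 hτ hτT x (r := 3 / 2) (by norm_num) le_rfl
  have h32 : s ^ (-(3 / 2) : ℝ) ≤ s⁻¹ := by
    rw [← Real.rpow_neg_one]; exact Real.rpow_le_rpow_of_exponent_le hs (by norm_num)
  have hx := norm_le_sqrt_mul_WW hτ x
  have hx2 : ‖x‖ ^ 2 ≤ τ * WW τ x ^ 2 := by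
    calc ‖x‖ ^ 2 ≤ (√τ * WW τ x) ^ 2 := by gcongr
      _ = _ := by rw [mul_pow, Real.sq_sqrt hτ.le]
  have hv := ha.v
  have hBS := ha.B
  set W := WW τ x
  set L := LL T (YY τ x) ^ (-(3 / 2) : ℝ) with hLd
  have hL0 : 0 ≤ L := Real.rpow_nonneg (by have := one_le_LL h.h0 h.h1 (YY τ x); linarith) _
  set B := a.BB T F (SS T (YY τ x))
  set d : ℝ := ((Module.finrank ℝ E : ℕ) : ℝ) with hdd
  have hd0 : 0 ≤ d := Nat.cast_nonneg _
  have hsi : 0 < s⁻¹ := by positivity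
  have hLs : L ≤ 20 * W * s⁻¹ := hL.trans (by gcongr)
  have hW2 : W ^ 3 ≤ W ^ 4 := pow_le_pow_right₀ hW (by norm_num)
  have hW3 : W ≤ W ^ 2 := by nlinarith
  have hW1 : 1 ≤ W ^ 2 := by nlinarith
  have hBS2 : |B| ≤ (2 * a.b + 20 * K) * W ^ 2 * s⁻¹ := by
    have t1 : |B| ≤ |B - a.BB T F τ| + |a.BB T F τ| := by
      simpa using abs_add_le (B - a.BB T F τ) (a.BB T F τ)
    have t2 : 2 * a.b * s⁻¹ * 1 ≤ 2 * a.b * s⁻¹ * W ^ 2 := by gcongr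
    have t3 : K * (W * L) ≤ K * (W * (20 * W * s⁻¹)) := by gcongr
    calc _ ≤ K * (W * (20 * W * s⁻¹)) + 2 * a.b * s⁻¹ * W ^ 2 := by linarith
      _ = _ := by ring
  have hq : |‖x‖ ^ 2 - 2 * d * τ| ≤ (1 + 2 * d) * (τ * W ^ 2) := by
    have : 2 * d * τ * 1 ≤ 2 * d * τ * W ^ 2 := by gcongr
    have h0 : 0 ≤ 2 * d * τ := by positivity
    rw [abs_le]; constructor
    · linarith [sq_nonneg ‖x‖, mul_pos hτ (by linarith : 0 < W ^ 2)]
    · linarith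
  have t4 : |a.vv T k F τ x - a.P * τ| ≤
      |a.vv T k F τ x - a.P * τ - B * (‖x‖ ^ 2 - 2 * d * τ)| + |B * (‖x‖ ^ 2 - 2 * d * τ)| := by
    have := abs_add_le (a.vv T k F τ x - a.P * τ - B * (‖x‖ ^ 2 - 2 * d * τ))
      (B * (‖x‖ ^ 2 - 2 * d * τ))
    rwa [sub_add_cancel] at this
  refine t4.trans ((add_le_add hv ?_ : _ ≤ K * (τ * W ^ 2 * L) +
    ((2 * a.b + 20 * K) * W ^ 2 * s⁻¹) * ((1 + 2 * d) * (τ * W ^ 2))).trans ?_)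
  · rw [abs_mul]; exact mul_le_mul hBS2 hq (abs_nonneg _) (by positivity)
  · calc _ ≤ K * (τ * W ^ 2 * (20 * W * s⁻¹)) +
        ((2 * a.b + 20 * K) * W ^ 2 * s⁻¹) * ((1 + 2 * d) * (τ * W ^ 2)) := by gcongr
      _ = 20 * K * τ * s⁻¹ * W ^ 3 + (2 * a.b + 20 * K) * (1 + 2 * d) * s⁻¹ * τ * W ^ 4 := by ring
      _ ≤ 20 * K * τ * s⁻¹ * W ^ 4 + (2 * a.b + 20 * K) * (1 + 2 * d) * s⁻¹ * τ * W ^ 4 := by gcongr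
      _ = _ := by ring

end

end Sol

end BlowUp

namespace BlowUp

variable {E : Type*} [NormedAddCommGroup E] [InnerProductSpace ℝ E] [FiniteDimensional ℝ E]
  [MeasurableSpace E] [BorelSpace E]
variable {V : Type*} [NormedAddCommGroup V] [NormedSpace ℝ V]

lemma nonloc_weight_le {γ τ : ℝ} (hγ : 0 < γ) (hτ : 0 < τ) (h1 : 1 ≤ -Real.log τ) :
    τ ^ (γ / 2) ≤ (5 / γ) ^ (5 / 2 : ℝ) * (-Real.log τ) ^ (-(5 / 2) : ℝ) := by
  have h := log_rpow_le (k := 5 / 2) (η := γ / 2) (by norm_num) (by positivity) hτ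
    (by by_contra! hc; linarith [Real.log_pos hc])
  have e : (5 / 2 : ℝ) / (γ / 2) = 5 / γ := by field_simp
  rw [e] at h
  have hp : 0 < (-Real.log τ) ^ (5 / 2 : ℝ) := Real.rpow_pos_of_pos (by linarith) _
  rw [Real.rpow_neg (by linarith), ← div_eq_mul_inv, le_div_iff₀ hp, mul_comm]
  exact h

namespace Sol

variable {a : Par E} {A T k : ℝ} {F : ℝ → E → ℝ}

section
variable (h : Sol a A T k F) {K : ℝ} (hK : 1 ≤ K) {τ : ℝ} (hτ : 0 < τ) (hτT : τ ≤ T) {x : E}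
  (ha : Approx a K T k F τ x) (hB0 : 0 ≤ a.BB T F τ) (hB : a.BB T F τ ≤ 2 * a.b * (-Real.log τ)⁻¹)
include h hK hτ hτT ha hB0 hB

lemma abs_Gcl_gg_sub_le :
    |a.Gcl T τ ‖a.gg T F τ x‖ x - 2 * a.BB T F τ * ‖x‖| ≤
      60 * K * WW τ x ^ 3 * (-Real.log τ) ^ (-(3 / 2) : ℝ) * √τ ∧
    2 * a.BB T F τ * ‖x‖ ≤ a.C1 * YY τ x / LL T (YY τ x) := by
  have hL1 := one_le_LL h.h0 h.h1 (YY τ x)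
  have hLs := LL_le hτ hτT (sqrt_le_YY τ x)
  have hle : 2 * a.BB T F τ * ‖x‖ ≤ a.C1 * YY τ x / LL T (YY τ x) := by
    rw [le_div_iff₀ (by linarith)]
    calc 2 * a.BB T F τ * ‖x‖ * LL T (YY τ x)
        ≤ 2 * (2 * a.b * (-Real.log τ)⁻¹) * YY τ x * (-Real.log τ) := by
          have := a.b_pos
          have := norm_le_YY τ x
          have := YY_pos hτ x
          have : 0 ≤ (-Real.log τ)⁻¹ := inv_nonneg.2 (by linarith)
          gcongr
      _ = 4 * a.b * YY τ x * ((-Real.log τ)⁻¹ * (-Real.log τ)) := by ring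
      _ = 4 * a.b * YY τ x := by rw [inv_mul_cancel₀ (by linarith), mul_one]
      _ ≤ a.C1 * YY τ x := by
          have := a.b_pos
          unfold Par.C1
          exact mul_le_mul_of_nonneg_right (by linarith) (YY_pos hτ x).le
  refine ⟨?_, hle⟩
  unfold Par.Gcl
  rw [abs_norm]
  refine (abs_min_sub_le hle).trans ?_
  have e : 2 * a.BB T F τ * ‖x‖ = ‖(2 * a.BB T F τ) • x‖ := by
    rw [norm_smul, Real.norm_of_nonneg (by positivity)]
  rw [e]
  exact (abs_norm_sub_norm_le _ _).trans (norm_gg_sub_le h hK hτ hτT ha)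

lemma abs_vcl_vv_sub_le :
    |a.vcl T τ (a.vv T k F τ) x - a.P * τ| ≤
      (20 * K + (2 * a.b + 20 * K) * (1 + 2 * Module.finrank ℝ E) + 20 * a.c1) * WW τ x ^ 4 *
        (-Real.log τ)⁻¹ * τ := by
  have hW := one_le_WW τ x
  have hc1 := a.c1_pos
  have hs : 1 ≤ -Real.log τ := one_le_neg_log hτ (hτT.trans h.h1)
  have hL := LL_YY_rpow_le h.h0 h.h1 hτ hτT x (r := 1) (by norm_num) (by norm_num)
  rw [Real.rpow_neg_one, Real.rpow_neg_one] at hL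
  have hx := norm_le_sqrt_mul_WW hτ x
  have hx2 : ‖x‖ ^ 2 ≤ τ * WW τ x ^ 2 := by
    calc ‖x‖ ^ 2 ≤ (√τ * WW τ x) ^ 2 := by gcongr
      _ = _ := by rw [mul_pow, Real.sq_sqrt hτ.le]
  have hsi : 0 ≤ (-Real.log τ)⁻¹ := inv_nonneg.2 (by linarith)
  have hq : a.c1 * qq T τ x ≤ a.P * τ + 20 * a.c1 * WW τ x ^ 4 * (-Real.log τ)⁻¹ * τ := by
    unfold qq
    rw [mul_add]
    refine add_le_add (mul_le_mul_of_nonneg_right (c1_le_P a) hτ.le) ?_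
    have : (LL T (YY τ x))⁻¹ ≥ 0 := inv_nonneg.2 (by linarith [one_le_LL h.h0 h.h1 (YY τ x)])
    calc a.c1 * (‖x‖ ^ 2 / LL T (YY τ x)) = a.c1 * (‖x‖ ^ 2 * (LL T (YY τ x))⁻¹) := by
          rw [div_eq_mul_inv]
      _ ≤ a.c1 * (τ * WW τ x ^ 2 * (20 * WW τ x * (-Real.log τ)⁻¹)) := by gcongr
      _ = 20 * a.c1 * WW τ x ^ 3 * (-Real.log τ)⁻¹ * τ := by ring
      _ ≤ _ := by gcongr; norm_num
  refine (abs_max_sub_le (by positivity) hq).trans ?_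
  have := abs_vv_sub_le h hK hτ hτT ha (by rwa [abs_of_nonneg hB0])
  calc _ ≤ _ := add_le_add_left this _
    _ = _ := by ring

lemma abs_F_sub_le :
    |F τ x - 4 * a.c * a.BB T F τ ^ 2 / (a.P * τ) * ‖x‖ ^ 2| ≤
      (a.c * (2 * (20 * a.C1) * (60 * K) / a.c1 + (20 * a.C1) ^ 2 *
        (20 * K + (2 * a.b + 20 * K) * (1 + 2 * Module.finrank ℝ E) + 20 * a.c1) / (a.c1 * a.P)) +
        K * (5 / a.γ) ^ (5 / 2 : ℝ)) * (WW τ x ^ 8 * (-Real.log τ) ^ (-(5 / 2) : ℝ)) := by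
  have hW := one_le_WW τ x
  have hc1 := a.c1_pos
  have hc := a.c_pos
  have hP := a.hP
  have hC1 := a.C1_pos
  have hb := a.b_pos
  have hs : 1 ≤ -Real.log τ := one_le_neg_log hτ (hτT.trans h.h1)
  have hL := LL_YY_rpow_le h.h0 h.h1 hτ hτT x (r := 1) (by norm_num) (by norm_num)
  rw [Real.rpow_neg_one, Real.rpow_neg_one] at hL
  have hL0 : 0 ≤ (LL T (YY τ x))⁻¹ := inv_nonneg.2 (by linarith [one_le_LL h.h0 h.h1 (YY τ x)])
  obtain ⟨hG1, hG2⟩ := abs_Gcl_gg_sub_le h hK hτ hτT ha hB0 hB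
  have hv := abs_vcl_vv_sub_le h hK hτ hτT ha hB0 hB
  have hvl : a.c1 * τ ≤ a.vcl T τ (a.vv T k F τ) x :=
    (mul_le_mul_of_nonneg_left (le_qq h.h0 h.h1 x) hc1.le).trans (le_max_right _ _)
  have hM : a.C1 * YY τ x / LL T (YY τ x) ≤ 20 * a.C1 * WW τ x ^ 2 * (-Real.log τ)⁻¹ * √τ := by
    rw [YY_eq hτ] at hL hL0 ⊢
    rw [div_eq_mul_inv]
    calc _ ≤ a.C1 * (√τ * WW τ x) * (20 * WW τ x * (-Real.log τ)⁻¹) := by gcongr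
      _ = _ := by ring
  have key := abs_quot_sub_le hc.le hc1 hP hτ (Real.sq_sqrt hτ.le) hvl
    (Par.Gcl_nonneg (a := a) (T := T) (τ := τ) h.h0 h.h1 hτ ‖a.gg T F τ x‖ x) (by positivity)
    ((Par.Gcl_le h.h0 h.h1 ‖a.gg T F τ x‖ x).trans hM) (hG2.trans hM) hG1 hv
  have hnl := ha.nonloc
  have hnw := nonloc_weight_le a.γ_pos hτ hs
  have hF := h.fix τ hτ hτT x
  rw [Par.src, Par.Ftr] at hF
  have e52 : (-Real.log τ)⁻¹ * (-Real.log τ) ^ (-(3 / 2) : ℝ) = (-Real.log τ) ^ (-(5 / 2) : ℝ) := by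
    rw [← Real.rpow_neg_one, ← Real.rpow_add (by linarith)]; norm_num
  have e3 : (-Real.log τ)⁻¹ ^ 3 ≤ (-Real.log τ) ^ (-(5 / 2) : ℝ) := by
    rw [← Real.rpow_neg_one, ← Real.rpow_natCast, ← Real.rpow_mul (by linarith)]
    exact Real.rpow_le_rpow_of_exponent_le hs (by norm_num)
  have eF : F τ x - 4 * a.c * a.BB T F τ ^ 2 / (a.P * τ) * ‖x‖ ^ 2 =
      (a.c * a.Gcl T τ ‖a.gg T F τ x‖ x ^ 2 / a.vcl T τ (a.vv T k F τ) x -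
        a.c * (2 * a.BB T F τ * ‖x‖) ^ 2 / (a.P * τ)) +
      a.μ * a.Gcl T τ ‖a.gg T F τ x‖ x * a.nl T τ (a.vv T k F τ) x := by rw [hF]; ring
  rw [eF]
  clear eF hF
  set D := 20 * K + (2 * a.b + 20 * K) * (1 + 2 * Module.finrank ℝ E) + 20 * a.c1
  have hD : 0 ≤ D := by positivity
  set W := WW τ x
  set s := -Real.log τ
  set K5 := (5 / a.γ) ^ (5 / 2 : ℝ)
  have hK5 : 0 ≤ K5 := Real.rpow_nonneg (div_nonneg (by norm_num) a.γ_pos.le) _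
  set r := s ^ (-(5 / 2) : ℝ)
  have hr : 0 ≤ r := Real.rpow_nonneg (by linarith) _
  have hW5 : W ^ 5 ≤ W ^ 8 := pow_le_pow_right₀ hW (by norm_num)
  have hW1 : W ≤ W ^ 8 := le_self_pow₀ hW (by norm_num)
  refine (abs_add_le _ _).trans ((add_le_add key hnl).trans ?_)
  calc a.c * (2 * (20 * a.C1 * W ^ 2 * s⁻¹) * (60 * K * W ^ 3 * s ^ (-(3 / 2) : ℝ)) / a.c1 +
          (20 * a.C1 * W ^ 2 * s⁻¹) ^ 2 * (D * W ^ 4 * s⁻¹) / (a.c1 * a.P)) + K * (τ ^ (a.γ / 2) * W)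
      = a.c * (2 * (20 * a.C1) * (60 * K) / a.c1 * (W ^ 5 * (s⁻¹ * s ^ (-(3 / 2) : ℝ))) +
          (20 * a.C1) ^ 2 * D / (a.c1 * a.P) * (W ^ 8 * s⁻¹ ^ 3)) + K * (τ ^ (a.γ / 2) * W) := by ring
    _ ≤ a.c * (2 * (20 * a.C1) * (60 * K) / a.c1 * (W ^ 8 * r) +
          (20 * a.C1) ^ 2 * D / (a.c1 * a.P) * (W ^ 8 * r)) + K * (K5 * r * W ^ 8) := by
        rw [e52]; gcongr
    _ = _ := by ring

end

end Sol

/-- The quadratic mode of the source term follows the law `B ^ 2 / b` of the profile. -/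
lemma Par.exists_NN_expansion (a : Par E) {A : ℝ} (hA : 0 ≤ A) : ∃ K : ℝ, 0 ≤ K ∧
    ∀ (T k : ℝ) (F : ℝ → E → ℝ), Sol a A T k F → ∀ τ, 0 < τ → τ ≤ T → 0 ≤ a.BB T F τ →
      a.BB T F τ ≤ 2 * a.b * (-Real.log τ)⁻¹ →
      |τ * NN F τ - a.BB T F τ ^ 2 / a.b| ≤ K * (-Real.log τ) ^ (-(5 / 2) : ℝ) := by
  obtain ⟨K, hK, hap⟩ := a.exists_approx hA
  have hc1 := a.c1_pos
  have hc := a.c_pos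
  have hP := a.hP
  have hC1 := a.C1_pos
  have hb := a.b_pos
  have hd : (0 : ℝ) < Module.finrank ℝ E := by exact_mod_cast a.hd
  have hK5 : 0 ≤ (5 / a.γ) ^ (5 / 2 : ℝ) := Real.rpow_nonneg (div_nonneg (by norm_num) a.γ_pos.le) _
  obtain ⟨D, hD⟩ : ∃ D, D = a.c * (2 * (20 * a.C1) * (60 * K) / a.c1 + (20 * a.C1) ^ 2 *
        (20 * K + (2 * a.b + 20 * K) * (1 + 2 * Module.finrank ℝ E) + 20 * a.c1) / (a.c1 * a.P)) +
        K * (5 / a.γ) ^ (5 / 2 : ℝ) := ⟨_, rfl⟩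
  have hD0 : 0 ≤ D := by rw [hD]; positivity
  have hm : 0 ≤ mom (lgau : E → ℝ) 8 := mom_nonneg _ _
  refine ⟨256 * D * mom (lgau : E → ℝ) 8 / (4 * Module.finrank ℝ E), by positivity, ?_⟩
  intro T k F h τ hτ hτT hB0 hB
  have hs : 1 ≤ -Real.log τ := one_le_neg_log hτ (hτT.trans h.h1)
  set r := (-Real.log τ) ^ (-(5 / 2) : ℝ)
  have hr : 0 ≤ r := Real.rpow_nonneg (by linarith) _
  set B := a.BB T F τ
  have hF : ∀ x, |F τ x - 4 * a.c * B ^ 2 / (a.P * τ) * ‖x‖ ^ 2| ≤ D * (WW τ x ^ 8 * r) := fun x => by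
    rw [hD]; exact Sol.abs_F_sub_le h hK hτ hτT (hap T k F h τ hτ hτT x) hB0 hB
  set f : E → ℝ := fun x => F τ x - 4 * a.c * B ^ 2 / (a.P * τ) * ‖x‖ ^ 2 with hf
  have hfb : ∀ ξ : E, |f (0 + √(2 * τ) • ξ)| ≤ 256 * D * r * (1 + ‖ξ‖) ^ 8 := fun ξ => by
    refine (hF _).trans ?_
    have h8 : WW τ ((0 : E) + √(2 * τ) • ξ) ^ 8 ≤ (2 * (1 + ‖ξ‖) ^ 1) ^ 8 :=
      pow_le_pow_left₀ (WW_pos _ _).le (WW_center_le hτ ξ) 8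
    calc _ ≤ D * ((2 * (1 + ‖ξ‖) ^ 1) ^ 8 * r) := by gcongr
      _ = _ := by ring
  have hfc : Continuous f := by
    have := h.adm.continuous_slice hτ
    fun_prop
  have hn := norm_gs_le gw_lgau 8 hfb
  have hi := gs_integrable gw_lgau hfc 8 hfb
  have hsq : ∀ ξ : E, |(fun y : E => ‖y‖ ^ 2) ((0 : E) + √(2 * τ) • ξ)| ≤ 2 * τ * (1 + ‖ξ‖) ^ 2 := fun ξ => by
    simp only [zero_add]
    rw [norm_smul, Real.norm_of_nonneg (Real.sqrt_nonneg _), mul_pow, Real.sq_sqrt (by positivity),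
      abs_of_nonneg (by positivity)]
    gcongr; linarith
  have hi2 := gs_integrable gw_lgau (f := fun y : E => ‖y‖ ^ 2) (by fun_prop) 2 hsq
  have hq : ∫ ξ : E, ‖(0 : E) + √(2 * τ) • ξ‖ ^ 2 • lgau ξ = 4 * Module.finrank ℝ E * τ := by
    have : ∀ ξ : E, ‖(0 : E) + √(2 * τ) • ξ‖ ^ 2 • lgau ξ = (2 * τ) * (‖ξ‖ ^ 2 * lgau ξ) := fun ξ => by
      rw [zero_add, norm_smul, Real.norm_of_nonneg (Real.sqrt_nonneg _), mul_pow,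
        Real.sq_sqrt (by positivity), smul_eq_mul]; ring
    simp_rw [this]
    rw [integral_const_mul, integral_sq_lgau]; ring
  have hgs : gs lgau (F τ) (√(2 * τ)) 0 =
      gs lgau f (√(2 * τ)) 0 + 4 * a.c * B ^ 2 / (a.P * τ) * (4 * Module.finrank ℝ E * τ) := by
    unfold gs
    rw [← hq, ← integral_const_mul, ← integral_add hi (hi2.const_mul _)]
    refine integral_congr_ae (.of_forall fun ξ => ?_)
    simp only [hf, smul_eq_mul]; ring
  have hcb : 4 * a.c / a.P = 1 / a.b := by
    unfold Par.c Par.b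
    field_simp
  have e : τ * NN F τ - B ^ 2 / a.b = gs lgau f (√(2 * τ)) 0 / (4 * Module.finrank ℝ E) := by
    have e1 : B ^ 2 / a.b = 4 * a.c / a.P * B ^ 2 := by rw [hcb]; ring
    rw [NN, hgs, e1]
    field_simp
    ring
  rw [e, abs_div, abs_of_pos (a := 4 * (Module.finrank ℝ E : ℝ)) (by positivity), div_le_iff₀ (by positivity)]
  rw [Real.norm_eq_abs] at hn
  refine hn.trans (le_of_eq ?_)
  field_simp

end BlowUp

namespace BlowUp

variable {E : Type*} [NormedAddCommGroup E] [InnerProductSpace ℝ E] [FiniteDimensional ℝ E]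
  [MeasurableSpace E] [BorelSpace E]
variable {V : Type*} [NormedAddCommGroup V] [NormedSpace ℝ V]

section ODE
variable {B n : ℝ → ℝ} {b K T : ℝ} (hb : 0 < b) (hK : 0 ≤ K) (h0 : 0 < T) (h1 : T ≤ Real.exp (-1))
  (hB : ∀ τ, 0 < τ → HasDerivAt B (n τ) τ) (hBT : B T = b / (-Real.log T))
  (hn : ∀ τ, 0 < τ → τ ≤ T → 0 ≤ B τ → B τ ≤ 2 * b * (-Real.log τ)⁻¹ →
    |τ * n τ - B τ ^ 2 / b| ≤ K * (-Real.log τ) ^ (-(5 / 2) : ℝ))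
include hb hK h0 h1 hB hBT hn

lemma abs_inv_sub_le {σ : ℝ} (hσ : 0 < σ) (hσT : σ ≤ T)
    (hw : ∀ τ ∈ Icc σ T, b / 2 * (-Real.log τ)⁻¹ ≤ B τ ∧ B τ ≤ 2 * b * (-Real.log τ)⁻¹) :
    |1 / B σ - -Real.log σ / b| ≤ 8 * K / b ^ 2 * √(-Real.log σ) := by
  have hs : ∀ τ ∈ Icc σ T, 1 ≤ -Real.log τ := fun τ hτ =>
    one_le_neg_log (hσ.trans_le hτ.1) (hτ.2.trans h1)
  have hBp : ∀ τ ∈ Icc σ T, 0 < B τ := fun τ hτ => by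
    have := hs τ hτ
    have : 0 < (-Real.log τ)⁻¹ := by positivity
    exact (by positivity : 0 < b / 2 * (-Real.log τ)⁻¹).trans_le (hw τ hτ).1
  have hd : ∀ ε : ℝ, ∀ τ ∈ Icc σ T,
      HasDerivAt (fun τ => 1 / B τ - -Real.log τ / b + ε * (8 * K / b ^ 2 * √(-Real.log τ)))
        (-n τ / B τ ^ 2 - -τ⁻¹ / b + ε * (8 * K / b ^ 2 * (-τ⁻¹ / (2 * √(-Real.log τ))))) τ := fun ε τ hτ => by
    have hτ0 : 0 < τ := hσ.trans_le hτ.1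
    have hl : HasDerivAt (fun τ => -Real.log τ) (-τ⁻¹) τ := (Real.hasDerivAt_log hτ0.ne').neg
    have hs' := hs τ hτ
    have : HasDerivAt (fun τ => (B τ)⁻¹) (-n τ / B τ ^ 2) τ := (hB τ hτ0).inv (hBp τ hτ).ne'
    simp only [one_div]
    exact (this.sub (hl.div_const b)).add (((hl.sqrt (by linarith)).const_mul _).const_mul ε)
  have hest : ∀ τ ∈ Icc σ T, |-n τ / B τ ^ 2 - -τ⁻¹ / b| ≤ 8 * K / b ^ 2 * (τ⁻¹ / (2 * √(-Real.log τ))) := fun τ hτ => by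
    have hτ0 : 0 < τ := hσ.trans_le hτ.1
    have hs' := hs τ hτ
    have hBt := hBp τ hτ
    have e : -n τ / B τ ^ 2 - -τ⁻¹ / b = -(τ * n τ - B τ ^ 2 / b) / (τ * B τ ^ 2) := by
      field_simp; ring
    rw [e, abs_div, abs_neg, abs_of_pos (a := τ * B τ ^ 2) (by positivity), div_le_iff₀ (by positivity)]
    refine (hn τ hτ0 hτ.2 hBt.le (hw τ hτ).2).trans ?_
    have e2 : (-Real.log τ) ^ (-(5 / 2) : ℝ) = (-Real.log τ)⁻¹ ^ 2 * (√(-Real.log τ))⁻¹ := by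
      rw [← rpow_neg_half' (by linarith), ← Real.rpow_neg_one, ← Real.rpow_natCast,
        ← Real.rpow_mul (by linarith), ← Real.rpow_add (by linarith)]; norm_num
    have hsi : 0 < (-Real.log τ)⁻¹ := by positivity
    have h2 : (b / 2 * (-Real.log τ)⁻¹) ^ 2 ≤ B τ ^ 2 := pow_le_pow_left₀ (by positivity) (hw τ hτ).1 2
    calc K * (-Real.log τ) ^ (-(5 / 2) : ℝ) =
        4 * K / b ^ 2 * (√(-Real.log τ))⁻¹ * (b / 2 * (-Real.log τ)⁻¹) ^ 2 := by
          rw [e2]; field_simp; ring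
      _ ≤ 4 * K / b ^ 2 * (√(-Real.log τ))⁻¹ * B τ ^ 2 := by gcongr
      _ = _ := by field_simp; ring
  have hmono : MonotoneOn (fun τ => 1 / B τ - -Real.log τ / b + (-1) * (8 * K / b ^ 2 * √(-Real.log τ)))
      (Icc σ T) := by
    refine monotoneOn_of_deriv_nonneg (convex_Icc _ _) ?_ ?_ ?_
    · exact fun τ hτ => (hd (-1) τ hτ).continuousAt.continuousWithinAt
    · intro τ hτ
      rw [interior_Icc] at hτ
      exact (hd (-1) τ ⟨hτ.1.le, hτ.2.le⟩).differentiableAt.differentiableWithinAt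
    · intro τ hτ
      rw [interior_Icc] at hτ
      have hτ' : τ ∈ Icc σ T := ⟨hτ.1.le, hτ.2.le⟩
      rw [(hd (-1) τ hτ').deriv]
      have h3 := (abs_le.1 (hest τ hτ')).1
      have e3 : -1 * (8 * K / b ^ 2 * (-τ⁻¹ / (2 * √(-Real.log τ)))) =
        8 * K / b ^ 2 * (τ⁻¹ / (2 * √(-Real.log τ))) := by ring
      rw [e3]; linarith
  have hanti : AntitoneOn (fun τ => 1 / B τ - -Real.log τ / b + 1 * (8 * K / b ^ 2 * √(-Real.log τ)))
      (Icc σ T) := by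
    refine antitoneOn_of_deriv_nonpos (convex_Icc _ _) ?_ ?_ ?_
    · exact fun τ hτ => (hd 1 τ hτ).continuousAt.continuousWithinAt
    · intro τ hτ
      rw [interior_Icc] at hτ
      exact (hd 1 τ ⟨hτ.1.le, hτ.2.le⟩).differentiableAt.differentiableWithinAt
    · intro τ hτ
      rw [interior_Icc] at hτ
      have hτ' : τ ∈ Icc σ T := ⟨hτ.1.le, hτ.2.le⟩
      rw [(hd 1 τ hτ').deriv]
      have h3 := (abs_le.1 (hest τ hτ')).2
      have e3 : 1 * (8 * K / b ^ 2 * (-τ⁻¹ / (2 * √(-Real.log τ)))) =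
        -(8 * K / b ^ 2 * (τ⁻¹ / (2 * √(-Real.log τ)))) := by ring
      rw [e3]; linarith
  have hl : σ ∈ Icc σ T := ⟨le_rfl, hσT⟩
  have hr : T ∈ Icc σ T := ⟨hσT, le_rfl⟩
  have hm := hmono hl hr hσT
  have ha := hanti hl hr hσT
  have hT0 : 1 / B T - -Real.log T / b = 0 := by rw [hBT, one_div_div, sub_self]
  simp only [hT0] at hm ha
  have hq : 0 ≤ 8 * K / b ^ 2 * √(-Real.log T) := by positivity
  rw [abs_le]; constructor <;> linarith

lemma window_of_abs_inv_sub_le {σ : ℝ} (hσ : 0 < σ) (hσT : σ ≤ T) (hs : 24 * K / b ≤ √(-Real.log T))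
    (hw : ∀ τ ∈ Icc σ T, b / 2 * (-Real.log τ)⁻¹ ≤ B τ ∧ B τ ≤ 2 * b * (-Real.log τ)⁻¹) :
    b / 2 * (-Real.log σ)⁻¹ < B σ ∧ B σ < 2 * b * (-Real.log σ)⁻¹ := by
  have h := abs_inv_sub_le hb hK h0 h1 hB hBT hn hσ hσT hw
  have hs1 : 1 ≤ -Real.log σ := one_le_neg_log hσ (hσT.trans h1)
  have hss : √(-Real.log T) ≤ √(-Real.log σ) :=
    Real.sqrt_le_sqrt (by linarith [Real.log_le_log hσ hσT])
  have hBp : 0 < B σ := by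
    have : 0 < (-Real.log σ)⁻¹ := by positivity
    exact (by positivity : 0 < b / 2 * (-Real.log σ)⁻¹).trans_le (hw σ ⟨le_rfl, hσT⟩).1
  set s := -Real.log σ
  have hsp : 0 < s := by linarith
  have h2 : 8 * K / b ^ 2 * √s ≤ s / (3 * b) := by
    have e : 8 * K / b ^ 2 = 24 * K / b / (3 * b) := by field_simp; ring
    rw [e, div_mul_eq_mul_div]
    refine div_le_div_of_nonneg_right ?_ (by positivity)
    calc _ ≤ √s * √s := mul_le_mul_of_nonneg_right (hs.trans hss) (Real.sqrt_nonneg _)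
      _ = s := Real.mul_self_sqrt hsp.le
  obtain ⟨h3, h4⟩ := abs_le.1 (h.trans h2)
  have e1 : s / b = 3 * (s / (3 * b)) := by field_simp
  have hq : 0 < s / (3 * b) := by positivity
  rw [e1] at h3 h4
  set u := s / (3 * b) with hu
  have es : s⁻¹ = 1 / (3 * b * u) := by rw [hu]; field_simp
  have hBu : B σ = 1 / (1 / B σ) := by field_simp
  set w := 1 / B σ
  have hw0 : 0 < w := by positivity
  rw [es, hBu]
  constructor
  · rw [← mul_div_assoc, div_lt_div_iff₀ (by positivity) hw0]
    nlinarith [mul_pos hb hq]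
  · rw [← mul_div_assoc, div_lt_div_iff₀ hw0 (by positivity)]
    nlinarith [mul_pos hb hq]

/-- Solutions of `τ B' = B ^ 2 / b + O(|log τ| ^ (-5/2))` with `B T = b / |log T|` satisfy
`B = b / |log τ| + O(|log τ| ^ (-3/2))`. -/
lemma abs_sub_div_neg_log_le (hs : 24 * K / b ≤ √(-Real.log T)) {τ : ℝ} (hτ : 0 < τ) (hτT : τ ≤ T) :
    (b / 2 * (-Real.log τ)⁻¹ ≤ B τ ∧ B τ ≤ 2 * b * (-Real.log τ)⁻¹) ∧
    |B τ - b * (-Real.log τ)⁻¹| ≤ 16 * K * (-Real.log τ) ^ (-(3 / 2) : ℝ) := by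
  have hwin : ∀ σ ∈ Icc τ T, b / 2 * (-Real.log σ)⁻¹ < B σ ∧ B σ < 2 * b * (-Real.log σ)⁻¹ := by
    by_contra! hc
    have hpos : ∀ σ ∈ Icc τ T, 0 < σ := fun σ hσ => hτ.trans_le hσ.1
    have hcB : ContinuousOn B (Icc τ T) := fun σ hσ =>
      (hB σ (hpos σ hσ)).continuousAt.continuousWithinAt
    have hcl : ContinuousOn (fun σ => (-Real.log σ)⁻¹) (Icc τ T) := by
      refine ContinuousOn.inv₀ ?_ fun σ hσ => ?_
      · exact (Real.continuousOn_log.mono fun σ hσ => (hpos σ hσ).ne').neg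
      · have := one_le_neg_log (hpos σ hσ) (hσ.2.trans h1); linarith
    let φ : ℝ → ℝ := fun σ => min (B σ - b / 2 * (-Real.log σ)⁻¹) (2 * b * (-Real.log σ)⁻¹ - B σ)
    have hφ : ContinuousOn φ (Icc τ T) :=
      ContinuousOn.inf (hcB.sub (hcl.const_smul (b / 2))) ((hcl.const_smul (2 * b)).sub hcB)
    have hcomp : IsCompact (Icc τ T ∩ φ ⁻¹' Iic 0) :=
      isCompact_Icc.of_isClosed_subset (hφ.preimage_isClosed_of_isClosed isClosed_Icc isClosed_Iic)
        inter_subset_left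
    have hne : (Icc τ T ∩ φ ⁻¹' Iic 0).Nonempty := by
      obtain ⟨σ, hσ, h⟩ := hc
      refine ⟨σ, hσ, ?_⟩
      simp only [φ, mem_preimage, mem_Iic, min_le_iff, sub_nonpos]
      by_contra! h'
      exact absurd (h h'.1) (not_le.2 h'.2)
    obtain ⟨σ, ⟨hσ, hσφ⟩, hmax⟩ := hcomp.exists_isGreatest hne
    have hgood : ∀ ρ ∈ Ioc σ T, 0 < φ ρ := fun ρ hρ => by
      by_contra! h'
      exact absurd (hmax ⟨⟨hσ.1.trans hρ.1.le, hρ.2⟩, h'⟩) (not_le.2 hρ.1)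
    have hT0 : 1 ≤ -Real.log T := one_le_neg_log h0 h1
    have hφT : 0 < φ T := by
      have hi : 0 < b * (-Real.log T)⁻¹ := by positivity
      simp only [φ, hBT, div_eq_mul_inv, lt_min_iff]
      constructor <;> linarith
    have hσT : σ < T := lt_of_le_of_ne hσ.2 fun h => by
      rw [h] at hσφ; exact absurd hφT (not_lt.2 hσφ)
    have hφσ : 0 ≤ φ σ := by
      have h2 : ContinuousOn φ (Icc σ T) := hφ.mono (Icc_subset_Icc_left hσ.1)
      have h3 : ∀ ρ ∈ closure (Ioo σ T), 0 ≤ φ ρ := by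
        refine fun ρ hρ => le_on_closure (f := fun _ => (0 : ℝ)) (g := φ) (fun ρ hρ => (hgood ρ ⟨hρ.1, hρ.2.le⟩).le)
          continuousOn_const ?_ hρ
        rw [closure_Ioo hσT.ne]; exact h2
      exact h3 σ (by rw [closure_Ioo hσT.ne]; exact ⟨le_rfl, hσT.le⟩)
    have hall : ∀ ρ ∈ Icc σ T, b / 2 * (-Real.log ρ)⁻¹ ≤ B ρ ∧ B ρ ≤ 2 * b * (-Real.log ρ)⁻¹ := fun ρ hρ => by
      have : 0 ≤ φ ρ := by
        rcases hρ.1.eq_or_lt with h' | h'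
        · rwa [← h']
        · exact (hgood ρ ⟨h', hρ.2⟩).le
      simpa only [φ, le_min_iff, sub_nonneg] using this
    have := window_of_abs_inv_sub_le hb hK h0 h1 hB hBT hn (hpos σ hσ) hσ.2 hs hall
    simp only [φ, mem_preimage, mem_Iic, min_le_iff, sub_nonpos] at hσφ
    rcases hσφ with h' | h' <;> linarith [this.1, this.2]
  have hw := hwin τ ⟨le_rfl, hτT⟩
  refine ⟨⟨hw.1.le, hw.2.le⟩, ?_⟩
  have hi := abs_inv_sub_le hb hK h0 h1 hB hBT hn hτ hτT fun σ hσ => ⟨(hwin σ hσ).1.le, (hwin σ hσ).2.le⟩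
  have hs1 : 1 ≤ -Real.log τ := one_le_neg_log hτ (hτT.trans h1)
  set s := -Real.log τ
  have hsi : 0 < s⁻¹ := by positivity
  have hBp : 0 < B τ := (by positivity : 0 < b / 2 * s⁻¹).trans hw.1
  have e : B τ - b * s⁻¹ = -(1 / B τ - s / b) * (B τ * (b * s⁻¹)) := by
    field_simp; ring
  rw [e, abs_mul, abs_neg, abs_of_pos (a := B τ * (b * s⁻¹)) (by positivity)]
  calc _ ≤ 8 * K / b ^ 2 * √s * (2 * b * s⁻¹ * (b * s⁻¹)) := by
        refine mul_le_mul hi ?_ (by positivity) (by positivity)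
        exact mul_le_mul_of_nonneg_right hw.2.le (by positivity)
    _ = 16 * K * (s⁻¹ * (√s * s⁻¹)) := by field_simp; ring
    _ = _ := by
        rw [rpow_neg_three_halves (by linarith)]
        congr 2
        rw [← Real.mul_self_sqrt (by linarith : 0 ≤ s)]
        have : 0 < √s := Real.sqrt_pos.2 (by linarith)
        simp only [Real.sqrt_mul_self this.le]
        field_simp

end ODE

lemma Sol.hasDerivAt_BB {a : Par E} {A T k : ℝ} {F : ℝ → E → ℝ} (h : Sol a A T k F) {τ : ℝ} (hτ : 0 < τ) :
    HasDerivAt (a.BB T F) (NN F τ) τ := by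
  have hc := h.continuousOn_NN
  have hi : IntervalIntegrable (NN F) volume τ T :=
    (hc.mono fun x hx => (lt_min hτ h.h0).trans_le hx.1).intervalIntegrable
  have := intervalIntegral.integral_hasDerivAt_left hi
    (hc.stronglyMeasurableAtFilter isOpen_Ioi _ hτ) (hc.continuousAt (Ioi_mem_nhds hτ))
  have h2 : HasDerivAt (fun ζ => a.B0 T - ∫ σ in ζ..T, NN F σ) (-(-NN F τ)) τ := this.const_sub (a.B0 T)
  rwa [neg_neg] at h2

/-- The coefficient of the quadratic mode is `b / |log τ|` up to `O(|log τ| ^ (-3/2))`. -/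
lemma Par.exists_BB_expansion (a : Par E) {A : ℝ} (hA : 0 ≤ A) : ∃ K s0 : ℝ, 0 ≤ K ∧
    ∀ (T k : ℝ) (F : ℝ → E → ℝ), Sol a A T k F → s0 ≤ -Real.log T → ∀ τ, 0 < τ → τ ≤ T →
      (a.b / 2 * (-Real.log τ)⁻¹ ≤ a.BB T F τ ∧ a.BB T F τ ≤ 2 * a.b * (-Real.log τ)⁻¹) ∧
      |a.BB T F τ - a.b * (-Real.log τ)⁻¹| ≤ K * (-Real.log τ) ^ (-(3 / 2) : ℝ) := by
  obtain ⟨K, hK, hn⟩ := a.exists_NN_expansion hA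
  refine ⟨16 * K, (24 * K / a.b) ^ 2, by positivity, fun T k F h hs τ hτ hτT => ?_⟩
  refine abs_sub_div_neg_log_le a.b_pos hK h.h0 h.h1 (fun τ hτ => h.hasDerivAt_BB hτ) ?_
    (fun τ hτ hτT => hn T k F h τ hτ hτT) ?_ hτ hτT
  · simp [BB, B0]
  · exact Real.le_sqrt_of_sq_le hs

end BlowUp

namespace BlowUp

section Weights
variable {s L y a β κ : ℝ} (hL : 1 ≤ L) (hLs : L ≤ s) (hy : 0 ≤ y)

lemma one_add_sq_le {r : ℝ} (hr : 1 ≤ r) : (1 + y) ^ 2 ≤ 4 * (r * (1 + y ^ 2 / r)) := by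
  have : r * (1 + y ^ 2 / r) = r + y ^ 2 := by field_simp
  rw [this]; nlinarith [sq_nonneg (1 - y)]

lemma one_add_rpow_le {r ε : ℝ} (hr : 1 ≤ r) (hy : 0 ≤ y) (hε : 0 ≤ ε) :
    (1 + y) ^ ε ≤ 2 ^ ε * (r ^ (ε / 2) * (1 + y ^ 2 / r) ^ (ε / 2)) := by
  have h := Real.rpow_le_rpow (by positivity) (one_add_sq_le (y := y) hr) (by positivity : 0 ≤ ε / 2)
  have hr0 : 0 ≤ r := by linarith
  have e : ((1 + y) ^ 2) ^ (ε / 2) = (1 + y) ^ ε := by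
    rw [← Real.rpow_natCast, ← Real.rpow_mul (by linarith)]; congr 1; push_cast; ring
  have e4 : (4 : ℝ) ^ (ε / 2) = 2 ^ ε := by
    rw [show (4 : ℝ) = 2 ^ (2 : ℝ) by norm_num, ← Real.rpow_mul (by norm_num)]; congr 1; ring
  rw [e, Real.mul_rpow (by norm_num) (by positivity), e4, Real.mul_rpow hr0 (by positivity)] at h
  exact h

lemma log_one_add_le {r ε : ℝ} (hr : 1 ≤ r) (hy : 0 ≤ y) (hε : 0 < ε) :
    Real.log (1 + y) ≤ 2 ^ ε / ε * (r ^ (ε / 2) * (1 + y ^ 2 / r) ^ (ε / 2)) := by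
  refine (Real.log_le_rpow_div (by linarith) hε).trans ?_
  calc _ ≤ 2 ^ ε * (r ^ (ε / 2) * (1 + y ^ 2 / r) ^ (ε / 2)) / ε :=
        div_le_div_of_nonneg_right (one_add_rpow_le hr hy hε.le) hε.le
    _ = _ := by ring

variable (hs : s ≤ L + 2 * Real.log (1 + y))
include hL hLs hy hs

lemma ratio_le {ε : ℝ} (hε : 0 < ε) (hε1 : ε ≤ 1) :
    s / L ≤ (1 + 4 / ε) * (1 + y ^ 2 / L) ^ (ε / 2) := by
  have hL0 : 0 < L := by linarith
  have hZ : 1 ≤ (1 + y ^ 2 / L) ^ (ε / 2) :=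
    Real.one_le_rpow (by have : 0 ≤ y ^ 2 / L := by positivity
                         linarith) (by positivity)
  have h1 : L ^ (ε / 2) ≤ L := by
    calc _ ≤ L ^ (1 : ℝ) := Real.rpow_le_rpow_of_exponent_le hL (by linarith)
      _ = L := Real.rpow_one L
  have h2 : (2 : ℝ) ^ ε ≤ 2 := by
    calc _ ≤ (2 : ℝ) ^ (1 : ℝ) := Real.rpow_le_rpow_of_exponent_le (by norm_num) hε1
      _ = 2 := Real.rpow_one 2
  rw [div_le_iff₀ hL0]
  set Z := (1 + y ^ 2 / L) ^ (ε / 2)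
  calc s ≤ L * 1 + 2 * (2 ^ ε / ε * (L ^ (ε / 2) * Z)) := by
        linarith [log_one_add_le hL hy hε]
    _ ≤ L * Z + 2 * (2 / ε * (L * Z)) := by gcongr
    _ = _ := by ring

/-- Weights at the local logarithmic scale `L` are controlled by those at the scale `s`. -/
lemma local_weight_le (hβ : 0 ≤ β) (hκ : 0 < κ) (hκ1 : κ ≤ 1 / 2) (ha : a = β / 2 + κ) :
    (1 + y ^ 2 / L) ^ (-a) * L ^ (-(1 / 2) : ℝ) ≤
      2 ^ β * √(1 + 4 / (2 * κ)) * ((1 + y) ^ (-β) * s ^ (-((1 - β) / 2))) := by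
  have hL0 : 0 < L := by linarith
  have hs0 : 0 < s := by linarith
  have hy1 : 0 < 1 + y := by linarith
  have hr := ratio_le hL hLs hy hs (ε := 2 * κ) (by positivity) (by linarith)
  have hw := one_add_rpow_le hL hy hβ
  have hr1 : 1 ≤ s / L := by rwa [one_le_div hL0]
  set Z := 1 + y ^ 2 / L with hZd
  have hZ1 : 1 ≤ Z := by have : 0 ≤ y ^ 2 / L := by positivity
                         linarith
  have hZ0 : 0 < Z := by linarith
  have h2 : (s / L) ^ ((1 - β) / 2) ≤ √(1 + 4 / (2 * κ)) * Z ^ (κ / 2) := by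
    calc _ ≤ (s / L) ^ (1 / 2 : ℝ) := Real.rpow_le_rpow_of_exponent_le hr1 (by linarith)
      _ ≤ ((1 + 4 / (2 * κ)) * Z ^ (2 * κ / 2)) ^ (1 / 2 : ℝ) :=
        Real.rpow_le_rpow (by positivity) hr (by norm_num)
      _ = _ := by
        rw [Real.mul_rpow (by positivity) (by positivity), ← Real.sqrt_eq_rpow, ← Real.rpow_mul hZ0.le]
        congr 2; ring
  have h3 : (s / L) ^ ((1 - β) / 2) ≤ √(1 + 4 / (2 * κ)) * Z ^ κ :=
    h2.trans (mul_le_mul_of_nonneg_left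
      (Real.rpow_le_rpow_of_exponent_le hZ1 (by linarith)) (Real.sqrt_nonneg _))
  rw [Real.div_rpow hs0.le hL0.le] at h3
  set D := √(1 + 4 / (2 * κ))
  rw [Real.rpow_neg hy1.le, Real.rpow_neg hs0.le, Real.rpow_neg hZ0.le, Real.rpow_neg hL0.le, ha,
    Real.rpow_add hZ0, ← mul_inv, ← mul_inv]
  have e : L ^ (1 / 2 : ℝ) = L ^ (β / 2) * L ^ ((1 - β) / 2) := by
    rw [← Real.rpow_add hL0]; congr 1; ring
  rw [e]
  have p1 : 0 < L ^ (β / 2) := Real.rpow_pos_of_pos hL0 _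
  have p2 : 0 < L ^ ((1 - β) / 2) := Real.rpow_pos_of_pos hL0 _
  have p3 : 0 < Z ^ (β / 2) := Real.rpow_pos_of_pos hZ0 _
  have p4 : 0 < Z ^ κ := Real.rpow_pos_of_pos hZ0 _
  have p5 : 0 < s ^ ((1 - β) / 2) := Real.rpow_pos_of_pos hs0 _
  have p6 : 0 < (1 + y) ^ β := Real.rpow_pos_of_pos hy1 _
  have p7 : (0 : ℝ) < 2 ^ β := Real.rpow_pos_of_pos (by norm_num) _
  rw [div_le_iff₀ p2] at h3
  rw [← div_eq_mul_inv (2 ^ β * D), inv_eq_one_div, div_le_div_iff₀ (by positivity) (by positivity), one_mul]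
  calc (1 + y) ^ β * s ^ ((1 - β) / 2)
      ≤ (2 ^ β * (L ^ (β / 2) * Z ^ (β / 2))) * (D * Z ^ κ * L ^ ((1 - β) / 2)) := by gcongr
    _ = _ := by ring

lemma profile_weight_le (hβ : 0 ≤ β) (hκ : 0 < κ) (hκ1 : κ ≤ 1 / 2) (ha : a = β / 2 + κ) :
    (1 + y ^ 2 / s) ^ (-a) * (Real.log (1 + y) / L) ≤
      2 ^ β * ((1 + 4 / (κ / 2)) ^ 2 * (2 / κ)) * ((1 + y) ^ (-β) * s ^ (-((1 - β) / 2))) := by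
  have hL0 : 0 < L := by linarith
  have hs1 : 1 ≤ s := by linarith
  have hs0 : 0 < s := by linarith
  have hy1 : 0 < 1 + y := by linarith
  have hr := ratio_le hL hLs hy hs (ε := κ / 2) (by positivity) (by linarith)
  have hw := one_add_rpow_le hs1 hy hβ
  have hl := log_one_add_le hs1 hy hκ
  have hr1 : 1 ≤ s / L := by rwa [one_le_div hL0]
  have hZL : 1 + y ^ 2 / L ≤ s / L * (1 + y ^ 2 / s) := by
    have : s / L * (1 + y ^ 2 / s) = s / L + y ^ 2 / L := by field_simp
    rw [this]; linarith
  set Z := 1 + y ^ 2 / s with hZd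
  have hZ1 : 1 ≤ Z := by have : 0 ≤ y ^ 2 / s := by positivity
                         linarith
  have hZ0 : 0 < Z := by linarith
  set C := 1 + 4 / (κ / 2) with hCd
  have hC : 0 < C := by positivity
  have hR0 : 0 < s / L := by positivity
  have h2 : s / L ≤ C ^ 2 * Z ^ (κ / 2) := by
    have h3 : s / L ≤ C * ((s / L) ^ (1 / 2 : ℝ) * Z ^ (κ / 4)) := by
      calc _ ≤ C * (1 + y ^ 2 / L) ^ (κ / 2 / 2) := hr
        _ ≤ C * (s / L * Z) ^ (κ / 2 / 2) := by
          gcongr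
        _ = C * ((s / L) ^ (κ / 4) * Z ^ (κ / 4)) := by
          rw [Real.mul_rpow hR0.le hZ0.le]; congr 3 <;> ring
        _ ≤ _ := by
          have := Real.rpow_le_rpow_of_exponent_le hr1 (by linarith : κ / 4 ≤ 1 / 2)
          gcongr
    rw [← Real.sqrt_eq_rpow] at h3
    have hq : 0 < √(s / L) := Real.sqrt_pos.2 hR0
    have h4 : √(s / L) ≤ C * Z ^ (κ / 4) := by
      have e := Real.mul_self_sqrt hR0.le
      refine le_of_mul_le_mul_right ?_ hq
      calc √(s / L) * √(s / L) = s / L := e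
        _ ≤ _ := h3
        _ = _ := by ring
    calc s / L = √(s / L) ^ 2 := (Real.sq_sqrt hR0.le).symm
      _ ≤ (C * Z ^ (κ / 4)) ^ 2 := pow_le_pow_left₀ hq.le h4 2
      _ = _ := by
        rw [mul_pow, ← Real.rpow_natCast (Z ^ (κ / 4)), ← Real.rpow_mul hZ0.le]
        congr 2; push_cast; ring
  have hlog : Real.log (1 + y) ≤ 2 / κ * (s ^ (1 / 2 : ℝ) * Z ^ (κ / 2)) := by
    have h5 : (2 : ℝ) ^ κ ≤ 2 := by
      calc _ ≤ (2 : ℝ) ^ (1 : ℝ) := Real.rpow_le_rpow_of_exponent_le (by norm_num) (by linarith)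
        _ = 2 := Real.rpow_one 2
    have h6 : s ^ (κ / 2) ≤ s ^ (1 / 2 : ℝ) := Real.rpow_le_rpow_of_exponent_le hs1 (by linarith)
    exact hl.trans (by gcongr)
  have hlog0 : 0 ≤ Real.log (1 + y) := Real.log_nonneg (by linarith)
  have p1 : 0 < s ^ (β / 2) := Real.rpow_pos_of_pos hs0 _
  have p3 : 0 < Z ^ (β / 2) := Real.rpow_pos_of_pos hZ0 _
  have p4 : 0 < Z ^ κ := Real.rpow_pos_of_pos hZ0 _
  have p5 : 0 < s ^ ((1 - β) / 2) := Real.rpow_pos_of_pos hs0 _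
  have p6 : 0 < (1 + y) ^ β := Real.rpow_pos_of_pos hy1 _
  have p7 : (0 : ℝ) < 2 ^ β := Real.rpow_pos_of_pos (by norm_num) _
  have hlL : Real.log (1 + y) / L * s ≤ C ^ 2 * (2 / κ) * (s ^ (1 / 2 : ℝ) * Z ^ κ) := by
    calc Real.log (1 + y) / L * s = Real.log (1 + y) * (s / L) := by ring
      _ ≤ (2 / κ * (s ^ (1 / 2 : ℝ) * Z ^ (κ / 2))) * (C ^ 2 * Z ^ (κ / 2)) := by gcongr
      _ = C ^ 2 * (2 / κ) * (s ^ (1 / 2 : ℝ) * (Z ^ (κ / 2) * Z ^ (κ / 2))) := by ring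
      _ = _ := by rw [← Real.rpow_add hZ0, add_halves]
  rw [Real.rpow_neg hy1.le, Real.rpow_neg hs0.le, Real.rpow_neg hZ0.le, ha,
    Real.rpow_add hZ0, ← mul_inv]
  set D := C ^ 2 * (2 / κ)
  set l := Real.log (1 + y) / L
  have hlL0 : 0 ≤ l := by positivity
  rw [← div_eq_mul_inv (2 ^ β * D), inv_mul_eq_div, div_le_div_iff₀ (by positivity) (by positivity)]
  have e : s = s ^ (1 / 2 : ℝ) * s ^ (1 / 2 : ℝ) := by
    rw [← Real.rpow_add hs0]; norm_num
  have e2 : s ^ (1 / 2 : ℝ) = s ^ (β / 2) * s ^ ((1 - β) / 2) := by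
    rw [← Real.rpow_add hs0]; congr 1; ring
  have p8 : 0 < s ^ (1 / 2 : ℝ) := Real.rpow_pos_of_pos hs0 _
  have h7 : l * s ^ (1 / 2 : ℝ) ≤ D * Z ^ κ := by
    refine le_of_mul_le_mul_right ?_ p8
    calc l * s ^ (1 / 2 : ℝ) * s ^ (1 / 2 : ℝ) = l * s := by rw [mul_assoc, ← e]
      _ ≤ _ := hlL
      _ = _ := by ring
  calc l * ((1 + y) ^ β * s ^ ((1 - β) / 2))
      ≤ l * ((2 ^ β * (s ^ (β / 2) * Z ^ (β / 2))) * s ^ ((1 - β) / 2)) := by gcongr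
    _ = (l * s ^ (1 / 2 : ℝ)) * (2 ^ β * Z ^ (β / 2)) := by rw [e2]; ring
    _ ≤ (D * Z ^ κ) * (2 ^ β * Z ^ (β / 2)) := by gcongr
    _ = _ := by ring

end Weights

end BlowUp

namespace BlowUp

variable {E : Type*} [NormedAddCommGroup E] [InnerProductSpace ℝ E] [FiniteDimensional ℝ E]
  [MeasurableSpace E] [BorelSpace E]
variable {V : Type*} [NormedAddCommGroup V] [NormedSpace ℝ V]

lemma neg_log_SS {T Y : ℝ} (h0 : 0 < T) (hY : 0 < Y) :
    -Real.log (SS T Y) ≤ LL T Y ∧ LL T Y - 6 ≤ -Real.log (SS T Y) := by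
  have h256 : Real.log (256 * Y ^ 2) = 8 * Real.log 2 + 2 * Real.log Y := by
    rw [Real.log_mul (by norm_num) (by positivity), Real.log_pow, show (256 : ℝ) = 2 ^ 8 by norm_num,
      Real.log_pow]; norm_num
  have hl2 := Real.log_two_lt_d9
  have hl2' := Real.log_two_gt_d9
  unfold SS LL
  rcases le_total (256 * Y ^ 2) T with h | h
  · have := Real.log_le_log (by positivity) h
    rw [min_eq_left h, h256]
    constructor
    · exact le_max_of_le_right (by linarith)
    · rw [sub_le_iff_le_add, max_le_iff]; constructor <;> linarith
  · have := Real.log_le_log h0 h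
    rw [min_eq_right h]
    constructor
    · exact le_max_left _ _
    · rw [sub_le_iff_le_add, max_le_iff]; constructor <;> linarith

/-- The leading-order behaviour of a solution, uniformly in space. -/
structure Sol.Asym (a : Par E) (K T k : ℝ) (F : ℝ → E → ℝ) (τ : ℝ) (x : E) : Prop where
  v : |a.vv T k F τ x - (a.P * τ + a.b * ‖x‖ ^ 2 / LL T (YY τ x))| ≤
    K * (τ + ‖x‖ ^ 2 / LL T (YY τ x)) * (√(LL T (YY τ x)))⁻¹
  g : ‖a.gg T F τ x - (2 * a.b / LL T (YY τ x)) • x‖ ≤ K * YY τ x * LL T (YY τ x) ^ (-(5 / 4) : ℝ)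

lemma Sol.abs_BB_SS_sub_le {a : Par E} {A K T k : ℝ} {F : ℝ → E → ℝ} (hK : 0 ≤ K) (h : Sol a A T k F)
    (hs : 12 ≤ -Real.log T)
    (hB : ∀ τ, 0 < τ → τ ≤ T →
      |a.BB T F τ - a.b * (-Real.log τ)⁻¹| ≤ K * (-Real.log τ) ^ (-(3 / 2) : ℝ))
    {τ : ℝ} (hτ : 0 < τ) (hτT : τ ≤ T) (x : E) :
    |a.BB T F (SS T (YY τ x)) - a.b / LL T (YY τ x)| ≤
      (3 * K + 12 * a.b) * LL T (YY τ x) ^ (-(3 / 2) : ℝ) := by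
  have hY := YY_pos hτ x
  obtain ⟨l1, l2⟩ := neg_log_SS h.h0 hY
  have hS := hB (SS T (YY τ x)) (hτ.trans_le (le_SS hτ hτT)) (min_le_right _ _)
  have hL12 : 12 ≤ LL T (YY τ x) := hs.trans (le_max_left _ _)
  have hb := a.b_pos
  set L := LL T (YY τ x)
  set u := -Real.log (SS T (YY τ x))
  have hL0 : 0 < L := by linarith
  have hu : L / 2 ≤ u := by linarith
  have hu0 : 0 < u := by linarith
  have h1 : u ^ (-(3 / 2) : ℝ) ≤ 3 * L ^ (-(3 / 2) : ℝ) := by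
    rw [rpow_neg_three_halves hu0, rpow_neg_three_halves hL0]
    have h2 : (√u)⁻¹ ≤ 3 / 2 * (√L)⁻¹ := by
      rw [← div_eq_mul_inv, inv_eq_one_div, div_le_div_iff₀ (Real.sqrt_pos.2 hu0) (Real.sqrt_pos.2 hL0), one_mul]
      rw [Real.sqrt_le_left (by positivity), mul_pow, Real.sq_sqrt hu0.le]; linarith
    have h3 : u⁻¹ ≤ 2 * L⁻¹ := by
      rw [← div_eq_mul_inv, inv_eq_one_div, div_le_div_iff₀ hu0 hL0]; linarith
    calc u⁻¹ * (√u)⁻¹ ≤ (2 * L⁻¹) * (3 / 2 * (√L)⁻¹) := by gcongr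
      _ = _ := by ring
  have h4 : |a.b * u⁻¹ - a.b / L| ≤ 12 * a.b * L ^ (-(3 / 2) : ℝ) := by
    have e : a.b * u⁻¹ - a.b / L = a.b * (L - u) / (u * L) := by field_simp
    rw [e, abs_of_nonneg (div_nonneg (mul_nonneg hb.le (by linarith)) (by positivity))]
    have h5 : L ^ (-2 : ℝ) ≤ L ^ (-(3 / 2) : ℝ) :=
      Real.rpow_le_rpow_of_exponent_le (by linarith) (by norm_num)
    have h6 : L ^ (-2 : ℝ) = (L ^ 2)⁻¹ := by
      rw [Real.rpow_neg hL0.le, Real.rpow_ofNat]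
    calc a.b * (L - u) / (u * L) ≤ a.b * 6 / (L / 2 * L) := by gcongr; linarith
      _ = 12 * a.b * (L ^ 2)⁻¹ := by field_simp; norm_num
      _ ≤ _ := by rw [← h6]; gcongr
  have h7 := abs_add_le (a.BB T F (SS T (YY τ x)) - a.b * u⁻¹) (a.b * u⁻¹ - a.b / L)
  rw [sub_add_sub_cancel] at h7
  calc _ ≤ K * (3 * L ^ (-(3 / 2) : ℝ)) + 12 * a.b * L ^ (-(3 / 2) : ℝ) :=
        h7.trans (add_le_add (hS.trans (by gcongr)) h4)
    _ = _ := by ring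

lemma Par.exists_asym (a : Par E) {A : ℝ} (hA : 0 ≤ A) : ∃ K s0 : ℝ, 0 ≤ K ∧
    ∀ (T k : ℝ) (F : ℝ → E → ℝ), Sol a A T k F → s0 ≤ -Real.log T → ∀ τ, 0 < τ → τ ≤ T →
      ∀ x, Sol.Asym a K T k F τ x := by
  obtain ⟨K1, hK1, hap⟩ := a.exists_approx hA
  obtain ⟨K2, s0, hK2, hB⟩ := a.exists_BB_expansion hA
  have hb := a.b_pos
  obtain ⟨D, hDdef⟩ : ∃ D, D = 3 * K2 + 12 * a.b := ⟨_, rfl⟩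
  have hD : 0 ≤ D := by rw [hDdef]; positivity
  refine ⟨4 * (K1 + (D + a.b) * (1 + 2 * Module.finrank ℝ E)), max s0 12, by positivity, ?_⟩
  intro T k F h hs τ hτ hτT x
  have hS := Sol.abs_BB_SS_sub_le hK2 h ((le_max_right _ _).trans hs)
    (fun τ hτ hτT => (hB T k F h ((le_max_left _ _).trans hs) τ hτ hτT).2) hτ hτT x
  rw [← hDdef] at hS
  have ha := hap T k F h τ hτ hτT x
  have hv := ha.v
  have hg := ha.g
  have hL1 : 1 ≤ LL T (YY τ x) := one_le_LL h.h0 h.h1 _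
  have hY := YY_eq hτ x
  have hxY := norm_le_YY τ x
  have hY2 : YY τ x ^ 2 ≤ 2 * (τ + ‖x‖ ^ 2) := by
    have : √τ ^ 2 = τ := Real.sq_sqrt hτ.le
    unfold YY
    linarith [sq_nonneg (‖x‖ - √τ), (by ring : (‖x‖ + √τ) ^ 2 = 2 * (√τ ^ 2 + ‖x‖ ^ 2) - (‖x‖ - √τ) ^ 2)]
  have hτW : τ * WW τ x ^ 2 = YY τ x ^ 2 := by rw [hY, mul_pow, Real.sq_sqrt hτ.le]
  rw [hτW] at hv
  rw [← hY] at hg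
  set L := LL T (YY τ x)
  have hL0 : 0 < L := by linarith
  set B := a.BB T F (SS T (YY τ x))
  set Y := YY τ x
  set d : ℝ := ((Module.finrank ℝ E : ℕ) : ℝ) with hdd
  have hd0 : 0 ≤ d := Nat.cast_nonneg _
  have hsq1 : 1 ≤ √L := by rw [← Real.sqrt_one]; exact Real.sqrt_le_sqrt hL1
  have hsqi : 0 < (√L)⁻¹ := by positivity
  have hLi : L⁻¹ ≤ (√L)⁻¹ := by
    apply inv_anti₀ (by positivity); nlinarith [Real.mul_self_sqrt hL0.le]
  have e32 : L ^ (-(3 / 2) : ℝ) = L⁻¹ * (√L)⁻¹ := rpow_neg_three_halves hL0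
  have hLi1 : L⁻¹ ≤ 1 := inv_le_one_of_one_le₀ hL1
  have hY2L : Y ^ 2 * L⁻¹ ≤ 2 * (τ + ‖x‖ ^ 2 / L) := by
    have hi : 0 < L⁻¹ := by positivity
    calc Y ^ 2 * L⁻¹ ≤ 2 * (τ + ‖x‖ ^ 2) * L⁻¹ := by gcongr
      _ = 2 * (τ * L⁻¹ + ‖x‖ ^ 2 / L) := by ring
      _ ≤ 2 * (τ * 1 + ‖x‖ ^ 2 / L) := by gcongr
      _ = _ := by ring
  have hτY : τ + ‖x‖ ^ 2 / L ≥ τ := by have : 0 ≤ ‖x‖ ^ 2 / L := by positivity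
                                       linarith
  set q := τ + ‖x‖ ^ 2 / L
  have hq0 : 0 < q := by linarith
  have hτx : |‖x‖ ^ 2 - 2 * d * τ| ≤ (1 + 2 * d) * (Y ^ 2) := by
    have h1 : τ ≤ Y ^ 2 := by
      have := sqrt_le_YY τ x
      calc τ = √τ ^ 2 := (Real.sq_sqrt hτ.le).symm
        _ ≤ _ := pow_le_pow_left₀ (Real.sqrt_nonneg _) this 2
    have h2 : ‖x‖ ^ 2 ≤ Y ^ 2 := pow_le_pow_left₀ (norm_nonneg _) hxY 2
    have h3 : 2 * d * τ ≤ 2 * d * Y ^ 2 := by gcongr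
    have h4 : 0 ≤ 2 * d * τ := by positivity
    rw [abs_le]; constructor <;> linarith [sq_nonneg ‖x‖, sq_nonneg Y]
  constructor
  · have e : a.vv T k F τ x - (a.P * τ + a.b * ‖x‖ ^ 2 / L) =
        (a.vv T k F τ x - a.P * τ - B * (‖x‖ ^ 2 - 2 * d * τ)) +
          ((B - a.b / L) * (‖x‖ ^ 2 - 2 * d * τ) - 2 * d * a.b * (τ * L⁻¹)) := by ring
    rw [e]
    have h1 : |(B - a.b / L) * (‖x‖ ^ 2 - 2 * d * τ)| ≤ D * (L⁻¹ * (√L)⁻¹) * ((1 + 2 * d) * Y ^ 2) := by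
      rw [abs_mul, ← e32]; exact mul_le_mul hS hτx (abs_nonneg _) (by positivity)
    have h2 : |2 * d * a.b * (τ * L⁻¹)| ≤ 2 * d * a.b * (q * (√L)⁻¹) := by
      rw [abs_of_nonneg (by positivity)]; gcongr
    calc _ ≤ K1 * (Y ^ 2 * (L⁻¹ * (√L)⁻¹)) +
          (D * (L⁻¹ * (√L)⁻¹) * ((1 + 2 * d) * Y ^ 2) + 2 * d * a.b * (q * (√L)⁻¹)) := by
          rw [e32] at hv
          exact (abs_add_le _ _).trans (add_le_add hv ((abs_sub _ _).trans (add_le_add h1 h2)))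
      _ = ((K1 + D * (1 + 2 * d)) * (Y ^ 2 * L⁻¹) + 2 * d * a.b * q) * (√L)⁻¹ := by ring
      _ ≤ ((K1 + D * (1 + 2 * d)) * (2 * q) + 2 * d * a.b * q) * (√L)⁻¹ := by gcongr
      _ ≤ _ := by
        apply mul_le_mul_of_nonneg_right _ hsqi.le
        have : 0 ≤ (2 * K1 + 2 * D * (1 + 2 * d) + a.b * (4 + 6 * d)) * q := by positivity
        linarith
  · have e : a.gg T F τ x - (2 * a.b / L) • x = (a.gg T F τ x - (2 * B) • x) + (2 * (B - a.b / L)) • x := by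
      module
    rw [e]
    have h54 : L ^ (-(3 / 2) : ℝ) ≤ L ^ (-(5 / 4) : ℝ) :=
      Real.rpow_le_rpow_of_exponent_le hL1 (by norm_num)
    have hp : 0 ≤ L ^ (-(5 / 4) : ℝ) := Real.rpow_nonneg hL0.le _
    have h1 : ‖(2 * (B - a.b / L)) • x‖ ≤ 2 * (D * L ^ (-(5 / 4) : ℝ)) * Y := by
      rw [norm_smul, norm_mul, Real.norm_of_nonneg (by norm_num : (0 : ℝ) ≤ 2), Real.norm_eq_abs]
      have := hS.trans (mul_le_mul_of_nonneg_left h54 hD)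
      gcongr
    have hY0 : 0 < Y := YY_pos hτ x
    calc _ ≤ K1 * (Y * L ^ (-(5 / 4) : ℝ)) + 2 * (D * L ^ (-(5 / 4) : ℝ)) * Y :=
          (norm_add_le _ _).trans (add_le_add hg h1)
      _ = (K1 + 2 * D) * (Y * L ^ (-(5 / 4) : ℝ)) := by ring
      _ ≤ (4 * (K1 + (D + a.b) * (1 + 2 * d))) * (Y * L ^ (-(5 / 4) : ℝ)) := by
        apply mul_le_mul_of_nonneg_right _ (by positivity)
        have : 0 ≤ 3 * K1 + 2 * D + 4 * a.b + 8 * (D + a.b) * d := by positivity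
        linarith
      _ = _ := by ring

/-- For small `T` the truncations in the nonlinearity are inactive. -/
lemma Par.exists_clamp_inactive (a : Par E) {A : ℝ} (hA : 0 ≤ A) : ∃ K s0 : ℝ, 0 ≤ K ∧
    ∀ (T k : ℝ) (F : ℝ → E → ℝ), Sol a A T k F → s0 ≤ -Real.log T → ∀ τ, 0 < τ → τ ≤ T →
      ∀ x, Sol.Asym a K T k F τ x ∧ a.c1 * qq T τ x ≤ a.vv T k F τ x ∧
        ‖a.gg T F τ x‖ ≤ a.C1 * YY τ x / LL T (YY τ x) := by
  obtain ⟨K, s0, hK, has⟩ := a.exists_asym hA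
  have hb := a.b_pos
  have hc1 := a.c1_pos
  refine ⟨K, max s0 (max ((K / a.c1) ^ 2) (K ^ 4)), hK, fun T k F h hs τ hτ hτT x => ?_⟩
  have hA := has T k F h ((le_max_left _ _).trans hs) τ hτ hτT x
  have hLT : -Real.log T ≤ LL T (YY τ x) := le_max_left _ _
  have hL1 : 1 ≤ LL T (YY τ x) := one_le_LL h.h0 h.h1 _
  have hK1 : (K / a.c1) ^ 2 ≤ LL T (YY τ x) :=
    (((le_max_left _ _).trans (le_max_right _ _)).trans hs).trans hLT
  have hK2 : K ^ 4 ≤ LL T (YY τ x) :=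
    (((le_max_right _ _).trans (le_max_right _ _)).trans hs).trans hLT
  have hv := hA.v
  have hg := hA.g
  refine ⟨hA, ?_, ?_⟩
  · unfold qq
    set L := LL T (YY τ x)
    have hL0 : 0 < L := by linarith
    have h1 : K * (√L)⁻¹ ≤ a.c1 := by
      have h2 : K / a.c1 ≤ √L := Real.le_sqrt_of_sq_le hK1
      rw [div_le_iff₀ hc1] at h2
      rw [← div_eq_mul_inv, div_le_iff₀ (Real.sqrt_pos.2 hL0)]; linarith
    have hq : 0 ≤ τ + ‖x‖ ^ 2 / L := by positivity
    have h2 : K * (τ + ‖x‖ ^ 2 / L) * (√L)⁻¹ ≤ a.c1 * (τ + ‖x‖ ^ 2 / L) := by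
      calc _ = K * (√L)⁻¹ * (τ + ‖x‖ ^ 2 / L) := by ring
        _ ≤ _ := mul_le_mul_of_nonneg_right h1 hq
    have h3 := (abs_le.1 (hv.trans h2)).1
    have h4 : a.c1 ≤ a.P / 2 := min_le_left _ _
    have h5 : a.c1 ≤ a.b / 4 := min_le_right _ _
    have h6 : 2 * (a.c1 * (τ + ‖x‖ ^ 2 / L)) ≤ a.P * τ + a.b * ‖x‖ ^ 2 / L := by
      have h7 : a.c1 * τ ≤ a.P / 2 * τ := by gcongr
      have hX : 0 ≤ ‖x‖ ^ 2 / L := by positivity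
      have h8 : a.c1 * (‖x‖ ^ 2 / L) ≤ a.b / 4 * (‖x‖ ^ 2 / L) := by gcongr
      have h9 : 0 ≤ a.b * (‖x‖ ^ 2 / L) := by positivity
      rw [mul_div_assoc]; linarith
    linarith
  · have hY := YY_pos hτ x
    have hxY := norm_le_YY τ x
    set L := LL T (YY τ x)
    set Y := YY τ x
    have hL0 : 0 < L := by linarith
    have e : a.gg T F τ x = (a.gg T F τ x - (2 * a.b / L) • x) + (2 * a.b / L) • x := by abel
    rw [e]
    have h1 : ‖(2 * a.b / L) • x‖ ≤ 2 * a.b / L * Y := by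
      rw [norm_smul, Real.norm_of_nonneg (by positivity)]; gcongr
    have h2 : K * L ^ (-(5 / 4) : ℝ) ≤ L⁻¹ := by
      have h3 : K ≤ L ^ (1 / 4 : ℝ) := by
        calc K = (K ^ 4) ^ (1 / 4 : ℝ) := by
              rw [← Real.rpow_natCast, ← Real.rpow_mul hK]; norm_num
          _ ≤ _ := Real.rpow_le_rpow (by positivity) hK2 (by norm_num)
      calc _ ≤ L ^ (1 / 4 : ℝ) * L ^ (-(5 / 4) : ℝ) :=
            mul_le_mul_of_nonneg_right h3 (Real.rpow_nonneg hL0.le _)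
        _ = _ := by rw [← Real.rpow_add hL0, ← Real.rpow_neg_one]; norm_num
    calc _ ≤ K * Y * L ^ (-(5 / 4) : ℝ) + 2 * a.b / L * Y := (norm_add_le _ _).trans (add_le_add hg h1)
      _ = Y * (K * L ^ (-(5 / 4) : ℝ)) + 2 * a.b / L * Y := by ring
      _ ≤ Y * L⁻¹ + 2 * a.b / L * Y := by gcongr
      _ = (2 * a.b + 1) * (Y / L) := by ring
      _ ≤ a.C1 * (Y / L) := by
        unfold Par.C1
        gcongr; linarith
      _ = _ := by ring

end BlowUp

namespace BlowUp

variable {E : Type*} [NormedAddCommGroup E] [InnerProductSpace ℝ E] [FiniteDimensional ℝ E]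
  [MeasurableSpace E] [BorelSpace E]
variable {V : Type*} [NormedAddCommGroup V] [NormedSpace ℝ V]

section Profile

variable {L s y P b c K e v : ℝ}

lemma mul_one_add_le_profile (hr : 0 < s) (hcP : c ≤ P) (hcb : c ≤ b) :
    c * (1 + y ^ 2 / s) ≤ P + b * y ^ 2 / s := by
  have : c * (y ^ 2 / s) ≤ b * (y ^ 2 / s) := by gcongr
  rw [mul_add, mul_one, mul_div_assoc]; linarith

lemma mul_rpow_neg_sub_one {c Z : ℝ} (hc : 0 < c) (hZ : 0 < Z) :
    (c * Z) ^ (-e - 1) * Z = c ^ (-e - 1) * Z ^ (-e) := by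
  rw [Real.mul_rpow hc.le hZ.le, mul_assoc, ← Real.rpow_add_one hZ.ne', sub_add_cancel]

lemma abs_rpow_sub_profile_local_le (hc : 0 < c) (hcP : c ≤ P) (hcb : c ≤ b) (he : 0 ≤ e) (hL : 1 ≤ L)
    (hv : c * (1 + y ^ 2 / L) ≤ v)
    (h : |v - (P + b * y ^ 2 / L)| ≤ K * (1 + y ^ 2 / L) * L ^ (-(1 / 2) : ℝ)) :
    |v ^ (-e) - (P + b * y ^ 2 / L) ^ (-e)| ≤
      e * c ^ (-e - 1) * K * ((1 + y ^ 2 / L) ^ (-e) * L ^ (-(1 / 2) : ℝ)) := by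
  have hZ : 0 < 1 + y ^ 2 / L := by positivity
  refine (abs_rpow_neg_sub_le he (mul_pos hc hZ) hv
    (mul_one_add_le_profile (by linarith) hcP hcb)).trans ?_
  calc _ ≤ e * (c * (1 + y ^ 2 / L)) ^ (-e - 1) * (K * (1 + y ^ 2 / L) * L ^ (-(1 / 2) : ℝ)) := by
        gcongr
    _ = e * K * L ^ (-(1 / 2) : ℝ) * ((c * (1 + y ^ 2 / L)) ^ (-e - 1) * (1 + y ^ 2 / L)) := by ring
    _ = _ := by rw [mul_rpow_neg_sub_one hc hZ]; ring

lemma abs_profile_local_sub_profile_le (hc : 0 < c) (hcP : c ≤ P) (hcb : c ≤ b) (he : 0 ≤ e)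
    (hL : 1 ≤ L) (hLs : L ≤ s) (hs : s ≤ L + 2 * Real.log (1 + y)) :
    |(P + b * y ^ 2 / L) ^ (-e) - (P + b * y ^ 2 / s) ^ (-e)| ≤
      e * c ^ (-e - 1) * (2 * b) * ((1 + y ^ 2 / s) ^ (-e) * (Real.log (1 + y) / L)) := by
  have hL0 : 0 < L := by linarith
  have hs0 : 0 < s := by linarith
  have hb : 0 < b := by linarith
  have hZ : 0 < 1 + y ^ 2 / s := by positivity
  have h1 : P + b * y ^ 2 / s ≤ P + b * y ^ 2 / L := by gcongr
  have h2 := mul_one_add_le_profile (y := y) hs0 hcP hcb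
  refine (abs_rpow_neg_sub_le he (mul_pos hc hZ) (h2.trans h1) h2).trans ?_
  have h3 : |P + b * y ^ 2 / L - (P + b * y ^ 2 / s)| ≤
      2 * b * (1 + y ^ 2 / s) * (Real.log (1 + y) / L) := by
    rw [abs_of_nonneg (by linarith)]
    calc _ = b * (y ^ 2 / s) * ((s - L) / L) := by field_simp; ring
      _ ≤ b * (1 + y ^ 2 / s) * (2 * Real.log (1 + y) / L) := by
        have : 0 ≤ s - L := by linarith
        gcongr
        · linarith
        · linarith
      _ = _ := by ring
  calc _ ≤ e * (c * (1 + y ^ 2 / s)) ^ (-e - 1) *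
          (2 * b * (1 + y ^ 2 / s) * (Real.log (1 + y) / L)) := by gcongr
    _ = e * (2 * b) * (Real.log (1 + y) / L) *
          ((c * (1 + y ^ 2 / s)) ^ (-e - 1) * (1 + y ^ 2 / s)) := by ring
    _ = _ := by rw [mul_rpow_neg_sub_one hc hZ]; ring

lemma abs_rpow_sub_profile_le (hc : 0 < c) (hcP : c ≤ P) (hcb : c ≤ b) (he : 0 ≤ e)
    (hL : 1 ≤ L) (hLs : L ≤ s) (hs : s ≤ L + 2 * Real.log (1 + y))
    (hv : c * (1 + y ^ 2 / L) ≤ v)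
    (h : |v - (P + b * y ^ 2 / L)| ≤ K * (1 + y ^ 2 / L) * L ^ (-(1 / 2) : ℝ)) :
    |v ^ (-e) - (P + b * y ^ 2 / s) ^ (-e)| ≤
      e * c ^ (-e - 1) * K * ((1 + y ^ 2 / L) ^ (-e) * L ^ (-(1 / 2) : ℝ)) +
      e * c ^ (-e - 1) * (2 * b) * ((1 + y ^ 2 / s) ^ (-e) * (Real.log (1 + y) / L)) :=
  (abs_sub_le _ _ _).trans (add_le_add (abs_rpow_sub_profile_local_le hc hcP hcb he hL hv h)
    (abs_profile_local_sub_profile_le hc hcP hcb he hL hLs hs))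

lemma div_le_one_add_sq_div (hr : 1 ≤ s) : y / s ≤ 1 + y ^ 2 / s := by
  have hs : 0 < s := by linarith
  rw [div_le_iff₀ hs, add_mul, div_mul_cancel₀ _ hs.ne']
  nlinarith [sq_nonneg (y - 1)]

lemma norm_gradient_sub_profile_le {G X : V} (hX : ‖X‖ = y) (hc : 0 < c) (hcP : c ≤ P) (hcb : c ≤ b)
    (he : 0 ≤ e) (hK : 0 ≤ K)
    (hL : 1 ≤ L) (hLs : L ≤ s) (hs : s ≤ L + 2 * Real.log (1 + y))
    (hv : c * (1 + y ^ 2 / L) ≤ v)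
    (h : |v - (P + b * y ^ 2 / L)| ≤ K * (1 + y ^ 2 / L) * L ^ (-(1 / 2) : ℝ))
    (hG : ‖G - (2 * b / L) • X‖ ≤ K * (1 + y) * L ^ (-(5 / 4) : ℝ)) :
    ‖v ^ (-e - 1) • G - ((P + b * y ^ 2 / s) ^ (-e - 1) * (2 * b / s)) • X‖ ≤
      (2 * c ^ (-e - 1) * K + (e + 1) * c ^ (-e - 2) * K * (2 * b)) *
        ((1 + y ^ 2 / L) ^ (-e) * L ^ (-(1 / 2) : ℝ)) +
      ((e + 1) * c ^ (-e - 2) * (2 * b) * (2 * b) + c ^ (-e - 1) * (4 * b)) *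
        ((1 + y ^ 2 / s) ^ (-e) * (Real.log (1 + y) / L)) := by
  have hy : 0 ≤ y := hX ▸ norm_nonneg X
  have hL0 : 0 < L := by linarith
  have hs0 : 0 < s := by linarith
  have hb : 0 < b := by linarith
  have hsL : 0 ≤ s - L := by linarith
  have hlog : 0 ≤ Real.log (1 + y) := Real.log_nonneg (by linarith)
  have d1 := abs_rpow_sub_profile_local_le (e := e + 1) hc hcP hcb (by linarith) hL hv h
  have d2 := abs_profile_local_sub_profile_le (y := y) (e := e + 1) hc hcP hcb (by linarith) hL hLs hs
  have ee : -(e + 1) = -e - 1 := by ring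
  have ee2 : -e - 1 - 1 = -e - 2 := by ring
  rw [ee, ee2] at d1 d2
  have hw : P + b * y ^ 2 / s ≤ P + b * y ^ 2 / L := by gcongr
  have hws := mul_one_add_le_profile (y := y) hs0 hcP hcb
  have yL := div_le_one_add_sq_div (y := y) hL
  have ys := div_le_one_add_sq_div (y := y) (hL.trans hLs)
  have hy1 := one_add_sq_le (y := y) hL
  set w := P + b * y ^ 2 / L
  set w' := P + b * y ^ 2 / s
  set Z := 1 + y ^ 2 / L with hZd
  set Z' := 1 + y ^ 2 / s with hZd'
  have hZ : 1 ≤ Z := by rw [hZd]; have : 0 ≤ y ^ 2 / L := by positivity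
                        linarith
  have hZ' : 0 < Z' := by positivity
  have hZ0 : 0 < Z := by linarith
  have m1 : ∀ r : ℝ, 0 < r → r ^ (-e - 1) * r = r ^ (-e) := fun r hr => by
    rw [← Real.rpow_add_one hr.ne', sub_add_cancel]
  have t1 : ‖v ^ (-e - 1) • (G - (2 * b / L) • X)‖ ≤
      2 * c ^ (-e - 1) * K * (Z ^ (-e) * L ^ (-(1 / 2) : ℝ)) := by
    have hv0 : 0 ≤ v := (mul_pos hc hZ0).le.trans hv
    rw [norm_smul, Real.norm_of_nonneg (Real.rpow_nonneg hv0 _)]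
    have q1 : v ^ (-e - 1) ≤ c ^ (-e - 1) * Z ^ (-e - 1) := by
      rw [← Real.mul_rpow hc.le hZ0.le]
      exact Real.rpow_le_rpow_of_nonpos (mul_pos hc hZ0) hv (by linarith)
    have q2 : 1 + y ≤ 2 * (√L * Z) := by
      refine abs_le_of_sq_le_sq' ?_ (by positivity) |>.2
      calc _ ≤ 4 * (L * Z) := hy1
        _ ≤ 4 * (L * Z ^ 2) := by gcongr; nlinarith
        _ = _ := by rw [mul_pow, mul_pow, Real.sq_sqrt hL0.le]; ring
    have q3 : √L * L ^ (-(5 / 4) : ℝ) ≤ L ^ (-(1 / 2) : ℝ) := by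
      rw [Real.sqrt_eq_rpow, ← Real.rpow_add hL0]
      exact Real.rpow_le_rpow_of_exponent_le hL (by norm_num)
    calc _ ≤ (c ^ (-e - 1) * Z ^ (-e - 1)) * (K * (2 * (√L * Z)) * L ^ (-(5 / 4) : ℝ)) := by
          refine mul_le_mul q1 (hG.trans ?_) (norm_nonneg _) (by positivity)
          gcongr
      _ = 2 * c ^ (-e - 1) * K * (Z ^ (-e - 1) * Z * (√L * L ^ (-(5 / 4) : ℝ))) := by ring
      _ ≤ _ := by
        rw [m1 Z hZ0]
        gcongr
  have t2 : ‖((v ^ (-e - 1) - w ^ (-e - 1)) * (2 * b / L)) • X‖ ≤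
      (e + 1) * c ^ (-e - 2) * K * (2 * b) * (Z ^ (-e) * L ^ (-(1 / 2) : ℝ)) := by
    rw [norm_smul, norm_mul, Real.norm_eq_abs, Real.norm_of_nonneg (by positivity : 0 ≤ 2 * b / L), hX]
    calc _ = |v ^ (-e - 1) - w ^ (-e - 1)| * (2 * b * (y / L)) := by ring
      _ ≤ ((e + 1) * c ^ (-e - 2) * K * (Z ^ (-e - 1) * L ^ (-(1 / 2) : ℝ))) * (2 * b * Z) := by gcongr
      _ = (e + 1) * c ^ (-e - 2) * K * (2 * b) * (Z ^ (-e - 1) * Z * L ^ (-(1 / 2) : ℝ)) := by ring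
      _ = _ := by rw [m1 Z hZ0]
  have t3 : ‖((w ^ (-e - 1) - w' ^ (-e - 1)) * (2 * b / s)) • X‖ ≤
      (e + 1) * c ^ (-e - 2) * (2 * b) * (2 * b) * (Z' ^ (-e) * (Real.log (1 + y) / L)) := by
    rw [norm_smul, norm_mul, Real.norm_eq_abs, Real.norm_of_nonneg (by positivity : 0 ≤ 2 * b / s), hX]
    calc _ = |w ^ (-e - 1) - w' ^ (-e - 1)| * (2 * b * (y / s)) := by ring
      _ ≤ ((e + 1) * c ^ (-e - 2) * (2 * b) * (Z' ^ (-e - 1) * (Real.log (1 + y) / L))) *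
          (2 * b * Z') := by gcongr
      _ = (e + 1) * c ^ (-e - 2) * (2 * b) * (2 * b) *
          (Z' ^ (-e - 1) * Z' * (Real.log (1 + y) / L)) := by ring
      _ = _ := by rw [m1 Z' hZ']
  have t4 : ‖(w ^ (-e - 1) * (2 * b / L - 2 * b / s)) • X‖ ≤
      c ^ (-e - 1) * (4 * b) * (Z' ^ (-e) * (Real.log (1 + y) / L)) := by
    have q1 : w ^ (-e - 1) ≤ c ^ (-e - 1) * Z' ^ (-e - 1) := by
      rw [← Real.mul_rpow hc.le hZ'.le]
      exact Real.rpow_le_rpow_of_nonpos (mul_pos hc hZ') (hws.trans hw) (by linarith)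
    have q2 : 2 * b / L - 2 * b / s = 2 * b * ((s - L) / L) * (1 / s) := by field_simp
    have q0 : 0 ≤ w ^ (-e - 1) :=
      Real.rpow_nonneg ((mul_pos hc hZ').le.trans (hws.trans hw)) _
    rw [q2, norm_smul, Real.norm_of_nonneg (by positivity), hX]
    calc _ = w ^ (-e - 1) * (2 * b * ((s - L) / L) * (y / s)) := by ring
      _ ≤ (c ^ (-e - 1) * Z' ^ (-e - 1)) * (2 * b * (2 * Real.log (1 + y) / L) * Z') := by
        gcongr
        linarith
      _ = c ^ (-e - 1) * (4 * b) * (Z' ^ (-e - 1) * Z' * (Real.log (1 + y) / L)) := by ring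
      _ = _ := by rw [m1 Z' hZ']
  have key : v ^ (-e - 1) • G - (w' ^ (-e - 1) * (2 * b / s)) • X =
      v ^ (-e - 1) • (G - (2 * b / L) • X) + ((v ^ (-e - 1) - w ^ (-e - 1)) * (2 * b / L)) • X +
      (((w ^ (-e - 1) - w' ^ (-e - 1)) * (2 * b / s)) • X +
        (w ^ (-e - 1) * (2 * b / L - 2 * b / s)) • X) := by
    module
  rw [key, add_mul (2 * c ^ (-e - 1) * K), add_mul ((e + 1) * c ^ (-e - 2) * (2 * b) * (2 * b))]
  exact (norm_add_le _ _).trans (add_le_add ((norm_add_le _ _).trans (add_le_add t1 t2))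
    ((norm_add_le _ _).trans (add_le_add t3 t4)))

end Profile

end BlowUp

namespace BlowUp

variable {E : Type*} [NormedAddCommGroup E] [InnerProductSpace ℝ E] [FiniteDimensional ℝ E]
  [MeasurableSpace E] [BorelSpace E]

lemma LL_bounds {T τ : ℝ} (h0 : 0 < T) (h1 : T ≤ Real.exp (-1)) (hτ : 0 < τ) (hτT : τ ≤ T) (x : E) :
    1 ≤ LL T (YY τ x) ∧ LL T (YY τ x) ≤ -Real.log τ ∧
      -Real.log τ ≤ LL T (YY τ x) + 2 * Real.log (1 + ‖x‖ / √τ) := by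
  refine ⟨one_le_LL h0 h1 _, LL_le hτ hτT (sqrt_le_YY τ x), ?_⟩
  have h2 : -2 * Real.log (YY τ x) ≤ LL T (YY τ x) := le_max_right _ _
  have hW : 0 < 1 + ‖x‖ / √τ := by positivity
  rw [YY_eq hτ, Real.log_mul (Real.sqrt_pos.2 hτ).ne' (by exact hW.ne'), Real.log_sqrt hτ.le] at h2
  rw [YY_eq hτ]
  unfold WW at h2 ⊢
  linarith

lemma Par.exists_profile_estimate (a : Par E) {K β κ : ℝ} (hK : 0 ≤ K) (hβ : 0 ≤ β) (hκ : 0 < κ)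
    (hκ1 : κ ≤ 1 / 2) : ∃ C, 0 < C ∧ ∀ e, e = β / 2 + κ → ∀ T k F, 0 < T → T ≤ Real.exp (-1) →
    ∀ τ, 0 < τ → τ ≤ T → ∀ x, Sol.Asym a K T k F τ x → a.c1 * qq T τ x ≤ a.vv T k F τ x →
    |a.vv T k F τ x ^ (-e) - τ ^ (-e) * (a.P + a.b * (‖x‖ / √τ) ^ 2 / -Real.log τ) ^ (-e)| ≤
      C * τ ^ (-e) * ((1 + ‖x‖ / √τ) ^ (-β) * (-Real.log τ) ^ (-((1 - β) / 2))) ∧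
    ‖a.vv T k F τ x ^ (-e - 1) • a.gg T F τ x -
      (τ ^ (-(1 / 2) - e) * ((a.P + a.b * (‖x‖ / √τ) ^ 2 / -Real.log τ) ^ (-e - 1) *
        (2 * a.b / -Real.log τ))) • (√τ)⁻¹ • x‖ ≤
      C * τ ^ (-(1 / 2) - e) * ((1 + ‖x‖ / √τ) ^ (-β) * (-Real.log τ) ^ (-((1 - β) / 2))) := by
  have hc := a.c1_pos
  have hb := a.b_pos
  have hcP : a.c1 ≤ a.P := (min_le_left _ _).trans (by linarith [a.hP])
  have hcb : a.c1 ≤ a.b := (min_le_right _ _).trans (by linarith)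
  set e₀ := β / 2 + κ with he₀
  have he : 0 ≤ e₀ := by positivity
  set M := 2 ^ β * √(1 + 4 / (2 * κ))
  set M' := 2 ^ β * ((1 + 4 / (κ / 2)) ^ 2 * (2 / κ))
  have hM : 0 ≤ M := by positivity
  have hM' : 0 ≤ M' := by positivity
  set A₁ := e₀ * a.c1 ^ (-e₀ - 1) * K
  set A₂ := e₀ * a.c1 ^ (-e₀ - 1) * (2 * a.b)
  set B₁ := 2 * a.c1 ^ (-e₀ - 1) * K + (e₀ + 1) * a.c1 ^ (-e₀ - 2) * K * (2 * a.b)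
  set B₂ := (e₀ + 1) * a.c1 ^ (-e₀ - 2) * (2 * a.b) * (2 * a.b) + a.c1 ^ (-e₀ - 1) * (4 * a.b)
  have hA1 : 0 ≤ A₁ := by positivity
  have hA2 : 0 ≤ A₂ := by positivity
  have hB1 : 0 ≤ B₁ := by positivity
  have hB2 : 0 ≤ B₂ := by positivity
  refine ⟨A₁ * M + A₂ * M' + (B₁ * M + B₂ * M') + 1, by positivity, ?_⟩
  rintro e rfl T k F h0 h1 τ hτ hτT x ⟨hv, hg⟩ hl
  obtain ⟨hL, hLs, hs⟩ := LL_bounds h0 h1 hτ hτT x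
  have hy : 0 ≤ ‖x‖ / √τ := by positivity
  have w1 := local_weight_le hL hLs hy hs hβ hκ hκ1 he₀
  have w2 := profile_weight_le hL hLs hy hs hβ hκ hκ1 he₀
  have hr : 0 < √τ := Real.sqrt_pos.2 hτ
  have hrr : √τ ^ 2 = τ := Real.sq_sqrt hτ.le
  have hyx : ‖x‖ = √τ * (‖x‖ / √τ) := by field_simp
  have hX : ‖(√τ)⁻¹ • x‖ = ‖x‖ / √τ := by
    rw [norm_smul, norm_inv, Real.norm_of_nonneg hr.le]; ring
  have hYY : YY τ x = √τ * (1 + ‖x‖ / √τ) := YY_eq hτ x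
  set v := a.vv T k F τ x
  set g := a.gg T F τ x
  unfold qq at hl
  set L := LL T (YY τ x)
  set s := -Real.log τ
  set y := ‖x‖ / √τ
  set X := (√τ)⁻¹ • x with hXd
  have hxX : x = √τ • X := by rw [hXd, smul_smul, mul_inv_cancel₀ hr.ne', one_smul]
  have hL0 : 0 < L := by linarith
  have hx2 : ‖x‖ ^ 2 = τ * y ^ 2 := by rw [hyx, mul_pow, hrr]
  have hsq : (√L)⁻¹ = L ^ (-(1 / 2) : ℝ) := by rw [Real.sqrt_eq_rpow, Real.rpow_neg hL0.le]
  have hvτ : v = τ * (v / τ) := by field_simp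
  have hV : a.c1 * (1 + y ^ 2 / L) ≤ v / τ := by
    rw [le_div_iff₀ hτ]
    calc _ = a.c1 * (τ + ‖x‖ ^ 2 / L) := by rw [hx2]; ring
      _ ≤ _ := hl
  have hV0 : 0 ≤ v / τ := le_trans (by positivity) hV
  have hVd : |v / τ - (a.P + a.b * y ^ 2 / L)| ≤ K * (1 + y ^ 2 / L) * L ^ (-(1 / 2) : ℝ) := by
    have e1 : v / τ - (a.P + a.b * y ^ 2 / L) = (v - (a.P * τ + a.b * ‖x‖ ^ 2 / L)) / τ := by
      rw [hx2]; field_simp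
    rw [e1, abs_div, abs_of_pos hτ, div_le_iff₀ hτ, ← hsq]
    calc _ ≤ _ := hv
      _ = _ := by rw [hx2]; ring
  have hgG : g = √τ • ((√τ)⁻¹ • g) := by rw [smul_smul, mul_inv_cancel₀ hr.ne', one_smul]
  have hG : ‖(√τ)⁻¹ • g - (2 * a.b / L) • X‖ ≤ K * (1 + y) * L ^ (-(5 / 4) : ℝ) := by
    have e1 : (√τ)⁻¹ • g - (2 * a.b / L) • X = (√τ)⁻¹ • (g - (2 * a.b / L) • x) := by
      rw [hXd]; module
    rw [e1, norm_smul, norm_inv, Real.norm_of_nonneg hr.le, inv_mul_le_iff₀ hr]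
    calc _ ≤ _ := hg
      _ = _ := by rw [hYY]; ring
  set w := a.P + a.b * y ^ 2 / s
  have p1 := abs_rpow_sub_profile_le hc hcP hcb he hL hLs hs hV hVd
  have p2 := norm_gradient_sub_profile_le hX hc hcP hcb he hK hL hLs hs hV hVd hG
  set R := (1 + y) ^ (-β) * s ^ (-((1 - β) / 2))
  have hR : 0 ≤ R := by
    have : 0 ≤ s := by linarith
    positivity
  have q1 : A₁ * ((1 + y ^ 2 / L) ^ (-e₀) * L ^ (-(1 / 2) : ℝ)) ≤ A₁ * (M * R) := by gcongr
  have q2 : A₂ * ((1 + y ^ 2 / s) ^ (-e₀) * (Real.log (1 + y) / L)) ≤ A₂ * (M' * R) := by gcongr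
  have q3 : B₁ * ((1 + y ^ 2 / L) ^ (-e₀) * L ^ (-(1 / 2) : ℝ)) ≤ B₁ * (M * R) := by gcongr
  have q4 : B₂ * ((1 + y ^ 2 / s) ^ (-e₀) * (Real.log (1 + y) / L)) ≤ B₂ * (M' * R) := by gcongr
  have r1 : 0 ≤ A₁ * M * R := by positivity
  have r2 : 0 ≤ A₂ * M' * R := by positivity
  have r3 : 0 ≤ B₁ * M * R := by positivity
  have r4 : 0 ≤ B₂ * M' * R := by positivity
  constructor
  · rw [hvτ, Real.mul_rpow hτ.le hV0, ← mul_sub, abs_mul, abs_of_nonneg (Real.rpow_nonneg hτ.le _)]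
    have := p1.trans (add_le_add q1 q2)
    calc _ ≤ τ ^ (-e₀) * ((A₁ * M + A₂ * M' + (B₁ * M + B₂ * M') + 1) * R) := by
          gcongr
          refine this.trans ?_
          linarith
      _ = _ := by ring
  · have e1 : v ^ (-e₀ - 1) • g - (τ ^ (-(1 / 2) - e₀) * (w ^ (-e₀ - 1) * (2 * a.b / s))) • X =
        τ ^ (-(1 / 2) - e₀) • ((v / τ) ^ (-e₀ - 1) • ((√τ)⁻¹ • g) - (w ^ (-e₀ - 1) * (2 * a.b / s)) • X) := by
      have e2 : v ^ (-e₀ - 1) = τ ^ (-(1 / 2) - e₀) * (√τ)⁻¹ * (v / τ) ^ (-e₀ - 1) := by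
        rw [Real.sqrt_eq_rpow, ← Real.rpow_neg hτ.le, ← Real.rpow_add hτ]
        conv_lhs => rw [hvτ, Real.mul_rpow hτ.le hV0]
        congr 2; ring
      rw [e2, smul_sub]
      module
    rw [e1, norm_smul, Real.norm_of_nonneg (Real.rpow_nonneg hτ.le _)]
    have := p2.trans (add_le_add q3 q4)
    calc _ ≤ τ ^ (-(1 / 2) - e₀) * ((A₁ * M + A₂ * M' + (B₁ * M + B₂ * M') + 1) * R) := by
          gcongr
          refine this.trans ?_
          linarith
      _ = _ := by ring

end BlowUp

namespace BlowUp

lemma hasGradientAt_rpow_neg {E : Type*} [NormedAddCommGroup E] [InnerProductSpace ℝ E]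
    [CompleteSpace E] {v : E → ℝ} {g x : E} (e : ℝ)
    (hv : 0 < v x) (h : HasFDerivAt v (innerSL ℝ g) x) :
    HasGradientAt (fun x => v x ^ (-e)) ((-e * v x ^ (-e - 1)) • g) x := by
  rw [hasGradientAt_iff_hasFDerivAt]
  refine (h.rpow_const (p := -e) (Or.inl hv.ne')).congr_fderiv ?_
  ext z
  simp

lemma gradient_profF {N : ℕ} {p : ℝ} (hp : 1 < p) (z : EuclideanSpace ℝ (Fin N)) :
    gradient (profF N p) z = (-(1 / (p - 1)) * (p - 1 + (p - 1) ^ 2 / (4 * p) * ‖z‖ ^ 2) ^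
      (-(1 / (p - 1)) - 1) * (2 * ((p - 1) ^ 2 / (4 * p)))) • z := by
  have hb : 0 ≤ (p - 1) ^ 2 / (4 * p) := by positivity
  have h1 := ((hasStrictFDerivAt_norm_sq z).hasFDerivAt.const_mul ((p - 1) ^ 2 / (4 * p))).const_add (p - 1)
  have h2 : HasFDerivAt (fun z : EuclideanSpace ℝ (Fin N) => p - 1 + (p - 1) ^ 2 / (4 * p) * ‖z‖ ^ 2)
      (innerSL ℝ ((2 * ((p - 1) ^ 2 / (4 * p))) • z)) z := by
    refine h1.congr_fderiv ?_
    ext w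
    simp
    ring
  have hv : 0 < p - 1 + (p - 1) ^ 2 / (4 * p) * ‖z‖ ^ 2 := by
    have : 0 < p - 1 := by linarith
    positivity
  have := (hasGradientAt_rpow_neg
    (v := fun z : EuclideanSpace ℝ (Fin N) => p - 1 + (p - 1) ^ 2 / (4 * p) * ‖z‖ ^ 2)
    (1 / (p - 1)) hv h2).gradient
  unfold profF
  rw [this, smul_smul]

/-- The solution of the truncated problem solves the untruncated one. -/
structure Sol.Good {E : Type*} [NormedAddCommGroup E] [InnerProductSpace ℝ E] [FiniteDimensional ℝ E]
    [MeasurableSpace E] [BorelSpace E] (a : Par E) (A T k : ℝ) (F : ℝ → E → ℝ) : Prop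
    extends Sol a A T k F where
  low : ∀ τ, 0 < τ → τ ≤ T → ∀ x, a.c1 * qq T τ x ≤ a.vv T k F τ x
  up : ∀ τ, 0 < τ → τ ≤ T → ∀ x, ‖a.gg T F τ x‖ ≤ a.C1 * YY τ x / LL T (YY τ x)

namespace Sol.Good

section General
variable {E : Type*} [NormedAddCommGroup E] [InnerProductSpace ℝ E] [FiniteDimensional ℝ E]
  [MeasurableSpace E] [BorelSpace E]
variable {a : Par E} {A T k τ : ℝ} {F : ℝ → E → ℝ} (h : Sol.Good a A T k F)
  (hτ : 0 < τ) (hT : τ ≤ T)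
include h hτ hT

lemma vv_pos (x : E) : 0 < a.vv T k F τ x :=
  (mul_pos a.c1_pos (Par.qq_pos h.h0 h.h1 hτ x)).trans_le (h.low τ hτ hT x)

lemma F_eq (x : E) : F τ x = a.c * ‖a.gg T F τ x‖ ^ 2 / a.vv T k F τ x +
    a.μ * ‖a.gg T F τ x‖ * ∫ y in Metric.ball (0 : E) ‖x‖, a.vv T k F τ y ^ (-a.m) := by
  have hv : a.vcl T τ (a.vv T k F τ) = a.vv T k F τ :=
    funext fun y => max_eq_left (h.low τ hτ hT y)
  have hg : a.Gcl T τ ‖a.gg T F τ x‖ x = ‖a.gg T F τ x‖ := by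
    unfold Par.Gcl
    rw [abs_norm]
    exact min_eq_left (h.up τ hτ hT x)
  rw [h.fix τ hτ hT x]
  unfold Par.src Par.Ftr Par.nl
  rw [hv, hg]

lemma gradient_eq (e : ℝ) (x : E) : gradient (fun x => a.vv T k F τ x ^ (-e)) x =
    (-e * a.vv T k F τ x ^ (-e - 1)) • a.gg T F τ x :=
  (hasGradientAt_rpow_neg e (h.vv_pos hτ hT x) (h.hasFDerivAt_vv hτ hT x)).gradient

lemma contDiff_rpow (e : ℝ) : ContDiff ℝ 2 (fun x => a.vv T k F τ x ^ (-e)) :=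
  (h.contDiff_vv hτ hT).rpow_const_of_ne fun x => (h.vv_pos hτ hT x).ne'

end General

section Time
variable {E : Type*} [NormedAddCommGroup E] [InnerProductSpace ℝ E] [FiniteDimensional ℝ E]
  [MeasurableSpace E] [BorelSpace E]
variable {a : Par E} {A T k S t : ℝ} {F : ℝ → E → ℝ} (h : Sol.Good a A T k F) (hS : S < T)
include h

lemma hasDerivAt_time (e : ℝ) (ht : S - T < t) (htS : t < S) (x : E) :
    HasDerivAt (fun t => a.vv T k F (S - t) x ^ (-e))
      (e * a.vv T k F (S - t) x ^ (-e - 1) * (a.P - 2 * Module.finrank ℝ E * a.B0 T +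
        (F (S - t) x + Kop lgau F T (S - t) x))) t := by
  have hτ : 0 < S - t := by linarith
  have hT : S - t < T := by linarith
  have h1 := h.hasDerivAt_vv hτ hT x
  have h2 := (h1.comp_const_sub S t).rpow_const (p := -e) (Or.inl (h.vv_pos hτ hT.le x).ne')
  convert h2 using 1
  ring

include hS in
lemma contDiffOn_time (e : ℝ) (x : E) :
    ContDiffOn ℝ 1 (fun t => a.vv T k F (S - t) x ^ (-e)) (Ico 0 S) := by
  have hsub : Ico 0 S ⊆ Ioo (S - T) S := fun t ht => ⟨by linarith [ht.1], ht.2⟩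
  refine ContDiffOn.mono ?_ hsub
  have hd : ∀ t ∈ Ioo (S - T) S, _ := fun t ht => h.hasDerivAt_time e ht.1 ht.2 x
  have hm : MapsTo (fun t => S - t) (Ioo (S - T) S) (Ioc 0 T) := fun t ht =>
    ⟨by simpa using ht.2, by have := ht.1; simp only; linarith⟩
  have hcv : ContinuousOn (fun t => a.vv T k F (S - t) x) (Ioo (S - T) S) := fun t ht => by
    have hτ := (hm ht).1
    have hT : (fun t => S - t) t < T := by simp only; linarith [ht.1]
    exact ((h.hasDerivAt_vv hτ hT x).comp_const_sub S t).continuousAt.continuousWithinAt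
  rw [show (1 : WithTop ℕ∞) = 0 + 1 by simp, contDiffOn_succ_iff_deriv_of_isOpen isOpen_Ioo]
  refine ⟨fun t ht => (hd t ht).differentiableAt.differentiableWithinAt, by simp, ?_⟩
  rw [contDiffOn_zero]
  refine ContinuousOn.congr ?_ fun t ht => (hd t ht).deriv
  refine ContinuousOn.mul (continuousOn_const.mul (hcv.rpow_const fun t ht =>
    Or.inl (h.vv_pos (hm ht).1 (hm ht).2 x).ne')) ?_
  exact (h.continuousOn_dt x).comp (by fun_prop) hm

end Time

section Euclidean
variable {N : ℕ} {a : Par (EuclideanSpace ℝ (Fin N))} {A T k τ : ℝ}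
  {F : ℝ → EuclideanSpace ℝ (Fin N) → ℝ} (h : Sol.Good a A T k F)
  (hτ : 0 < τ) (hT : τ ≤ T)
include h hτ hT

lemma lapl_eq (e : ℝ) (x : EuclideanSpace ℝ (Fin N)) : lapl (fun x => a.vv T k F τ x ^ (-e)) x =
    e * (e + 1) * a.vv T k F τ x ^ (-e - 1 - 1) * ‖a.gg T F τ x‖ ^ 2 -
      e * a.vv T k F τ x ^ (-e - 1) * (2 * N * a.B0 T - Kop lgau F T τ x) := by
  set v := a.vv T k F τ with hv
  set g := a.gg T F τ with hg
  have hp := h.vv_pos hτ hT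
  have h1 : ∀ z w, fderiv ℝ (fun x => v x ^ (-e)) z w = -e * v z ^ (-e - 1) * inner ℝ (g z) w := by
    intro z w
    rw [((h.hasFDerivAt_vv hτ hT z).rpow_const (p := -e) (Or.inl (hp z).ne')).fderiv]
    simp
    rfl
  set b := EuclideanSpace.basisFun (Fin N) ℝ
  have h2 : ∀ i, fderiv ℝ (fun z => fderiv ℝ (fun x => v x ^ (-e)) z (b i)) x (b i) =
      e * (e + 1) * v x ^ (-e - 1 - 1) * inner ℝ (g x) (b i) ^ 2 -
        e * v x ^ (-e - 1) * (2 * a.B0 T - inner ℝ (b i) (Kop hgau F T τ x (b i))) := by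
    intro i
    have d1 := ((h.hasFDerivAt_vv hτ hT x).rpow_const (p := -e - 1) (Or.inl (hp x).ne')).const_mul (-e)
    have d2 := (h.hasFDerivAt_gg hτ hT x).inner ℝ (hasFDerivAt_const (b i) x)
    have d3 : HasFDerivAt (fun z => -e * v z ^ (-e - 1) * inner ℝ (g z) (b i)) _ x := d1.mul d2
    simp only [h1]
    rw [d3.fderiv]
    simp [inner_sub_right, inner_smul_right, real_inner_comm (b i), ← hv, ← hg]
    ring
  unfold lapl
  have h3 : ∀ i, EuclideanSpace.single i (1 : ℝ) = b i := fun i => by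
    simp [b, EuclideanSpace.basisFun_apply]
  simp only [h3]
  rw [Finset.sum_congr rfl fun i _ => h2 i, Finset.sum_sub_distrib, ← Finset.mul_sum,
    ← Finset.mul_sum, Finset.sum_sub_distrib, h.trace_Kop hτ hT x b]
  congr 2
  · rw [← b.sum_sq_norm_inner_left]
    simp
  · simp
    ring

end Euclidean

end Sol.Good

end BlowUp

namespace BlowUp

lemma Sol.Good.pde {N : ℕ} {a : Par (EuclideanSpace ℝ (Fin N))} {A T k τ : ℝ}
    {F : ℝ → EuclideanSpace ℝ (Fin N) → ℝ} (h : Sol.Good a A T k F) (hτ : 0 < τ) (hT : τ ≤ T)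
    {e r : ℝ} (he : e * a.P = 1) (hr : e * r = a.m) (x : EuclideanSpace ℝ (Fin N)) :
    e * a.vv T k F τ x ^ (-e - 1) * (a.P - 2 * Module.finrank ℝ (EuclideanSpace ℝ (Fin N)) * a.B0 T +
        (F τ x + Kop lgau F T τ x)) =
      lapl (fun x => a.vv T k F τ x ^ (-e)) x +
        |a.vv T k F τ x ^ (-e)| ^ a.P * a.vv T k F τ x ^ (-e) +
        a.μ * ‖gradient (fun x => a.vv T k F τ x ^ (-e)) x‖ *
          ∫ y in Metric.ball (0 : EuclideanSpace ℝ (Fin N)) ‖x‖, |a.vv T k F τ y ^ (-e)| ^ r := by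
  have hp := h.vv_pos hτ hT
  have hP := a.hP
  have he0 : 0 < e := by
    by_contra hn
    nlinarith
  have hc : a.c = e + 1 := by
    unfold Par.c
    rw [div_eq_iff hP.ne']
    linarith
  have h1 : ∀ y ρ, |a.vv T k F τ y ^ (-e)| ^ ρ = a.vv T k F τ y ^ (-(e * ρ)) := fun y ρ => by
    rw [abs_of_pos (Real.rpow_pos_of_pos (hp y) _), ← Real.rpow_mul (hp y).le, neg_mul]
  have h2 : a.vv T k F τ x ^ (-1 : ℝ) * a.vv T k F τ x ^ (-e) = a.vv T k F τ x ^ (-e - 1) := by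
    rw [← Real.rpow_add (hp x)]; congr 1; ring
  have h3 : a.vv T k F τ x ^ (-e - 1 - 1) = a.vv T k F τ x ^ (-e - 1) / a.vv T k F τ x :=
    Real.rpow_sub_one (hp x).ne' _
  rw [h.lapl_eq hτ hT, h.gradient_eq hτ hT, norm_smul, norm_mul, norm_neg, Real.norm_of_nonneg he0.le,
    Real.norm_of_nonneg (Real.rpow_nonneg (hp x).le _), h1, he, h2, h3, h.F_eq hτ hT x, hc,
    finrank_euclideanSpace_fin]
  simp only [h1, hr]
  linear_combination (a.vv T k F τ x ^ (-e - 1)) * he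

lemma Sol.Good.blowUp {E : Type*} [NormedAddCommGroup E] [InnerProductSpace ℝ E]
    [FiniteDimensional ℝ E] [MeasurableSpace E] [BorelSpace E] {a : Par E} {A K T k e : ℝ}
    {F : ℝ → E → ℝ} (h : Sol.Good a A T k F) (hK : 0 ≤ K) (he : 0 < e)
    (hv : ∀ τ, 0 < τ → τ ≤ T → Sol.Asym a K T k F τ 0) {S : ℝ} (hS : 0 < S) (hST : S ≤ T) (M : ℝ) :
    ∃ t₀ ∈ Ico 0 S, ∀ t ∈ Ico t₀ S, M ≤ |a.vv T k F (S - t) 0 ^ (-e)| := by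
  have hP := a.hP
  set D := a.P + K with hD
  have hD0 : 0 < D := by positivity
  have hup : ∀ τ, 0 < τ → τ ≤ T → a.vv T k F τ 0 ≤ D * τ := by
    intro τ hτ hT
    have h1 := (abs_le.1 (hv τ hτ hT).v).2
    have h2 := one_le_LL h.h0 h.h1 (YY τ (0 : E))
    have h3 : (√(LL T (YY τ (0 : E))))⁻¹ ≤ 1 := inv_le_one_of_one_le₀ (Real.one_le_sqrt.2 h2)
    simp only [norm_zero, ne_eq, OfNat.ofNat_ne_zero, not_false_eq_true, zero_pow, mul_zero, zero_div,
      add_zero] at h1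
    have h4 : K * τ * (√(LL T (YY τ (0 : E))))⁻¹ ≤ K * τ * 1 := by gcongr
    linarith
  set M' := max M 1
  have hM' : 0 < M' := lt_max_of_lt_right one_pos
  set ρ := M' ^ (-(1 / e)) / D with hρ
  have hρ0 : 0 < ρ := by positivity
  refine ⟨max 0 (S - ρ), ⟨le_max_left _ _, max_lt hS (by linarith)⟩, fun t ht => ?_⟩
  have ht0 : 0 ≤ t := (le_max_left _ _).trans ht.1
  have htρ : S - ρ ≤ t := (le_max_right _ _).trans ht.1
  have hτ : 0 < S - t := by linarith [ht.2]
  have hτT : S - t ≤ T := by linarith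
  have hp := h.vv_pos hτ hτT 0
  have h1 : a.vv T k F (S - t) 0 ≤ M' ^ (-(1 / e)) := by
    calc _ ≤ D * (S - t) := hup _ hτ hτT
      _ ≤ D * ρ := by gcongr; linarith
      _ = _ := by rw [hρ]; field_simp
  rw [abs_of_pos (Real.rpow_pos_of_pos hp _)]
  calc M ≤ M' := le_max_left _ _
    _ = (M' ^ (-(1 / e))) ^ (-e) := by
      rw [← Real.rpow_mul hM'.le]
      rw [show -(1 / e) * -e = 1 by field_simp, Real.rpow_one]
    _ ≤ _ := Real.rpow_le_rpow_of_nonpos hp h1 (by linarith)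

lemma profile_weight_comparison {τ β y s : ℝ} {n : ℝ} (hτ : 0 < τ) (hβ : 0 ≤ β) (hn : 0 ≤ n)
    (hy : y = n / √τ) (hs : 0 < s) :
    (1 + y) ^ (-β) * s ^ (-((1 - β) / 2)) ≤
      2 / ((1 + (n ^ 2 / τ) ^ (β / 2)) * s ^ ((1 - β) / 2)) := by
  have hy0 : 0 ≤ y := by rw [hy]; positivity
  have h1 : n ^ 2 / τ = y ^ 2 := by rw [hy, div_pow, Real.sq_sqrt hτ.le]
  have h2 : (y ^ 2) ^ (β / 2) = y ^ β := by
    rw [← Real.rpow_natCast, ← Real.rpow_mul hy0]; congr 1; push_cast; ring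
  have h3 : 1 ≤ (1 + y) ^ β := Real.one_le_rpow (by linarith) hβ
  have h4 : y ^ β ≤ (1 + y) ^ β := Real.rpow_le_rpow hy0 (by linarith) hβ
  have hs' := Real.rpow_pos_of_pos hs ((1 - β) / 2)
  have h5 : 0 ≤ y ^ β := Real.rpow_nonneg hy0 _
  rw [h1, h2, Real.rpow_neg (by positivity), Real.rpow_neg hs.le, ← mul_inv, ← one_div,
    div_le_div_iff₀ (by positivity) (by positivity), one_mul, ← mul_assoc]
  gcongr
  linarith

end BlowUp

theorem stmt_0 (N : ℕ) (hN : 1 ≤ N) (μ p q β : ℝ) (hp : 3 < p)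
    (hq1 : (N : ℝ) * (p - 1) / 2 + 1 < q) (hq2 : q < (N : ℝ) * (p - 1) / 2 + (p + 1) / 2)
    (hβ0 : μ = 0 → 0 < β ∧ β < 2 / (p - 1))
    (hβ1 : μ ≠ 0 → (N : ℝ) / (q - 1) < β ∧ β < 2 / (p - 1)) :
    ∃ (T C : ℝ) (u : ℝ → EuclideanSpace ℝ (Fin N) → ℝ),
      0 < T ∧ T < 1 ∧ 0 < C ∧
      -- regularity: C¹ in time, C² in space
      (∀ t ∈ Ico (0 : ℝ) T, ContDiff ℝ 2 (u t)) ∧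
      (∀ x, ContDiffOn ℝ 1 (fun τ => u τ x) (Ico (0 : ℝ) T)) ∧
      -- (1) the PDE
      (∀ t ∈ Ico (0 : ℝ) T, ∀ x,
        deriv (fun τ => u τ x) t =
          lapl (u t) x + |u t x| ^ (p - 1) * u t x +
            μ * ‖gradient (u t) x‖ *
              ∫ y in Metric.ball (0 : EuclideanSpace ℝ (Fin N)) ‖x‖, |u t y| ^ (q - 1)) ∧
      -- (2) blow-up at time T : sup_x |u(x,t)| → ∞ as t → T⁻
      (∀ M : ℝ, ∃ t₀ ∈ Ico (0 : ℝ) T, ∀ t ∈ Ico t₀ T, ∃ x, M ≤ |u t x|) ∧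
      -- (3) convergence to the profile
      (∀ t ∈ Ico (0 : ℝ) T, ∀ x,
        |u t x - (T - t) ^ (-(1 / (p - 1))) *
            profF N p ((Real.sqrt ((T - t) * |Real.log (T - t)|))⁻¹ • x)| ≤
          C * (T - t) ^ (-(1 / (p - 1))) /
            ((1 + (‖x‖ ^ 2 / (T - t)) ^ (β / 2)) * |Real.log (T - t)| ^ ((1 - β) / 2))) ∧
      -- (4) convergence of the gradient
      (∀ t ∈ Ico (0 : ℝ) T, ∀ x,
        ‖gradient (u t) x -
            ((T - t) ^ (-(1 / 2 : ℝ) - 1 / (p - 1)) * |Real.log (T - t)| ^ (-(1 / 2) : ℝ)) •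
              gradient (profF N p) ((Real.sqrt ((T - t) * |Real.log (T - t)|))⁻¹ • x)‖ ≤
          C * (T - t) ^ (-(1 / 2 : ℝ) - 1 / (p - 1)) /
            ((1 + (‖x‖ ^ 2 / (T - t)) ^ (β / 2)) * |Real.log (T - t)| ^ ((1 - β) / 2))) := by
  have hP : 0 < p - 1 := by linarith
  have hN1 : (1 : ℝ) ≤ N := by exact_mod_cast hN
  have hβ : 0 < β ∧ β < 2 / (p - 1) := by
    by_cases h : μ = 0
    · exact hβ0 h
    · refine ⟨lt_of_le_of_lt ?_ (hβ1 h).1, (hβ1 h).2⟩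
      have : 0 < (N : ℝ) * (p - 1) / 2 := by positivity
      exact div_nonneg (by linarith) (by linarith)
  obtain ⟨hβ, hβ2⟩ := hβ
  let a : BlowUp.Par (EuclideanSpace ℝ (Fin N)) :=
    { P := p - 1
      μ := μ
      m := (q - 1) / (p - 1)
      hP := hP
      hd := by rw [finrank_euclideanSpace_fin]; omega
      hm1 := by rw [finrank_euclideanSpace_fin, lt_div_iff₀ hP]; linarith
      hm2 := by rw [finrank_euclideanSpace_fin, div_lt_iff₀ hP]; linarith }
  have haP : a.P = p - 1 := rfl
  have hb : a.b = (p - 1) ^ 2 / (4 * p) := by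
    unfold BlowUp.Par.b
    rw [haP]; ring
  set e := 1 / (p - 1) with he
  have he0 : 0 < e := by positivity
  have he1 : e < 1 / 2 := by
    rw [he, div_lt_div_iff₀ hP two_pos]; linarith
  have heP : e * a.P = 1 := by rw [haP, he]; field_simp
  have her : e * (q - 1) = a.m := by
    change e * (q - 1) = (q - 1) / (p - 1)
    rw [he]; ring
  have h2e : 2 / (p - 1) = 2 * e := by rw [he]; ring
  obtain ⟨A, hA, hsol⟩ := a.exists_sol
  obtain ⟨K, s0, hK, hcl⟩ := a.exists_clamp_inactive hA.le
  obtain ⟨C, hC, hest⟩ := a.exists_profile_estimate (β := β) (κ := e - β / 2) hK hβ.le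
    (by linarith) (by linarith)
  set T := Real.exp (-(max s0 1)) with hT
  have hT0 : 0 < T := Real.exp_pos _
  have hT1 : T ≤ Real.exp (-1) := Real.exp_le_exp.2 (neg_le_neg (le_max_right _ _))
  have hTs : s0 ≤ -Real.log T := by rw [hT, Real.log_exp, neg_neg]; exact le_max_left _ _
  have hT2 : T < 1 := hT1.trans_lt (Real.exp_zero ▸ Real.exp_lt_exp.2 (by norm_num))
  obtain ⟨k, F, hF⟩ := hsol T hT0 hT1
  have hcl' := hcl T k F hF hTs
  have hG : BlowUp.Sol.Good a A T k F :=
    { hF with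
      low := fun τ h1 h2 x => (hcl' τ h1 h2 x).2.1
      up := fun τ h1 h2 x => (hcl' τ h1 h2 x).2.2 }
  set S := T / 2 with hS
  have hS0 : 0 < S := by positivity
  have hST : S < T := by linarith
  have hτ : ∀ t ∈ Ico 0 S, 0 < S - t ∧ S - t ≤ T ∧ 0 < -Real.log (S - t) ∧
      |Real.log (S - t)| = -Real.log (S - t) := by
    intro t ht
    have h1 : 0 < S - t := by linarith [ht.2]
    have h2 : S - t ≤ T := by linarith [ht.1]
    have h3 : Real.log (S - t) < 0 := Real.log_neg h1 (by linarith)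
    exact ⟨h1, h2, by linarith, abs_of_neg h3⟩
  have hz : ∀ τ s : ℝ, 0 < τ → 0 < s → ∀ x : EuclideanSpace ℝ (Fin N),
      ‖(√(τ * s))⁻¹ • x‖ ^ 2 = (‖x‖ / √τ) ^ 2 / s := by
    intro τ s h1 h2 x
    rw [norm_smul, norm_inv, Real.norm_of_nonneg (Real.sqrt_nonneg _), mul_pow, inv_pow,
      Real.sq_sqrt (by positivity), div_pow, Real.sq_sqrt h1.le]
    field_simp
  refine ⟨S, 2 * C * (1 + e), fun t x => a.vv T k F (S - t) x ^ (-e), hS0, by linarith,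
    by positivity, fun t ht => hG.contDiff_rpow (hτ t ht).1 (hτ t ht).2.1 e,
    fun x => hG.contDiffOn_time hST e x, fun t ht x => ?_, fun M => ?_, fun t ht x => ?_,
    fun t ht x => ?_⟩
  · rw [(hG.hasDerivAt_time e (by linarith [ht.1]) ht.2 x).deriv]
    exact hG.pde (hτ t ht).1 (hτ t ht).2.1 heP her x
  · obtain ⟨t₀, h1, h2⟩ := hG.blowUp hK he0 (fun τ h1 h2 => (hcl' τ h1 h2 0).1) hS0 hST.le M
    exact ⟨t₀, h1, fun t ht => ⟨0, h2 t ht⟩⟩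
  · obtain ⟨h1, h2, h3, h4⟩ := hτ t ht
    have hx := hcl' _ h1 h2 x
    have hw := BlowUp.profile_weight_comparison h1 hβ.le (norm_nonneg x) rfl h3
    have h5 := (hest e (by ring) T k F hT0 hT1 _ h1 h2 x hx.1 hx.2.1).1
    rw [h4]
    set D := (1 + (‖x‖ ^ 2 / (S - t)) ^ (β / 2)) * (-Real.log (S - t)) ^ ((1 - β) / 2)
    have hD : 0 ≤ D := by positivity
    unfold profF
    rw [hz _ _ h1 h3, ← hb, ← haP, ← mul_div_assoc, haP, ← he]
    refine h5.trans ?_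
    have h6 := Real.rpow_pos_of_pos h1 (-e)
    calc _ ≤ C * (S - t) ^ (-e) * _ := mul_le_mul_of_nonneg_left hw (by positivity)
      _ = 2 * C * 1 * (S - t) ^ (-e) / D := by ring
      _ ≤ _ := by
        gcongr
        linarith
  · obtain ⟨h1, h2, h3, h4⟩ := hτ t ht
    have hx := hcl' _ h1 h2 x
    have hw := BlowUp.profile_weight_comparison h1 hβ.le (norm_nonneg x) rfl h3
    have h5 := (hest e (by ring) T k F hT0 hT1 _ h1 h2 x hx.1 hx.2.1).2
    rw [h4, hG.gradient_eq h1 h2, BlowUp.gradient_profF (by linarith), hz _ _ h1 h3, ← hb, ← haP,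
      ← mul_div_assoc, haP, ← he]
    set D := (1 + (‖x‖ ^ 2 / (S - t)) ^ (β / 2)) * (-Real.log (S - t)) ^ ((1 - β) / 2)
    have hD : 0 ≤ D := by positivity
    have h7 : ∀ w : ℝ, (-e * a.vv T k F (S - t) x ^ (-e - 1)) • a.gg T F (S - t) x -
        ((S - t) ^ (-(1 / 2 : ℝ) - e) * (-Real.log (S - t)) ^ (-(1 / 2) : ℝ)) •
          (-e * w * (2 * a.b)) • (√((S - t) * -Real.log (S - t)))⁻¹ • x =
        (-e) • (a.vv T k F (S - t) x ^ (-e - 1) • a.gg T F (S - t) x -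
          ((S - t) ^ (-(1 / 2) - e) * (w * (2 * a.b / -Real.log (S - t)))) • (√(S - t))⁻¹ • x) := by
      intro w
      have h8 : (-Real.log (S - t)) ^ (-(1 / 2) : ℝ) * (√(-Real.log (S - t)))⁻¹ =
          (-Real.log (S - t))⁻¹ := by
        rw [Real.sqrt_eq_rpow, ← Real.rpow_neg h3.le, ← Real.rpow_add h3, ← Real.rpow_neg_one]
        norm_num
      rw [Real.sqrt_mul h1.le, smul_sub, div_eq_mul_inv (2 * a.b), ← h8]
      simp only [smul_smul]
      congr 2
      rw [mul_inv]; ring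
    rw [h7, norm_smul, norm_neg, Real.norm_of_nonneg he0.le]
    have h6 := Real.rpow_pos_of_pos h1 (-(1 / 2) - e)
    calc _ ≤ e * (C * (S - t) ^ (-(1 / 2) - e) * _) :=
          mul_le_mul_of_nonneg_left (h5.trans (mul_le_mul_of_nonneg_left hw (by positivity))) he0.le
      _ = 2 * C * e * (S - t) ^ (-(1 / 2) - e) / D := by ring
      _ ≤ _ := by
        gcongr
        linarith
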